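/- Second-order maximum-norm velocity error of the RMAC scheme on uniform grids: let (u,p) be a smooth solution of the Stokes problem with source g, with u ∈ W^{2,∞}([0,T];W^{4,∞}(Ω))². Suppose the grid is uniform (h_{i+1/2}≡h, k_{j+1/2}≡k with k comparable to h) and Δt ≤ c₀h² for a fixed constant c₀. Then the RMAC solution satisfies max_{i,j}|W^{x,m}_{i,j+1/2} − u^x(x_i,y_{j+1/2},t^m)| + max_{i,j}|W^{y,m}_{i+1/2,j} − u^y(x_{i+1/2},y_j,t^m)| ≤ C·h² for every 1 ≤ m ≤ N, where C depends only on T, Ω, c₀, Sobolev norms of u (and their time derivatives up to second order), and remains bounded as μ→0; in particular C is independent of h, Δt and of the pressure p. -/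

import Mathlib

open Finset MeasureTheory Real

noncomputable section

namespace RMAC

/-! ### Continuous-level notions -/

/-- Partial derivative in the first (x) variable of a function of (x, y, t). -/
def pdx (f : ℝ → ℝ → ℝ → ℝ) : ℝ → ℝ → ℝ → ℝ := fun x y t => deriv (fun s => f s y t) x

/-- Partial derivative in the second (y) variable. -/
def pdy (f : ℝ → ℝ → ℝ → ℝ) : ℝ → ℝ → ℝ → ℝ := fun x y t => deriv (fun s => f x s t) y

/-- Partial derivative in the third (t) variable. -/
def pdt (f : ℝ → ℝ → ℝ → ℝ) : ℝ → ℝ → ℝ → ℝ := fun x y t => deriv (fun s => f x y s) t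

/-- Infinitely differentiable function of (x, y, t). -/
def Smooth (f : ℝ → ℝ → ℝ → ℝ) : Prop :=
  ∀ n : ℕ, ContDiff ℝ n (fun q : ℝ × ℝ × ℝ => f q.1 q.2.1 q.2.2)

/-- `SobBound a b f Lx Ly T M` : all derivatives `∂_t^{a'} ∂_x^{b'} ∂_y^{c'} f` with `a' ≤ a`,
`b' + c' ≤ b` are bounded by `M` on `[0,Lx] × [0,Ly] × [0,T]`; this encodes
`‖f‖_{W^{a,∞}([0,T];W^{b,∞}(Ω))} ≤ M`. -/
def SobBound (a b : ℕ) (f : ℝ → ℝ → ℝ → ℝ) (Lx Ly T M : ℝ) : Prop :=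
  ∀ a' b' c' : ℕ, a' ≤ a → b' + c' ≤ b →
    ∀ x y t : ℝ, x ∈ Set.Icc 0 Lx → y ∈ Set.Icc 0 Ly → t ∈ Set.Icc 0 T →
      |(pdt^[a'] (pdx^[b'] (pdy^[c'] f))) x y t| ≤ M

/-- The time-dependent Stokes problem on `Ω = (0,Lx) × (0,Ly)`, `t ∈ (0,T]`, with
viscosity `μ`, source `(gx, gy)`, homogeneous Dirichlet boundary condition and
homogeneous initial condition. -/
def IsStokesSol (μ Lx Ly T : ℝ) (ux uy p gx gy : ℝ → ℝ → ℝ → ℝ) : Prop :=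
  (∀ x y t : ℝ, x ∈ Set.Ioo 0 Lx → y ∈ Set.Ioo 0 Ly → t ∈ Set.Ioc 0 T →
      pdt ux x y t - μ * (pdx (pdx ux) x y t + pdy (pdy ux) x y t) + pdx p x y t = gx x y t ∧
      pdt uy x y t - μ * (pdx (pdx uy) x y t + pdy (pdy uy) x y t) + pdy p x y t = gy x y t ∧
      pdx ux x y t + pdy uy x y t = 0) ∧
  (∀ x y t : ℝ, x ∈ Set.Icc 0 Lx → y ∈ Set.Icc 0 Ly → t ∈ Set.Ioc 0 T →
      (x = 0 ∨ x = Lx ∨ y = 0 ∨ y = Ly) → ux x y t = 0 ∧ uy x y t = 0) ∧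
  (∀ x y : ℝ, x ∈ Set.Icc 0 Lx → y ∈ Set.Icc 0 Ly → ux x y 0 = 0 ∧ uy x y 0 = 0)

/-- Divergence-free velocity field on `Ω` for all times in `[0,T]`. -/
def DivFree (Lx Ly T : ℝ) (ux uy : ℝ → ℝ → ℝ → ℝ) : Prop :=
  ∀ x y t : ℝ, x ∈ Set.Ioo 0 Lx → y ∈ Set.Ioo 0 Ly → t ∈ Set.Icc 0 T →
    pdx ux x y t + pdy uy x y t = 0

/-- Homogeneous velocity boundary values on `∂Ω` for all times in `[0,T]`. -/
def BoundaryZero (Lx Ly T : ℝ) (ux uy : ℝ → ℝ → ℝ → ℝ) : Prop :=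
  ∀ x y t : ℝ, x ∈ Set.Icc 0 Lx → y ∈ Set.Icc 0 Ly → t ∈ Set.Icc 0 T →
    (x = 0 ∨ x = Lx ∨ y = 0 ∨ y = Ly) → ux x y t = 0 ∧ uy x y t = 0

/-! ### The staggered (MAC) grid

Index conventions for grid functions `f : ℤ → ℤ → ℝ`:
* cell-centered functions: `f i j` is the value at `(x_{i+1/2}, y_{j+1/2})`;
* x-edge functions (like `u^x`): `f i j` is the value at `(x_i, y_{j+1/2})`,
  with `j = -1` and `j = Ny` the ghost values representing `(x_i, y_0)` and `(x_i, y_{Ny})`;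
* y-edge functions (like `u^y`): `f i j` is the value at `(x_{i+1/2}, y_j)`,
  with `i = -1` and `i = Nx` the ghost values representing `(x_0, y_j)` and `(x_{Nx}, y_j)`;
* node functions: `f i j` is the value at `(x_i, y_j)`. -/
structure Grid where
  Nx : ℕ
  Ny : ℕ
  Lx : ℝ
  Ly : ℝ
  xp : ℤ → ℝ
  yp : ℤ → ℝ
  one_le_Nx : 1 ≤ Nx
  one_le_Ny : 1 ≤ Ny
  xp_zero : xp 0 = 0
  xp_last : xp Nx = Lx
  yp_zero : yp 0 = 0
  yp_last : yp Ny = Ly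
  xp_mono : ∀ i : ℤ, 0 ≤ i → i < Nx → xp i < xp (i + 1)
  yp_mono : ∀ j : ℤ, 0 ≤ j → j < Ny → yp j < yp (j + 1)

namespace Grid

variable (G : Grid)

/-- `h_{i+1/2} = x_{i+1} - x_i`. -/
def hh (i : ℤ) : ℝ := G.xp (i + 1) - G.xp i

/-- `k_{j+1/2} = y_{j+1} - y_j`. -/
def kk (j : ℤ) : ℝ := G.yp (j + 1) - G.yp j

/-- `x_{i+1/2} = (x_i + x_{i+1})/2`. -/
def xh (i : ℤ) : ℝ := (G.xp i + G.xp (i + 1)) / 2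

/-- `y_{j+1/2} = (y_j + y_{j+1})/2`. -/
def yh (j : ℤ) : ℝ := (G.yp j + G.yp (j + 1)) / 2

/-- `h_i = (h_{i-1/2} + h_{i+1/2})/2`, with `h_0 = h_{1/2}/2`, `h_{Nx} = h_{Nx-1/2}/2`. -/
def hc (i : ℤ) : ℝ :=
  if i = 0 then G.hh 0 / 2
  else if i = (G.Nx : ℤ) then G.hh ((G.Nx : ℤ) - 1) / 2
  else (G.hh (i - 1) + G.hh i) / 2

/-- `k_j = (k_{j-1/2} + k_{j+1/2})/2`, with `k_0 = k_{1/2}/2`, `k_{Ny} = k_{Ny-1/2}/2`. -/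
def kc (j : ℤ) : ℝ :=
  if j = 0 then G.kk 0 / 2
  else if j = (G.Ny : ℤ) then G.kk ((G.Ny : ℤ) - 1) / 2
  else (G.kk (j - 1) + G.kk j) / 2

/-- `h = max_i h_{i+1/2}`. -/
def hmax : ℝ :=
  (Finset.Icc (0 : ℤ) ((G.Nx : ℤ) - 1)).sup'
    (Finset.nonempty_Icc.mpr (by have := G.one_le_Nx; omega)) G.hh

/-- `k = max_j k_{j+1/2}`. -/
def kmax : ℝ :=
  (Finset.Icc (0 : ℤ) ((G.Ny : ℤ) - 1)).sup'
    (Finset.nonempty_Icc.mpr (by have := G.one_le_Ny; omega)) G.kk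

/-- Mesh regularity: `min_{i,j} {h_{i+1/2}, k_{j+1/2}} ≥ C₀ · max_{i,j} {h_{i+1/2}, k_{j+1/2}}`. -/
def Regular (C₀ : ℝ) : Prop :=
  (∀ i : ℤ, 0 ≤ i → i < G.Nx → C₀ * G.hmax ≤ G.hh i ∧ C₀ * G.kmax ≤ G.hh i) ∧
  (∀ j : ℤ, 0 ≤ j → j < G.Ny → C₀ * G.hmax ≤ G.kk j ∧ C₀ * G.kmax ≤ G.kk j)

/-! ### Difference operators -/

/-- `d_x` of an x-edge function: value at the cell center `(x_{i+1/2}, y_{j+1/2})`. -/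
def dxEx (f : ℤ → ℤ → ℝ) (i j : ℤ) : ℝ := (f (i + 1) j - f i j) / G.hh i

/-- `D_y` of an x-edge function: value at the node `(x_i, y_j)`. -/
def DyEx (f : ℤ → ℤ → ℝ) (i j : ℤ) : ℝ := (f i j - f i (j - 1)) / G.kc j

/-- `d_y` of a y-edge function: value at the cell center `(x_{i+1/2}, y_{j+1/2})`. -/
def dyEy (f : ℤ → ℤ → ℝ) (i j : ℤ) : ℝ := (f i (j + 1) - f i j) / G.kk j

/-- `D_x` of a y-edge function: value at the node `(x_i, y_j)`. -/
def DxEy (f : ℤ → ℤ → ℝ) (i j : ℤ) : ℝ := (f i j - f (i - 1) j) / G.hc i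

/-- `D_x` of a cell-centered function: value at the x-edge point `(x_i, y_{j+1/2})`. -/
def DxC (q : ℤ → ℤ → ℝ) (i j : ℤ) : ℝ := (q i j - q (i - 1) j) / G.hc i

/-- `D_y` of a cell-centered function: value at the y-edge point `(x_{i+1/2}, y_j)`. -/
def DyC (q : ℤ → ℤ → ℝ) (i j : ℤ) : ℝ := (q i j - q i (j - 1)) / G.kc j

/-! ### Discrete inner products and norms -/

/-- `(f,g)_{l²,M}` over cell centers. -/
def ipM (f g : ℤ → ℤ → ℝ) : ℝ :=
  ∑ i ∈ Finset.Icc (0 : ℤ) ((G.Nx : ℤ) - 1), ∑ j ∈ Finset.Icc (0 : ℤ) ((G.Ny : ℤ) - 1),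
    G.hh i * G.kk j * f i j * g i j

/-- `(f,g)_{l²,T,M}` over x-edge points. -/
def ipTM (f g : ℤ → ℤ → ℝ) : ℝ :=
  ∑ i ∈ Finset.Icc (1 : ℤ) ((G.Nx : ℤ) - 1), ∑ j ∈ Finset.Icc (0 : ℤ) ((G.Ny : ℤ) - 1),
    G.hc i * G.kk j * f i j * g i j

/-- `(f,g)_{l²,M,T}` over y-edge points. -/
def ipMT (f g : ℤ → ℤ → ℝ) : ℝ :=
  ∑ i ∈ Finset.Icc (0 : ℤ) ((G.Nx : ℤ) - 1), ∑ j ∈ Finset.Icc (1 : ℤ) ((G.Ny : ℤ) - 1),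
    G.hh i * G.kc j * f i j * g i j

/-- `(f,g)_{l²,T_x}`. -/
def ipTx (f g : ℤ → ℤ → ℝ) : ℝ :=
  ∑ i ∈ Finset.Icc (0 : ℤ) (G.Nx : ℤ), ∑ j ∈ Finset.Icc (1 : ℤ) ((G.Ny : ℤ) - 1),
    G.hc i * G.kc j * f i j * g i j

/-- `(f,g)_{l²,T_y}`. -/
def ipTy (f g : ℤ → ℤ → ℝ) : ℝ :=
  ∑ i ∈ Finset.Icc (1 : ℤ) ((G.Nx : ℤ) - 1), ∑ j ∈ Finset.Icc (0 : ℤ) (G.Ny : ℤ),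
    G.hc i * G.kc j * f i j * g i j

/-- `‖v‖²_{l²} = ‖v^x‖²_{l²,T,M} + ‖v^y‖²_{l²,M,T}` for a discrete velocity. -/
def velNormSq (vx vy : ℤ → ℤ → ℝ) : ℝ := G.ipTM vx vx + G.ipMT vy vy

/-- `‖Dv‖²_{l²}` for a discrete velocity. -/
def DvelNormSq (vx vy : ℤ → ℤ → ℝ) : ℝ :=
  G.ipM (G.dxEx vx) (G.dxEx vx) + G.ipTy (G.DyEx vx) (G.DyEx vx) +
    G.ipTx (G.DxEy vy) (G.DxEy vy) + G.ipM (G.dyEy vy) (G.dyEy vy)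

/-! ### Right-hand side discretization and the RMAC scheme -/

/-- `f^{x,n}_{i,j+1/2} = (1/h_i) ∫_{x_{i-1/2}}^{x_{i+1/2}} g^x(x, y_{j+1/2}, t^n) dx`. -/
def avgFx (gx : ℝ → ℝ → ℝ → ℝ) (Δt : ℝ) : ℕ → ℤ → ℤ → ℝ := fun n i j =>
  (1 / G.hc i) * ∫ x in (G.xh (i - 1))..(G.xh i), gx x (G.yh j) ((n : ℝ) * Δt)

/-- `f^{y,n}_{i+1/2,j} = (1/k_j) ∫_{y_{j-1/2}}^{y_{j+1/2}} g^y(x_{i+1/2}, y, t^n) dy`. -/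
def avgFy (gy : ℝ → ℝ → ℝ → ℝ) (Δt : ℝ) : ℕ → ℤ → ℤ → ℝ := fun n i j =>
  (1 / G.kc j) * ∫ y in (G.yh (j - 1))..(G.yh j), gy (G.xh i) y ((n : ℝ) * Δt)

/-- The RMAC scheme for the time-dependent Stokes equations, with discrete right-hand
sides `fx`, `fy`: homogeneous discrete boundary and initial conditions, the two discrete
momentum equations and the discrete divergence-free constraint. -/
def IsRMAC (μ Δt : ℝ) (fx fy Wx Wy Z : ℕ → ℤ → ℤ → ℝ) : Prop :=
  (∀ n : ℕ, ∀ j : ℤ, Wx n 0 j = 0 ∧ Wx n (G.Nx : ℤ) j = 0) ∧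
  (∀ n : ℕ, ∀ i : ℤ, Wx n i (-1) = 0 ∧ Wx n i (G.Ny : ℤ) = 0) ∧
  (∀ n : ℕ, ∀ i : ℤ, Wy n i 0 = 0 ∧ Wy n i (G.Ny : ℤ) = 0) ∧
  (∀ n : ℕ, ∀ j : ℤ, Wy n (-1) j = 0 ∧ Wy n (G.Nx : ℤ) j = 0) ∧
  (∀ i j : ℤ, Wx 0 i j = 0 ∧ Wy 0 i j = 0) ∧
  (∀ n : ℕ, 1 ≤ n →
    ∀ i ∈ Finset.Icc (1 : ℤ) ((G.Nx : ℤ) - 1), ∀ j ∈ Finset.Icc (0 : ℤ) ((G.Ny : ℤ) - 1),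
      (Wx n i j - Wx (n - 1) i j) / Δt
        - μ * ((G.dxEx (Wx n) i j - G.dxEx (Wx n) (i - 1) j) / G.hc i)
        - μ * ((G.DyEx (Wx n) i (j + 1) - G.DyEx (Wx n) i j) / G.kk j)
        + G.DxC (Z n) i j = fx n i j) ∧
  (∀ n : ℕ, 1 ≤ n →
    ∀ i ∈ Finset.Icc (0 : ℤ) ((G.Nx : ℤ) - 1), ∀ j ∈ Finset.Icc (1 : ℤ) ((G.Ny : ℤ) - 1),
      (Wy n i j - Wy (n - 1) i j) / Δt
        - μ * ((G.DxEy (Wy n) (i + 1) j - G.DxEy (Wy n) i j) / G.hh i)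
        - μ * ((G.dyEy (Wy n) i j - G.dyEy (Wy n) i (j - 1)) / G.kc j)
        + G.DyC (Z n) i j = fy n i j) ∧
  (∀ n : ℕ, 1 ≤ n →
    ∀ i ∈ Finset.Icc (0 : ℤ) ((G.Nx : ℤ) - 1), ∀ j ∈ Finset.Icc (0 : ℤ) ((G.Ny : ℤ) - 1),
      G.dxEx (Wx n) i j + G.dyEy (Wy n) i j = 0)

/-- The compact-support condition: the discrete solution vanishes within one mesh
layer of `∂Ω`. -/
def CompactSupp (Wx Wy Z : ℕ → ℤ → ℤ → ℝ) : Prop :=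
  (∀ n : ℕ, ∀ j : ℤ,
    Wx n 0 j = 0 ∧ Wx n 1 j = 0 ∧ Wx n ((G.Nx : ℤ) - 1) j = 0 ∧ Wx n (G.Nx : ℤ) j = 0) ∧
  (∀ n : ℕ, ∀ i : ℤ,
    Wx n i (-1) = 0 ∧ Wx n i 0 = 0 ∧ Wx n i ((G.Ny : ℤ) - 1) = 0 ∧ Wx n i (G.Ny : ℤ) = 0) ∧
  (∀ n : ℕ, ∀ j : ℤ,
    Wy n (-1) j = 0 ∧ Wy n 0 j = 0 ∧ Wy n ((G.Nx : ℤ) - 1) j = 0 ∧ Wy n (G.Nx : ℤ) j = 0) ∧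
  (∀ n : ℕ, ∀ i : ℤ,
    Wy n i 0 = 0 ∧ Wy n i 1 = 0 ∧ Wy n i ((G.Ny : ℤ) - 1) = 0 ∧ Wy n i (G.Ny : ℤ) = 0) ∧
  (∀ n : ℕ, ∀ j : ℤ, Z n 0 j = 0) ∧
  (∀ n : ℕ, ∀ i : ℤ, Z n i 0 = 0)

/-! ### Auxiliary interpolants and consistency functions -/

/-- The auxiliary interpolant `ũ^{x,n}_{i,j+1/2}`, with its boundary extension. -/
def tux (ux : ℝ → ℝ → ℝ → ℝ) (Δt : ℝ) (n : ℕ) (i j : ℤ) : ℝ :=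
  if j = -1 then ux (G.xp i) (G.yp 0) ((n : ℝ) * Δt)
  else if j = (G.Ny : ℤ) then ux (G.xp i) (G.yp (G.Ny : ℤ)) ((n : ℝ) * Δt)
  else (1 / G.kk j) * (∫ y in (G.yp j)..(G.yp (j + 1)), ux (G.xp i) y ((n : ℝ) * Δt))
    - (G.kk j) ^ 2 / 6 * pdy (pdy ux) (G.xp i) (G.yh j) ((n : ℝ) * Δt)

/-- The auxiliary interpolant `ũ^{y,n}_{i+1/2,j}`, with its boundary extension. -/
def tuy (uy : ℝ → ℝ → ℝ → ℝ) (Δt : ℝ) (n : ℕ) (i j : ℤ) : ℝ :=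
  if i = -1 then uy (G.xp 0) (G.yp j) ((n : ℝ) * Δt)
  else if i = (G.Nx : ℤ) then uy (G.xp (G.Nx : ℤ)) (G.yp j) ((n : ℝ) * Δt)
  else (1 / G.hh i) * (∫ x in (G.xp i)..(G.xp (i + 1)), uy x (G.yp j) ((n : ℝ) * Δt))
    - (G.hh i) ^ 2 / 6 * pdx (pdx uy) (G.xh i) (G.yp j) ((n : ℝ) * Δt)

/-- `γ^{x,n}_{i+1/2,j+1/2} = (h_{i+1/2}²/8) ∂²u^x/∂t∂x (x_{i+1/2}, y_{j+1/2}, t^n)`. -/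
def gammax (ux : ℝ → ℝ → ℝ → ℝ) (Δt : ℝ) (n : ℕ) (i j : ℤ) : ℝ :=
  (G.hh i) ^ 2 / 8 * pdt (pdx ux) (G.xh i) (G.yh j) ((n : ℝ) * Δt)

/-- `γ^{y,n}_{i+1/2,j+1/2} = (k_{j+1/2}²/8) ∂²u^y/∂t∂y (x_{i+1/2}, y_{j+1/2}, t^n)`. -/
def gammay (uy : ℝ → ℝ → ℝ → ℝ) (Δt : ℝ) (n : ℕ) (i j : ℤ) : ℝ :=
  (G.kk j) ^ 2 / 8 * pdt (pdy uy) (G.xh i) (G.yh j) ((n : ℝ) * Δt)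

end Grid

/-! ### Averaging (interpolation) operators on a uniform grid -/

/-- `P^x_h` : x-edge function → cell-centered function. -/
def PxEx (f : ℤ → ℤ → ℝ) (i j : ℤ) : ℝ := (f i j + f (i + 1) j) / 2

/-- `P^x_h` : cell-centered function → x-edge function. -/
def PxC (q : ℤ → ℤ → ℝ) (i j : ℤ) : ℝ := (q (i - 1) j + q i j) / 2

/-- `P^x_h` : y-edge function → node function. -/
def PxEyN (f : ℤ → ℤ → ℝ) (i j : ℤ) : ℝ := (f (i - 1) j + f i j) / 2

/-- `P^x_h` : node function → y-edge function. -/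
def PxN (g : ℤ → ℤ → ℝ) (i j : ℤ) : ℝ := (g i j + g (i + 1) j) / 2

/-- `P^y_h` : y-edge function → cell-centered function. -/
def PyEy (f : ℤ → ℤ → ℝ) (i j : ℤ) : ℝ := (f i j + f i (j + 1)) / 2

/-- `P^y_h` : cell-centered function → y-edge function. -/
def PyC (q : ℤ → ℤ → ℝ) (i j : ℤ) : ℝ := (q i (j - 1) + q i j) / 2

/-- `P^y_h` : x-edge function → node function. -/
def PyEx (f : ℤ → ℤ → ℝ) (i j : ℤ) : ℝ := (f i (j - 1) + f i j) / 2

/-- `P^y_h` : node function → x-edge function. -/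
def PyN (g : ℤ → ℤ → ℝ) (i j : ℤ) : ℝ := (g i j + g i (j + 1)) / 2

namespace Grid

variable (G : Grid)

/-- The discrete nonlinear term `α^{x,n}_{i,j+1/2}` of the fully implicit RMAC scheme. -/
def alphaX (Wx Wy : ℤ → ℤ → ℝ) (i j : ℤ) : ℝ :=
  (Wx i j * G.DxC (PxEx Wx) i j
    + PxC (G.dxEx fun a b => (Wx a b) ^ 2) i j
    + PyN (fun a b => PxEyN Wy a b * G.DyEx Wx a b) i j
    + (PyEx Wx i (j + 1) * PxEyN Wy i (j + 1) - PyEx Wx i j * PxEyN Wy i j) / G.kk j) / 2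

/-- The discrete nonlinear term `α^{y,n}_{i+1/2,j}` of the fully implicit RMAC scheme. -/
def alphaY (Wx Wy : ℤ → ℤ → ℝ) (i j : ℤ) : ℝ :=
  (Wy i j * G.DyC (PyEy Wy) i j
    + PyC (G.dyEy fun a b => (Wy a b) ^ 2) i j
    + PxN (fun a b => PyEx Wx a b * G.DxEy Wy a b) i j
    + (PyEx Wx (i + 1) j * PxEyN Wy (i + 1) j - PyEx Wx i j * PxEyN Wy i j) / G.hh i) / 2

/-- The fully implicit RMAC scheme for the Navier–Stokes equations. -/
def IsRMACNS (μ Δt : ℝ) (fx fy Wx Wy Z : ℕ → ℤ → ℤ → ℝ) : Prop :=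
  (∀ n : ℕ, ∀ j : ℤ, Wx n 0 j = 0 ∧ Wx n (G.Nx : ℤ) j = 0) ∧
  (∀ n : ℕ, ∀ i : ℤ, Wx n i (-1) = 0 ∧ Wx n i (G.Ny : ℤ) = 0) ∧
  (∀ n : ℕ, ∀ i : ℤ, Wy n i 0 = 0 ∧ Wy n i (G.Ny : ℤ) = 0) ∧
  (∀ n : ℕ, ∀ j : ℤ, Wy n (-1) j = 0 ∧ Wy n (G.Nx : ℤ) j = 0) ∧
  (∀ i j : ℤ, Wx 0 i j = 0 ∧ Wy 0 i j = 0) ∧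
  (∀ n : ℕ, 1 ≤ n →
    ∀ i ∈ Finset.Icc (1 : ℤ) ((G.Nx : ℤ) - 1), ∀ j ∈ Finset.Icc (0 : ℤ) ((G.Ny : ℤ) - 1),
      (Wx n i j - Wx (n - 1) i j) / Δt
        - μ * ((G.dxEx (Wx n) i j - G.dxEx (Wx n) (i - 1) j) / G.hc i)
        - μ * ((G.DyEx (Wx n) i (j + 1) - G.DyEx (Wx n) i j) / G.kk j)
        + G.alphaX (Wx n) (Wy n) i j
        + G.DxC (Z n) i j = fx n i j) ∧
  (∀ n : ℕ, 1 ≤ n →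
    ∀ i ∈ Finset.Icc (0 : ℤ) ((G.Nx : ℤ) - 1), ∀ j ∈ Finset.Icc (1 : ℤ) ((G.Ny : ℤ) - 1),
      (Wy n i j - Wy (n - 1) i j) / Δt
        - μ * ((G.DxEy (Wy n) (i + 1) j - G.DxEy (Wy n) i j) / G.hh i)
        - μ * ((G.dyEy (Wy n) i j - G.dyEy (Wy n) i (j - 1)) / G.kc j)
        + G.alphaY (Wx n) (Wy n) i j
        + G.DyC (Z n) i j = fy n i j) ∧
  (∀ n : ℕ, 1 ≤ n →
    ∀ i ∈ Finset.Icc (0 : ℤ) ((G.Nx : ℤ) - 1), ∀ j ∈ Finset.Icc (0 : ℤ) ((G.Ny : ℤ) - 1),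
      G.dxEx (Wx n) i j + G.dyEy (Wy n) i j = 0)

/-- A uniform grid with mesh sizes `h` (in x) and `k` (in y). -/
def Uniform (h k : ℝ) : Prop :=
  (∀ i : ℤ, 0 ≤ i → i < G.Nx → G.hh i = h) ∧ (∀ j : ℤ, 0 ≤ j → j < G.Ny → G.kk j = k)

end Grid

end RMAC

open RMAC

namespace RMACProof

section LinearAlgebra
open scoped InnerProductSpace

variable {V : Type*} [AddCommGroup V] [Module ℝ V]

/-- A symmetric bilinear form, as a bare function. -/
structure IsForm (m : V → V → ℝ) : Prop where
  symm : ∀ u v, m u v = m v u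
  add : ∀ u v w, m (u + v) w = m u w + m v w
  smul : ∀ (c : ℝ) u w, m (c • u) w = c * m u w

/-- A symmetric positive definite bilinear form. -/
structure IsPos (m : V → V → ℝ) : Prop extends IsForm m where
  pos : ∀ v, v ≠ 0 → 0 < m v v

theorem IsForm.add_right {m : V → V → ℝ} (h : IsForm m) (u v w : V) :
    m u (v + w) = m u v + m u w := by
  rw [h.symm, h.add, h.symm v, h.symm w]

theorem IsForm.smul_right {m : V → V → ℝ} (h : IsForm m) (c : ℝ) (u w : V) :
    m u (c • w) = c * m u w := by
  rw [h.symm, h.smul, h.symm w]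

theorem IsForm.zero_left {m : V → V → ℝ} (h : IsForm m) (w : V) : m 0 w = 0 := by
  have := h.smul 0 0 w
  simpa using this

theorem IsForm.sum_left {m : V → V → ℝ} (h : IsForm m) {ι : Type*} (s : Finset ι)
    (f : ι → V) (w : V) : m (∑ i ∈ s, f i) w = ∑ i ∈ s, m (f i) w := by
  classical
  induction s using Finset.induction_on with
  | empty => simp [h.zero_left]
  | insert a s ha ih => rw [sum_insert ha, sum_insert ha, h.add, ih]

theorem IsForm.sum_right {m : V → V → ℝ} (h : IsForm m) {ι : Type*} (s : Finset ι)
    (f : ι → V) (w : V) : m w (∑ i ∈ s, f i) = ∑ i ∈ s, m w (f i) := by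
  rw [h.symm, h.sum_left]
  exact sum_congr rfl fun i _ => h.symm _ _

theorem IsPos.nonneg {m : V → V → ℝ} (h : IsPos m) (v : V) : 0 ≤ m v v := by
  by_cases hv : v = 0
  · rw [hv, h.zero_left]
  · exact (h.pos v hv).le

/-- The inner product space structure attached to a positive definite form. -/
@[reducible] def IsPos.core {m : V → V → ℝ} (h : IsPos m) : InnerProductSpace.Core ℝ V where
  inner := m
  conj_inner_symm u v := by simp [h.symm u v]
  re_inner_nonneg v := by simpa using h.nonneg v
  add_left := h.add
  smul_left u v r := by simp [h.smul]
  definite v hv := by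
    by_contra hne
    exact (h.pos v hne).ne' hv

/-- Simultaneous diagonalisation of two symmetric forms, the first one positive definite. -/
theorem exists_simul_basis [FiniteDimensional ℝ V] {m a : V → V → ℝ} (hm : IsPos m)
    (ha : IsForm a) :
    ∃ (ι : Type) (_ : Fintype ι) (b : ι → V) (l : ι → ℝ), 
      (∀ v, v = ∑ i, m (b i) v • b i) ∧
      (∀ u v, m u v = ∑ i, m (b i) u * m (b i) v) ∧
      (∀ i, m (b i) (b i) = 1) ∧ (∀ i j, i ≠ j → m (b i) (b j) = 0) ∧
      (∀ i v, a (b i) v = l i * m (b i) v) := by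
  let _ : NormedAddCommGroup V := hm.core.toNormedAddCommGroup
  let _ : InnerProductSpace ℝ V := InnerProductSpace.ofCore hm.core.toCore
  have hin : ∀ u v : V, ⟪u, v⟫_ℝ = m u v := fun u v => rfl
  let A₀ : V →ₗ[ℝ] V →ₗ[ℝ] ℝ := LinearMap.mk₂ ℝ a ha.add ha.smul ha.add_right ha.smul_right
  let A : V →ₗ[ℝ] V :=
    { toFun := fun u => (InnerProductSpace.toDual ℝ V).symm (LinearMap.toContinuousLinearMap (A₀ u))
      map_add' := by intro u v; simp
      map_smul' := by intro c v; simp }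
  have hA : ∀ u v, ⟪A u, v⟫_ℝ = a u v := by
    intro u v
    change ⟪(InnerProductSpace.toDual ℝ V).symm (LinearMap.toContinuousLinearMap (A₀ u)), v⟫_ℝ = _
    rw [InnerProductSpace.toDual_symm_apply]
    rfl
  have hAs : A.IsSymmetric := by
    intro u v
    rw [hA, real_inner_comm, hA, ha.symm]
  let e := hAs.eigenvectorBasis rfl
  refine ⟨_, inferInstance, e, fun i => hAs.eigenvalues rfl i, ?_, ?_, ?_, ?_, ?_⟩
  · intro v
    exact (e.sum_repr' v).symm
  · intro u v
    have := e.sum_inner_mul_inner u v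
    rw [← hin, ← this]
    refine sum_congr rfl fun i _ => ?_
    rw [real_inner_comm, hin, hin]
  · intro i
    have := e.inner_eq_one i
    exact this
  · intro i j hij
    exact e.inner_eq_zero hij
  · intro i v
    rw [← hA, hAs.apply_eigenvectorBasis, ← hin]
    simp [inner_smul_left, e]

theorem exists_riesz [FiniteDimensional ℝ V] {m : V → V → ℝ} (hm : IsPos m) (r : V →ₗ[ℝ] ℝ) :
    ∃ κ, ∀ v, m κ v = r v := by
  obtain ⟨ι, _, b, l, hb, -⟩ := exists_simul_basis hm hm.toIsForm
  refine ⟨∑ i, r (b i) • b i, fun v => ?_⟩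
  conv_rhs => rw [hb v]
  rw [hm.sum_left, map_sum]
  refine sum_congr rfl fun i _ => ?_
  rw [hm.smul, map_smul, smul_eq_mul, mul_comm]

end LinearAlgebra

section Operators
open scoped InnerProductSpace

variable {H : Type*} [NormedAddCommGroup H] [InnerProductSpace ℝ H]

theorem norm_sq_lt_of_add_pos {x y w : H} {τ : ℝ} (hτ : 0 < τ) (hw : w ≠ 0)
    (hxy : x = y + τ • w) (hy : 0 ≤ ⟪y, w⟫_ℝ) : ⟪y, y⟫_ℝ < ⟪x, x⟫_ℝ := by
  have h0 : 0 < ⟪w, w⟫_ℝ := real_inner_self_pos.2 hw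
  rw [hxy, inner_add_left, inner_add_right, inner_add_right, inner_smul_left, inner_smul_right,
    inner_smul_left, inner_smul_right, real_inner_comm y w]
  simp only [conj_trivial]
  nlinarith [mul_pos hτ hτ, mul_nonneg hτ.le hy, mul_pos (mul_pos hτ hτ) h0]

variable [FiniteDimensional ℝ H]

/-- A symmetric operator without negative eigenvalues is positive. -/
theorem nonneg_of_no_neg_eigen {T : H →ₗ[ℝ] H} (hT : T.IsSymmetric)
    (h : ∀ (w : H) (τ : ℝ), w ≠ 0 → 0 < τ → T w = -τ • w → False) (x : H) : 0 ≤ ⟪T x, x⟫_ℝ := by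
  let e := hT.eigenvectorBasis rfl
  have hl : ∀ i, 0 ≤ hT.eigenvalues rfl i := by
    intro i
    by_contra hneg
    push Not at hneg
    refine h (e i) (-hT.eigenvalues rfl i) ?_ (by linarith) ?_
    · exact e.orthonormal.ne_zero i
    · rw [neg_neg]
      exact hT.apply_eigenvectorBasis rfl i
  have h1 : ∀ i, ⟪T x, e i⟫_ℝ = hT.eigenvalues rfl i * ⟪x, e i⟫_ℝ := by
    intro i
    rw [hT x (e i), hT.apply_eigenvectorBasis rfl i, inner_smul_right]
    simp [e]
  rw [← e.sum_inner_mul_inner]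
  refine sum_nonneg fun i _ => ?_
  rw [h1, real_inner_comm x (e i)]
  have := hl i
  have h2 := mul_self_nonneg ⟪x, e i⟫_ℝ
  rw [mul_assoc]
  rw [real_inner_comm (e i) x] at *
  positivity

/-- Positive square root of a positive definite symmetric operator. -/
theorem exists_sqrt {Q : H →ₗ[ℝ] H} (hQ : Q.IsSymmetric) (hpos : ∀ w, w ≠ 0 → 0 < ⟪Q w, w⟫_ℝ) :
    ∃ S : H →ₗ[ℝ] H, S.IsSymmetric ∧ (∀ w, S (S w) = Q w) ∧ ∀ w, w ≠ 0 → 0 < ⟪S w, w⟫_ℝ := by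
  let e := hQ.eigenvectorBasis rfl
  let l := hQ.eigenvalues rfl
  have hl : ∀ i, 0 < l i := by
    intro i
    have h1 := hpos (e i) (e.orthonormal.ne_zero i)
    have h2 : Q (e i) = l i • e i := hQ.apply_eigenvectorBasis rfl i
    rw [h2, inner_smul_left, e.inner_eq_one] at h1
    simpa using h1
  let S : H →ₗ[ℝ] H := e.toBasis.constr ℝ fun i => √(l i) • e i
  have hS : ∀ i, S (e i) = √(l i) • e i := by
    intro i
    have := e.toBasis.constr_basis ℝ (fun i => √(l i) • e i) i
    rwa [e.coe_toBasis] at this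
  have hexp : ∀ w, S w = ∑ i, (√(l i) * ⟪e i, w⟫_ℝ) • e i := by
    intro w
    conv_lhs => rw [← e.sum_repr' w]
    rw [map_sum]
    refine sum_congr rfl fun i _ => ?_
    rw [map_smul, hS, smul_smul, mul_comm]
  have hin : ∀ u w, ⟪S u, w⟫_ℝ = ∑ i, √(l i) * ⟪e i, u⟫_ℝ * ⟪e i, w⟫_ℝ := by
    intro u w
    rw [hexp, sum_inner]
    refine sum_congr rfl fun i _ => ?_
    rw [inner_smul_left]
    simp
  refine ⟨S, ?_, ?_, ?_⟩
  · intro u w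
    rw [hin, real_inner_comm (S w), hin]
    exact sum_congr rfl fun i _ => by ring
  · have : S ∘ₗ S = Q := by
      refine e.toBasis.ext fun i => ?_
      have h2 : Q (e i) = l i • e i := hQ.apply_eigenvectorBasis rfl i
      simp only [OrthonormalBasis.coe_toBasis, LinearMap.comp_apply]
      rw [hS, map_smul, hS, smul_smul, h2, Real.mul_self_sqrt (hl i).le]
    intro w
    rw [← this]
    rfl
  · intro w hw
    rw [hin]
    have h0 : 0 < ‖w‖ ^ 2 := by positivity
    rw [← e.sum_sq_norm_inner_right w] at h0
    obtain ⟨i, hi, hi'⟩ := exists_lt_of_sum_lt (s := Finset.univ) (f := fun _ => (0:ℝ))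
      (g := fun i => ‖⟪e i, w⟫_ℝ‖ ^ 2) (by simpa using h0)
    refine sum_pos' (fun i _ => ?_) ⟨i, hi, ?_⟩
    · rw [mul_assoc]
      exact mul_nonneg (sqrt_nonneg _) (mul_self_nonneg _)
    · rw [mul_assoc]
      refine mul_pos (sqrt_pos.2 (hl i)) ?_
      have : ⟪e i, w⟫_ℝ ≠ 0 := by
        intro h
        simp [h] at hi'
      exact mul_self_pos.2 this

/-- Third order regularity for `(Dx² + Ex) + (Dy² + Ey) + 2 Dx Dy`. -/
theorem third_order_bound {Dx Dy Ex Ey : H →ₗ[ℝ] H}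
    (sDx : Dx.IsSymmetric) (sDy : Dy.IsSymmetric) (sEx : Ex.IsSymmetric) (sEy : Ey.IsSymmetric)
    (cDD : ∀ w, Dx (Dy w) = Dy (Dx w)) (cDE : ∀ w, Dx (Ey w) = Ey (Dx w))
    (cED : ∀ w, Ex (Dy w) = Dy (Ex w)) (cEE : ∀ w, Ex (Ey w) = Ey (Ex w))
    (pDx : ∀ w, w ≠ 0 → 0 < ⟪Dx w, w⟫_ℝ) (pEx : ∀ w, 0 ≤ ⟪Ex w, w⟫_ℝ) (pEy : ∀ w, 0 ≤ ⟪Ey w, w⟫_ℝ)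
    (pDD : ∀ w, 0 ≤ ⟪Dx (Dy w), w⟫_ℝ) (pDE : ∀ w, 0 ≤ ⟪Dx (Ey w), w⟫_ℝ)
    (pEE : ∀ w, 0 ≤ ⟪Ex (Ey w), w⟫_ℝ)
    {F : ℝ} {ψ : H}
    (hF : ∀ φ, |⟪Dx (Dx ψ) + Ex ψ + (Dy (Dy ψ) + Ey ψ) + (2:ℝ) • Dx (Dy ψ), φ⟫_ℝ| ≤
      F * √(⟪Dx φ, φ⟫_ℝ + ⟪Dy φ, φ⟫_ℝ)) :
    ⟪Dx (Dy ψ), Dy ψ⟫_ℝ ≤ 8 * F ^ 2 := by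
  obtain ⟨Bx, hBx⟩ : ∃ B : H →ₗ[ℝ] H, ∀ w, B w = Dx (Dx w) + Ex w := ⟨Dx ∘ₗ Dx + Ex, fun w => rfl⟩
  obtain ⟨By, hBy⟩ : ∃ B : H →ₗ[ℝ] H, ∀ w, B w = Dy (Dy w) + Ey w := ⟨Dy ∘ₗ Dy + Ey, fun w => rfl⟩
  have sBx : Bx.IsSymmetric := fun u v => by
    rw [hBx, hBx, inner_add_left, inner_add_right, sDx, sDx, sEx]
  have sBy : By.IsSymmetric := fun u v => by
    rw [hBy, hBy, inner_add_left, inner_add_right, sDy, sDy, sEy]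
  have cBB : ∀ w, Bx (By w) = By (Bx w) := fun w => by
    simp only [hBx, hBy, map_add, cDD, cDE, cED, cEE]; abel
  have cDB : ∀ w, Dx (By w) = By (Dx w) := fun w => by
    simp only [hBy, map_add, cDD, cDE]
  have Dx_le : ∀ w, ⟪Dx w, Dx w⟫_ℝ ≤ ⟪Bx w, w⟫_ℝ := fun w => by
    rw [hBx, inner_add_left, sDx (Dx w)]; linarith [pEx w]
  have Dy_le : ∀ w, ⟪Dy w, Dy w⟫_ℝ ≤ ⟪By w, w⟫_ℝ := fun w => by
    rw [hBy, inner_add_left, sDy (Dy w)]; linarith [pEy w]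
  have pBx : ∀ w, 0 ≤ ⟪Bx w, w⟫_ℝ := fun w => le_trans real_inner_self_nonneg (Dx_le w)
  have pBy : ∀ w, 0 ≤ ⟪By w, w⟫_ℝ := fun w => le_trans real_inner_self_nonneg (Dy_le w)
  obtain ⟨Q, hQ⟩ : ∃ B : H →ₗ[ℝ] H, ∀ w, B w = Bx w + By w := ⟨Bx + By, fun w => rfl⟩
  have sQ : Q.IsSymmetric := fun u v => by
    rw [hQ, hQ, inner_add_left, inner_add_right, sBx, sBy]
  have pQ : ∀ w, w ≠ 0 → 0 < ⟪Q w, w⟫_ℝ := by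
    intro w hw
    rw [hQ, inner_add_left]
    have h1 : Dx w ≠ 0 := fun h => by
      have := pDx w hw
      rw [h, inner_zero_left] at this
      exact lt_irrefl _ this
    have h2 := real_inner_self_pos.2 h1
    linarith [Dx_le w, pBy w]
  have Qx_le : ∀ w, ⟪Bx w, w⟫_ℝ ≤ ⟪Q w, w⟫_ℝ := fun w => by
    rw [hQ, inner_add_left]; linarith [pBy w]
  have Qy_le : ∀ w, ⟪By w, w⟫_ℝ ≤ ⟪Q w, w⟫_ℝ := fun w => by
    rw [hQ, inner_add_left]; linarith [pBx w]
  obtain ⟨S, sS, hSS, pS⟩ := exists_sqrt sQ pQ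
  have pS' : ∀ w, 0 ≤ ⟪S w, w⟫_ℝ := fun w => by
    by_cases hw : w = 0
    · simp [hw]
    · exact (pS w hw).le
  -- the operators `Dx`, `Dy` are dominated by `S`
  have D_le_S : ∀ D : H →ₗ[ℝ] H, D.IsSymmetric → (∀ w, ⟪D w, D w⟫_ℝ ≤ ⟪Q w, w⟫_ℝ) →
      ∀ w, ⟪D w, w⟫_ℝ ≤ ⟪S w, w⟫_ℝ := by
    intro D sD hD w
    have hT : (S - D).IsSymmetric := sS.sub sD
    have := nonneg_of_no_neg_eigen hT (fun w τ hw hτ h => ?_) w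
    · rw [LinearMap.sub_apply, inner_sub_left] at this
      linarith
    · have h1 : D w = S w + τ • w := by
        rw [LinearMap.sub_apply, neg_smul] at h
        rw [← sub_eq_iff_eq_add', ← neg_sub, h, neg_neg]
      have h2 := norm_sq_lt_of_add_pos hτ hw h1 (pS' w)
      rw [sS, hSS, real_inner_comm] at h2
      linarith [hD w]
  have Sx := D_le_S Dx sDx fun w => (Dx_le w).trans (Qx_le w)
  have Sy := D_le_S Dy sDy fun w => (Dy_le w).trans (Qy_le w)
  -- the mixed operator
  obtain ⟨Y, hY⟩ : ∃ B : H →ₗ[ℝ] H, ∀ w, B w = (2:ℝ) • Dx (Dy w) :=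
    ⟨(2:ℝ) • (Dx ∘ₗ Dy), fun w => rfl⟩
  have sY : Y.IsSymmetric := fun u v => by
    rw [hY, hY, inner_smul_left, inner_smul_right, sDx, sDy, cDD]; simp
  have pY : ∀ w, 0 ≤ ⟪Y w, w⟫_ℝ := fun w => by
    rw [hY, inner_smul_left]
    have := pDD w
    simp only [conj_trivial]
    positivity
  have hDDB : ∀ w, ⟪Dx (Dy w), Dx (Dy w)⟫_ℝ ≤ ⟪Bx w, By w⟫_ℝ := by
    intro w
    rw [hBx, hBy, inner_add_left, inner_add_right, inner_add_right]
    have e1 : ⟪Dx (Dx w), Dy (Dy w)⟫_ℝ = ⟪Dx (Dy w), Dx (Dy w)⟫_ℝ := by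
      rw [sDx, cDD, cDD, ← sDy, ← cDD]
    have e2 : ⟪Dx (Dx w), Ey w⟫_ℝ = ⟪Ey (Dx w), Dx w⟫_ℝ := by
      rw [sDx, cDE, real_inner_comm]
    have e3 : ⟪Ex w, Dy (Dy w)⟫_ℝ = ⟪Ex (Dy w), Dy w⟫_ℝ := by
      rw [← sDy, cED]
    have e4 : ⟪Ex w, Ey w⟫_ℝ = ⟪Ex (Ey w), w⟫_ℝ := by
      rw [sEx, real_inner_comm, sEx]
    have := pEE w
    linarith [pEy (Dx w), pEx (Dy w)]
  have hYQ : ∀ w, ⟪Y w, Y w⟫_ℝ ≤ ⟪Q w, Q w⟫_ℝ := by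
    intro w
    have h1 := hDDB w
    have h2 : 0 ≤ ⟪Bx w - By w, Bx w - By w⟫_ℝ := real_inner_self_nonneg
    rw [inner_sub_left, inner_sub_right, inner_sub_right, real_inner_comm (Bx w) (By w)] at h2
    rw [hY, hQ, inner_smul_left, inner_smul_right, inner_add_left, inner_add_right, inner_add_right,
      real_inner_comm (Bx w) (By w)]
    simp only [conj_trivial]
    linarith
  have hmix : ∀ w, 0 ≤ 2 * ⟪Y w, S w⟫_ℝ + ⟪S (S (S w)), w⟫_ℝ := by
    intro w
    have hT : (Y ∘ₗ S + S ∘ₗ Y + S ∘ₗ S ∘ₗ S).IsSymmetric := by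
      intro u v
      simp only [LinearMap.add_apply, LinearMap.comp_apply, inner_add_left, inner_add_right]
      rw [sY, sS, sS, sS, sS, sS, sY]
      ring
    have := nonneg_of_no_neg_eigen hT (fun w τ hw hτ h => ?_) w
    · simp only [LinearMap.add_apply, LinearMap.comp_apply, inner_add_left] at this
      rw [sY, sS (Y w), real_inner_comm (Y w)] at this
      linarith
    · have h1 := congrArg (fun x => ⟪x, S w⟫_ℝ) h
      simp only [LinearMap.add_apply, LinearMap.comp_apply, inner_add_left, inner_smul_left] at h1
      have e1 : ⟪S (Y w), S w⟫_ℝ = ⟪Y w, Q w⟫_ℝ := by rw [sS, hSS]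
      have e2 : ⟪S (S (S w)), S w⟫_ℝ = ⟪Q w, Q w⟫_ℝ := by rw [sS, hSS]
      rw [e1, e2] at h1
      have h2 : 0 ≤ ⟪Y w + Q w, Y w + Q w⟫_ℝ := real_inner_self_nonneg
      rw [inner_add_left, inner_add_right, inner_add_right, real_inner_comm (Y w) (Q w)] at h2
      have h3 := pY (S w)
      have h4 := hYQ w
      have h5 := pS w hw
      rw [real_inner_comm] at h5
      simp only [conj_trivial] at h1
      nlinarith [mul_pos hτ h5]
  -- the third order operator
  have hDB : ∀ w, ⟪Dx (By w), w⟫_ℝ ≤ ⟪S (S (S w)), w⟫_ℝ := by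
    intro w
    have hT : (S ∘ₗ S ∘ₗ S - Dx ∘ₗ By).IsSymmetric := by
      intro u v
      simp only [LinearMap.sub_apply, LinearMap.comp_apply, inner_sub_left, inner_sub_right]
      rw [sS, sS, sS, sDx, sBy, cDB]
    have := nonneg_of_no_neg_eigen hT (fun w τ hw hτ h => ?_) w
    · simp only [LinearMap.sub_apply, LinearMap.comp_apply, inner_sub_left] at this
      linarith
    · simp only [LinearMap.sub_apply, LinearMap.comp_apply] at h
      have h1 : Dx (By w) = S (S (S w)) + τ • w := by
        rw [neg_smul] at h
        rw [← sub_eq_iff_eq_add', ← neg_sub, h, neg_neg]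
      have h2 := norm_sq_lt_of_add_pos hτ hw h1 (by rw [sS]; exact pS' _)
      have e1 : ⟪S (S (S w)), S (S (S w))⟫_ℝ = ⟪Q (Q w), Q w⟫_ℝ := by
        rw [sS, ← hSS w, hSS (S (S w)), ← hSS (S (S w)), sS, sS, real_inner_comm, sS]
        exact sS _ _
      have h3 := Dx_le (By w)
      have e2 : ⟪Q (Q w), Q w⟫_ℝ = ⟪Bx (By w), By w⟫_ℝ + (⟪Bx (Bx w), Bx w⟫_ℝ
          + 3 * ⟪By (Bx w), Bx w⟫_ℝ + 2 * ⟪Bx (By w), By w⟫_ℝ + ⟪By (By w), By w⟫_ℝ) := by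
        have f1 : ⟪Bx (Bx w), By w⟫_ℝ = ⟪By (Bx w), Bx w⟫_ℝ := by
          rw [sBx, cBB, real_inner_comm]
        have f2 : ⟪Bx (By w), Bx w⟫_ℝ = ⟪By (Bx w), Bx w⟫_ℝ := by rw [cBB]
        have f3 : ⟪By (Bx w), By w⟫_ℝ = ⟪Bx (By w), By w⟫_ℝ := by rw [cBB]
        have f4 : ⟪By (By w), Bx w⟫_ℝ = ⟪Bx (By w), By w⟫_ℝ := by
          rw [sBy, ← cBB, real_inner_comm]
        rw [hQ (Q w), hQ w]
        simp only [map_add, inner_add_left, inner_add_right]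
        rw [f1, f2, f3, f4]
        ring
      linarith [pBx (Bx w), pBy (Bx w), pBx (By w), pBy (By w)]
  have key : ⟪S (S (S ψ)), ψ⟫_ℝ ≤ 8 * F ^ 2 := by
    have h1 := hF (S ψ)
    have h2 := hmix ψ
    have e0 : ⟪S (S (S ψ)), ψ⟫_ℝ = ⟪S (S ψ), S ψ⟫_ℝ := sS _ _
    have h3 : ⟪Dx (Dx ψ) + Ex ψ + (Dy (Dy ψ) + Ey ψ) + (2:ℝ) • Dx (Dy ψ), S ψ⟫_ℝ
        = ⟪S (S (S ψ)), ψ⟫_ℝ + ⟪Y ψ, S ψ⟫_ℝ := by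
      rw [← hY, inner_add_left, ← hBx, ← hBy, ← hQ, ← hSS, ← sS (S (S ψ)) ψ]
    rw [h3] at h1
    have h4 : ⟪Dx (S ψ), S ψ⟫_ℝ + ⟪Dy (S ψ), S ψ⟫_ℝ ≤ 2 * ⟪S (S (S ψ)), ψ⟫_ℝ := by
      rw [e0]; linarith [Sx (S ψ), Sy (S ψ)]
    set t := ⟪S (S (S ψ)), ψ⟫_ℝ
    have ht : 0 ≤ t := by rw [e0]; exact pS' _
    have h5 : t ≤ 2 * (F * √(⟪Dx (S ψ), S ψ⟫_ℝ + ⟪Dy (S ψ), S ψ⟫_ℝ)) := by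
      have := le_abs_self (t + ⟪Y ψ, S ψ⟫_ℝ)
      linarith
    by_cases h0 : t = 0
    · rw [h0]; positivity
    have ht' : 0 < t := lt_of_le_of_ne ht (Ne.symm h0)
    set s := √(⟪Dx (S ψ), S ψ⟫_ℝ + ⟪Dy (S ψ), S ψ⟫_ℝ) with hs
    have hs2 : s ^ 2 ≤ 2 * t := by
      rcases le_total 0 (⟪Dx (S ψ), S ψ⟫_ℝ + ⟪Dy (S ψ), S ψ⟫_ℝ) with h | h
      · rw [hs, Real.sq_sqrt h]; exact h4
      · rw [hs, Real.sqrt_eq_zero_of_nonpos h]; simp; exact ht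
    have h6 : t ^ 2 ≤ (2 * (F * s)) ^ 2 := pow_le_pow_left₀ ht h5 2
    have h7 : t * t ≤ 8 * F ^ 2 * t := by nlinarith [sq_nonneg F]
    exact le_of_mul_le_mul_right h7 ht'
  have hlast : ⟪Dx (Dy ψ), Dy ψ⟫_ℝ ≤ ⟪Dx (By ψ), ψ⟫_ℝ := by
    rw [hBy, map_add, inner_add_left]
    have : ⟪Dx (Dy (Dy ψ)), ψ⟫_ℝ = ⟪Dx (Dy ψ), Dy ψ⟫_ℝ := by rw [cDD, sDy]
    linarith [pDE ψ]
  linarith [hDB ψ]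

end Operators

section Duhamel

theorem sum_inv_sqrt_le (Y : ℝ) (hY : 0 ≤ Y) (m : ℕ) :
    ∑ s ∈ range m, (if ((s:ℝ) + 1) ≤ Y then (√((s:ℝ) + 1))⁻¹ else 0) ≤ 2 * √(min (m:ℝ) Y) := by
  induction m with
  | zero => simp [hY]
  | succ m ih =>
    rw [sum_range_succ]
    have hm0 : (0:ℝ) ≤ m := Nat.cast_nonneg m
    split_ifs with h
    · rw [min_eq_left (by linarith)] at ih
      push_cast
      rw [min_eq_left h]
      have h1 : 0 < √((m:ℝ) + 1) := sqrt_pos.mpr (by linarith)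
      have h2 := sq_sqrt (show (0:ℝ) ≤ (m:ℝ) + 1 by linarith)
      have h3 := sq_sqrt hm0
      have h4 := sqrt_nonneg (m:ℝ)
      have h5 : (√((m:ℝ) + 1))⁻¹ ≤ 2 * √((m:ℝ) + 1) - 2 * √(m:ℝ) := by
        rw [inv_eq_one_div, div_le_iff₀ h1]
        nlinarith [sq_nonneg (√((m:ℝ) + 1) - √(m:ℝ))]
      linarith
    · have : √(min (m:ℝ) Y) ≤ √(min ((m + 1 : ℕ):ℝ) Y) := by
        apply sqrt_le_sqrt
        apply min_le_min_right
        push_cast; linarith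
      linarith

theorem sum_inv_sqrt_le' (m : ℕ) :
    ∑ s ∈ range m, (√((s:ℝ) + 1))⁻¹ ≤ 2 * √(m:ℝ) := by
  have h := sum_inv_sqrt_le m (Nat.cast_nonneg m) m
  rw [min_self] at h
  refine le_trans (sum_le_sum fun s hs => ?_) h
  rw [if_pos]
  have := mem_range.mp hs
  exact_mod_cast this

theorem sum_inv_sqrt_geom_le {q : ℝ} (hq0 : 0 < q) (hq1 : q < 1) (m : ℕ) :
    ∑ s ∈ range m, (√((s:ℝ) + 1))⁻¹ * q ^ s ≤ 3 / √(1 - q) := by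
  have ha : 0 < 1 - q := by linarith
  have hs := sqrt_pos.mpr ha
  have h1 := sum_inv_sqrt_le (1 / (1 - q)) (by positivity) m
  have h2 : √(min (m:ℝ) (1 / (1 - q))) ≤ 1 / √(1 - q) := by
    rw [← sqrt_one, ← sqrt_div zero_le_one, sqrt_one]
    exact sqrt_le_sqrt (min_le_right _ _)
  have h3 : ∑ s ∈ range m, q ^ s ≤ 1 / (1 - q) := by
    rw [geom_sum_eq hq1.ne, ← neg_div_neg_eq, neg_sub, neg_sub]
    gcongr
    linarith [pow_nonneg hq0.le m]
  have h4 : ∀ s ∈ range m, (√((s:ℝ) + 1))⁻¹ * q ^ s ≤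
      (if ((s:ℝ) + 1) ≤ 1 / (1 - q) then (√((s:ℝ) + 1))⁻¹ else 0) + √(1 - q) * q ^ s := by
    intro s _
    have hp := pow_nonneg hq0.le s
    split_ifs with h
    · have := pow_le_one₀ hq0.le hq1.le (n := s)
      have h5 : 0 ≤ (√((s:ℝ) + 1))⁻¹ := by positivity
      nlinarith [mul_nonneg hs.le hp]
    · rw [zero_add]
      gcongr
      rw [inv_le_iff_one_le_mul₀ (by positivity), ← sqrt_mul ha.le, one_le_sqrt]
      rw [not_le, div_lt_iff₀ ha] at h
      linarith
  refine (sum_le_sum h4).trans ?_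
  rw [sum_add_distrib, ← mul_sum]
  have h6 : √(1 - q) * (1 / (1 - q)) = 1 / √(1 - q) := by
    field_simp
    rw [sq_sqrt ha.le]
  have h7 : √(1 - q) * ∑ s ∈ range m, q ^ s ≤ 1 / √(1 - q) := by
    rw [← h6]; gcongr
  have : 3 / √(1 - q) = 2 * (1 / √(1 - q)) + 1 / √(1 - q) := by ring
  rw [this]
  linarith

variable {V : Type*} [AddCommGroup V] [Module ℝ V] [FiniteDimensional ℝ V]

/-- Solution operator bounds for the implicit Euler scheme of `M ∂ₜρ + μ a ρ = M κ`, measured by a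
functional which is controlled by interpolation between the energy and the residual norm. -/
theorem duhamel_bound {M a : V → V → ℝ} (hM : IsPos M) (ha : IsForm a) {l₁ : ℝ} (hl₁ : 0 < l₁)
    (hP : ∀ v, l₁ * M v v ≤ a v v) (p : V →ₗ[ℝ] ℝ) {C : ℝ} (hC : 0 ≤ C)
    (hp : ∀ ψ F, 0 ≤ F → (∀ φ, |a ψ φ| ≤ F * √(M φ φ)) → p ψ ^ 2 ≤ C * √(M ψ ψ) * F)
    {τ μ R : ℝ} (hτ : 0 < τ) (hμ : 0 < μ) (hR : 0 ≤ R) (ρ κ : ℕ → V) (h0 : ρ 0 = 0) (N : ℕ)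
    (heq : ∀ s < N, ∀ φ, M (ρ (s + 1) - ρ s) φ + τ * μ * a (ρ (s + 1)) φ = τ * M (κ (s + 1)) φ)
    (hκ : ∀ s < N, M (κ (s + 1)) (κ (s + 1)) ≤ R ^ 2) (m : ℕ) (hm : m ≤ N) :
    |p (ρ m)| ≤ 2 * √C * R * √(m * τ / μ) ∧ |p (ρ m)| ≤ √C * R * √(18 / l₁) / μ := by
  obtain ⟨ι, _, b, l, hexp, hpars, hone, hzero, hal⟩ := exists_simul_basis hM ha
  set δ := τ * μ with hδ
  have hδ0 : 0 < δ := mul_pos hτ hμ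
  have hl : ∀ i, l₁ ≤ l i := fun i => by
    have := hP (b i); rw [hal, hone] at this; linarith
  have hl0 : ∀ i, 0 < l i := fun i => hl₁.trans_le (hl i)
  set g : ι → ℝ := fun i => (1 + δ * l i)⁻¹ with hg
  have hg0 : ∀ i, 0 < g i := fun i => inv_pos.mpr (by have := mul_pos hδ0 (hl0 i); linarith)
  let E : ℕ → V → V := fun K v => ∑ i, (g i ^ K * M (b i) v) • b i
  have hcoord : ∀ (x : ι → ℝ) i, M (b i) (∑ j, x j • b j) = x i := by
    intro x i
    rw [hM.sum_right, Finset.sum_eq_single i]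
    · rw [hM.smul_right, hone, mul_one]
    · intro j _ hj; rw [hM.smul_right, hzero i j hj.symm, mul_zero]
    · simp
  have hE : ∀ K v i, M (b i) (E K v) = g i ^ K * M (b i) v := fun K v i => hcoord _ i
  -- the basic smoothing estimate
  set Q : ℝ := (1 + δ * l₁)⁻¹ with hQ
  have hd1 : 0 < δ * l₁ := mul_pos hδ0 hl₁
  have hQ0 : 0 < Q := inv_pos.mpr (by linarith)
  have hgQ : ∀ i, g i ≤ Q := fun i => by
    apply inv_anti₀ (by linarith)
    have := mul_le_mul_of_nonneg_left (hl i) hδ0.le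
    linarith
  have key : ∀ (K : ℕ) (v : V), M v v ≤ R ^ 2 →
      p (E (K + 1) v) ^ 2 ≤ C * (Q ^ (K + 1) * R) * (R / ((K + 1) * δ)) := by
    intro K v hv
    have e1 : √(M (E (K + 1) v) (E (K + 1) v)) ≤ Q ^ (K + 1) * R := by
      rw [sqrt_le_left (by positivity), hpars, mul_pow]
      refine le_trans ?_ (mul_le_mul_of_nonneg_left hv (by positivity))
      rw [hpars v v, mul_sum]
      refine sum_le_sum fun i _ => ?_
      rw [hE]
      have h1 : g i ^ (K + 1) ≤ Q ^ (K + 1) := pow_le_pow_left₀ (hg0 i).le (hgQ i) _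
      have h2 : 0 ≤ g i ^ (K + 1) := pow_nonneg (hg0 i).le _
      have h3 := mul_self_nonneg (M (b i) v)
      have : (g i ^ (K + 1)) ^ 2 ≤ (Q ^ (K + 1)) ^ 2 := pow_le_pow_left₀ h2 h1 _
      nlinarith [mul_le_mul_of_nonneg_right this h3]
    have hF0 : 0 ≤ R / ((K + 1) * δ) := by positivity
    refine (hp (E (K + 1) v) (R / ((K + 1) * δ)) hF0 ?_).trans ?_
    · intro φ
      have e2 : a (E (K + 1) v) φ = ∑ i, (l i * g i ^ (K + 1) * M (b i) v) * M (b i) φ := by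
        change a (∑ i, (g i ^ (K + 1) * M (b i) v) • b i) φ = _
        rw [ha.sum_left]
        refine sum_congr rfl fun i _ => ?_
        rw [ha.smul, hal]; ring
      have e3 : (a (E (K + 1) v) φ) ^ 2 ≤ (R / ((K + 1) * δ)) ^ 2 * M φ φ := by
        rw [e2]
        refine (sum_mul_sq_le_sq_mul_sq _ _ _).trans ?_
        have e4 : ∑ i, M (b i) φ ^ 2 = M φ φ := by
          rw [hpars φ φ]; exact sum_congr rfl fun i _ => by ring
        rw [e4]
        refine mul_le_mul_of_nonneg_right ?_ (hM.nonneg φ)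
        rw [div_pow]
        have e5 : ∑ i, (l i * g i ^ (K + 1) * M (b i) v) ^ 2 ≤
            (1 / ((K + 1) * δ)) ^ 2 * M v v := by
          rw [hpars v v, mul_sum]
          refine sum_le_sum fun i _ => ?_
          have h1 : l i * g i ^ (K + 1) ≤ 1 / ((K + 1) * δ) := by
            have hb := one_add_mul_le_pow (a := δ * l i)
              (by have := mul_pos hδ0 (hl0 i); linarith) (K + 1)
            push_cast at hb
            have hpp : 0 < (1 + δ * l i) ^ (K + 1) := by
              have := mul_pos hδ0 (hl0 i); positivity
            simp only [hg, inv_pow]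
            rw [← div_eq_mul_inv, div_le_div_iff₀ hpp (by positivity)]
            nlinarith [mul_pos hδ0 (hl0 i)]
          have h2 : 0 ≤ l i * g i ^ (K + 1) := mul_nonneg (hl0 i).le (pow_nonneg (hg0 i).le _)
          have h3 := pow_le_pow_left₀ h2 h1 2
          have h4 := mul_self_nonneg (M (b i) v)
          rw [mul_pow, pow_two (M (b i) v)]
          exact mul_le_mul_of_nonneg_right h3 h4
        refine e5.trans ?_
        rw [div_pow, one_pow, div_mul_eq_mul_div, one_mul]
        gcongr
      rw [← sqrt_sq hF0, ← sqrt_mul (sq_nonneg _), ← sqrt_sq_eq_abs]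
      exact sqrt_le_sqrt e3
    · gcongr
  have hrep : ∀ m ≤ N, ρ m = τ • ∑ s ∈ range m, E (s + 1) (κ (m - s)) := by
    intro m
    induction m with
    | zero => intro _; simp [h0]
    | succ m ih =>
      intro hm
      have ih' := ih (by omega)
      have hc : ∀ i, M (b i) (ρ (m + 1)) = g i * (M (b i) (ρ m) + τ * M (b i) (κ (m + 1))) := by
        intro i
        have h1 := heq m (by omega) (b i)
        rw [ha.symm, hal, hM.symm _ (b i), hM.symm _ (b i), sub_eq_add_neg, ← neg_one_smul ℝ (ρ m),
          hM.add_right, hM.smul_right] at h1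
        have h2 : 1 + δ * l i ≠ 0 := by have := mul_pos hδ0 (hl0 i); positivity
        simp only [hg]
        field_simp
        linarith
      rw [hexp (ρ (m + 1)), sum_range_succ', hexp (τ • _)]
      refine sum_congr rfl fun i _ => ?_
      congr 1
      rw [hc i, ih', hM.smul_right, hM.smul_right, hM.add_right, hM.sum_right, hM.sum_right]
      simp only [hE]
      rw [zero_add, pow_one, Nat.sub_zero, mul_add, ← mul_assoc, mul_comm (g i) τ, mul_assoc,
        mul_sum]
      rw [mul_add]
      congr 1
      · congr 1
        refine sum_congr rfl fun s _ => ?_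
        rw [show m + 1 - (s + 1) = m - s by omega]; ring
      · ring
  have hbound : ∀ s < m, |p (E (s + 1) (κ (m - s)))| ≤
      √C * R * (√((s:ℝ) + 1))⁻¹ * (√δ)⁻¹ * √Q ^ (s + 1) := by
    intro s hs
    have hk := key s (κ (m - s)) (by
      have := hκ (m - s - 1) (by omega)
      rwa [show m - s - 1 + 1 = m - s by omega] at this)
    rw [← sqrt_sq_eq_abs, sqrt_le_left (by positivity)]
    refine hk.trans_eq ?_
    simp only [mul_pow, inv_pow]
    rw [sq_sqrt hC, sq_sqrt (show (0:ℝ) ≤ (s:ℝ) + 1 by positivity), sq_sqrt hδ0.le, ← pow_mul,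
      mul_comm (s + 1) 2, pow_mul, sq_sqrt hQ0.le]
    field_simp
  have hsum : |p (ρ m)| ≤ τ * ∑ s ∈ range m,
      √C * R * (√((s:ℝ) + 1))⁻¹ * (√δ)⁻¹ * √Q ^ (s + 1) := by
    rw [hrep m hm, map_smul, map_sum, smul_eq_mul, abs_mul, abs_of_pos hτ]
    refine mul_le_mul_of_nonneg_left ?_ hτ.le
    exact (abs_sum_le_sum_abs _ _).trans (sum_le_sum fun s hs => hbound s (mem_range.mp hs))
  have hQ1 : Q < 1 := inv_lt_one_of_one_lt₀ (by linarith)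
  have hq1 : √Q < 1 := by rw [sqrt_lt' one_pos]; simpa using hQ1
  have hq0 : 0 < √Q := sqrt_pos.mpr hQ0
  have hsδ : 0 < √δ := sqrt_pos.mpr hδ0
  constructor
  · refine hsum.trans ?_
    have h1 : ∑ s ∈ range m, √C * R * (√((s:ℝ) + 1))⁻¹ * (√δ)⁻¹ * √Q ^ (s + 1) ≤
        √C * R * (√δ)⁻¹ * (2 * √(m:ℝ)) := by
      refine le_trans ?_ (mul_le_mul_of_nonneg_left (sum_inv_sqrt_le' m) (by positivity))
      rw [mul_sum]
      refine sum_le_sum fun s _ => ?_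
      have := pow_le_one₀ hq0.le hq1.le (n := s + 1)
      calc √C * R * (√((s:ℝ) + 1))⁻¹ * (√δ)⁻¹ * √Q ^ (s + 1)
          ≤ √C * R * (√((s:ℝ) + 1))⁻¹ * (√δ)⁻¹ * 1 := by gcongr
        _ = _ := by ring
    refine (mul_le_mul_of_nonneg_left h1 hτ.le).trans_eq ?_
    have h2 : √((m:ℝ) * τ / μ) = √(m:ℝ) * (τ * (√δ)⁻¹) := by
      rw [← sqrt_sq (show 0 ≤ τ * (√δ)⁻¹ by positivity), ← sqrt_mul (Nat.cast_nonneg m)]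
      congr 1
      rw [mul_pow, inv_pow, sq_sqrt hδ0.le, hδ]
      field_simp
    rw [h2]; ring
  · refine hsum.trans ?_
    have h1 : ∑ s ∈ range m, √C * R * (√((s:ℝ) + 1))⁻¹ * (√δ)⁻¹ * √Q ^ (s + 1) ≤
        √C * R * (√δ)⁻¹ * √Q * (3 / √(1 - √Q)) := by
      refine le_trans (le_of_eq ?_) (mul_le_mul_of_nonneg_left
        (sum_inv_sqrt_geom_le hq0 hq1 m) (by positivity))
      rw [mul_sum]
      exact sum_congr rfl fun s _ => by ring
    refine (mul_le_mul_of_nonneg_left h1 hτ.le).trans ?_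
    have h3 : √δ * √Q * (3 / √(1 - √Q)) ≤ √(18 / l₁) := by
      have h1q : 0 < 1 - √Q := by linarith
      rw [le_sqrt' (by positivity)]
      rw [mul_pow, mul_pow, div_pow, sq_sqrt hδ0.le, sq_sqrt hQ0.le, sq_sqrt h1q.le,
        mul_div_assoc', div_le_div_iff₀ h1q hl₁]
      have h5 : 1 - Q = δ * l₁ * Q := by
        rw [hQ]; field_simp; ring
      have h6 := sq_sqrt hQ0.le
      have : δ * Q * 3 ^ 2 * l₁ = 9 * ((1 - √Q) * (1 + √Q)) := by
        linear_combination (-9) * h5 + 9 * h6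
      rw [this]
      nlinarith
    have h4 : τ * (√C * R * (√δ)⁻¹ * √Q * (3 / √(1 - √Q))) =
        √C * R * (√δ * √Q * (3 / √(1 - √Q))) / μ := by
      have h5 : (√δ)⁻¹ = √δ / δ := by
        rw [inv_eq_one_div, div_eq_div_iff hsδ.ne' hδ0.ne', ← pow_two, sq_sqrt hδ0.le, one_mul]
      rw [h5, hδ]
      field_simp
    rw [h4]
    gcongr

end Duhamel

/-! ### Discrete calculus -/

section Discrete

/-- Summation by parts. -/
theorem sum_by_parts (p g : ℕ → ℝ) (n : ℕ) :
    ∑ i ∈ range (n + 1), p i * (g (i + 1) - g i) =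
      p n * g (n + 1) - p 0 * g 0 - ∑ i ∈ range n, (p (i + 1) - p i) * g (i + 1) := by
  induction n with
  | zero => simp; ring
  | succ n ih => rw [sum_range_succ, ih, sum_range_succ _ n]; ring

theorem double_cauchy (n m : ℕ) (x y : ℕ → ℕ → ℝ) :
    ∑ i ∈ range n, ∑ j ∈ range m, x i j * y i j ≤
      √(∑ i ∈ range n, ∑ j ∈ range m, x i j ^ 2) * √(∑ i ∈ range n, ∑ j ∈ range m, y i j ^ 2) := by
  have h := sum_mul_le_sqrt_mul_sqrt (range n ×ˢ range m) (fun q => x q.1 q.2) (fun q => y q.1 q.2)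
  simpa only [sum_product] using h

/-- Transposition of a grid function. -/
def tr (f : ℕ → ℕ → ℝ) : ℕ → ℕ → ℝ := fun i j => f j i

/-- Forward difference quotient in the first index. -/
def dx (h : ℝ) (f : ℕ → ℕ → ℝ) (i j : ℕ) : ℝ := (f (i + 1) j - f i j) / h

/-- Forward difference quotient in the second index. -/
def dy (k : ℝ) (f : ℕ → ℕ → ℝ) (i j : ℕ) : ℝ := (f i (j + 1) - f i j) / k

theorem dx_dy_comm (h k : ℝ) (f : ℕ → ℕ → ℝ) (i j : ℕ) : dx h (dy k f) i j = dy k (dx h f) i j := by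
  simp only [dx, dy]; ring

theorem dy_tr (h : ℝ) (f : ℕ → ℕ → ℝ) (i j : ℕ) : dy h (tr f) i j = dx h f j i := rfl

/-- Grid functions on the nodes, vanishing outside of the interior nodes. -/
def nodeSpace (n m : ℕ) : Submodule ℝ (ℕ → ℕ → ℝ) where
  carrier := {f | ∀ i j, (i = 0 ∨ n ≤ i ∨ j = 0 ∨ m ≤ j) → f i j = 0}
  add_mem' := by
    intro f g hf hg i j hij
    simp [hf i j hij, hg i j hij]
  zero_mem' := by intro i j _; rfl
  smul_mem' := by
    intro c f hf i j hij
    simp [hf i j hij]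

/-- Grid functions on the cells, vanishing outside. -/
def cellSpace (n m : ℕ) : Submodule ℝ (ℕ → ℕ → ℝ) where
  carrier := {f | ∀ i j, (n ≤ i ∨ m ≤ j) → f i j = 0}
  add_mem' := by
    intro f g hf hg i j hij
    simp [hf i j hij, hg i j hij]
  zero_mem' := by intro i j _; rfl
  smul_mem' := by
    intro c f hf i j hij
    simp [hf i j hij]

/-- Grid functions on a line, vanishing outside of the interior nodes. -/
def lineSpace (n : ℕ) : Submodule ℝ (ℕ → ℝ) where
  carrier := {f | ∀ i, (i = 0 ∨ n ≤ i) → f i = 0}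
  add_mem' := by
    intro f g hf hg i hij
    simp [hf i hij, hg i hij]
  zero_mem' := by intro i _; rfl
  smul_mem' := by
    intro c f hf i hij
    simp [hf i hij]

instance (n m : ℕ) : FiniteDimensional ℝ (cellSpace n m) := by
  let L : cellSpace n m →ₗ[ℝ] (Fin n → Fin m → ℝ) :=
    { toFun := fun f i j => f.1 i j
      map_add' := fun _ _ => rfl
      map_smul' := fun _ _ => rfl }
  refine FiniteDimensional.of_injective L fun f g hfg => ?_
  ext i j
  by_cases hij : n ≤ i ∨ m ≤ j
  · rw [f.2 i j hij, g.2 i j hij]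
  · push Not at hij
    exact congrFun (congrFun hfg ⟨i, hij.1⟩) ⟨j, hij.2⟩

instance (n m : ℕ) : FiniteDimensional ℝ (nodeSpace n m) := by
  let L : nodeSpace n m →ₗ[ℝ] (cellSpace n m) :=
    { toFun := fun f => ⟨f.1, fun i j h => f.2 i j (by tauto)⟩
      map_add' := fun _ _ => rfl
      map_smul' := fun _ _ => rfl }
  refine FiniteDimensional.of_injective L fun f g hfg => ?_
  exact Subtype.ext (congrArg (fun u : cellSpace n m => u.1) hfg)

instance (n : ℕ) : FiniteDimensional ℝ (lineSpace n) := by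
  let L : lineSpace n →ₗ[ℝ] (Fin n → ℝ) :=
    { toFun := fun f i => f.1 i
      map_add' := fun _ _ => rfl
      map_smul' := fun _ _ => rfl }
  refine FiniteDimensional.of_injective L fun f g hfg => ?_
  ext i
  by_cases hij : n ≤ i
  · rw [f.2 i (Or.inr hij), g.2 i (Or.inr hij)]
  · push Not at hij
    exact congrFun hfg ⟨i, hij⟩

theorem tr_mem {n m : ℕ} {f : ℕ → ℕ → ℝ} (hf : f ∈ nodeSpace n m) : tr f ∈ nodeSpace m n :=
  fun i j h => hf j i (by tauto)

theorem col_mem {n m : ℕ} {f : ℕ → ℕ → ℝ} (hf : f ∈ nodeSpace n m) (j : ℕ) :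
    (fun i => f i j) ∈ lineSpace n := fun i h => hf i j (by tauto)

theorem row_mem {n m : ℕ} {f : ℕ → ℕ → ℝ} (hf : f ∈ nodeSpace n m) (i : ℕ) :
    f i ∈ lineSpace m := fun j h => hf i j (by tauto)

/-- Negative second difference with homogeneous Dirichlet values. -/
def D2 (n : ℕ) (h : ℝ) (f : ℕ → ℝ) (i : ℕ) : ℝ :=
  if i = 0 ∨ n ≤ i then 0 else (2 * f i - f (i - 1) - f (i + 1)) / h ^ 2

theorem D2_mem (n : ℕ) (h : ℝ) (f : ℕ → ℝ) : D2 n h f ∈ lineSpace n := fun _ hi => if_pos hi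

theorem sum_D2_mul {n : ℕ} {h : ℝ} (f : ℕ → ℝ) {g : ℕ → ℝ} (hg : g ∈ lineSpace n) :
    ∑ i ∈ range n, D2 n h f i * g i =
      ∑ i ∈ range n, (f (i + 1) - f i) / h * ((g (i + 1) - g i) / h) := by
  rcases n with _ | n
  · simp
  have h1 := sum_by_parts (fun i => (f (i + 1) - f i) / h ^ 2) g n
  rw [hg 0 (Or.inl rfl), hg (n + 1) (Or.inr le_rfl), mul_zero, mul_zero, sub_zero, zero_sub] at h1
  have h2 : ∑ i ∈ range (n + 1), (f (i + 1) - f i) / h * ((g (i + 1) - g i) / h) =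
      ∑ i ∈ range (n + 1), (f (i + 1) - f i) / h ^ 2 * (g (i + 1) - g i) :=
    sum_congr rfl fun i _ => by ring
  rw [h2, h1, sum_range_succ', hg 0 (Or.inl rfl), mul_zero, add_zero, ← sum_neg_distrib]
  refine sum_congr rfl fun i hi => ?_
  have := mem_range.mp hi
  rw [D2, if_neg (by omega)]
  simp only [Nat.add_sub_cancel]
  ring

/-- The Dirichlet form on cells with odd reflection at the walls. -/
def bc (m : ℕ) (k : ℝ) (w z : ℕ → ℝ) : ℝ :=
  (∑ j ∈ range (m - 1), (w (j + 1) - w j) * (z (j + 1) - z j) + 2 * w 0 * z 0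
    + 2 * w (m - 1) * z (m - 1)) / k ^ 2

/-- Second difference on cells with odd reflection at the walls. -/
def Lc (m : ℕ) (k : ℝ) (w : ℕ → ℝ) (j : ℕ) : ℝ :=
  ((if j + 1 < m then w (j + 1) else - w j) - 2 * w j + (if j = 0 then - w 0 else w (j - 1))) / k ^ 2

theorem bc_eq_sum_Lc {m : ℕ} (hm : 1 ≤ m) (k : ℝ) (w z : ℕ → ℝ) :
    bc m k w z = - ∑ j ∈ range m, Lc m k w j * z j := by
  obtain ⟨m, rfl⟩ : ∃ q, m = q + 1 := ⟨m - 1, by omega⟩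
  simp only [bc, Lc, Nat.add_sub_cancel]
  have e1 : ∑ j ∈ range (m + 1), ((if j + 1 < m + 1 then w (j + 1) else - w j) - w j) * z j =
      ∑ j ∈ range m, (w (j + 1) - w j) * z j - 2 * w m * z m := by
    rw [sum_range_succ, if_neg (by omega)]
    rw [sum_congr rfl (g := fun j => (w (j + 1) - w j) * z j)]
    · ring
    · intro j hj
      rw [if_pos (by have := mem_range.mp hj; omega)]
  have e2 : ∑ j ∈ range (m + 1), (w j - (if j = 0 then - w 0 else w (j - 1))) * z j =
      ∑ j ∈ range m, (w (j + 1) - w j) * z (j + 1) + 2 * w 0 * z 0 := by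
    rw [sum_range_succ', if_pos rfl, sum_congr rfl (g := fun j => (w (j + 1) - w j) * z (j + 1))]
    · ring
    · intro j _
      rw [if_neg (Nat.succ_ne_zero j), Nat.add_sub_cancel]
  have e3 : ∑ j ∈ range (m + 1), ((if j + 1 < m + 1 then w (j + 1) else - w j) - 2 * w j +
      (if j = 0 then - w 0 else w (j - 1))) / k ^ 2 * z j =
      (∑ j ∈ range (m + 1), ((if j + 1 < m + 1 then w (j + 1) else - w j) - w j) * z j
      - ∑ j ∈ range (m + 1), (w j - (if j = 0 then - w 0 else w (j - 1))) * z j) / k ^ 2 := by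
    rw [← sum_sub_distrib, sum_div]
    exact sum_congr rfl fun j _ => by ring
  rw [e3, e1, e2]
  have e4 : ∑ j ∈ range m, (w (j + 1) - w j) * (z (j + 1) - z j) =
      ∑ j ∈ range m, (w (j + 1) - w j) * z (j + 1) - ∑ j ∈ range m, (w (j + 1) - w j) * z j := by
    rw [← sum_sub_distrib]
    exact sum_congr rfl fun j _ => by ring
  rw [e4]
  ring

/-- Boundary weight of the clamped fourth difference. -/
def wt (n : ℕ) (h : ℝ) (i : ℕ) : ℝ :=
  (if i = 1 then 2 / h ^ 4 else 0) + (if i + 1 = n then 2 / h ^ 4 else 0)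

theorem wt_nonneg (n : ℕ) (h : ℝ) (i : ℕ) : 0 ≤ wt n h i := by
  unfold wt
  have : 0 ≤ 2 / h ^ 4 := by positivity
  split_ifs <;> linarith

theorem bc_diff {m : ℕ} {k : ℝ} {f g : ℕ → ℝ} (hf : f ∈ lineSpace m) (hg : g ∈ lineSpace m) :
    bc m k (fun j => (f (j + 1) - f j) / k) (fun j => (g (j + 1) - g j) / k) =
      ∑ j ∈ range m, D2 m k f j * D2 m k g j + ∑ j ∈ range m, wt m k j * f j * g j := by
  rcases m with _ | m
  · have hf' : ∀ j, f j = 0 := fun j => hf j (Or.inr (Nat.zero_le _))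
    simp [bc, hf']
  simp only [bc, Nat.add_sub_cancel]
  have e1 : ∑ j ∈ range (m + 1), D2 (m + 1) k f j * D2 (m + 1) k g j =
      (∑ j ∈ range m, ((f (j + 1 + 1) - f (j + 1)) / k - (f (j + 1) - f j) / k) *
        ((g (j + 1 + 1) - g (j + 1)) / k - (g (j + 1) - g j) / k)) / k ^ 2 := by
    rw [sum_range_succ', D2_mem _ _ _ 0 (Or.inl rfl), zero_mul, add_zero, sum_div]
    refine sum_congr rfl fun j hj => ?_
    have := mem_range.mp hj
    rw [D2, D2, if_neg (by omega), if_neg (by omega)]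
    simp only [Nat.add_sub_cancel]
    ring
  have f0 : f 0 = 0 := hf 0 (Or.inl rfl)
  have g0 : g 0 = 0 := hg 0 (Or.inl rfl)
  have fm : f (m + 1) = 0 := hf _ (Or.inr le_rfl)
  have gm : g (m + 1) = 0 := hg _ (Or.inr le_rfl)
  have e2 : ∑ j ∈ range (m + 1), wt (m + 1) k j * f j * g j =
      2 / k ^ 4 * f 1 * g 1 + 2 / k ^ 4 * f m * g m := by
    have : ∀ j ∈ range (m + 1), wt (m + 1) k j * f j * g j =
        (if j = 1 then 2 / k ^ 4 * f 1 * g 1 else 0) + (if j = m then 2 / k ^ 4 * f m * g m else 0) := by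
      intro j _
      simp only [wt, Nat.add_right_cancel_iff]
      split_ifs with h1 h2 h2 <;> (try subst h1) <;> (try subst h2) <;> ring
    rw [sum_congr rfl this, sum_add_distrib, sum_ite_eq', sum_ite_eq']
    rcases m with _ | m
    · simp [fm]
    · simp
  rw [e1, e2, f0, g0, fm, gm]
  ring

theorem bc_self_nonneg (m : ℕ) (k : ℝ) (w : ℕ → ℝ) : 0 ≤ bc m k w w := by
  unfold bc
  refine div_nonneg ?_ (sq_nonneg k)
  have : 0 ≤ ∑ j ∈ range (m - 1), (w (j + 1) - w j) * (w (j + 1) - w j) :=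
    sum_nonneg fun j _ => mul_self_nonneg _
  nlinarith [mul_self_nonneg (w 0), mul_self_nonneg (w (m - 1))]

/-- A sequence with zero start is controlled by its difference quotients. -/
theorem sq_le_sum_diff {n : ℕ} {h : ℝ} (hh : 0 < h) {f : ℕ → ℝ} (f0 : f 0 = 0) {i : ℕ} (hi : i ≤ n) :
    f i ^ 2 ≤ n * h ^ 2 * ∑ s ∈ range n, ((f (s + 1) - f s) / h) ^ 2 := by
  have e1 : f i = ∑ s ∈ range i, (f (s + 1) - f s) := by rw [sum_range_sub, f0, sub_zero]
  have e2 := sq_sum_le_card_mul_sum_sq (s := range i) (f := fun s => f (s + 1) - f s)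
  rw [← e1, card_range] at e2
  have e3 : ∑ s ∈ range i, (f (s + 1) - f s) ^ 2 ≤ ∑ s ∈ range n, (f (s + 1) - f s) ^ 2 :=
    sum_le_sum_of_subset_of_nonneg (range_mono hi) fun _ _ _ => sq_nonneg _
  have e4 : h ^ 2 * ∑ s ∈ range n, ((f (s + 1) - f s) / h) ^ 2 =
      ∑ s ∈ range n, (f (s + 1) - f s) ^ 2 := by
    rw [mul_sum]
    exact sum_congr rfl fun s _ => by field_simp
  rw [mul_assoc, e4]
  refine e2.trans ?_
  have h0 : 0 ≤ ∑ s ∈ range i, (f (s + 1) - f s) ^ 2 := sum_nonneg fun _ _ => sq_nonneg _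
  gcongr

theorem sum_sq_le_sum_diff {n : ℕ} {h : ℝ} (hh : 0 < h) {f : ℕ → ℝ} (f0 : f 0 = 0) :
    ∑ i ∈ range n, f i ^ 2 ≤ (n * h) ^ 2 * ∑ s ∈ range n, ((f (s + 1) - f s) / h) ^ 2 := by
  refine (sum_le_sum fun i hi => sq_le_sum_diff (n := n) hh f0 (mem_range.mp hi).le).trans ?_
  rw [sum_const, card_range, nsmul_eq_mul]
  apply le_of_eq; ring

end Discrete

section Forms

/-- The `l²` form on node functions. -/
def l2 (n m : ℕ) (ψ φ : ℕ → ℕ → ℝ) : ℝ := ∑ i ∈ range n, ∑ j ∈ range m, ψ i j * φ i j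

theorem l2_tr (n m : ℕ) (ψ φ : ℕ → ℕ → ℝ) : l2 m n (tr ψ) (tr φ) = l2 n m ψ φ := sum_comm

theorem l2_symm (n m : ℕ) (u v : ℕ → ℕ → ℝ) : l2 n m u v = l2 n m v u :=
  sum_congr rfl fun _ _ => sum_congr rfl fun _ _ => mul_comm _ _

theorem l2_add (n m : ℕ) (u v w : ℕ → ℕ → ℝ) : l2 n m (u + v) w = l2 n m u w + l2 n m v w := by
  simp only [l2, Pi.add_apply, add_mul, sum_add_distrib]

theorem l2_smul (n m : ℕ) (c : ℝ) (u w : ℕ → ℕ → ℝ) : l2 n m (c • u) w = c * l2 n m u w := by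
  simp only [l2, Pi.smul_apply, smul_eq_mul, mul_sum, mul_assoc]

theorem l2_isForm (n m : ℕ) : IsForm (l2 n m) := ⟨l2_symm n m, l2_add n m, l2_smul n m⟩

theorem l2_self_nonneg (n m : ℕ) (u : ℕ → ℕ → ℝ) : 0 ≤ l2 n m u u :=
  sum_nonneg fun _ _ => sum_nonneg fun _ _ => mul_self_nonneg _

theorem l2_self_eq (n m : ℕ) (u : ℕ → ℕ → ℝ) :
    l2 n m u u = ∑ i ∈ range n, ∑ j ∈ range m, u i j ^ 2 :=
  sum_congr rfl fun _ _ => sum_congr rfl fun _ _ => (pow_two _).symm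

theorem eq_zero_of_l2_self {n m : ℕ} {u : ℕ → ℕ → ℝ} (h : l2 n m u u = 0) {i j : ℕ} (hi : i < n)
    (hj : j < m) : u i j = 0 := by
  rw [l2, sum_eq_zero_iff_of_nonneg fun _ _ => sum_nonneg fun _ _ => mul_self_nonneg _] at h
  have h1 := h i (mem_range.mpr hi)
  rw [sum_eq_zero_iff_of_nonneg fun _ _ => mul_self_nonneg _] at h1
  exact mul_self_eq_zero.mp (h1 j (mem_range.mpr hj))

theorem l2_cauchy (n m : ℕ) (x y : ℕ → ℕ → ℝ) : l2 n m x y ≤ √(l2 n m x x) * √(l2 n m y y) := by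
  rw [l2_self_eq, l2_self_eq]; exact double_cauchy n m x y

/-- Kinetic energy form in terms of the stream function. -/
def Mf (n m : ℕ) (h k : ℝ) (ψ φ : ℕ → ℕ → ℝ) : ℝ :=
  h * k * (l2 n m (dx h ψ) (dx h φ) + l2 n m (dy k ψ) (dy k φ))

/-- One half of the dissipation form in terms of the stream function. -/
def Uf (n m : ℕ) (h k : ℝ) (ψ φ : ℕ → ℕ → ℝ) : ℝ :=
  ∑ i ∈ range n, bc m k (dy k ψ i) (dy k φ i) + l2 n m (dx h (dy k ψ)) (dx h (dy k φ))

/-- Dissipation form in terms of the stream function. -/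
def af (n m : ℕ) (h k : ℝ) (ψ φ : ℕ → ℕ → ℝ) : ℝ :=
  h * k * (Uf n m h k ψ φ + Uf m n k h (tr ψ) (tr φ))

theorem Mf_tr (n m : ℕ) (h k : ℝ) (ψ φ : ℕ → ℕ → ℝ) :
    Mf m n k h (tr ψ) (tr φ) = Mf n m h k ψ φ := by
  unfold Mf
  rw [← l2_tr n m (dx h ψ), ← l2_tr n m (dy k ψ), add_comm, mul_comm k h]
  rfl

theorem af_tr (n m : ℕ) (h k : ℝ) (ψ φ : ℕ → ℕ → ℝ) :
    af m n k h (tr ψ) (tr φ) = af n m h k ψ φ := by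
  unfold af
  rw [add_comm, mul_comm k h]
  rfl

theorem dx_add (h : ℝ) (u v : ℕ → ℕ → ℝ) : dx h (u + v) = dx h u + dx h v := by
  funext i j; simp only [dx, Pi.add_apply]; ring

theorem dy_add (h : ℝ) (u v : ℕ → ℕ → ℝ) : dy h (u + v) = dy h u + dy h v := by
  funext i j; simp only [dy, Pi.add_apply]; ring

theorem dx_smul (h c : ℝ) (u : ℕ → ℕ → ℝ) : dx h (c • u) = c • dx h u := by
  funext i j; simp only [dx, Pi.smul_apply, smul_eq_mul]; ring

theorem dy_smul (h c : ℝ) (u : ℕ → ℕ → ℝ) : dy h (c • u) = c • dy h u := by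
  funext i j; simp only [dy, Pi.smul_apply, smul_eq_mul]; ring

theorem bc_isForm (m : ℕ) (k : ℝ) : IsForm (bc m k) where
  symm u v := by
    unfold bc
    congr 1
    rw [sum_congr rfl fun j _ => mul_comm (u (j + 1) - u j) (v (j + 1) - v j)]; ring
  add u v w := by
    unfold bc
    have : ∑ j ∈ range (m - 1), ((u + v) (j + 1) - (u + v) j) * (w (j + 1) - w j) =
        ∑ j ∈ range (m - 1), (u (j + 1) - u j) * (w (j + 1) - w j) +
        ∑ j ∈ range (m - 1), (v (j + 1) - v j) * (w (j + 1) - w j) := by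
      rw [← sum_add_distrib]
      exact sum_congr rfl fun j _ => by simp only [Pi.add_apply]; ring
    rw [this]; simp only [Pi.add_apply]; ring
  smul c u w := by
    unfold bc
    have : ∑ j ∈ range (m - 1), ((c • u) (j + 1) - (c • u) j) * (w (j + 1) - w j) =
        c * ∑ j ∈ range (m - 1), (u (j + 1) - u j) * (w (j + 1) - w j) := by
      rw [mul_sum]
      exact sum_congr rfl fun j _ => by simp only [Pi.smul_apply, smul_eq_mul]; ring
    rw [this]; simp only [Pi.smul_apply, smul_eq_mul]; ring

theorem Mf_isForm (n m : ℕ) (h k : ℝ) : IsForm (Mf n m h k) where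
  symm u v := by unfold Mf; rw [l2_symm, l2_symm n m (dy k u)]
  add u v w := by unfold Mf; rw [dx_add, dy_add, l2_add, l2_add]; ring
  smul c u w := by unfold Mf; rw [dx_smul, dy_smul, l2_smul, l2_smul]; ring

theorem Uf_isForm (n m : ℕ) (h k : ℝ) : IsForm (Uf n m h k) where
  symm u v := by
    unfold Uf
    rw [l2_symm, sum_congr rfl fun i _ => (bc_isForm m k).symm (dy k u i) (dy k v i)]
  add u v w := by
    unfold Uf
    rw [dy_add, dx_add, l2_add]
    simp only [Pi.add_apply, (bc_isForm m k).add, sum_add_distrib]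
    ring
  smul c u w := by
    unfold Uf
    rw [dy_smul, dx_smul, l2_smul]
    simp only [Pi.smul_apply, (bc_isForm m k).smul, ← mul_sum]
    ring

theorem af_isForm (n m : ℕ) (h k : ℝ) : IsForm (af n m h k) where
  symm u v := by unfold af; rw [(Uf_isForm n m h k).symm, (Uf_isForm m n k h).symm]
  add u v w := by
    unfold af
    rw [(Uf_isForm n m h k).add, show tr (u + v) = tr u + tr v from rfl, (Uf_isForm m n k h).add]
    ring
  smul c u w := by
    unfold af
    rw [(Uf_isForm n m h k).smul, show tr (c • u) = c • tr u from rfl, (Uf_isForm m n k h).smul]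
    ring

theorem dy_zero_left {n m : ℕ} {k : ℝ} {ψ : ℕ → ℕ → ℝ} (hψ : ψ ∈ nodeSpace n m) (j : ℕ) :
    dy k ψ 0 j = 0 := by
  simp [dy, hψ 0 j (by simp), hψ 0 (j + 1) (by simp)]

theorem dy_zero_right {n m : ℕ} {k : ℝ} {ψ : ℕ → ℕ → ℝ} (hψ : ψ ∈ nodeSpace n m) {i : ℕ}
    (hi : n ≤ i) (j : ℕ) : dy k ψ i j = 0 := by
  simp [dy, hψ i j (by tauto), hψ i (j + 1) (by tauto)]

theorem dx_zero_left {n m : ℕ} {h : ℝ} {ψ : ℕ → ℕ → ℝ} (hψ : ψ ∈ nodeSpace n m) (i : ℕ) :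
    dx h ψ i 0 = 0 := by
  simp [dx, hψ i 0 (by simp), hψ (i + 1) 0 (by simp)]

theorem l2_dy_le {n m : ℕ} {h k : ℝ} (hh : 0 < h) {ψ : ℕ → ℕ → ℝ} (hψ : ψ ∈ nodeSpace n m) :
    l2 n m (dy k ψ) (dy k ψ) ≤ (n * h) ^ 2 * l2 n m (dx h (dy k ψ)) (dx h (dy k ψ)) := by
  rw [l2_self_eq, l2_self_eq, sum_comm, sum_comm (s := range n), mul_sum]
  exact sum_le_sum fun j _ => sum_sq_le_sum_diff hh (f := fun i => dy k ψ i j) (dy_zero_left hψ j)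

theorem Uf_ge (n m : ℕ) (h k : ℝ) (ψ : ℕ → ℕ → ℝ) :
    l2 n m (dx h (dy k ψ)) (dx h (dy k ψ)) ≤ Uf n m h k ψ ψ := by
  unfold Uf
  have : 0 ≤ ∑ i ∈ range n, bc m k (dy k ψ i) (dy k ψ i) :=
    sum_nonneg fun i _ => bc_self_nonneg _ _ _
  linarith

theorem l2_dxdy_tr (n m : ℕ) (h k : ℝ) (ψ : ℕ → ℕ → ℝ) :
    l2 m n (dx k (dy h (tr ψ))) (dx k (dy h (tr ψ))) = l2 n m (dx h (dy k ψ)) (dx h (dy k ψ)) := by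
  rw [← l2_tr n m]
  congr 1 <;> (funext i j; exact (dx_dy_comm h k ψ j i).symm)

/-- Poincaré inequality. -/
theorem poincare {n m : ℕ} {h k : ℝ} (hh : 0 < h) (hk : 0 < k) {ψ : ℕ → ℕ → ℝ}
    (hψ : ψ ∈ nodeSpace n m) :
    2 * Mf n m h k ψ ψ ≤ ((n * h) ^ 2 + (m * k) ^ 2) * af n m h k ψ ψ := by
  have h1 := l2_dy_le (k := k) hh hψ
  have h2 := l2_dy_le (k := h) hk (tr_mem hψ)
  rw [l2_dxdy_tr] at h2
  have h3 := Uf_ge n m h k ψ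
  have h4 := Uf_ge m n k h (tr ψ)
  rw [l2_dxdy_tr] at h4
  have h5 : l2 m n (dy h (tr ψ)) (dy h (tr ψ)) = l2 n m (dx h ψ) (dx h ψ) := l2_tr n m (dx h ψ) _
  rw [h5] at h2
  have h6 := l2_self_nonneg n m (dx h (dy k ψ))
  unfold Mf af
  have hhk : 0 < h * k := mul_pos hh hk
  have h7 : 2 * (l2 n m (dx h ψ) (dx h ψ) + l2 n m (dy k ψ) (dy k ψ)) ≤
      ((n * h) ^ 2 + (m * k) ^ 2) * (Uf n m h k ψ ψ + Uf m n k h (tr ψ) (tr ψ)) := by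
    have : ((n * h) ^ 2 + (m * k) ^ 2) * (2 * l2 n m (dx h (dy k ψ)) (dx h (dy k ψ))) ≤
      ((n * h) ^ 2 + (m * k) ^ 2) * (Uf n m h k ψ ψ + Uf m n k h (tr ψ) (tr ψ)) := by
      apply mul_le_mul_of_nonneg_left _ (by positivity)
      linarith
    linarith
  nlinarith

theorem Mf_nonneg {n m : ℕ} {h k : ℝ} (hh : 0 < h) (hk : 0 < k) (ψ : ℕ → ℕ → ℝ) :
    0 ≤ Mf n m h k ψ ψ := by
  unfold Mf
  have := l2_self_nonneg n m (dx h ψ)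
  have := l2_self_nonneg n m (dy k ψ)
  positivity

theorem Mf_pos {n m : ℕ} {h k : ℝ} (hh : 0 < h) (hk : 0 < k) {ψ : ℕ → ℕ → ℝ}
    (hψ : ψ ∈ nodeSpace n m) (hne : ψ ≠ 0) : 0 < Mf n m h k ψ ψ := by
  refine lt_of_le_of_ne (Mf_nonneg hh hk ψ) fun h0 => hne ?_
  have h1 := l2_self_nonneg n m (dx h ψ)
  have h2 := l2_self_nonneg n m (dy k ψ)
  have h3 : l2 n m (dx h ψ) (dx h ψ) = 0 := by
    have : l2 n m (dx h ψ) (dx h ψ) + l2 n m (dy k ψ) (dy k ψ) = 0 := by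
      have := h0.symm
      unfold Mf at this
      simpa [hh.ne', hk.ne'] using this
    linarith
  have h4 : ∀ j < m, ∀ i ≤ n, ψ i j = 0 := by
    intro j hj i
    induction i with
    | zero => intro _; exact hψ 0 j (by simp)
    | succ i ih =>
      intro hi
      have h5 := eq_zero_of_l2_self h3 (show i < n by omega) hj
      rw [dx, ih (by omega), sub_zero, div_eq_zero_iff] at h5
      exact h5.resolve_right hh.ne'
  funext i j
  by_cases hi : i ≤ n
  · by_cases hj : j < m
    · exact h4 j hj i hi
    · exact hψ i j (by omega)
  · exact hψ i j (by omega)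

/-- The kinetic form on node functions. -/
abbrev nM (n m : ℕ) (h k : ℝ) (u v : nodeSpace n m) : ℝ := Mf n m h k u.1 v.1

/-- The dissipation form on node functions. -/
abbrev na (n m : ℕ) (h k : ℝ) (u v : nodeSpace n m) : ℝ := af n m h k u.1 v.1

theorem nM_isPos (n m : ℕ) {h k : ℝ} (hh : 0 < h) (hk : 0 < k) : IsPos (nM n m h k) where
  symm u v := (Mf_isForm n m h k).symm u.1 v.1
  add u v w := (Mf_isForm n m h k).add u.1 v.1 w.1
  smul c u w := (Mf_isForm n m h k).smul c u.1 w.1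
  pos v hv := Mf_pos hh hk v.2 fun h0 => hv (Subtype.ext h0)

theorem na_isForm (n m : ℕ) (h k : ℝ) : IsForm (na n m h k) where
  symm u v := (af_isForm n m h k).symm u.1 v.1
  add u v w := (af_isForm n m h k).add u.1 v.1 w.1
  smul c u w := (af_isForm n m h k).smul c u.1 w.1

theorem nl_isPos (n m : ℕ) : IsPos (fun u v : nodeSpace n m => l2 n m u.1 v.1) where
  symm u v := l2_symm n m u.1 v.1
  add u v w := l2_add n m u.1 v.1 w.1
  smul c u w := l2_smul n m c u.1 w.1
  pos v hv := by
    refine lt_of_le_of_ne (l2_self_nonneg n m v.1) fun h0 => hv (Subtype.ext ?_)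
    funext i j
    by_cases hij : i < n ∧ j < m
    · exact eq_zero_of_l2_self h0.symm hij.1 hij.2
    · exact v.2 i j (by omega)

end Forms

section Agmon
open scoped InnerProductSpace

/-- Negative second difference in the first index. -/
def Gx (n : ℕ) (h : ℝ) (ψ : ℕ → ℕ → ℝ) (i j : ℕ) : ℝ := D2 n h (fun s => ψ s j) i

/-- Negative second difference in the second index. -/
def Gy (m : ℕ) (k : ℝ) (ψ : ℕ → ℕ → ℝ) (i j : ℕ) : ℝ := D2 m k (ψ i) j

theorem l2_Gy {n m : ℕ} {k : ℝ} (ψ : ℕ → ℕ → ℝ) {φ : ℕ → ℕ → ℝ} (hφ : ∀ i, φ i ∈ lineSpace m) :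
    l2 n m (Gy m k ψ) φ = l2 n m (dy k ψ) (dy k φ) :=
  sum_congr rfl fun i _ => sum_D2_mul (ψ i) (hφ i)

theorem l2_Gx {n m : ℕ} {h : ℝ} (ψ : ℕ → ℕ → ℝ) {φ : ℕ → ℕ → ℝ}
    (hφ : ∀ j, (fun i => φ i j) ∈ lineSpace n) :
    l2 n m (Gx n h ψ) φ = l2 n m (dx h ψ) (dx h φ) := by
  unfold l2
  rw [sum_comm, sum_comm (s := range n)]
  exact sum_congr rfl fun j _ => sum_D2_mul (fun i => ψ i j) (hφ j)

theorem D2_zero (n : ℕ) (h : ℝ) (i : ℕ) : D2 n h (fun _ => 0) i = 0 := by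
  unfold D2; split_ifs <;> simp

theorem Gx_mem {n m : ℕ} {h : ℝ} {ψ : ℕ → ℕ → ℝ} (hψ : ψ ∈ nodeSpace n m) :
    Gx n h ψ ∈ nodeSpace n m := by
  intro i j hij
  by_cases hi : i = 0 ∨ n ≤ i
  · exact if_pos hi
  · have : (fun s => ψ s j) = fun _ => 0 := by funext s; exact hψ s j (by tauto)
    rw [Gx, this, D2_zero]

theorem Gy_mem {n m : ℕ} {k : ℝ} {ψ : ℕ → ℕ → ℝ} (hψ : ψ ∈ nodeSpace n m) :
    Gy m k ψ ∈ nodeSpace n m := by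
  intro i j hij
  by_cases hj : j = 0 ∨ m ≤ j
  · exact if_pos hj
  · have : ψ i = fun _ => 0 := by funext s; exact hψ i s (by tauto)
    rw [Gy, this, D2_zero]

theorem dx_row_mem {n m : ℕ} {h : ℝ} {ψ : ℕ → ℕ → ℝ} (hψ : ψ ∈ nodeSpace n m) (i : ℕ) :
    dx h ψ i ∈ lineSpace m := by
  intro j hj
  simp [dx, hψ i j (by tauto), hψ (i + 1) j (by tauto)]

theorem dx_Gy (m : ℕ) (h k : ℝ) (ψ : ℕ → ℕ → ℝ) : dx h (Gy m k ψ) = Gy m k (dx h ψ) := by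
  funext i j
  simp only [dx, Gy, D2]
  split_ifs <;> ring

theorem Gx_Gy (n m : ℕ) (h k : ℝ) (ψ : ℕ → ℕ → ℝ) : Gx n h (Gy m k ψ) = Gy m k (Gx n h ψ) := by
  funext i j
  simp only [Gx, Gy, D2]
  split_ifs <;> ring

theorem l2_Gx_Gy {n m : ℕ} {h k : ℝ} (ψ : ℕ → ℕ → ℝ) {φ : ℕ → ℕ → ℝ} (hφ : φ ∈ nodeSpace n m) :
    l2 n m (Gx n h (Gy m k ψ)) φ = l2 n m (dx h (dy k ψ)) (dx h (dy k φ)) := by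
  rw [l2_Gx _ (col_mem hφ), dx_Gy, l2_Gy _ (dx_row_mem hφ)]
  congr 1 <;> (funext i j; exact (dx_dy_comm _ _ _ _ _).symm)

/-- The second difference in the first index as an operator on node functions. -/
def opX (n m : ℕ) (h : ℝ) : nodeSpace n m →ₗ[ℝ] nodeSpace n m where
  toFun ψ := ⟨Gx n h ψ.1, Gx_mem ψ.2⟩
  map_add' u v := by
    ext i j
    simp only [Gx, D2, Submodule.coe_add, Pi.add_apply]
    split_ifs <;> ring
  map_smul' c u := by
    ext i j
    simp only [Gx, D2, Submodule.coe_smul, Pi.smul_apply, smul_eq_mul, RingHom.id_apply]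
    split_ifs <;> ring

/-- The second difference in the second index as an operator on node functions. -/
def opY (n m : ℕ) (k : ℝ) : nodeSpace n m →ₗ[ℝ] nodeSpace n m where
  toFun ψ := ⟨Gy m k ψ.1, Gy_mem ψ.2⟩
  map_add' u v := by
    ext i j
    simp only [Gy, D2, Submodule.coe_add, Pi.add_apply]
    split_ifs <;> ring
  map_smul' c u := by
    ext i j
    simp only [Gy, D2, Submodule.coe_smul, Pi.smul_apply, smul_eq_mul, RingHom.id_apply]
    split_ifs <;> ring

/-- Multiplication by a weight as an operator on node functions. -/
def opW (n m : ℕ) (w : ℕ → ℕ → ℝ) : nodeSpace n m →ₗ[ℝ] nodeSpace n m where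
  toFun ψ := ⟨fun i j => w i j * ψ.1 i j, fun i j hij => by simp [ψ.2 i j hij]⟩
  map_add' u v := by
    ext i j
    simp only [Submodule.coe_add, Pi.add_apply]
    ring
  map_smul' c u := by
    ext i j
    simp only [Submodule.coe_smul, Pi.smul_apply, smul_eq_mul, RingHom.id_apply]
    ring

theorem Uf_eq {n m : ℕ} {h k : ℝ} {ψ φ : ℕ → ℕ → ℝ} (hψ : ψ ∈ nodeSpace n m)
    (hφ : φ ∈ nodeSpace n m) :
    Uf n m h k ψ φ = l2 n m (Gy m k (Gy m k ψ)) φ + l2 n m (fun i j => wt m k j * ψ i j) φ +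
      l2 n m (Gx n h (Gy m k ψ)) φ := by
  unfold Uf
  rw [l2_Gx_Gy ψ hφ]
  congr 1
  have h1 : l2 n m (Gy m k (Gy m k ψ)) φ = l2 n m (Gy m k ψ) (Gy m k φ) := by
    rw [l2_Gy _ (row_mem hφ), l2_symm n m (Gy m k ψ), l2_Gy _ (row_mem (Gy_mem hψ)), l2_symm]
  rw [h1]
  unfold l2
  rw [← sum_add_distrib]
  exact sum_congr rfl fun i _ => bc_diff (row_mem hψ i) (row_mem hφ i)

theorem Gx_tr (n : ℕ) (h : ℝ) (ψ : ℕ → ℕ → ℝ) : Gx n h (tr ψ) = tr (Gy n h ψ) := rfl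
theorem Gy_tr (m : ℕ) (k : ℝ) (ψ : ℕ → ℕ → ℝ) : Gy m k (tr ψ) = tr (Gx m k ψ) := rfl

theorem af_eq {n m : ℕ} {h k : ℝ} {ψ φ : ℕ → ℕ → ℝ} (hψ : ψ ∈ nodeSpace n m)
    (hφ : φ ∈ nodeSpace n m) :
    af n m h k ψ φ = h * k * (l2 n m (Gx n h (Gx n h ψ)) φ + l2 n m (fun i j => wt n h i * ψ i j) φ
      + (l2 n m (Gy m k (Gy m k ψ)) φ + l2 n m (fun i j => wt m k j * ψ i j) φ)
      + 2 * l2 n m (Gx n h (Gy m k ψ)) φ) := by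
  unfold af
  rw [Uf_eq hψ hφ, Uf_eq (tr_mem hψ) (tr_mem hφ)]
  simp only [Gx_tr, Gy_tr, l2_tr]
  have : l2 m n (fun i j => wt n h j * tr ψ i j) (tr φ) = l2 n m (fun i j => wt n h i * ψ i j) φ :=
    l2_tr n m (fun i j => wt n h i * ψ i j) φ
  rw [this, ← Gx_Gy]
  ring

theorem third_difference_bound {n m : ℕ} {h k : ℝ} (hh : 0 < h) (hk : 0 < k) {ψ : ℕ → ℕ → ℝ}
    (hψ : ψ ∈ nodeSpace n m) {F : ℝ}
    (hF : ∀ φ ∈ nodeSpace n m, |af n m h k ψ φ| ≤ F * √(Mf n m h k φ φ)) :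
    h * k * l2 n m (dx h (Gy m k ψ)) (dx h (Gy m k ψ)) ≤ 8 * F ^ 2 := by
  have hl := nl_isPos n m
  let _ : NormedAddCommGroup (nodeSpace n m) := hl.core.toNormedAddCommGroup
  let _ : InnerProductSpace ℝ (nodeSpace n m) := InnerProductSpace.ofCore hl.core.toCore
  have hin : ∀ u v : nodeSpace n m, ⟪u, v⟫_ℝ = l2 n m u.1 v.1 := fun u v => rfl
  have hhk : 0 < h * k := mul_pos hh hk
  have wx0 : ∀ i j, 0 ≤ (fun i _ => wt n h i : ℕ → ℕ → ℝ) i j := fun i _ => wt_nonneg n h i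
  have wy0 : ∀ i j, 0 ≤ (fun _ j => wt m k j : ℕ → ℕ → ℝ) i j := fun _ j => wt_nonneg m k j
  have key := third_order_bound (H := nodeSpace n m) (Dx := opX n m h) (Dy := opY n m k)
    (Ex := opW n m fun i _ => wt n h i) (Ey := opW n m fun _ j => wt m k j)
    (fun u v => by
      rw [hin, hin]
      change l2 n m (Gx n h u.1) v.1 = l2 n m u.1 (Gx n h v.1)
      rw [l2_Gx _ (col_mem v.2), l2_symm n m u.1, l2_Gx _ (col_mem u.2), l2_symm])
    (fun u v => by
      rw [hin, hin]
      change l2 n m (Gy m k u.1) v.1 = l2 n m u.1 (Gy m k v.1)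
      rw [l2_Gy _ (row_mem v.2), l2_symm n m u.1, l2_Gy _ (row_mem u.2), l2_symm])
    (fun u v => by
      rw [hin, hin]
      exact sum_congr rfl fun i _ => sum_congr rfl fun j _ => by simp only [opW, LinearMap.coe_mk, AddHom.coe_mk]; ring)
    (fun u v => by
      rw [hin, hin]
      exact sum_congr rfl fun i _ => sum_congr rfl fun j _ => by simp only [opW, LinearMap.coe_mk, AddHom.coe_mk]; ring)
    (fun w => Subtype.ext (Gx_Gy n m h k w.1))
    (fun w => by
      ext i j
      simp only [opX, opW, LinearMap.coe_mk, AddHom.coe_mk, Gx, D2]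
      split_ifs <;> ring)
    (fun w => by
      ext i j
      simp only [opY, opW, LinearMap.coe_mk, AddHom.coe_mk, Gy, D2]
      split_ifs <;> ring)
    (fun w => by
      ext i j
      simp only [opW, LinearMap.coe_mk, AddHom.coe_mk]
      ring)
    (fun w hw => by
      rw [hin]
      change 0 < l2 n m (Gx n h w.1) w.1
      rw [l2_Gx _ (col_mem w.2)]
      refine lt_of_le_of_ne (l2_self_nonneg _ _ _) fun h0 => ?_
      have h1 := hl.pos w hw
      have h2 : l2 n m w.1 w.1 ≤ (n * h) ^ 2 * l2 n m (dx h w.1) (dx h w.1) := by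
        rw [l2_self_eq, l2_self_eq, sum_comm, sum_comm (s := range n), mul_sum]
        exact sum_le_sum fun j _ => sum_sq_le_sum_diff hh (f := fun i => w.1 i j) (w.2 0 j (by simp))
      rw [← h0, mul_zero] at h2
      exact absurd h1 (not_lt.mpr h2))
    (fun w => by
      rw [hin]
      exact sum_nonneg fun i _ => sum_nonneg fun j _ => by
        simp only [opW, LinearMap.coe_mk, AddHom.coe_mk]
        nlinarith [mul_nonneg (wx0 i j) (mul_self_nonneg (w.1 i j))])
    (fun w => by
      rw [hin]
      exact sum_nonneg fun i _ => sum_nonneg fun j _ => by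
        simp only [opW, LinearMap.coe_mk, AddHom.coe_mk]
        nlinarith [mul_nonneg (wy0 i j) (mul_self_nonneg (w.1 i j))])
    (fun w => by
      rw [hin]
      change 0 ≤ l2 n m (Gx n h (Gy m k w.1)) w.1
      rw [l2_Gx_Gy _ w.2]
      exact l2_self_nonneg _ _ _)
    (fun w => by
      rw [hin]
      change 0 ≤ l2 n m (Gx n h (fun i j => wt m k j * w.1 i j)) w.1
      rw [l2_Gx _ (col_mem w.2)]
      exact sum_nonneg fun i _ => sum_nonneg fun j _ => by
        simp only [dx]
        rw [show (wt m k j * w.1 (i + 1) j - wt m k j * w.1 i j) / h = wt m k j *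
          ((w.1 (i + 1) j - w.1 i j) / h) by ring, mul_assoc]
        exact mul_nonneg (wy0 i j) (mul_self_nonneg _))
    (fun w => by
      rw [hin]
      exact sum_nonneg fun i _ => sum_nonneg fun j _ => by
        simp only [opW, LinearMap.coe_mk, AddHom.coe_mk]
        nlinarith [mul_nonneg (mul_nonneg (wx0 i j) (wy0 i j)) (mul_self_nonneg (w.1 i j))])
    (F := F / √(h * k)) (ψ := ⟨ψ, hψ⟩)
    (fun φ => by
      have h1 := hF φ.1 φ.2
      rw [af_eq hψ φ.2, abs_mul, abs_of_pos hhk] at h1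
      have h2 : Mf n m h k φ.1 φ.1 = h * k * (⟪opX n m h φ, φ⟫_ℝ + ⟪opY n m k φ, φ⟫_ℝ) := by
        rw [hin, hin]
        change _ = h * k * (l2 n m (Gx n h φ.1) φ.1 + l2 n m (Gy m k φ.1) φ.1)
        rw [l2_Gx _ (col_mem φ.2), l2_Gy _ (row_mem φ.2)]
        rfl
      rw [h2, sqrt_mul hhk.le] at h1
      have h3 : ⟪opX n m h (opX n m h ⟨ψ, hψ⟩) + (opW n m fun i _ => wt n h i) ⟨ψ, hψ⟩ +
          (opY n m k (opY n m k ⟨ψ, hψ⟩) + (opW n m fun _ j => wt m k j) ⟨ψ, hψ⟩) +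
          (2:ℝ) • opX n m h (opY n m k ⟨ψ, hψ⟩), φ⟫_ℝ =
          (l2 n m (Gx n h (Gx n h ψ)) φ.1 + l2 n m (fun i j => wt n h i * ψ i j) φ.1
      + (l2 n m (Gy m k (Gy m k ψ)) φ.1 + l2 n m (fun i j => wt m k j * ψ i j) φ.1)
      + 2 * l2 n m (Gx n h (Gy m k ψ)) φ.1) := by
        rw [inner_add_left, inner_add_left, inner_add_left, inner_add_left, real_inner_smul_left]
        rfl
      rw [h3]
      have hs := sqrt_pos.mpr hhk
      rw [div_mul_eq_mul_div, le_div_iff₀ hs]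
      have h4 := mul_self_sqrt hhk.le
      refine le_of_mul_le_mul_left ?_ hs
      have h5 : ∀ x : ℝ, √(h * k) * (x * √(h * k)) = h * k * x := fun x => by
        linear_combination x * h4
      rw [h5]
      exact h1.trans_eq (by ring))
  rw [hin] at key
  change l2 n m (Gx n h (Gy m k ψ)) (Gy m k ψ) ≤ _ at key
  rw [l2_Gx _ (col_mem (Gy_mem hψ)), div_pow, sq_sqrt hhk.le, mul_div_assoc', le_div_iff₀ hhk] at key
  linarith

end Agmon

section Agmon

theorem sum_range_shift_le {n : ℕ} {f : ℕ → ℝ} (hf : ∀ i, 0 ≤ f i) (hn : f n = 0) :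
    ∑ i ∈ range n, f (i + 1) ≤ ∑ i ∈ range n, f i := by
  have h1 := sum_range_succ' f n
  rw [sum_range_succ, hn] at h1
  linarith [hf 0]

theorem sum_range_pred_shift_le {m : ℕ} {f : ℕ → ℝ} (hf : ∀ i, 0 ≤ f i) :
    ∑ i ∈ range (m - 1), f (i + 1) ≤ ∑ i ∈ range m, f i := by
  rcases m with _ | m
  · simp
  · rw [Nat.add_sub_cancel, sum_range_succ']; linarith [hf 0]

theorem sum_range_pred_le {m : ℕ} {f : ℕ → ℝ} (hf : ∀ i, 0 ≤ f i) :
    ∑ i ∈ range (m - 1), f i ≤ ∑ i ∈ range m, f i :=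
  sum_le_sum_of_subset_of_nonneg (range_mono (by omega)) fun i _ _ => hf i

set_option maxHeartbeats 1000000 in
/-- Maximum bound of the first velocity component by interpolation. -/
theorem agmon {n m : ℕ} {h k : ℝ} (hh : 0 < h) (hk : 0 < k) {ψ : ℕ → ℕ → ℝ}
    (hψ : ψ ∈ nodeSpace n m) {F : ℝ} (hF0 : 0 ≤ F)
    (hF : ∀ φ ∈ nodeSpace n m, |af n m h k ψ φ| ≤ F * √(Mf n m h k φ φ))
    {i j : ℕ} (hi : i ≤ n) (hj : j < m) :
    dy k ψ i j ^ 2 ≤ 10 * √(Mf n m h k ψ ψ) * F := by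
  have hhk : 0 < h * k := mul_pos hh hk
  set A := af n m h k ψ ψ with hA
  have hAF : A ≤ F * √(Mf n m h k ψ ψ) := (le_abs_self _).trans (hF ψ hψ)
  have hM0 := Mf_nonneg (n := n) (m := m) hh hk ψ
  set v := dy k ψ with hv
  set G := Gy m k ψ with hG
  have hMv : h * k * l2 n m v v ≤ Mf n m h k ψ ψ := by
    unfold Mf
    have := l2_self_nonneg n m (dx h ψ)
    nlinarith
  have hU2 := Uf_ge m n k h (tr ψ)
  rw [l2_dxdy_tr] at hU2
  have hl0 := l2_self_nonneg n m (dx h v)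
  have hbc0 : 0 ≤ ∑ i ∈ range n, bc m k (v i) (v i) := sum_nonneg fun i _ => bc_self_nonneg _ _ _
  have hUdef : Uf n m h k ψ ψ = ∑ i ∈ range n, bc m k (v i) (v i) + l2 n m (dx h v) (dx h v) := rfl
  have hAdx : h * k * l2 n m (dx h v) (dx h v) ≤ A := by
    rw [hA, af, hUdef]
    refine mul_le_mul_of_nonneg_left ?_ hhk.le
    linarith
  have hAbc : h * k * ∑ i ∈ range n, bc m k (v i) (v i) ≤ A := by
    rw [hA, af, hUdef]
    refine mul_le_mul_of_nonneg_left ?_ hhk.le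
    linarith
  have hm : 1 ≤ m := by omega
  have hGv : ∀ s t, t + 1 < m → v s (t + 1) - v s t = - (k * G s (t + 1)) := by
    intro s t ht
    simp only [hv, hG, dy, Gy, D2]
    rw [if_neg (by omega)]
    simp only [Nat.add_sub_cancel]
    field_simp
    ring
  have hAG : h * k * l2 n m G G ≤ A := by
    refine le_trans (mul_le_mul_of_nonneg_left ?_ hhk.le) hAbc
    refine sum_le_sum fun s _ => ?_
    have := bc_diff (k := k) (row_mem hψ s) (row_mem hψ s)
    change bc m k (v s) (v s) = _ at this
    rw [this]
    have h1 : 0 ≤ ∑ j ∈ range m, wt m k j * ψ s j * ψ s j := sum_nonneg fun j _ => by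
      rw [mul_assoc]; exact mul_nonneg (wt_nonneg _ _ _) (mul_self_nonneg _)
    change ∑ j ∈ range m, D2 m k (ψ s) j * D2 m k (ψ s) j ≤ _
    linarith
  have hAw : 2 * (h / k * ∑ s ∈ range n, v s 0 ^ 2) ≤ A := by
    refine le_trans (le_trans (le_of_eq ?_) (mul_le_mul_of_nonneg_left
      (sum_le_sum (f := fun s => 2 * v s 0 ^ 2 / k ^ 2) fun s _ => ?_) hhk.le)) hAbc
    · rw [← sum_div, ← mul_sum]; field_simp
    · unfold bc
      have : 0 ≤ ∑ j ∈ range (m - 1), (v s (j + 1) - v s j) * (v s (j + 1) - v s j) :=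
        sum_nonneg fun j _ => mul_self_nonneg _
      gcongr
      nlinarith [mul_self_nonneg (v s (m - 1))]
  have hAT : h * k * l2 n m (dx h G) (dx h G) ≤ 8 * F ^ 2 := third_difference_bound hh hk hψ hF
  have vn : ∀ t, v n t = 0 := fun t => dy_zero_right hψ le_rfl t
  have v0 : ∀ t, v 0 t = 0 := fun t => dy_zero_left hψ t
  have Gn : ∀ t, G n t = 0 := fun t => Gy_mem hψ n t (by simp)
  set w : ℕ → ℕ → ℝ := fun s t => dx h v s t * (v (s + 1) t + v s t) with hw
  have hstep : ∀ s t, h * w s t = v (s + 1) t ^ 2 - v s t ^ 2 := by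
    intro s t; simp only [hw, dx]; field_simp; ring
  -- telescoping in the first index
  have t1 : v i j ^ 2 ≤ h * ∑ s ∈ range n, |w s j| := by
    have e1 : v i j ^ 2 = ∑ s ∈ range i, h * w s j := by
      rw [sum_congr rfl fun s _ => hstep s j, sum_range_sub (fun s => v s j ^ 2), v0]; ring
    rw [e1, ← mul_sum]
    refine mul_le_mul_of_nonneg_left ?_ hh.le
    refine (sum_le_sum fun s _ => le_abs_self _).trans ?_
    exact sum_le_sum_of_subset_of_nonneg (range_mono hi) fun _ _ _ => abs_nonneg _
  -- telescoping in the second index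
  have t2 : ∀ s, |w s j| ≤ |w s 0| + ∑ t ∈ range (m - 1), |w s (t + 1) - w s t| := by
    intro s
    have e1 : w s j = w s 0 + ∑ t ∈ range j, (w s (t + 1) - w s t) := by
      rw [sum_range_sub]; ring
    rw [e1]
    refine (abs_add_le _ _).trans ?_
    gcongr
    refine (abs_sum_le_sum_abs _ _).trans ?_
    exact sum_le_sum_of_subset_of_nonneg (range_mono (by omega)) fun _ _ _ => abs_nonneg _
  have t3 : ∀ s, ∀ t ∈ range (m - 1), |w s (t + 1) - w s t| ≤
      k * (|dx h G s (t + 1)| * |v (s + 1) (t + 1) + v s (t + 1)|) +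
      k * (dx h v s t ^ 2 + (G (s + 1) (t + 1) ^ 2 + G s (t + 1) ^ 2) / 2) := by
    intro s t ht
    have ht' : t + 1 < m := by have := mem_range.mp ht; omega
    have e1 := hGv s t ht'
    have e2 := hGv (s + 1) t ht'
    have e3 : dx h v s (t + 1) = dx h v s t - k * dx h G s (t + 1) := by
      simp only [dx]
      rw [eq_sub_iff_add_eq, ← sub_eq_zero]
      have : (v (s + 1) (t + 1) - v s (t + 1)) / h + k * ((G (s + 1) (t + 1) - G s (t + 1)) / h)
        - (v (s + 1) t - v s t) / h = ((v (s + 1) (t + 1) - v (s + 1) t + k * G (s + 1) (t + 1)) -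
        (v s (t + 1) - v s t + k * G s (t + 1))) / h := by ring
      rw [this, e1, e2]; simp
    have e4 : w s (t + 1) - w s t = -(k * (dx h G s (t + 1) * (v (s + 1) (t + 1) + v s (t + 1))))
        + -(k * (dx h v s t * (G (s + 1) (t + 1) + G s (t + 1)))) := by
      simp only [hw]
      rw [e3]
      linear_combination dx h v s t * (e1 + e2)
    rw [e4]
    refine (abs_add_le _ _).trans ?_
    rw [abs_neg, abs_neg, abs_mul, abs_mul, abs_mul, abs_of_pos hk]
    gcongr
    rw [abs_le]
    constructor <;> nlinarith [sq_nonneg (dx h v s t + G (s + 1) (t + 1)),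
      sq_nonneg (dx h v s t + G s (t + 1)), sq_nonneg (dx h v s t - G (s + 1) (t + 1)),
      sq_nonneg (dx h v s t - G s (t + 1))]
  have t4 : ∀ s, |w s 0| ≤ k * dx h v s 0 ^ 2 + (v (s + 1) 0 ^ 2 + v s 0 ^ 2) / (2 * k) := by
    intro s
    have e1 : ∀ x a : ℝ, |x * a| ≤ k * x ^ 2 / 2 + a ^ 2 / (2 * k) := by
      intro x a
      have : k * x ^ 2 / 2 + a ^ 2 / (2 * k) = (k ^ 2 * x ^ 2 + a ^ 2) / (2 * k) := by field_simp
      rw [this, le_div_iff₀ (by positivity), abs_mul, ← sq_abs x, ← sq_abs a]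
      nlinarith [sq_nonneg (k * |x| - |a|)]
    simp only [hw]
    rw [mul_add]
    refine (abs_add_le _ _).trans ?_
    have := e1 (dx h v s 0) (v (s + 1) 0)
    have := e1 (dx h v s 0) (v s 0)
    have e2 : (v (s + 1) 0 ^ 2 + v s 0 ^ 2) / (2 * k) =
      v (s + 1) 0 ^ 2 / (2 * k) + v s 0 ^ 2 / (2 * k) := add_div _ _ _
    linarith
  -- summation
  have w1 : h * ∑ s ∈ range n, |w s 0| ≤ 3 / 2 * A := by
    have e1 : ∑ s ∈ range n, dx h v s 0 ^ 2 ≤ l2 n m (dx h v) (dx h v) := by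
      rw [l2_self_eq]
      exact sum_le_sum fun s _ => single_le_sum (f := fun t => dx h v s t ^ 2)
        (fun _ _ => sq_nonneg _) (mem_range.mpr hm)
    have e2 : ∑ s ∈ range n, v (s + 1) 0 ^ 2 ≤ ∑ s ∈ range n, v s 0 ^ 2 :=
      sum_range_shift_le (f := fun s => v s 0 ^ 2) (fun _ => sq_nonneg _) (by simp [vn])
    calc h * ∑ s ∈ range n, |w s 0|
        ≤ h * ∑ s ∈ range n, (k * dx h v s 0 ^ 2 + (v (s + 1) 0 ^ 2 + v s 0 ^ 2) / (2 * k)) :=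
          mul_le_mul_of_nonneg_left (sum_le_sum fun s _ => t4 s) hh.le
      _ = h * k * ∑ s ∈ range n, dx h v s 0 ^ 2 + h / k * ((∑ s ∈ range n, v (s + 1) 0 ^ 2 +
          ∑ s ∈ range n, v s 0 ^ 2) / 2) := by
          rw [sum_add_distrib, ← mul_sum, ← sum_div, sum_add_distrib]; field_simp
      _ ≤ h * k * l2 n m (dx h v) (dx h v) + h / k * ∑ s ∈ range n, v s 0 ^ 2 := by
          gcongr
          linarith
      _ ≤ 3 / 2 * A := by linarith
  have w2 : h * k * ∑ s ∈ range n, ∑ t ∈ range (m - 1),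
      |dx h G s (t + 1)| * |v (s + 1) (t + 1) + v s (t + 1)| ≤ 6 * (F * √(Mf n m h k ψ ψ)) := by
    have e1 : ∑ s ∈ range n, ∑ t ∈ range (m - 1),
        |dx h G s (t + 1)| * |v (s + 1) (t + 1) + v s (t + 1)| ≤
        l2 n m (fun s t => |dx h G s t|) (fun s t => |v (s + 1) t + v s t|) :=
      sum_le_sum fun s _ => sum_range_pred_shift_le
        (f := fun t => |dx h G s t| * |v (s + 1) t + v s t|)
        fun t => mul_nonneg (abs_nonneg _) (abs_nonneg _)
    have e2 := l2_cauchy n m (fun s t => |dx h G s t|) (fun s t => |v (s + 1) t + v s t|)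
    have e3 : l2 n m (fun s t => |dx h G s t|) (fun s t => |dx h G s t|) =
        l2 n m (dx h G) (dx h G) := by
      rw [l2_self_eq, l2_self_eq]; simp only [sq_abs]
    have e4 : l2 n m (fun s t => |v (s + 1) t + v s t|) (fun s t => |v (s + 1) t + v s t|) ≤
        4 * l2 n m v v := by
      rw [l2_self_eq, l2_self_eq, sum_comm, sum_comm (s := range n), mul_sum]
      refine sum_le_sum fun t _ => ?_
      have := sum_range_shift_le (n := n) (f := fun s => v s t ^ 2) (fun _ => sq_nonneg _)
        (by simp [vn])
      have e5 : ∑ s ∈ range n, |v (s + 1) t + v s t| ^ 2 ≤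
          ∑ s ∈ range n, (2 * v (s + 1) t ^ 2 + 2 * v s t ^ 2) :=
        sum_le_sum fun s _ => by rw [sq_abs]; nlinarith [sq_nonneg (v (s + 1) t - v s t)]
      rw [sum_add_distrib, ← mul_sum, ← mul_sum] at e5
      linarith
    rw [e3] at e2
    have e5 : h * k * (√(l2 n m (dx h G) (dx h G)) * √(l2 n m (fun s t => |v (s + 1) t + v s t|)
        (fun s t => |v (s + 1) t + v s t|))) ≤ √(8 * F ^ 2) * √(4 * Mf n m h k ψ ψ) := by
      rw [show h * k = √(h * k) * √(h * k) from (mul_self_sqrt hhk.le).symm, mul_mul_mul_comm,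
        ← sqrt_mul hhk.le, ← sqrt_mul hhk.le]
      refine mul_le_mul (sqrt_le_sqrt hAT) (sqrt_le_sqrt ?_) (sqrt_nonneg _) (sqrt_nonneg _)
      have := mul_le_mul_of_nonneg_left e4 hhk.le
      linarith
    have e6 : √(8 * F ^ 2) * √(4 * Mf n m h k ψ ψ) ≤ 6 * (F * √(Mf n m h k ψ ψ)) := by
      rw [sqrt_mul (by norm_num), sqrt_sq hF0, sqrt_mul (by norm_num),
        show (4:ℝ) = 2 ^ 2 by norm_num, sqrt_sq (by norm_num)]
      have : √8 ≤ 3 := by rw [sqrt_le_left (by norm_num)]; norm_num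
      have hp : 0 ≤ F * √(Mf n m h k ψ ψ) := by positivity
      nlinarith
    refine le_trans (mul_le_mul_of_nonneg_left (e1.trans e2) hhk.le) (e5.trans e6)
  have w3 : h * k * ∑ s ∈ range n, ∑ t ∈ range (m - 1),
      (dx h v s t ^ 2 + (G (s + 1) (t + 1) ^ 2 + G s (t + 1) ^ 2) / 2) ≤ 2 * A := by
    have e1 : ∑ s ∈ range n, ∑ t ∈ range (m - 1), dx h v s t ^ 2 ≤ l2 n m (dx h v) (dx h v) := by
      rw [l2_self_eq]
      exact sum_le_sum fun s _ => sum_range_pred_le fun t => sq_nonneg _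
    have e2 : ∑ s ∈ range n, ∑ t ∈ range (m - 1), G s (t + 1) ^ 2 ≤ l2 n m G G := by
      rw [l2_self_eq]
      exact sum_le_sum fun s _ => sum_range_pred_shift_le (f := fun t => G s t ^ 2)
        fun t => sq_nonneg _
    have e3 : ∑ s ∈ range n, ∑ t ∈ range (m - 1), G (s + 1) (t + 1) ^ 2 ≤
        ∑ s ∈ range n, ∑ t ∈ range (m - 1), G s (t + 1) ^ 2 := 
      sum_range_shift_le (f := fun s => ∑ t ∈ range (m - 1), G s (t + 1) ^ 2)
        (fun s => sum_nonneg fun t _ => sq_nonneg _) (by simp [Gn])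
    have e4 : ∑ s ∈ range n, ∑ t ∈ range (m - 1),
        (dx h v s t ^ 2 + (G (s + 1) (t + 1) ^ 2 + G s (t + 1) ^ 2) / 2) =
        ∑ s ∈ range n, ∑ t ∈ range (m - 1), dx h v s t ^ 2 +
        (∑ s ∈ range n, ∑ t ∈ range (m - 1), G (s + 1) (t + 1) ^ 2 +
        ∑ s ∈ range n, ∑ t ∈ range (m - 1), G s (t + 1) ^ 2) / 2 := by
      simp only [sum_add_distrib, ← sum_div]
    rw [e4]
    have e5 : ∑ s ∈ range n, ∑ t ∈ range (m - 1), dx h v s t ^ 2 +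
        (∑ s ∈ range n, ∑ t ∈ range (m - 1), G (s + 1) (t + 1) ^ 2 +
        ∑ s ∈ range n, ∑ t ∈ range (m - 1), G s (t + 1) ^ 2) / 2 ≤
        l2 n m (dx h v) (dx h v) + l2 n m G G := by linarith
    have := mul_le_mul_of_nonneg_left e5 hhk.le
    linarith
  have w4 : h * ∑ s ∈ range n, |w s j| ≤ h * ∑ s ∈ range n, |w s 0| +
      (h * k * ∑ s ∈ range n, ∑ t ∈ range (m - 1),
        |dx h G s (t + 1)| * |v (s + 1) (t + 1) + v s (t + 1)| +
      h * k * ∑ s ∈ range n, ∑ t ∈ range (m - 1),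
        (dx h v s t ^ 2 + (G (s + 1) (t + 1) ^ 2 + G s (t + 1) ^ 2) / 2)) := by
    rw [mul_assoc, mul_assoc, ← mul_add, ← mul_add]
    refine mul_le_mul_of_nonneg_left ?_ hh.le
    rw [mul_sum, mul_sum, ← sum_add_distrib, ← sum_add_distrib]
    refine sum_le_sum fun s _ => (t2 s).trans ?_
    refine add_le_add_right ?_ _
    rw [mul_sum, mul_sum, ← sum_add_distrib]
    exact sum_le_sum fun t ht => t3 s t ht
  have hp : 0 ≤ F * √(Mf n m h k ψ ψ) := by positivity
  calc v i j ^ 2 ≤ 3 / 2 * A + (6 * (F * √(Mf n m h k ψ ψ)) + 2 * A) := by linarith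
    _ ≤ _ := by linarith

end Agmon

section Evolution

theorem l2_pair_le (n m : ℕ) {h k : ℝ} (hh : 0 < h) (hk : 0 < k) (Ex Ey φ : ℕ → ℕ → ℝ) {R : ℝ}
    (hR : 0 ≤ R) (hE : h * k * (l2 n m Ex Ex + l2 n m Ey Ey) ≤ R ^ 2) :
    h * k * (l2 n m Ex (dy k φ) + l2 n m Ey (dx h φ)) ≤ R * √(Mf n m h k φ φ) := by
  have hhk : 0 < h * k := mul_pos hh hk
  have key : ∀ {a b c d x y : ℝ}, 0 ≤ a → 0 ≤ b → 0 ≤ c → 0 ≤ d → x ≤ √a * √b → y ≤ √c * √d →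
      x + y ≤ √(a + c) * √(b + d) := by
    intro a b c d x y ha hb hc hd hx hy
    rw [← sqrt_mul (by positivity)]
    refine (add_le_add hx hy).trans (le_sqrt_of_sq_le ?_)
    nlinarith [sq_sqrt ha, sq_sqrt hb, sq_sqrt hc, sq_sqrt hd,
      sq_nonneg (√a * √d - √b * √c), mul_self_sqrt ha]
  have h1 := key (l2_self_nonneg n m Ex) (l2_self_nonneg n m (dy k φ)) (l2_self_nonneg n m Ey)
    (l2_self_nonneg n m (dx h φ)) (l2_cauchy n m Ex (dy k φ)) (l2_cauchy n m Ey (dx h φ))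
  have h2 := mul_le_mul_of_nonneg_left h1 hhk.le
  refine h2.trans ?_
  rw [show h * k = √(h * k) * √(h * k) from (mul_self_sqrt hhk.le).symm, mul_mul_mul_comm,
    ← sqrt_mul hhk.le, ← sqrt_mul hhk.le]
  refine mul_le_mul ?_ (sqrt_le_sqrt ?_) (sqrt_nonneg _) hR
  · rw [sqrt_le_left hR]; exact hE
  · unfold Mf; rw [add_comm]

/-- Evaluation of the first velocity component as a linear functional. -/
def evalDy (n m : ℕ) (k : ℝ) (i j : ℕ) : nodeSpace n m →ₗ[ℝ] ℝ where
  toFun f := dy k f.1 i j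
  map_add' f g := by
    change dy k (f.1 + g.1) i j = _; rw [dy_add]; rfl
  map_smul' c f := by
    change dy k (c • f.1) i j = _; rw [dy_smul]; rfl

/-- The functional `φ ↦ ⟨E, ∇^⊥ φ⟩` has a representative with respect to the energy form. -/
theorem exists_riesz_pair (n m : ℕ) {h k : ℝ} (hh : 0 < h) (hk : 0 < k) (Ex Ey : ℕ → ℕ → ℝ) {R : ℝ}
    (hR : 0 ≤ R) (hE : h * k * (l2 n m Ex Ex + l2 n m Ey Ey) ≤ R ^ 2) :
    ∃ κ : nodeSpace n m, (∀ φ, nM n m h k κ φ =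
      h * k * (l2 n m Ex (dy k φ.1) + l2 n m Ey (dx h φ.1))) ∧ nM n m h k κ κ ≤ R ^ 2 := by
  let r : nodeSpace n m →ₗ[ℝ] ℝ :=
    { toFun := fun φ => h * k * (l2 n m Ex (dy k φ.1) + l2 n m Ey (dx h φ.1))
      map_add' := fun f g => by
        change h * k * (l2 n m Ex (dy k (f.1 + g.1)) + l2 n m Ey (dx h (f.1 + g.1))) = _
        rw [dy_add, dx_add, (l2_isForm n m).add_right, (l2_isForm n m).add_right]; ring
      map_smul' := fun c f => by
        change h * k * (l2 n m Ex (dy k (c • f.1)) + l2 n m Ey (dx h (c • f.1))) = _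
        rw [dy_smul, dx_smul, (l2_isForm n m).smul_right, (l2_isForm n m).smul_right]
        simp only [RingHom.id_apply, smul_eq_mul]; ring }
  obtain ⟨κ, hκ⟩ := exists_riesz (nM_isPos n m hh hk) r
  refine ⟨κ, hκ, ?_⟩
  have h1 : nM n m h k κ κ ≤ R * √(nM n m h k κ κ) :=
    (hκ κ).le.trans (l2_pair_le n m hh hk Ex Ey κ.1 hR hE)
  have h0 : 0 ≤ nM n m h k κ κ := (nM_isPos n m hh hk).nonneg κ
  have h2 := sq_sqrt h0
  have h3 := sqrt_nonneg (nM n m h k κ κ)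
  nlinarith [sq_nonneg (R - √(nM n m h k κ κ))]

theorem evolution_bound {n m : ℕ} {h k : ℝ} (hh : 0 < h) (hk : 0 < k) {τ μ R L : ℝ} (hτ : 0 < τ)
    (hμ : 0 < μ) (hR : 0 ≤ R) (hL0 : 0 < L) (hL : (n * h) ^ 2 + (m * k) ^ 2 ≤ L)
    (ρ : ℕ → ℕ → ℕ → ℝ) (hρ : ∀ s, ρ s ∈ nodeSpace n m) (h0 : ρ 0 = 0)
    (Ex Ey : ℕ → ℕ → ℕ → ℝ) (N : ℕ)
    (heq : ∀ s < N, ∀ φ ∈ nodeSpace n m,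
      Mf n m h k (ρ (s + 1) - ρ s) φ + τ * μ * af n m h k (ρ (s + 1)) φ =
        τ * (h * k * (l2 n m (Ex (s + 1)) (dy k φ) + l2 n m (Ey (s + 1)) (dx h φ))))
    (hE : ∀ s < N, h * k * (l2 n m (Ex (s + 1)) (Ex (s + 1)) + l2 n m (Ey (s + 1)) (Ey (s + 1)))
      ≤ R ^ 2) {q : ℕ} (hq : q ≤ N) {i j : ℕ} (hi : i ≤ n) (hj : j < m) :
    |dy k (ρ q) i j| ≤ 2 * √10 * R * √(q * τ / μ) ∧ |dy k (ρ q) i j| ≤ √10 * R * √(9 * L) / μ := by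
  have hex : ∀ s, ∃ κ : nodeSpace n m, s < N → (∀ φ, nM n m h k κ φ =
      h * k * (l2 n m (Ex (s + 1)) (dy k φ.1) + l2 n m (Ey (s + 1)) (dx h φ.1))) ∧
      nM n m h k κ κ ≤ R ^ 2 := by
    intro s
    by_cases hs : s < N
    · obtain ⟨κ, hκ⟩ := exists_riesz_pair n m hh hk (Ex (s + 1)) (Ey (s + 1)) hR (hE s hs)
      exact ⟨κ, fun _ => hκ⟩
    · exact ⟨0, fun h => absurd h hs⟩
  choose κ hκ using hex
  have hP : ∀ v : nodeSpace n m, 2 / L * nM n m h k v v ≤ na n m h k v v := by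
    intro v
    have h1 : 2 * nM n m h k v v ≤ ((n * h) ^ 2 + (m * k) ^ 2) * na n m h k v v :=
      poincare hh hk v.2
    have hM0 : 0 ≤ nM n m h k v v := (nM_isPos n m hh hk).nonneg v
    rcases le_or_gt 0 (na n m h k v v) with ha | ha
    · rw [div_mul_eq_mul_div, div_le_iff₀ hL0]
      nlinarith
    · exfalso
      nlinarith [sq_nonneg (n * h), sq_nonneg (m * k),
        mul_nonneg (add_nonneg (sq_nonneg (n * h)) (sq_nonneg (m * k))) (neg_nonneg.2 ha.le),
        Uf_ge n m h k v.1, Uf_ge m n k h (tr v.1), l2_self_nonneg n m (dx h (dy k v.1)),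
        l2_self_nonneg m n (dx k (dy h (tr v.1))), mul_pos hh hk,
        show na n m h k v v = h * k * (Uf n m h k v.1 v.1 + Uf m n k h (tr v.1) (tr v.1)) from rfl]
  have key := duhamel_bound (nM_isPos n m hh hk) (na_isForm n m h k) (l₁ := 2 / L)
    (by positivity) hP (evalDy n m k i j) (C := 10) (by norm_num)
    (fun ψ F hF0 hF => agmon hh hk ψ.2 hF0 (fun φ hφ => hF ⟨φ, hφ⟩) hi hj)
    hτ hμ hR (fun s => ⟨ρ s, hρ s⟩) (fun s => κ (s - 1)) (Subtype.ext h0) N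
    (fun s hs φ => by
      rw [Nat.add_sub_cancel, (hκ s hs).1 φ]
      exact heq s hs φ.1 φ.2)
    (fun s hs => by rw [Nat.add_sub_cancel]; exact (hκ s hs).2) q hq
  rw [show 18 / (2 / L) = 9 * L by field_simp; norm_num] at key
  exact key

theorem evolution_bound_dx {n m : ℕ} {h k : ℝ} (hh : 0 < h) (hk : 0 < k) {τ μ R L : ℝ} (hτ : 0 < τ)
    (hμ : 0 < μ) (hR : 0 ≤ R) (hL0 : 0 < L) (hL : (n * h) ^ 2 + (m * k) ^ 2 ≤ L)
    (ρ : ℕ → ℕ → ℕ → ℝ) (hρ : ∀ s, ρ s ∈ nodeSpace n m) (h0 : ρ 0 = 0)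
    (Ex Ey : ℕ → ℕ → ℕ → ℝ) (N : ℕ)
    (heq : ∀ s < N, ∀ φ ∈ nodeSpace n m,
      Mf n m h k (ρ (s + 1) - ρ s) φ + τ * μ * af n m h k (ρ (s + 1)) φ =
        τ * (h * k * (l2 n m (Ex (s + 1)) (dy k φ) + l2 n m (Ey (s + 1)) (dx h φ))))
    (hE : ∀ s < N, h * k * (l2 n m (Ex (s + 1)) (Ex (s + 1)) + l2 n m (Ey (s + 1)) (Ey (s + 1)))
      ≤ R ^ 2) {q : ℕ} (hq : q ≤ N) {i j : ℕ} (hi : i < n) (hj : j ≤ m) :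
    |dx h (ρ q) i j| ≤ 2 * √10 * R * √(q * τ / μ) ∧ |dx h (ρ q) i j| ≤ √10 * R * √(9 * L) / μ := by
  refine evolution_bound (n := m) (m := n) hk hh hτ hμ hR hL0 (by linarith) (fun s => tr (ρ s))
    (fun s => tr_mem (hρ s)) (by simp only [h0]; rfl) (fun s => tr (Ey s)) (fun s => tr (Ex s)) N ?_ ?_
    hq hj hi
  · intro s hs φ hφ
    have h1 := heq s hs (tr φ) (tr_mem hφ)
    rw [← Mf_tr, ← af_tr, ← l2_tr n m (Ex (s + 1)), ← l2_tr n m (Ey (s + 1))] at h1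
    refine h1.trans ?_
    rw [mul_comm h k, add_comm]; rfl
  · intro s hs
    have h1 := hE s hs
    rw [← l2_tr n m (Ex (s + 1)), ← l2_tr n m (Ey (s + 1))] at h1
    rw [mul_comm k h, add_comm]; exact h1

end Evolution

section Poisson

/-- Interpolation inequality for the first difference of a sequence with zero end values. -/
theorem landau {m : ℕ} {k B S : ℝ} (hk : 0 < k) (hS : 0 < S) {c : ℕ → ℝ} (c0 : c 0 = 0) (cm : c m = 0)
    (hB : ∀ j ≤ m, |c j| ≤ B)
    (h2 : ∀ j, j + 1 < m → |(c (j + 2) - c (j + 1)) - (c (j + 1) - c j)| ≤ S * k ^ 2)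
    {j : ℕ} (hj : j < m) : ((c (j + 1) - c j) / k) ^ 2 ≤ 8 * B * S := by
  have hB0 : 0 ≤ B := (abs_nonneg _).trans (hB 0 (Nat.zero_le _))
  wlog hpos : 0 ≤ c (j + 1) - c j generalizing c
  · have := this (c := fun j => - c j) (by simp [c0]) (by simp [cm])
      (fun j hj => by rw [abs_neg]; exact hB j hj)
      (fun j hj => by
        rw [← abs_neg]; convert h2 j hj using 2; ring) (by push Not at hpos; linarith)
    convert this using 1; ring
  set d : ℕ → ℝ := fun j => c (j + 1) - c j with hd
  -- differences of `d`
  have hlip : ∀ a b, a ≤ b → b < m → |d b - d a| ≤ (b - a : ℕ) * (S * k ^ 2) := by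
    intro a b hab
    induction b, hab using Nat.le_induction with
    | base => intro _; simp
    | succ b hab ih =>
      intro hb
      have h3 := ih (by omega)
      have h4 := h2 b hb
      have h5 : |d (b + 1) - d a| ≤ |d (b + 1) - d b| + |d b - d a| := by
        have := abs_add_le (d (b + 1) - d b) (d b - d a); simpa using this
      rw [Nat.succ_sub hab, Nat.cast_succ]
      have : |d (b + 1) - d b| ≤ S * k ^ 2 := h4
      linarith
  have hlip' : ∀ a b r : ℕ, a < m → b < m → a ≤ b + r → b ≤ a + r →
      d b - r * (S * k ^ 2) ≤ d a := by
    intro a b r ha hb h3 h4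
    have hSk : 0 < S * k ^ 2 := by positivity
    rcases le_total a b with hab | hab
    · have h5 := hlip a b hab hb
      have h6 : ((b - a : ℕ) : ℝ) ≤ r := by exact_mod_cast (by omega)
      nlinarith [le_abs_self (d b - d a)]
    · have h5 := hlip b a hab ha
      have h6 : ((a - b : ℕ) : ℝ) ≤ r := by exact_mod_cast (by omega)
      nlinarith [neg_abs_le (d a - d b)]
  set P := d j with hP
  have hPm : P ≤ (m - 1 : ℕ) * (S * k ^ 2) := by
    by_contra hcon
    push Not at hcon
    have h5 : ∀ a ∈ range m, 0 < d a := fun a ha => by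
      have := hlip' a j (m - 1) (mem_range.mp ha) hj (by have := mem_range.mp ha; omega) (by omega)
      linarith
    have h6 : 0 < ∑ a ∈ range m, d a := sum_pos h5 ⟨0, mem_range.mpr (by omega)⟩
    rw [hd, sum_range_sub, c0, cm] at h6
    linarith
  have hSk : 0 < S * k ^ 2 := by positivity
  set r := ⌊P / (2 * (S * k ^ 2))⌋₊ with hr
  have hr1 : (r : ℝ) ≤ P / (2 * (S * k ^ 2)) := Nat.floor_le (by positivity)
  have hr2 : P / (2 * (S * k ^ 2)) < r + 1 := Nat.lt_floor_add_one _
  rw [le_div_iff₀ (by positivity)] at hr1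
  rw [div_lt_iff₀ (by positivity)] at hr2
  have hrm : r ≤ m - 1 := by
    have : (r : ℝ) ≤ (m - 1 : ℕ) := by
      have h7 : (0:ℝ) ≤ (m - 1 : ℕ) := Nat.cast_nonneg _
      nlinarith
    exact_mod_cast this
  set s := min j (m - (r + 1)) with hs
  have hsum : c (s + (r + 1)) - c s = ∑ a ∈ range (r + 1), d (s + a) := by
    have := sum_range_sub (fun a => c (s + a)) (r + 1)
    simpa [hd, add_assoc] using this.symm
  have hlow : (r + 1) * (P / 2) ≤ ∑ a ∈ range (r + 1), d (s + a) := by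
    have := card_nsmul_le_sum (range (r + 1)) (fun a => d (s + a)) (P / 2) (fun a ha => by
      have h8 := mem_range.mp ha
      have := hlip' (s + a) j r (by omega) hj (by omega) (by omega)
      linarith)
    rw [card_range, nsmul_eq_mul] at this
    push_cast at this; exact this
  have h9 := abs_le.mp (hB (s + (r + 1)) (by omega))
  have h10 := abs_le.mp (hB s (by omega))
  have h11 : (r + 1) * (P / 2) ≤ 2 * B := by linarith
  rw [div_pow, div_le_iff₀ (by positivity)]
  have h12 : P * P ≤ (r + 1) * (P / 2) * (4 * (S * k ^ 2)) := by nlinarith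
  have h13 : (r + 1) * (P / 2) * (4 * (S * k ^ 2)) ≤ 2 * B * (4 * (S * k ^ 2)) :=
    mul_le_mul_of_nonneg_right h11 (by positivity)
  change P ^ 2 ≤ _
  nlinarith

/-- Discrete maximum principle in one dimension. -/
theorem max_principle {m : ℕ} {k l G : ℝ} (hl : 0 ≤ l) (hG : 0 ≤ G) {c g : ℕ → ℝ}
    (hc : c ∈ lineSpace m) (heq : ∀ j, 0 < j → j < m → D2 m k c j + l * c j = g j)
    (hg : ∀ j, 0 < j → j < m → g j ≤ G) (j : ℕ) : l * c j ≤ G := by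
  obtain ⟨q, hq, hmax⟩ := exists_max_image (range (m + 1)) c ⟨0, by simp⟩
  have hle : ∀ j, c j ≤ c q := by
    intro j
    by_cases hj : j ≤ m
    · exact hmax j (by simpa using Nat.lt_succ_of_le hj)
    · rw [hc j (by omega), ← hc 0 (Or.inl rfl)]; exact hmax 0 (by simp)
  refine (mul_le_mul_of_nonneg_left (hle j) hl).trans ?_
  by_cases hq' : q = 0 ∨ m ≤ q
  · rw [hc q hq']; simpa using hG
  · have h1 := heq q (by omega) (by omega)
    have h2 : 0 ≤ D2 m k c q := by
      rw [D2, if_neg hq']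
      have := hle (q - 1); have := hle (q + 1)
      refine div_nonneg (by linarith) (sq_nonneg _)
    linarith [hg q (by omega) (by omega)]

theorem scalar_gradient_bound {m : ℕ} {k l G : ℝ} (hk : 0 < k) (hl : 0 ≤ l) (hG : 0 ≤ G) {c g : ℕ → ℝ}
    (hc : c ∈ lineSpace m) (heq : ∀ j, 0 < j → j < m → D2 m k c j + l * c j = g j)
    (hg : ∀ j, 0 < j → j < m → |g j| ≤ G) {j : ℕ} (hj : j < m) :
    l * ((c (j + 1) - c j) / k) ^ 2 ≤ 16 * G ^ 2 := by
  rcases hl.eq_or_lt with rfl | hl'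
  · rw [zero_mul]; positivity
  have h1 : ∀ j, |l * c j| ≤ G := fun j => abs_le.mpr ⟨by
    have := max_principle (k := k) (c := -c) (g := -g) hl hG ((lineSpace m).neg_mem hc)
      (fun j h0 hm => by
        have := heq j h0 hm
        rw [D2, if_neg (by omega)] at this ⊢
        simp only [Pi.neg_apply]
        rw [← this]; ring) (fun j h0 hm => by
          have := hg j h0 hm; rw [abs_le] at this; simp only [Pi.neg_apply]; linarith) j
    simp only [Pi.neg_apply] at this
    linarith, max_principle hl hG hc heq (fun j h0 hm => (le_abs_self _).trans (hg j h0 hm)) j⟩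
  have h2 : ∀ j, |c j| ≤ G / l := fun j => by
    rw [le_div_iff₀ hl', ← abs_of_pos hl', ← abs_mul, mul_comm]; exact h1 j
  have h3 : ∀ j, j + 1 < m → |(c (j + 2) - c (j + 1)) - (c (j + 1) - c j)| ≤ 2 * G * k ^ 2 := by
    intro j hj
    have h4 := heq (j + 1) (by omega) hj
    rw [D2, if_neg (by omega), Nat.add_sub_cancel] at h4
    have h5 : (c (j + 2) - c (j + 1)) - (c (j + 1) - c j) = (l * c (j + 1) - g (j + 1)) * k ^ 2 := by
      rw [← h4]; field_simp; ring
    rw [h5, abs_mul, abs_of_pos (by positivity : 0 < k ^ 2)]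
    refine mul_le_mul_of_nonneg_right ?_ (by positivity)
    have := abs_sub (l * c (j + 1)) (g (j + 1))
    linarith [h1 (j + 1), hg (j + 1) (by omega) hj]
  rcases hG.eq_or_lt with rfl | hG'
  · have h0 : ∀ j, c j = 0 := fun j => by have := h2 j; simpa using this
    simp [h0]
  have h6 := landau (S := 2 * G) hk (by positivity) (hc 0 (Or.inl rfl)) (hc m (Or.inr le_rfl))
    (fun j _ => h2 j) h3 hj
  calc l * ((c (j + 1) - c j) / k) ^ 2 ≤ l * (8 * (G / l) * (2 * G)) :=
        mul_le_mul_of_nonneg_left h6 hl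
    _ = 16 * G ^ 2 := by field_simp; ring

theorem line_isPos (n : ℕ) :
    IsPos (fun u v : lineSpace n => ∑ i ∈ range n, u.1 i * v.1 i) where
  symm u v := sum_congr rfl fun i _ => mul_comm _ _
  add u v w := by
    rw [← sum_add_distrib]; exact sum_congr rfl fun i _ => add_mul _ _ _
  smul c u w := by
    rw [mul_sum]; exact sum_congr rfl fun i _ => mul_assoc _ _ _
  pos v hv := by
    refine lt_of_le_of_ne (sum_nonneg fun i _ => mul_self_nonneg _) fun h0 => hv (Subtype.ext ?_)
    funext i
    by_cases hi : i < n
    · have := (sum_eq_zero_iff_of_nonneg fun i _ => mul_self_nonneg (v.1 i)).mp h0.symm i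
        (mem_range.mpr hi)
      exact mul_self_eq_zero.mp this
    · exact v.2 i (by omega)

theorem lineD_isForm (n : ℕ) (h : ℝ) :
    IsForm (fun u v : lineSpace n =>
      ∑ i ∈ range n, (u.1 (i + 1) - u.1 i) / h * ((v.1 (i + 1) - v.1 i) / h)) where
  symm u v := sum_congr rfl fun i _ => mul_comm _ _
  add u v w := by
    rw [← sum_add_distrib]
    refine sum_congr rfl fun i _ => ?_
    change (u.1 (i + 1) + v.1 (i + 1) - (u.1 i + v.1 i)) / h * _ = _
    ring
  smul c u w := by
    rw [mul_sum]
    refine sum_congr rfl fun i _ => ?_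
    change (c * u.1 (i + 1) - c * u.1 i) / h * _ = _
    ring

/-- Growth of a sequence on the interior indices. -/
theorem sq_le_first_add_diff {m : ℕ} (g : ℕ → ℝ) {j : ℕ} (h0 : 0 < j) (hj : j < m) :
    g j ^ 2 ≤ 2 * g 1 ^ 2 + 2 * m * ∑ t ∈ range (m - 2), (g (t + 2) - g (t + 1)) ^ 2 := by
  have e1 : g j - g 1 = ∑ t ∈ range (j - 1), (g (t + 2) - g (t + 1)) := by
    rw [sum_range_sub (fun t => g (t + 1))]; simp [Nat.sub_add_cancel h0]
  have e2 := sq_sum_le_card_mul_sum_sq (s := range (j - 1)) (f := fun t => g (t + 2) - g (t + 1))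
  rw [← e1, card_range] at e2
  have e3 : ∑ t ∈ range (j - 1), (g (t + 2) - g (t + 1)) ^ 2 ≤
      ∑ t ∈ range (m - 2), (g (t + 2) - g (t + 1)) ^ 2 :=
    sum_le_sum_of_subset_of_nonneg (range_mono (by omega)) fun _ _ _ => sq_nonneg _
  have e4 : ((j - 1 : ℕ) : ℝ) ≤ m := by exact_mod_cast (by omega)
  have e5 : 0 ≤ ∑ t ∈ range (j - 1), (g (t + 2) - g (t + 1)) ^ 2 := sum_nonneg fun _ _ => sq_nonneg _
  have e6 : (g j - g 1) ^ 2 ≤ m * ∑ t ∈ range (m - 2), (g (t + 2) - g (t + 1)) ^ 2 :=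
    e2.trans (mul_le_mul e4 e3 e5 (Nat.cast_nonneg _))
  nlinarith [sq_nonneg (g j - 2 * g 1)]

/-- Mixed difference of the solution of the discrete Poisson problem, row by row. -/
theorem poisson_row_bound {n m : ℕ} {h k G₀ G₁ : ℝ} (hh : 0 < h) (hk : 0 < k)
    {κ g : ℕ → ℕ → ℝ} (hκ : κ ∈ nodeSpace n m) (hg : g ∈ nodeSpace n m)
    (heq : ∀ i j, 0 < i → i < n → 0 < j → j < m →
      D2 n h (fun i => κ i j) i + D2 m k (κ i) j = g i j)
    (hg0 : ∀ i j, |g i j| ≤ G₀)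
    (hg1 : ∀ i j, 0 < j → j + 1 < m → |g i (j + 1) - g i j| ≤ k * G₁) {j : ℕ} (hj : j < m) :
    h * ∑ i ∈ range n, dx h (dy k κ) i j ^ 2 ≤ 32 * (n * h) * (G₀ ^ 2 + (m * k) ^ 2 * G₁ ^ 2) := by
  obtain ⟨ι, _, b, l, hb1, hb2, hb3, hb4, hb5⟩ :=
    exists_simul_basis (line_isPos n) (lineD_isForm n h)
  have hl : ∀ p, 0 ≤ l p := by
    intro p
    have h1 := hb5 p (b p)
    rw [hb3 p, mul_one] at h1
    rw [← h1]; exact sum_nonneg fun i _ => mul_self_nonneg _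
  -- modes
  obtain ⟨c, hc⟩ : ∃ c : ι → ℕ → ℝ, c = fun p j => ∑ i ∈ range n, (b p).1 i * κ i j := ⟨_, rfl⟩
  obtain ⟨e, he⟩ : ∃ e : ι → ℕ → ℝ, e = fun p j => ∑ i ∈ range n, (b p).1 i * g i j := ⟨_, rfl⟩
  have hcm : ∀ p, c p ∈ lineSpace m := by
    intro p j hj
    rw [hc]
    refine sum_eq_zero fun i _ => ?_
    rw [hκ i j (by tauto), mul_zero]
  have hmode : ∀ p j, 0 < j → j < m → D2 m k (c p) j + l p * c p j = e p j := by
    intro p j h0 hm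
    have e1 := sum_D2_mul (h := h) (fun i => κ i j) (b p).2
    have e2 := hb5 p ⟨fun i => κ i j, col_mem hκ j⟩
    have e3 : ∑ i ∈ range n, (b p).1 i * D2 n h (fun i => κ i j) i = l p * c p j := by
      rw [hc]
      refine Eq.trans ?_ e2
      rw [sum_congr rfl fun i _ => mul_comm ((b p).1 i) _, e1]
      exact sum_congr rfl fun i _ => mul_comm _ _
    have e4 : ∑ i ∈ range n, (b p).1 i * D2 m k (κ i) j = D2 m k (c p) j := by
      simp only [D2, hc, if_neg (by omega : ¬ (j = 0 ∨ m ≤ j))]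
      rw [mul_sum, ← sum_sub_distrib, ← sum_sub_distrib, sum_div]
      exact sum_congr rfl fun i _ => by ring
    rw [← e3, ← e4, he, ← sum_add_distrib]
    refine sum_congr rfl fun i hi => ?_
    by_cases hi0 : i = 0
    · rw [(b p).2 i (Or.inl hi0)]; ring
    · rw [← heq i j (by omega) (mem_range.mp hi) h0 hm]; ring
  -- Parseval
  have hpars : ∀ v : ℕ → ℝ, v ∈ lineSpace n →
      ∑ p, (∑ i ∈ range n, (b p).1 i * v i) ^ 2 = ∑ i ∈ range n, v i ^ 2 := by
    intro v hv
    have := hb2 ⟨v, hv⟩ ⟨v, hv⟩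
    simp only [← pow_two] at this
    exact this.symm
  have hgrad : ∑ i ∈ range n, dx h (dy k κ) i j ^ 2 = ∑ p, l p * ((c p (j + 1) - c p j) / k) ^ 2 := by
    have hv : (fun i => dy k κ i j) ∈ lineSpace n := by
      intro i hi
      simp [dy, hκ i j (by tauto), hκ i (j + 1) (by tauto)]
    obtain ⟨v, hvdef⟩ : ∃ v : lineSpace n, v = ⟨fun i => dy k κ i j, hv⟩ := ⟨_, rfl⟩
    have h1 : ∀ p, ∑ i ∈ range n, (b p).1 i * v.1 i = (c p (j + 1) - c p j) / k := by
      intro p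
      rw [hc, hvdef]
      simp only [dy]
      rw [← sum_sub_distrib, sum_div]
      exact sum_congr rfl fun i _ => by ring
    have h2 : ∑ i ∈ range n, dx h (dy k κ) i j ^ 2 =
        ∑ i ∈ range n, (v.1 (i + 1) - v.1 i) / h * ((v.1 (i + 1) - v.1 i) / h) := by
      rw [hvdef]; exact sum_congr rfl fun i _ => pow_two _
    rw [h2]
    have h3 := (lineD_isForm n h).sum_left univ (fun p => (∑ i ∈ range n, (b p).1 i * v.1 i) • b p) v
    rw [← hb1 v] at h3
    refine h3.trans (sum_congr rfl fun p _ => ?_)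
    have h4 := (lineD_isForm n h).smul (∑ i ∈ range n, (b p).1 i * v.1 i) (b p) v
    refine h4.trans ?_
    rw [hb5 p v, h1 p]; ring
  have hmain : ∀ p, l p * ((c p (j + 1) - c p j) / k) ^ 2 ≤
      16 * (2 * e p 1 ^ 2 + 2 * m * ∑ t ∈ range (m - 2), (e p (t + 2) - e p (t + 1)) ^ 2) := by
    intro p
    have h0 : 0 ≤ 2 * e p 1 ^ 2 + 2 * m * ∑ t ∈ range (m - 2), (e p (t + 2) - e p (t + 1)) ^ 2 := by
      have : 0 ≤ ∑ t ∈ range (m - 2), (e p (t + 2) - e p (t + 1)) ^ 2 :=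
        sum_nonneg fun _ _ => sq_nonneg _
      positivity
    have := scalar_gradient_bound hk (hl p) (sqrt_nonneg (2 * e p 1 ^ 2 + 2 * m *
      ∑ t ∈ range (m - 2), (e p (t + 2) - e p (t + 1)) ^ 2)) (hcm p) (hmode p)
      (fun j h0 hm => abs_le_sqrt (sq_le_first_add_diff (e p) h0 hm)) hj
    rwa [sq_sqrt h0] at this
  have hE1 : ∑ p, e p 1 ^ 2 ≤ n * G₀ ^ 2 := by
    rw [he, hpars _ (col_mem hg 1)]
    refine (sum_le_card_nsmul _ _ (G₀ ^ 2) fun i _ => ?_).trans_eq (by simp)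
    exact sq_le_sq' (by linarith [(abs_le.mp (hg0 i 1)).1]) ((abs_le.mp (hg0 i 1)).2)
  have hE2 : ∀ t ∈ range (m - 2), ∑ p, (e p (t + 2) - e p (t + 1)) ^ 2 ≤ n * (k * G₁) ^ 2 := by
    intro t ht
    have hmem : (fun i => g i (t + 2) - g i (t + 1)) ∈ lineSpace n :=
      (lineSpace n).sub_mem (col_mem hg (t + 2)) (col_mem hg (t + 1))
    have h1 : ∑ p, (e p (t + 2) - e p (t + 1)) ^ 2 = ∑ i ∈ range n, (g i (t + 2) - g i (t + 1)) ^ 2 := by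
      rw [← hpars _ hmem]
      refine sum_congr rfl fun p _ => ?_
      rw [he]; simp only [mul_sub, sum_sub_distrib]
    rw [h1]
    refine (sum_le_card_nsmul _ _ ((k * G₁) ^ 2) fun i _ => ?_).trans_eq (by simp)
    have := abs_le.mp (hg1 i (t + 1) (by omega) (by have := mem_range.mp ht; omega))
    exact sq_le_sq' (by linarith) this.2
  have hE3 : ∑ p, ∑ t ∈ range (m - 2), (e p (t + 2) - e p (t + 1)) ^ 2 ≤ m * (n * (k * G₁) ^ 2) := by
    rw [sum_comm]
    refine (sum_le_card_nsmul _ _ _ hE2).trans ?_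
    rw [card_range, nsmul_eq_mul]
    have : ((m - 2 : ℕ) : ℝ) ≤ m := by exact_mod_cast (by omega)
    exact mul_le_mul_of_nonneg_right this (by positivity)
  rw [hgrad]
  have hfin : ∑ p, l p * ((c p (j + 1) - c p j) / k) ^ 2 ≤
      16 * (2 * (n * G₀ ^ 2) + 2 * m * (m * (n * (k * G₁) ^ 2))) := by
    refine (sum_le_sum fun p _ => hmain p).trans ?_
    rw [← mul_sum, sum_add_distrib, ← mul_sum, ← mul_sum]
    gcongr
  have := mul_le_mul_of_nonneg_left hfin hh.le
  refine this.trans_eq ?_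
  ring

/-- Strong form of the discrete Poisson problem. -/
theorem poisson_strong {n m : ℕ} {h k : ℝ} (hh : 0 < h) (hk : 0 < k) {κ g : ℕ → ℕ → ℝ}
    (hM : ∀ φ ∈ nodeSpace n m, Mf n m h k κ φ = h * k * l2 n m g φ) (i j : ℕ)
    (hi0 : 0 < i) (hi : i < n) (hj0 : 0 < j) (hj : j < m) :
    D2 n h (fun i => κ i j) i + D2 m k (κ i) j = g i j := by
  have hhk : 0 < h * k := mul_pos hh hk
  have hform : ∀ φ ∈ nodeSpace n m, Mf n m h k κ φ =
      h * k * l2 n m (fun i j => D2 n h (fun i => κ i j) i + D2 m k (κ i) j) φ := by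
    intro φ hφ
    unfold Mf l2
    congr 1
    have e1 : ∑ i ∈ range n, ∑ j ∈ range m, dx h κ i j * dx h φ i j =
        ∑ i ∈ range n, ∑ j ∈ range m, D2 n h (fun i => κ i j) i * φ i j := by
      rw [sum_comm, sum_comm (s := range n)]
      exact sum_congr rfl fun j _ => (sum_D2_mul (h := h) (fun i => κ i j) (col_mem hφ j)).symm
    have e2 : ∑ i ∈ range n, ∑ j ∈ range m, dy k κ i j * dy k φ i j =
        ∑ i ∈ range n, ∑ j ∈ range m, D2 m k (κ i) j * φ i j :=
      sum_congr rfl fun i _ => (sum_D2_mul (h := k) (κ i) (row_mem hφ i)).symm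
    rw [e1, e2, ← sum_add_distrib]
    refine sum_congr rfl fun i _ => ?_
    rw [← sum_add_distrib]
    exact sum_congr rfl fun j _ => by ring
  obtain ⟨e, he⟩ : ∃ e : ℕ → ℕ → ℝ, e = fun i j => if i = 0 ∨ n ≤ i ∨ j = 0 ∨ m ≤ j then 0 else
      D2 n h (fun i => κ i j) i + D2 m k (κ i) j - g i j := ⟨_, rfl⟩
  have hem : e ∈ nodeSpace n m := fun i j hij => by rw [he]; exact if_pos hij
  have h1 := (hform e hem).symm.trans (hM e hem)
  have h2 := mul_left_cancel₀ hhk.ne' h1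
  have h3 : l2 n m e e = 0 := by
    have : l2 n m e e = l2 n m (fun i j => D2 n h (fun i => κ i j) i + D2 m k (κ i) j) e -
        l2 n m g e := by
      unfold l2
      rw [← sum_sub_distrib]
      refine sum_congr rfl fun i _ => ?_
      rw [← sum_sub_distrib]
      refine sum_congr rfl fun j _ => ?_
      by_cases hij : i = 0 ∨ n ≤ i ∨ j = 0 ∨ m ≤ j
      · rw [hem i j hij]; ring
      · simp only [he, if_neg hij]; ring
    rw [this, h2, sub_self]
  have h4 := eq_zero_of_l2_self h3 hi hj
  rw [he] at h4
  simp only [if_neg (by omega : ¬ (i = 0 ∨ n ≤ i ∨ j = 0 ∨ m ≤ j))] at h4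
  linarith

end Poisson

section Barrier

/-- Weighted Euclidean norm of a finite sequence. -/
def nrm (n : ℕ) (h : ℝ) (f : ℕ → ℝ) : ℝ := √(h * ∑ i ∈ range n, f i ^ 2)

theorem nrm_nonneg (n : ℕ) (h : ℝ) (f : ℕ → ℝ) : 0 ≤ nrm n h f := sqrt_nonneg _

theorem nrm_sq {n : ℕ} {h : ℝ} (hh : 0 < h) (f : ℕ → ℝ) : nrm n h f ^ 2 = h * ∑ i ∈ range n, f i ^ 2 :=
  sq_sqrt (mul_nonneg hh.le (sum_nonneg fun _ _ => sq_nonneg _))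

theorem nrm_inner_le {n : ℕ} {h : ℝ} (hh : 0 < h) (f g : ℕ → ℝ) :
    h * ∑ i ∈ range n, f i * g i ≤ nrm n h f * nrm n h g := by
  have h1 := sum_mul_le_sqrt_mul_sqrt (range n) f g
  unfold nrm
  rw [sqrt_mul hh.le, sqrt_mul hh.le, mul_mul_mul_comm, mul_self_sqrt hh.le]
  exact mul_le_mul_of_nonneg_left h1 hh.le

theorem nrm_add_le {n : ℕ} {h : ℝ} (hh : 0 < h) (f g : ℕ → ℝ) :
    nrm n h (fun i => f i + g i) ≤ nrm n h f + nrm n h g := by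
  refine abs_le_of_sq_le_sq' ?_ (add_nonneg (nrm_nonneg _ _ _) (nrm_nonneg _ _ _)) |>.2
  rw [add_sq, nrm_sq hh, nrm_sq hh, nrm_sq hh]
  have h1 := nrm_inner_le (n := n) hh f g
  have h2 : h * ∑ i ∈ range n, (f i + g i) ^ 2 = h * ∑ i ∈ range n, f i ^ 2 +
      2 * (h * ∑ i ∈ range n, f i * g i) + h * ∑ i ∈ range n, g i ^ 2 := by
    simp only [add_sq, sum_add_distrib, mul_sum, mul_add]
    congr 2
    exact sum_congr rfl fun i _ => by ring
  rw [h2]; linarith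

theorem nrm_smul (n : ℕ) (h c : ℝ) (f : ℕ → ℝ) : nrm n h (fun i => c * f i) = |c| * nrm n h f := by
  unfold nrm
  rw [← sqrt_sq_eq_abs, ← sqrt_mul (sq_nonneg c)]
  congr 1
  simp only [mul_pow, ← mul_sum]; ring

theorem nrm_mono {n : ℕ} {h : ℝ} (hh : 0 < h) {f g : ℕ → ℝ} (hfg : ∀ i < n, |f i| ≤ |g i|) :
    nrm n h f ≤ nrm n h g := by
  refine sqrt_le_sqrt (mul_le_mul_of_nonneg_left (sum_le_sum fun i hi => ?_) hh.le)
  exact sq_le_sq.mpr (hfg i (mem_range.mp hi))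

theorem sum_abs_le_nrm {n : ℕ} {h : ℝ} (hh : 0 < h) (f : ℕ → ℝ) :
    h * ∑ i ∈ range n, |f i| ≤ √(n * h) * nrm n h f := by
  have h1 := nrm_inner_le (n := n) hh (fun _ => 1) (fun i => |f i|)
  simp only [one_mul] at h1
  refine h1.trans_eq ?_
  congr 1
  · simp [nrm, mul_comm]
  · simp [nrm]

/-- Comparison principle for the implicit step of the one-dimensional heat equation. -/
theorem heat_compare {m : ℕ} {k μ τ : ℝ} (hμ : 0 < μ) (hτ : 0 < τ) {e : ℕ → ℝ}
    (he : ∀ j < m, e j / τ - μ * Lc m k e j ≤ 0) {j : ℕ} (hj : j < m) : e j ≤ 0 := by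
  obtain ⟨q, hq, hmax⟩ := exists_max_image (range m) e ⟨j, mem_range.mpr hj⟩
  have hle : ∀ j < m, e j ≤ e q := fun j hj => hmax j (mem_range.mpr hj)
  have hq' := mem_range.mp hq
  refine (hle j hj).trans (le_of_not_gt fun hpos => ?_)
  have h1 := he q hq'
  have h2 : Lc m k e q ≤ 0 := by
    unfold Lc
    refine div_nonpos_of_nonpos_of_nonneg ?_ (sq_nonneg _)
    have h3 : (if q + 1 < m then e (q + 1) else - e q) ≤ e q := by
      split_ifs with h
      · exact hle _ h
      · linarith
    have h4 : (if q = 0 then - e 0 else e (q - 1)) ≤ e q := by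
      split_ifs with h
      · subst h; linarith
      · exact hle _ (by omega)
    linarith
  have h5 : 0 < e q / τ := by positivity
  nlinarith

theorem row_norm_step {n m : ℕ} {h k μ τ : ℝ} (hh : 0 < h) (hμ : 0 < μ)
    (hτ : 0 < τ) {v w f : ℕ → ℕ → ℝ}
    (heq : ∀ i < n, ∀ j < m, (v i j - w i j) / τ -
      μ * (Lc n h (fun i => v i j) i + Lc m k (v i) j) = f i j) {j : ℕ} (hj : j < m) :
    nrm n h (fun i => v i j) / τ - μ * Lc m k (fun j => nrm n h (fun i => v i j)) j ≤
      nrm n h (fun i => w i j) / τ + nrm n h (fun i => f i j) := by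
  obtain ⟨N, hN⟩ : ∃ N : ℕ → ℝ, N = fun j => nrm n h (fun i => v i j) := ⟨_, rfl⟩
  have hN0 : ∀ j, 0 ≤ N j := fun j => by rw [hN]; exact nrm_nonneg _ _ _
  have hNj : nrm n h (fun i => v i j) = N j := by rw [hN]
  rw [hNj, ← hN]
  rcases (hN0 j).eq_or_lt with h0 | hpos
  · have h1 : 0 ≤ Lc m k N j := by
      unfold Lc
      rw [← h0]
      refine div_nonneg ?_ (sq_nonneg _)
      have h3 : 0 ≤ (if j + 1 < m then N (j + 1) else - 0) := by
        split_ifs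
        · exact hN0 _
        · simp
      have h4 : 0 ≤ (if j = 0 then - N 0 else N (j - 1)) := by
        split_ifs with h
        · subst h; linarith
        · exact hN0 _
      linarith
    rw [← h0, zero_div]
    have := nrm_nonneg n h (fun i => w i j)
    have := nrm_nonneg n h (fun i => f i j)
    have h5 : 0 ≤ nrm n h (fun i => w i j) / τ := by positivity
    nlinarith
  rcases Nat.eq_zero_or_pos n with rfl | hn
  · rw [hN] at hpos; simp [nrm] at hpos
  -- inner product with the row
  have hsq : h * ∑ i ∈ range n, v i j * v i j = N j ^ 2 := by
    rw [hN, nrm_sq hh]; simp only [pow_two]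
  have hLx : 0 ≤ - (h * ∑ i ∈ range n, Lc n h (fun i => v i j) i * v i j) := by
    have h1 := bc_eq_sum_Lc hn h (fun i => v i j) (fun i => v i j)
    have h2 := bc_self_nonneg n h (fun i => v i j)
    rw [h1] at h2
    nlinarith
  have hLy : h * ∑ i ∈ range n, Lc m k (v i) j * v i j ≤ N j * Lc m k N j := by
    have e1 : h * ∑ i ∈ range n, Lc m k (v i) j * v i j =
        (h * ∑ i ∈ range n, (if j + 1 < m then v i (j + 1) else - v i j) * v i j -
          2 * (h * ∑ i ∈ range n, v i j * v i j) +
          h * ∑ i ∈ range n, (if j = 0 then - v i 0 else v i (j - 1)) * v i j) / k ^ 2 := by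
      simp only [Lc, mul_sum]
      rw [← sum_sub_distrib, ← sum_add_distrib, sum_div]
      exact sum_congr rfl fun i _ => by ring
    have e2 : h * ∑ i ∈ range n, (if j + 1 < m then v i (j + 1) else - v i j) * v i j ≤
        N j * (if j + 1 < m then N (j + 1) else - N j) := by
      split_ifs
      · refine (nrm_inner_le hh (fun i => v i (j + 1)) (fun i => v i j)).trans_eq ?_
        rw [hN]; ring
      · simp only [neg_mul, sum_neg_distrib, mul_neg, hsq]
        apply le_of_eq; ring
    have e3 : h * ∑ i ∈ range n, (if j = 0 then - v i 0 else v i (j - 1)) * v i j ≤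
        N j * (if j = 0 then - N 0 else N (j - 1)) := by
      split_ifs with hj0
      · subst hj0
        simp only [neg_mul, sum_neg_distrib, mul_neg, hsq]
        apply le_of_eq; ring
      · refine (nrm_inner_le hh (fun i => v i (j - 1)) (fun i => v i j)).trans_eq ?_
        rw [hN]; ring
    rw [e1, hsq]
    unfold Lc
    rw [← mul_div_assoc]
    refine div_le_div_of_nonneg_right ?_ (sq_nonneg _)
    linarith
  have hw := nrm_inner_le (n := n) hh (fun i => w i j) (fun i => v i j)
  have hf := nrm_inner_le (n := n) hh (fun i => f i j) (fun i => v i j)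
  rw [hNj] at hw hf
  have hid : h * ∑ i ∈ range n, f i j * v i j =
      (h * ∑ i ∈ range n, v i j * v i j - h * ∑ i ∈ range n, w i j * v i j) / τ -
      μ * (h * ∑ i ∈ range n, Lc n h (fun i => v i j) i * v i j +
        h * ∑ i ∈ range n, Lc m k (v i) j * v i j) := by
    simp only [mul_sum]
    rw [← sum_sub_distrib, ← sum_add_distrib, sum_div, mul_sum, ← sum_sub_distrib]
    refine sum_congr rfl fun i hi => ?_
    rw [← heq i (mem_range.mp hi) j hj]; ring
  rw [hid, hsq] at hf
  have h6 : (N j / τ - μ * Lc m k N j) * N j ≤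
      (nrm n h (fun i => w i j) / τ + nrm n h (fun i => f i j)) * N j := by
    have h7 : (N j ^ 2 - nrm n h (fun i => w i j) * N j) / τ ≤
        (N j ^ 2 - h * ∑ i ∈ range n, w i j * v i j) / τ :=
      div_le_div_of_nonneg_right (by linarith) hτ.le
    have h8 : μ * (h * ∑ i ∈ range n, Lc n h (fun i => v i j) i * v i j +
        h * ∑ i ∈ range n, Lc m k (v i) j * v i j) ≤ μ * (N j * Lc m k N j) :=
      mul_le_mul_of_nonneg_left (by linarith) hμ.le
    have h9 : (N j ^ 2 - nrm n h (fun i => w i j) * N j) / τ =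
      N j / τ * N j - nrm n h (fun i => w i j) / τ * N j := by ring
    rw [h9] at h7
    nlinarith
  exact le_of_mul_le_mul_right h6 hpos

/-- Propagation of a stationary barrier through the implicit heat steps. -/
theorem heat_barrier {m : ℕ} {k μ τ K : ℝ} (hμ : 0 < μ) (hτ : 0 < τ) (hK : 0 ≤ K) {b : ℕ → ℝ}
    (hb : ∀ j < m, b j ≤ 1 ∧ 1 - b j ≤ - μ * Lc m k b j) {N : ℕ → ℕ → ℝ} {S : ℕ}
    (hN0 : ∀ j < m, N 0 j ≤ K * b j)
    (hstep : ∀ s < S, ∀ j < m, N (s + 1) j / τ - μ * Lc m k (N (s + 1)) j ≤ N s j / τ + K)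
    {s : ℕ} (hs : s ≤ S) : ∀ j < m, N s j ≤ K * (1 + s * τ) * b j := by
  induction s with
  | zero => intro j hj; simpa using hN0 j hj
  | succ s ih =>
    intro j hj
    have h1 := ih (by omega)
    have key := heat_compare (m := m) (k := k) hμ hτ
      (e := fun j => N (s + 1) j - K * (1 + (s + 1 : ℕ) * τ) * b j) (fun j hj => by
        have h2 := hstep s (by omega) j hj
        have h3 := h1 j hj
        have h4 : Lc m k (fun j => N (s + 1) j - K * (1 + (s + 1 : ℕ) * τ) * b j) j =
            Lc m k (N (s + 1)) j - K * (1 + (s + 1 : ℕ) * τ) * Lc m k b j := by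
          unfold Lc; split_ifs <;> ring
        rw [h4]
        obtain ⟨h5, h6⟩ := hb j hj
        have h7 : N s j / τ ≤ K * (1 + s * τ) * b j / τ := div_le_div_of_nonneg_right h3 hτ.le
        have h8 : (N (s + 1) j - K * (1 + (s + 1 : ℕ) * τ) * b j) / τ =
            N (s + 1) j / τ - K * (1 + s * τ) * b j / τ - K * b j := by
          push_cast; field_simp; ring
        rw [h8]
        have h9 : K * (1 + (s + 1 : ℕ) * τ) * (1 - b j) ≤ K * (1 + (s + 1 : ℕ) * τ) * (- μ * Lc m k b j) :=
          mul_le_mul_of_nonneg_left h6 (by positivity)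
        have h10 : K * 1 * (1 - b j) ≤ K * (1 + (s + 1 : ℕ) * τ) * (1 - b j) := by
          refine mul_le_mul_of_nonneg_right (mul_le_mul_of_nonneg_left ?_ hK) (by linarith)
          have : 0 ≤ ((s + 1 : ℕ) : ℝ) * τ := by positivity
          linarith
        nlinarith) hj
    linarith

/-- Ratio of the exponential barrier. -/
def bq (r : ℝ) : ℝ := (r / (1 + r)) ^ 2

theorem bq_nonneg (r : ℝ) : 0 ≤ bq r := sq_nonneg _

theorem bq_lt_one {r : ℝ} (hr : 0 < r) : bq r < 1 := by
  unfold bq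
  rw [div_pow, div_lt_one (by positivity)]; nlinarith

theorem bq_le {r : ℝ} (hr : 0 < r) : bq r ≤ r ^ 2 * (1 - bq r) ^ 2 := by
  unfold bq
  have h1 : (1 - (r / (1 + r)) ^ 2) = (1 + 2 * r) / (1 + r) ^ 2 := by field_simp; ring
  rw [h1, ← mul_pow]
  refine pow_le_pow_left₀ (by positivity) ?_ 2
  rw [mul_div_assoc', div_le_div_iff₀ (by positivity) (by positivity)]
  have : r * (1 + 2 * r) * (1 + r) - r * (1 + r) ^ 2 = r ^ 2 * (1 + r) := by ring
  have : 0 ≤ r ^ 2 * (1 + r) := by positivity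
  linarith

theorem bq_wall {r : ℝ} (hr : 0 < r) : r * (1 - bq r) ≤ 2 := by
  unfold bq
  have h1 : (1 - (r / (1 + r)) ^ 2) = (1 + 2 * r) / (1 + r) ^ 2 := by field_simp; ring
  rw [h1, mul_div_assoc', div_le_iff₀ (by positivity)]
  nlinarith

theorem barrier_near {m : ℕ} {k μ : ℝ} (hk : 0 < k) (hμ : 0 < μ) {j : ℕ} :
    (1 - bq (√μ / k) ^ (j + 1)) ≤ 1 ∧ 1 - (1 - bq (√μ / k) ^ (j + 1)) ≤
      - μ * Lc m k (fun j => 1 - bq (√μ / k) ^ (j + 1)) j := by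
  obtain ⟨q, hq⟩ : ∃ q, q = bq (√μ / k) := ⟨_, rfl⟩
  have hr : 0 < √μ / k := by have := sqrt_pos.mpr hμ; positivity
  have h0 : 0 ≤ q := hq ▸ bq_nonneg _
  have h1 : q < 1 := hq ▸ bq_lt_one hr
  have h2 : q * k ^ 2 ≤ μ * (1 - q) ^ 2 := by
    have := bq_le hr
    rw [← hq, div_pow, sq_sqrt hμ.le, div_mul_eq_mul_div, le_div_iff₀ (by positivity)] at this
    exact this
  rw [← hq]
  have hp : ∀ t : ℕ, 0 ≤ q ^ t := fun t => pow_nonneg h0 t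
  have hp1 : ∀ t : ℕ, q ^ t ≤ 1 := fun t => pow_le_one₀ h0 h1.le
  refine ⟨by linarith [hp (j + 1)], ?_⟩
  have h3 : Lc m k (fun j => 1 - q ^ (j + 1)) j ≤ - (q ^ j * (1 - q) ^ 2) / k ^ 2 := by
    unfold Lc
    refine div_le_div_of_nonneg_right ?_ (sq_nonneg _)
    have h4 : (if j + 1 < m then 1 - q ^ (j + 1 + 1) else - (1 - q ^ (j + 1))) ≤ 1 - q ^ (j + 2) := by
      split_ifs
      · exact le_rfl
      · linarith [hp1 (j + 1), hp1 (j + 2)]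
    have h5 : (if j = 0 then - (1 - q ^ (0 + 1)) else 1 - q ^ (j - 1 + 1)) ≤ 1 - q ^ j := by
      split_ifs with h
      · subst h; simp only [zero_add, pow_one, pow_zero]; linarith
      · rw [Nat.sub_add_cancel (by omega)]
    have h6 : (1 - q ^ (j + 2)) - 2 * (1 - q ^ (j + 1)) + (1 - q ^ j) = - (q ^ j * (1 - q) ^ 2) := by
      ring
    rw [← h6]
    exact add_le_add (sub_le_sub_right h4 _) h5
  have h8 : q ^ (j + 1) ≤ μ * (q ^ j * (1 - q) ^ 2 / k ^ 2) := by
    rw [pow_succ, mul_div_assoc', le_div_iff₀ (by positivity)]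
    nlinarith [mul_le_mul_of_nonneg_left h2 (hp j)]
  have h9 := mul_le_mul_of_nonneg_left h3 hμ.le
  rw [neg_div] at h9
  linarith

theorem barrier_far {m : ℕ} {k μ : ℝ} (hk : 0 < k) (hμ : 0 < μ) {j : ℕ} (hj : j < m) :
    (1 - bq (√μ / k) ^ (m - j)) ≤ 1 ∧ 1 - (1 - bq (√μ / k) ^ (m - j)) ≤
      - μ * Lc m k (fun j => 1 - bq (√μ / k) ^ (m - j)) j := by
  have h1 := barrier_near (m := m) hk hμ (j := m - 1 - j)
  rw [show m - 1 - j + 1 = m - j by omega] at h1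
  refine ⟨h1.1, h1.2.trans_eq ?_⟩
  congr 1
  unfold Lc
  congr 1
  beta_reduce
  rw [show m - 1 - j + 1 = m - j by omega]
  have e1 : (if m - j < m then 1 - bq (√μ / k) ^ (m - j + 1) else -(1 - bq (√μ / k) ^ (m - j))) =
      (if j = 0 then -(1 - bq (√μ / k) ^ (m - 0)) else 1 - bq (√μ / k) ^ (m - (j - 1))) := by
    by_cases h : j = 0
    · rw [if_neg (by omega), if_pos h, h]
    · rw [if_pos (by omega), if_neg h, show m - (j - 1) = m - j + 1 by omega]
  have e2 : (if m - 1 - j = 0 then -(1 - bq (√μ / k) ^ (0 + 1))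
        else 1 - bq (√μ / k) ^ (m - 1 - j - 1 + 1)) =
      (if j + 1 < m then 1 - bq (√μ / k) ^ (m - (j + 1)) else -(1 - bq (√μ / k) ^ (m - j))) := by
    by_cases h : j + 1 < m
    · rw [if_neg (by omega), if_pos h, show m - 1 - j - 1 + 1 = m - (j + 1) by omega]
    · rw [if_pos (by omega), if_neg h, show m - j = 0 + 1 by omega]
  rw [e1, e2]; ring

end Barrier

section Heat

theorem Lc_add (m : ℕ) (k : ℝ) (w z : ℕ → ℝ) (j : ℕ) :
    Lc m k (fun j => w j + z j) j = Lc m k w j + Lc m k z j := by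
  unfold Lc
  split_ifs <;> ring

theorem Lc_smul (m : ℕ) (k c : ℝ) (w : ℕ → ℝ) (j : ℕ) :
    Lc m k (fun j => c * w j) j = c * Lc m k w j := by
  unfold Lc
  split_ifs <;> ring

theorem nrm_zero (n : ℕ) (h : ℝ) : nrm n h (fun _ => 0) = 0 := by simp [nrm]

theorem eq_zero_of_nrm {n : ℕ} {h : ℝ} (hh : 0 < h) {f : ℕ → ℝ} (hf : nrm n h f ≤ 0) {i : ℕ}
    (hi : i < n) : f i = 0 := by
  have h0 : nrm n h f = 0 := le_antisymm hf (nrm_nonneg _ _ _)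
  have h1 := nrm_sq (n := n) hh f
  rw [h0] at h1
  have h2 : ∑ i ∈ range n, f i ^ 2 = 0 := by
    have : h * ∑ i ∈ range n, f i ^ 2 = 0 := by rw [← h1]; norm_num
    exact (mul_eq_zero.mp this).resolve_left hh.ne'
  have h3 := (sum_eq_zero_iff_of_nonneg fun i _ => sq_nonneg (f i)).mp h2 i (mem_range.mpr hi)
  exact pow_eq_zero_iff (two_ne_zero) |>.mp h3

/-- The implicit Euler operator on cell functions. -/
def heatOp (n m : ℕ) (h k μ τ : ℝ) : cellSpace n m →ₗ[ℝ] cellSpace n m where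
  toFun v := ⟨fun i j => if i < n ∧ j < m then
      v.1 i j / τ - μ * (Lc n h (fun i => v.1 i j) i + Lc m k (v.1 i) j) else 0,
    fun i j hij => if_neg (by omega)⟩
  map_add' u v := by
    ext i j
    change (if i < n ∧ j < m then (u.1 i j + v.1 i j) / τ - μ * (Lc n h (fun i => u.1 i j + v.1 i j) i
      + Lc m k (fun j => u.1 i j + v.1 i j) j) else 0) =
      (if i < n ∧ j < m then _ else 0) + (if i < n ∧ j < m then _ else 0)
    rw [Lc_add, Lc_add]
    split_ifs
    · ring
    · ring
  map_smul' c v := by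
    ext i j
    change (if i < n ∧ j < m then (c * v.1 i j) / τ - μ * (Lc n h (fun i => c * v.1 i j) i
      + Lc m k (fun j => c * v.1 i j) j) else 0) = c * (if i < n ∧ j < m then _ else 0)
    rw [Lc_smul, Lc_smul]
    split_ifs
    · ring
    · ring

theorem exists_heat_step (n m : ℕ) {h k μ τ : ℝ} (hh : 0 < h) (hμ : 0 < μ) (hτ : 0 < τ)
    (g : ℕ → ℕ → ℝ) : ∃ v : cellSpace n m, ∀ i < n, ∀ j < m,
      v.1 i j / τ - μ * (Lc n h (fun i => v.1 i j) i + Lc m k (v.1 i) j) = g i j := by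
  have hinj : Function.Injective (heatOp n m h k μ τ) := by
    rw [injective_iff_map_eq_zero]
    intro v hv
    have hv' : ∀ i < n, ∀ j < m,
        v.1 i j / τ - μ * (Lc n h (fun i => v.1 i j) i + Lc m k (v.1 i) j) = 0 := by
      intro i hi j hj
      have h1 : (heatOp n m h k μ τ v).1 i j = 0 := by rw [hv]; rfl
      change (if i < n ∧ j < m then _ else 0) = (0 : ℝ) at h1
      rwa [if_pos ⟨hi, hj⟩] at h1
    have hN : ∀ j < m, nrm n h (fun i => v.1 i j) ≤ 0 := by
      intro j hj
      refine heat_compare (k := k) (e := fun j => nrm n h (fun i => v.1 i j)) hμ hτ (fun j hj => ?_) hj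
      have h2 := row_norm_step (n := n) (m := m) (k := k) hh hμ hτ (v := v.1) (w := fun _ _ => 0)
        (f := fun _ _ => 0) (fun i hi j hj => by rw [sub_zero]; exact hv' i hi j hj) hj
      rw [nrm_zero, zero_div, add_zero] at h2
      exact h2
    ext i j
    change v.1 i j = 0
    by_cases hij : i < n ∧ j < m
    · exact eq_zero_of_nrm hh (hN j hij.2) hij.1
    · exact v.2 i j (by omega)
  obtain ⟨v, hv⟩ := (LinearMap.injective_iff_surjective.mp hinj)
    ⟨fun i j => if i < n ∧ j < m then g i j else 0, fun i j hij => if_neg (by omega)⟩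
  refine ⟨v, fun i hi j hj => ?_⟩
  have h1 := congrArg (fun u : cellSpace n m => u.1 i j) hv
  change (if i < n ∧ j < m then _ else 0) = (if i < n ∧ j < m then _ else (0 : ℝ)) at h1
  rwa [if_pos ⟨hi, hj⟩, if_pos ⟨hi, hj⟩] at h1

theorem exists_heat (n m : ℕ) {h k μ τ : ℝ} (hh : 0 < h) (hμ : 0 < μ) (hτ : 0 < τ)
    (f : ℕ → ℕ → ℕ → ℝ) : ∃ v : ℕ → ℕ → ℕ → ℝ, v 0 = 0 ∧ (∀ s, v s ∈ cellSpace n m) ∧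
      ∀ s, ∀ i < n, ∀ j < m, (v (s + 1) i j - v s i j) / τ -
        μ * (Lc n h (fun i => v (s + 1) i j) i + Lc m k (v (s + 1) i) j) = f (s + 1) i j := by
  choose step hstep using fun g => exists_heat_step n m (k := k) hh hμ hτ g
  let v : ℕ → cellSpace n m := fun s =>
    Nat.rec 0 (fun s w => step (fun i j => f (s + 1) i j + w.1 i j / τ)) s
  refine ⟨fun s => (v s).1, rfl, fun s => (v s).2, fun s i hi j hj => ?_⟩
  have h1 := hstep (fun i j => f (s + 1) i j + (v s).1 i j / τ) i hi j hj
  change (v (s + 1)).1 i j / τ - μ * (Lc n h (fun i => (v (s + 1)).1 i j) i +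
    Lc m k ((v (s + 1)).1 i) j) = f (s + 1) i j + (v s).1 i j / τ at h1
  rw [sub_div]
  linarith

theorem heat_row_bounds {n m : ℕ} {h k μ τ K : ℝ} (hm : 1 ≤ m) (hh : 0 < h) (hk : 0 < k) (hμ : 0 < μ)
    (hτ : 0 < τ) (hK : 0 ≤ K) {v f : ℕ → ℕ → ℕ → ℝ} (h0 : v 0 = 0)
    (heq : ∀ s, ∀ i < n, ∀ j < m, (v (s + 1) i j - v s i j) / τ -
        μ * (Lc n h (fun i => v (s + 1) i j) i + Lc m k (v (s + 1) i) j) = f (s + 1) i j) {S : ℕ}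
    (hf : ∀ s < S, ∀ j < m, nrm n h (fun i => f (s + 1) i j) ≤ K) {s : ℕ} (hs : s ≤ S) :
    (∀ j < m, nrm n h (fun i => v s i j) ≤ K * (1 + s * τ)) ∧
    μ / k * nrm n h (fun i => v s i 0) ≤ 2 * √μ * (K * (1 + s * τ)) ∧
    μ / k * nrm n h (fun i => v s i (m - 1)) ≤ 2 * √μ * (K * (1 + s * τ)) := by
  have hr : 0 < √μ / k := by have := sqrt_pos.mpr hμ; positivity
  have hq1 := (bq_lt_one hr).le
  have hq0 := bq_nonneg (√μ / k)
  have hstep : ∀ s < S, ∀ j < m, nrm n h (fun i => v (s + 1) i j) / τ -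
      μ * Lc m k (fun j => nrm n h (fun i => v (s + 1) i j)) j ≤ nrm n h (fun i => v s i j) / τ + K :=
    fun s hs j hj => (row_norm_step hh hμ hτ (heq s) hj).trans (by linarith [hf s hs j hj])
  have hz : ∀ j, nrm n h (fun i => v 0 i j) = 0 := fun j => by rw [h0]; exact nrm_zero n h
  have hb1 := heat_barrier (K := K) (b := fun j => 1 - bq (√μ / k) ^ (j + 1))
    (N := fun s j => nrm n h (fun i => v s i j)) hμ hτ hK (fun j _ => barrier_near hk hμ)
    (fun j _ => by
      rw [hz]; exact mul_nonneg hK (by linarith [pow_le_one₀ (n := j + 1) hq0 hq1])) hstep hs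
  have hb2 := heat_barrier (K := K) (b := fun j => 1 - bq (√μ / k) ^ (m - j))
    (N := fun s j => nrm n h (fun i => v s i j)) hμ hτ hK (fun j hj => barrier_far hk hμ hj)
    (fun j _ => by
      rw [hz]; exact mul_nonneg hK (by linarith [pow_le_one₀ (n := m - j) hq0 hq1])) hstep hs
  have hK' : 0 ≤ K * (1 + s * τ) := by positivity
  have hwall : ∀ N, N ≤ K * (1 + s * τ) * (1 - bq (√μ / k)) →
      μ / k * N ≤ 2 * √μ * (K * (1 + s * τ)) := by
    intro N hN
    have h1 := bq_wall hr
    have h2 : μ / k = √μ * (√μ / k) := by rw [mul_div_assoc', mul_self_sqrt hμ.le]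
    calc μ / k * N ≤ μ / k * (K * (1 + s * τ) * (1 - bq (√μ / k))) :=
          mul_le_mul_of_nonneg_left hN (by positivity)
      _ = √μ * (K * (1 + s * τ)) * (√μ / k * (1 - bq (√μ / k))) := by rw [h2]; ring
      _ ≤ √μ * (K * (1 + s * τ)) * 2 := mul_le_mul_of_nonneg_left h1 (by positivity)
      _ = _ := by ring
  refine ⟨fun j hj => (hb1 j hj).trans ?_, hwall _ ?_, hwall _ ?_⟩
  · exact mul_le_of_le_one_right hK' (by linarith [pow_nonneg hq0 (j + 1)])
  · have := hb1 0 (by omega)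
    simpa using this
  · have := hb2 (m - 1) (by omega)
    rw [show m - (m - 1) = 1 by omega, pow_one] at this
    exact this

end Heat

section Corrector

/-- The first discrete sine mode on `n` cells, normalised to have sum one. -/
def sineMode (n i : ℕ) : ℝ := sin (π / (2 * n)) * sin (π * (2 * i + 1) / (2 * n))

/-- The eigenvalue of the first discrete sine mode. -/
def sineEig (n : ℕ) (h : ℝ) : ℝ := 4 / h ^ 2 * sin (π / (2 * n)) ^ 2

theorem two_mul_sineMode {n : ℕ} (hn : 1 ≤ n) (i : ℕ) :
    2 * sineMode n i = cos (π * i / n) - cos (π * (i + 1 : ℕ) / n) := by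
  have hn0 : (n : ℝ) ≠ 0 := by positivity
  rw [cos_sub_cos, sineMode]
  have e1 : (π * (i : ℝ) / n + π * ((i + 1 : ℕ) : ℝ) / n) / 2 = π * (2 * i + 1) / (2 * n) := by
    push_cast; field_simp; ring
  have e2 : (π * (i : ℝ) / n - π * ((i + 1 : ℕ) : ℝ) / n) / 2 = - (π / (2 * n)) := by
    push_cast; field_simp; ring
  rw [e1, e2, sin_neg]; ring

theorem sum_sineMode {n : ℕ} (hn : 1 ≤ n) : ∑ i ∈ range n, sineMode n i = 1 := by
  have hn0 : (n : ℝ) ≠ 0 := by positivity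
  have h1 : ∑ i ∈ range n, 2 * sineMode n i = 2 := by
    rw [sum_congr rfl fun i _ => two_mul_sineMode hn i,
      sum_range_sub' (fun i : ℕ => cos (π * i / n))]
    simp [mul_div_cancel_right₀ _ hn0]; norm_num
  rw [← mul_sum] at h1
  linarith

theorem sin_mode_bounds {n : ℕ} (hn : 1 ≤ n) : 0 ≤ sin (π / (2 * n)) ∧ sin (π / (2 * n)) ≤ 2 / n := by
  have hn0 : (1 : ℝ) ≤ n := by exact_mod_cast hn
  have h1 : π / (2 * n) ≤ 2 / n := by
    rw [div_le_div_iff₀ (by positivity) (by positivity)]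
    nlinarith [pi_le_four]
  refine ⟨sin_nonneg_of_nonneg_of_le_pi (by positivity) ?_, (sin_le (by positivity)).trans h1⟩
  rw [div_le_iff₀ (by positivity)]
  nlinarith [pi_pos]

theorem sineMode_nonneg {n i : ℕ} (hi : i < n) : 0 ≤ sineMode n i := by
  have hn : 1 ≤ n := by omega
  have hi' : (i : ℝ) + 1 ≤ n := by exact_mod_cast hi
  refine mul_nonneg (sin_mode_bounds hn).1 (sin_nonneg_of_nonneg_of_le_pi (by positivity) ?_)
  rw [div_le_iff₀ (by positivity)]
  nlinarith [pi_pos]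

theorem sineMode_le {n : ℕ} (hn : 1 ≤ n) (i : ℕ) : sineMode n i ≤ 2 / n :=
  (mul_le_of_le_one_right (sin_mode_bounds hn).1 (sin_le_one _)).trans (sin_mode_bounds hn).2

theorem sineMode_zero_le {n : ℕ} (hn : 1 ≤ n) : sineMode n 0 ≤ 4 / n ^ 2 := by
  obtain ⟨h1, h2⟩ := sin_mode_bounds hn
  have : sineMode n 0 = sin (π / (2 * n)) ^ 2 := by simp [sineMode]; ring
  rw [this]
  calc sin (π / (2 * n)) ^ 2 ≤ (2 / n) ^ 2 := pow_le_pow_left₀ h1 h2 2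
    _ = _ := by ring

theorem sineEig_nonneg (n : ℕ) (h : ℝ) : 0 ≤ sineEig n h := by unfold sineEig; positivity

theorem sineEig_le {n : ℕ} (hn : 1 ≤ n) {h : ℝ} (hh : 0 < h) : sineEig n h ≤ 16 / (n * h) ^ 2 := by
  obtain ⟨h1, h2⟩ := sin_mode_bounds hn
  have hn0 : (0 : ℝ) < n := by exact_mod_cast hn
  calc sineEig n h ≤ 4 / h ^ 2 * (2 / n) ^ 2 :=
        mul_le_mul_of_nonneg_left (pow_le_pow_left₀ h1 h2 2) (by positivity)
    _ = _ := by field_simp; norm_num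

theorem Lc_sineMode {n : ℕ} (hn : 1 ≤ n) (h : ℝ) {i : ℕ} (hi : i < n) :
    Lc n h (sineMode n) i = - sineEig n h * sineMode n i := by
  have hn0 : (n : ℝ) ≠ 0 := by positivity
  obtain ⟨a, ha⟩ : ∃ a, a = π / (2 * n) := ⟨_, rfl⟩
  have hm : ∀ j : ℕ, sineMode n j = sin a * sin (a * (2 * j + 1)) := fun j => by
    rw [sineMode, ha]; congr 2; ring
  have h1 : (if i + 1 < n then sineMode n (i + 1) else - sineMode n i) =
      sin a * sin (a * (2 * i + 1) + 2 * a) := by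
    split_ifs with hc
    · rw [hm]; congr 2; push_cast; ring
    · have hin : (n : ℝ) = i + 1 := by exact_mod_cast (by omega : n = i + 1)
      rw [hm, ← mul_neg]
      congr 1
      have hpi : a * (2 * (i + 1)) = π := by rw [ha, ← hin]; field_simp
      rw [show a * (2 * (i : ℝ) + 1) + 2 * a = π + a by rw [← hpi]; ring,
        show a * (2 * (i : ℝ) + 1) = π - a by rw [← hpi]; ring, sin_pi_sub, add_comm, sin_add_pi]
  have h2 : (if i = 0 then - sineMode n 0 else sineMode n (i - 1)) =
      sin a * sin (a * (2 * i + 1) - 2 * a) := by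
    split_ifs with hc
    · rw [hm, ← mul_neg, ← sin_neg, hc]
      congr 2; push_cast; ring
    · rw [hm]; congr 2
      rw [Nat.cast_sub (by omega)]; push_cast; ring
  rw [Lc, h1, h2, hm, sineEig, ← ha, sin_add, sin_sub, cos_two_mul, cos_sq']
  ring

/-- Sums over the first index. -/
def rs (n : ℕ) (v : ℕ → ℕ → ℝ) (j : ℕ) : ℝ := ∑ i ∈ range n, v i j

/-- Removal of the row and column sums. -/
def star (n m : ℕ) (v : ℕ → ℕ → ℝ) (i j : ℕ) : ℝ :=
  v i j - sineMode n i * rs n v j - sineMode m j * rs m (tr v) i +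
    sineMode n i * sineMode m j * ∑ j ∈ range m, rs n v j

/-- Wall flux through the two walls in the first direction. -/
def wallFlux (n : ℕ) (h : ℝ) (v : ℕ → ℕ → ℝ) (j : ℕ) : ℝ := 2 / h ^ 2 * (v 0 j + v (n - 1) j)

/-- Defect created by the removal of the row sums. -/
def rowDefect (n : ℕ) (h : ℝ) (v : ℕ → ℕ → ℝ) (j : ℕ) : ℝ :=
  sineEig n h * rs n v j - wallFlux n h v j

/-- Residual of the corrected cell function in the heat equation. -/
def starRes (n m : ℕ) (h k μ : ℝ) (v : ℕ → ℕ → ℝ) (i j : ℕ) : ℝ :=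
  - μ * (sineMode n i * rowDefect n h v j + sineMode m j * rowDefect m k (tr v) i -
    sineMode n i * sineMode m j *
      (∑ j ∈ range m, rowDefect n h v j + ∑ i ∈ range n, rowDefect m k (tr v) i))

theorem sum_rs_tr (n m : ℕ) (v : ℕ → ℕ → ℝ) :
    ∑ i ∈ range n, rs m (tr v) i = ∑ j ∈ range m, rs n v j := sum_comm

theorem star_tr (n m : ℕ) (v : ℕ → ℕ → ℝ) : star m n (tr v) = tr (star n m v) := by
  funext i j
  change tr v i j - sineMode m i * rs m (tr v) j - sineMode n j * rs n v i +
    sineMode m i * sineMode n j * ∑ j ∈ range n, rs m (tr v) j = star n m v j i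
  rw [sum_rs_tr, star]
  change v j i - _ - _ + _ = _
  ring

theorem rs_star {n m : ℕ} (hn : 1 ≤ n) (v : ℕ → ℕ → ℝ) (j : ℕ) : rs n (star n m v) j = 0 := by
  simp only [rs, star, sum_add_distrib, sum_sub_distrib, ← sum_mul, ← mul_sum, sum_sineMode hn]
  have := sum_rs_tr n m v
  simp only [rs] at this
  rw [this]
  ring

theorem sum_Lc {n : ℕ} (hn : 1 ≤ n) (h : ℝ) (w : ℕ → ℝ) :
    ∑ i ∈ range n, Lc n h w i = - (2 / h ^ 2 * (w 0 + w (n - 1))) := by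
  have h1 := bc_eq_sum_Lc hn h w (fun _ => 1)
  simp only [mul_one, bc, sub_self, mul_zero, sum_const_zero, zero_add] at h1
  rw [← neg_eq_iff_eq_neg] at h1
  rw [← h1]; ring

theorem sum_Lc_partial {n : ℕ} (h : ℝ) (w : ℕ → ℝ) {i : ℕ} (hi : i + 1 < n) :
    ∑ a ∈ range (i + 1), Lc n h w a = (w (i + 1) - w i - 2 * w 0) / h ^ 2 := by
  induction i with
  | zero => simp [Lc, hi]; ring
  | succ i ih =>
    rw [sum_range_succ, ih (by omega), Lc, if_pos hi, if_neg (by omega), Nat.add_sub_cancel]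
    ring

theorem Lc_finset_sum (m : ℕ) (k : ℝ) (s : ℕ) (w : ℕ → ℕ → ℝ) (j : ℕ) :
    Lc m k (fun j => ∑ i ∈ range s, w i j) j = ∑ i ∈ range s, Lc m k (w i) j := by
  induction s with
  | zero => simp [Lc]
  | succ s ih => simp only [sum_range_succ]; rw [Lc_add, ih]

theorem Lc_star {n m : ℕ} (hn : 1 ≤ n) (h : ℝ) (v : ℕ → ℕ → ℝ) {i : ℕ} (hi : i < n) (j : ℕ) :
    Lc n h (fun i => star n m v i j) i = Lc n h (fun i => v i j) i +
      sineEig n h * sineMode n i * rs n v j -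
      sineMode m j * ∑ b ∈ range m, Lc n h (fun i => v i b) i -
      sineEig n h * sineMode n i * sineMode m j * ∑ j ∈ range m, rs n v j := by
  have h1 : (fun i => star n m v i j) = fun i => v i j +
      ((sineMode m j * ∑ j ∈ range m, rs n v j - rs n v j) * sineMode n i +
        (- sineMode m j) * ∑ b ∈ range m, (tr v) b i) := by
    funext i; simp only [star, rs]; ring
  rw [h1, Lc_add, Lc_add, Lc_smul, Lc_smul, Lc_finset_sum, Lc_sineMode hn h hi]
  change _ + (_ + _ * ∑ b ∈ range m, Lc n h (fun i => v i b) i) = _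
  ring

theorem star_equation {n m : ℕ} {h k μ τ : ℝ} (hn : 1 ≤ n) (hm : 1 ≤ m) {u w f : ℕ → ℕ → ℝ}
    (heq : ∀ i < n, ∀ j < m, (u i j - w i j) / τ -
      μ * (Lc n h (fun i => u i j) i + Lc m k (u i) j) = f i j)
    (hf : ∀ j < m, rs n f j = 0) (hf' : ∀ i < n, rs m (tr f) i = 0) {i j : ℕ} (hi : i < n) (hj : j < m) :
    (star n m u i j - star n m w i j) / τ -
      μ * (Lc n h (fun i => star n m u i j) i + Lc m k (star n m u i) j) =
      f i j + starRes n m h k μ u i j := by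
  have e0 := heq i hi j hj
  have em : ∀ j < m, (rs n u j - rs n w j) / τ - μ * (- wallFlux n h u j +
      ∑ a ∈ range n, Lc m k (u a) j) = 0 := by
    intro j hj
    rw [← hf j hj]
    simp only [rs]
    rw [← sum_congr rfl fun i hi => heq i (mem_range.mp hi) j hj, sum_sub_distrib,
      ← sum_div, sum_sub_distrib, ← mul_sum, sum_add_distrib, sum_Lc hn h]
    rfl
  have em' : ∀ i < n, (rs m (tr u) i - rs m (tr w) i) / τ - μ * (∑ b ∈ range m, Lc n h (fun i => u i b) i
      - wallFlux m k (tr u) i) = 0 := by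
    intro i hi
    rw [← hf' i hi, rs]
    simp only [rs, tr]
    rw [← sum_congr rfl fun j hj => heq i hi j (mem_range.mp hj), sum_sub_distrib,
      ← sum_div, sum_sub_distrib, ← mul_sum, sum_add_distrib, sum_Lc hm k]
    simp only [wallFlux, tr]; ring
  have ec : (∑ j ∈ range m, rs n u j - ∑ j ∈ range m, rs n w j) / τ - μ * (- ∑ j ∈ range m, wallFlux n h u j
      - ∑ i ∈ range n, wallFlux m k (tr u) i) = 0 := by
    have h1 : ∑ j ∈ range m, ((rs n u j - rs n w j) / τ - μ * (- wallFlux n h u j +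
      ∑ a ∈ range n, Lc m k (u a) j)) = 0 := sum_eq_zero fun j hj => em j (mem_range.mp hj)
    rw [sum_sub_distrib, ← sum_div, sum_sub_distrib, ← mul_sum, sum_add_distrib, sum_neg_distrib,
      sum_comm (t := range n), sum_congr rfl fun i _ => sum_Lc hm k (u i), sum_neg_distrib] at h1
    exact h1
  have e1 := Lc_star (n := n) (m := m) hn h u hi j
  have e2 := Lc_star (n := m) (m := n) hm k (tr u) hj i
  rw [star_tr] at e2
  change Lc m k (star n m u i) j = Lc m k (u i) j + sineEig m k * sineMode m j * rs m (tr u) i -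
    sineMode n i * ∑ a ∈ range n, Lc m k (u a) j -
    sineEig m k * sineMode m j * sineMode n i * ∑ i ∈ range n, rs m (tr u) i at e2
  rw [e1, e2, sum_rs_tr]
  simp only [starRes, rowDefect, sum_sub_distrib, ← mul_sum, sum_rs_tr]
  have e3 := em j hj
  have e4 := em' i hi
  simp only [star]
  linear_combination e0 - sineMode n i * e3 - sineMode m j * e4 + sineMode n i * sineMode m j * ec

end Corrector

section Weak

/-- Discrete Laplacian of the first velocity component of a stream function. -/
def momLap (n m : ℕ) (h k : ℝ) (ψ : ℕ → ℕ → ℝ) (i j : ℕ) : ℝ :=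
  Lc m k (dy k ψ i) j - D2 n h (fun i => dy k ψ i j) i

theorem Uf_eq_momLap {n m : ℕ} (hm : 1 ≤ m) (h k : ℝ) (ψ : ℕ → ℕ → ℝ) {φ : ℕ → ℕ → ℝ}
    (hφ : φ ∈ nodeSpace n m) : Uf n m h k ψ φ = - l2 n m (momLap n m h k ψ) (dy k φ) := by
  have h1 : l2 n m (dx h (dy k ψ)) (dx h (dy k φ)) =
      ∑ i ∈ range n, ∑ j ∈ range m, D2 n h (fun i => dy k ψ i j) i * dy k φ i j := by
    rw [l2, sum_comm, sum_comm (s := range n)]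
    refine sum_congr rfl fun j _ => ?_
    refine (sum_D2_mul (fun i => dy k ψ i j) (g := fun i => dy k φ i j) fun i hi => ?_).symm
    rcases hi with hi | hi
    · rw [hi]; exact dy_zero_left hφ j
    · exact dy_zero_right hφ hi j
  rw [Uf, h1, sum_congr rfl fun i _ => bc_eq_sum_Lc hm k (dy k ψ i) (dy k φ i)]
  simp only [l2, momLap, sub_mul, sum_sub_distrib, sum_neg_distrib]
  ring

theorem weak_of_strong {n m : ℕ} {h k μ τ : ℝ} (hn : 1 ≤ n) (hm : 1 ≤ m) {ψ₁ ψ₀ Ax Ay φ : ℕ → ℕ → ℝ}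
    (hφ : φ ∈ nodeSpace n m)
    (hx : ∀ i j, 0 < i → i < n → j < m →
      dy k ψ₁ i j - dy k ψ₀ i j - τ * μ * momLap n m h k ψ₁ i j = τ * Ax i j)
    (hy : ∀ i j, i < n → 0 < j → j < m →
      dx h ψ₁ i j - dx h ψ₀ i j - τ * μ * momLap m n k h (tr ψ₁) j i = τ * Ay i j) :
    Mf n m h k (ψ₁ - ψ₀) φ + τ * μ * af n m h k ψ₁ φ =
      τ * (h * k * (l2 n m Ax (dy k φ) + l2 n m Ay (dx h φ))) := by
  have h1 : l2 n m (dy k (ψ₁ - ψ₀)) (dy k φ) - τ * μ * l2 n m (momLap n m h k ψ₁) (dy k φ) =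
      τ * l2 n m Ax (dy k φ) := by
    simp only [l2, mul_sum, ← sum_sub_distrib]
    refine sum_congr rfl fun i hi => sum_congr rfl fun j hj => ?_
    by_cases h0 : i = 0
    · rw [h0, dy_zero_left hφ]; ring
    · have := hx i j (by omega) (mem_range.mp hi) (mem_range.mp hj)
      rw [← mul_assoc, ← mul_assoc, ← this]
      simp only [dy, Pi.sub_apply]; ring
  have h2 : l2 n m (dx h (ψ₁ - ψ₀)) (dx h φ) - τ * μ * l2 n m (tr (momLap m n k h (tr ψ₁))) (dx h φ) =
      τ * l2 n m Ay (dx h φ) := by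
    simp only [l2, mul_sum, ← sum_sub_distrib]
    refine sum_congr rfl fun i hi => sum_congr rfl fun j hj => ?_
    by_cases h0 : j = 0
    · rw [h0, dx_zero_left hφ]; ring
    · have := hy i j (mem_range.mp hi) (by omega) (mem_range.mp hj)
      rw [← mul_assoc, ← mul_assoc, ← this]
      simp only [dx, Pi.sub_apply, tr]; ring
  have h3 : Uf m n k h (tr ψ₁) (tr φ) = - l2 n m (tr (momLap m n k h (tr ψ₁))) (dx h φ) := by
    rw [Uf_eq_momLap hn k h (tr ψ₁) (tr_mem hφ), ← l2_tr n m]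
    rfl
  rw [Mf, af, Uf_eq_momLap hm h k ψ₁ hφ, h3]
  linear_combination h * k * (h1 + h2)

end Weak

section Potential

/-- Stream function whose mixed difference is the corrected cell function. -/
def pot (n m : ℕ) (h k : ℝ) (v : ℕ → ℕ → ℝ) (i j : ℕ) : ℝ :=
  if n ≤ i ∨ m ≤ j then 0 else h * k * ∑ a ∈ range i, ∑ b ∈ range j, star n m v a b

theorem pot_mem (n m : ℕ) (h k : ℝ) (v : ℕ → ℕ → ℝ) : pot n m h k v ∈ nodeSpace n m := by
  intro i j hij
  unfold pot
  rcases hij with h1 | h1 | h1 | h1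
  · simp [h1]
  · rw [if_pos (Or.inl h1)]
  · simp [h1]
  · rw [if_pos (Or.inr h1)]

theorem pot_tr (n m : ℕ) (h k : ℝ) (v : ℕ → ℕ → ℝ) : pot m n k h (tr v) = tr (pot n m h k v) := by
  funext i j
  change (if m ≤ i ∨ n ≤ j then 0 else _) = if n ≤ j ∨ m ≤ i then 0 else _
  rw [star_tr, sum_comm, mul_comm k h]
  simp only [or_comm, tr]

theorem pot_eq {n m : ℕ} (hn : 1 ≤ n) (hm : 1 ≤ m) (h k : ℝ) (v : ℕ → ℕ → ℝ) {i j : ℕ} (hi : i ≤ n)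
    (hj : j ≤ m) : pot n m h k v i j = h * k * ∑ a ∈ range i, ∑ b ∈ range j, star n m v a b := by
  unfold pot
  split_ifs with hc
  · rcases hc with hc | hc
    · rw [le_antisymm hi hc, sum_comm]
      rw [sum_eq_zero fun b _ => ?_, mul_zero]
      exact rs_star hn v b
    · rw [le_antisymm hj hc, sum_eq_zero fun a _ => ?_, mul_zero]
      have := rs_star (n := m) (m := n) hm (tr v) a
      rw [star_tr] at this
      exact this
  · rfl

theorem dy_pot {n m : ℕ} (hn : 1 ≤ n) (hm : 1 ≤ m) {h k : ℝ} (hk : 0 < k) (v : ℕ → ℕ → ℝ) {i j : ℕ}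
    (hi : i ≤ n) (hj : j < m) : dy k (pot n m h k v) i j = h * ∑ a ∈ range i, star n m v a j := by
  rw [dy, pot_eq hn hm h k v hi hj, pot_eq hn hm h k v hi hj.le]
  simp only [sum_range_succ, sum_add_distrib]
  field_simp
  ring

theorem Lc_congr {m : ℕ} {k : ℝ} {w z : ℕ → ℝ} (hwz : ∀ j < m, w j = z j) {j : ℕ} (hj : j < m) :
    Lc m k w j = Lc m k z j := by
  unfold Lc
  rw [hwz j hj]
  split_ifs with h1 h2 h2
  · rw [hwz _ h1, hwz 0 (by omega)]
  · rw [hwz _ h1, hwz (j - 1) (by omega)]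
  · rw [hwz 0 (by omega)]
  · rw [hwz (j - 1) (by omega)]

theorem momLap_pot {n m : ℕ} (hm : 1 ≤ m) {h k : ℝ} (hh : 0 < h) (hk : 0 < k)
    (v : ℕ → ℕ → ℝ) {i j : ℕ} (hi : i + 1 < n) (hj : j < m) :
    momLap n m h k (pot n m h k v) (i + 1) j = h * ∑ a ∈ range (i + 1),
      (Lc m k (star n m v a) j + Lc n h (fun a => star n m v a j) a) + 2 / h * star n m v 0 j := by
  have hn : 1 ≤ n := by omega
  have h1 : Lc m k (dy k (pot n m h k v) (i + 1)) j = h * ∑ a ∈ range (i + 1), Lc m k (star n m v a) j := by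
    rw [Lc_congr (fun j hj => dy_pot hn hm hk v hi.le hj) hj, Lc_smul, Lc_finset_sum]
  have h2 : D2 n h (fun i => dy k (pot n m h k v) i j) (i + 1) =
      - ((star n m v (i + 1) j - star n m v i j) / h) := by
    rw [D2, if_neg (by omega), dy_pot hn hm hk v hi.le hj, dy_pot hn hm hk v (by omega) hj,
      dy_pot hn hm hk v (by omega) hj, Nat.add_sub_cancel]
    simp only [sum_range_succ]
    field_simp
    ring
  rw [momLap, h1, h2, sum_add_distrib, sum_Lc_partial h _ hi]
  field_simp
  ring

/-- Velocity residual of the corrector. -/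
def potRes (n m : ℕ) (h k μ : ℝ) (v : ℕ → ℕ → ℝ) (i j : ℕ) : ℝ :=
  h * ∑ a ∈ range i, starRes n m h k μ v a j - 2 * μ / h * star n m v 0 j

theorem rs_mixed {n m : ℕ} {h k : ℝ} (hh : 0 < h) {κ : ℕ → ℕ → ℝ} (hκ : κ ∈ nodeSpace n m) (i j : ℕ) :
    h * rs i (dx h (dy k κ)) j = dy k κ i j := by
  have h1 : ∀ a, dx h (dy k κ) a j = (dy k κ (a + 1) j - dy k κ a j) / h := fun a => rfl
  rw [rs, sum_congr rfl fun a _ => h1 a, ← sum_div, sum_range_sub (fun a => dy k κ a j),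
    dy_zero_left hκ, sub_zero, mul_div_cancel₀ _ hh.ne']

theorem pot_momentum {n m : ℕ} {h k μ τ : ℝ} (hm : 1 ≤ m) (hh : 0 < h) (hk : 0 < k) (hτ : 0 < τ)
    {u w κ : ℕ → ℕ → ℝ} (hκ : κ ∈ nodeSpace n m)
    (heq : ∀ i < n, ∀ j < m, (u i j - w i j) / τ -
      μ * (Lc n h (fun i => u i j) i + Lc m k (u i) j) = dx h (dy k κ) i j)
    {i j : ℕ} (hi0 : 0 < i) (hi : i < n) (hj : j < m) :
    dy k (pot n m h k u) i j - dy k (pot n m h k w) i j - τ * μ * momLap n m h k (pot n m h k u) i j =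
      τ * (dy k κ i j + potRes n m h k μ u i j) := by
  obtain ⟨i, rfl⟩ : ∃ q, i = q + 1 := ⟨i - 1, by omega⟩
  have hn : 1 ≤ n := by omega
  have hf : ∀ j < m, rs n (dx h (dy k κ)) j = 0 := by
    intro j _
    have := rs_mixed (k := k) hh hκ n j
    rw [dy_zero_right hκ le_rfl] at this
    exact (mul_eq_zero.mp this).resolve_left hh.ne'
  have hf' : ∀ i < n, rs m (tr (dx h (dy k κ))) i = 0 := by
    intro i _
    have e : tr (dx h (dy k κ)) = dx k (dy h (tr κ)) := by
      funext a b
      exact dx_dy_comm h k κ b a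
    have := rs_mixed (k := h) hk (tr_mem hκ) m i
    rw [dy_zero_right (tr_mem hκ) le_rfl, ← e] at this
    exact (mul_eq_zero.mp this).resolve_left hk.ne'
  have h1 : ∑ a ∈ range (i + 1), ((star n m u a j - star n m w a j) -
      τ * μ * (Lc m k (star n m u a) j + Lc n h (fun a => star n m u a j) a)) =
      ∑ a ∈ range (i + 1), τ * (dx h (dy k κ) a j + starRes n m h k μ u a j) := by
    refine sum_congr rfl fun a ha => ?_
    have := star_equation hn hm heq hf hf' (i := a) (j := j) (by have := mem_range.mp ha; omega) hj
    rw [← this]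
    field_simp
    ring
  rw [sum_sub_distrib, sum_sub_distrib, ← mul_sum, ← mul_sum, sum_add_distrib (s := range (i + 1))
    (f := fun a => dx h (dy k κ) a j)] at h1
  rw [dy_pot hn hm hk u hi.le hj, dy_pot hn hm hk w hi.le hj, momLap_pot hm hh hk u hi hj,
    ← rs_mixed hh hκ (i + 1) j, potRes, rs]
  linear_combination h * h1

end Potential

section CorrectorBounds

/-- Row bounds for a cell function, with smallness at the walls. -/
structure RowBd (n m : ℕ) (h k μ K : ℝ) (v : ℕ → ℕ → ℝ) : Prop where
  row : ∀ j < m, nrm n h (fun i => v i j) ≤ K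
  near : μ / k * nrm n h (fun i => v i 0) ≤ 2 * √μ * K
  far : μ / k * nrm n h (fun i => v i (m - 1)) ≤ 2 * √μ * K

/-- Weighted wall values. -/
def wallAbs (n : ℕ) (h μ : ℝ) (v : ℕ → ℕ → ℝ) (j : ℕ) : ℝ := 2 * μ / h * (|v 0 j| + |v (n - 1) j|)

theorem wallAbs_nonneg (n : ℕ) {h μ : ℝ} (hh : 0 < h) (hμ : 0 < μ) (v : ℕ → ℕ → ℝ) (j : ℕ) :
    0 ≤ wallAbs n h μ v j := by unfold wallAbs; positivity

theorem nrm_abs (n : ℕ) (h : ℝ) (f : ℕ → ℝ) : nrm n h (fun i => |f i|) = nrm n h f := by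
  simp [nrm, sq_abs]

theorem nrm_const {n : ℕ} {h : ℝ} {c : ℝ} (hc : 0 ≤ c) :
    nrm n h (fun _ => c) = √(n * h) * c := by
  have h1 := nrm_smul n h c (fun _ => 1)
  simp only [mul_one] at h1
  rw [h1, abs_of_nonneg hc, mul_comm]
  congr 1
  simp [nrm, mul_comm]

variable {n m : ℕ} {h k μ K X Y : ℝ} {v : ℕ → ℕ → ℝ}

theorem nrm_wallAbs (hh : 0 < h) (hk : 0 < k) (hμ : 0 < μ) (hc : RowBd m n k h μ K (tr v)) :
    nrm m k (wallAbs n h μ v) ≤ 8 * √μ * K := by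
  have e : wallAbs n h μ v = fun j => 2 * μ / h * |v 0 j| + 2 * μ / h * |v (n - 1) j| := by
    funext j; unfold wallAbs; ring
  have hp : 0 ≤ 2 * μ / h := by positivity
  rw [e]
  refine (nrm_add_le hk _ _).trans ?_
  rw [nrm_smul, nrm_smul, abs_of_nonneg hp, nrm_abs, nrm_abs]
  have h1 : μ / h * nrm m k (v 0) ≤ 2 * √μ * K := hc.near
  have h2 : μ / h * nrm m k (v (n - 1)) ≤ 2 * √μ * K := hc.far
  rw [mul_div_assoc]
  linarith

theorem mul_sum_abs_le (hh : 0 < h) (hX : n * h = X) (hr : RowBd n m h k μ K v) {j : ℕ} (hj : j < m) :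
    h * ∑ i ∈ range n, |v i j| ≤ √X * K :=
  (sum_abs_le_nrm hh _).trans (by rw [hX]; exact mul_le_mul_of_nonneg_left (hr.row j hj) (sqrt_nonneg _))

theorem mul_abs_rs_le (hh : 0 < h) (hX : n * h = X) (hr : RowBd n m h k μ K v) {j : ℕ} (hj : j < m) :
    h * |rs n v j| ≤ √X * K :=
  (mul_le_mul_of_nonneg_left (abs_sum_le_sum_abs _ _) hh.le).trans (mul_sum_abs_le hh hX hr hj)

theorem rowDefect_le (hn : 1 ≤ n) (hh : 0 < h) (hμ : 0 < μ) (hX : n * h = X)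
    (hr : RowBd n m h k μ K v) {j : ℕ} (hj : j < m) :
    μ * h * |rowDefect n h v j| ≤ 16 / X ^ 2 * √X * (μ * K) + wallAbs n h μ v j := by
  have h1 : |rowDefect n h v j| ≤ sineEig n h * |rs n v j| + 2 / h ^ 2 * (|v 0 j| + |v (n - 1) j|) := by
    refine (abs_sub _ _).trans ?_
    rw [abs_mul, abs_of_nonneg (sineEig_nonneg n h), wallFlux, abs_mul,
      abs_of_nonneg (by positivity : 0 ≤ 2 / h ^ 2)]
    gcongr
    exact abs_add_le _ _
  have h2 := mul_abs_rs_le hh hX hr hj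
  have h3 := sineEig_le hn hh
  rw [hX] at h3
  calc μ * h * |rowDefect n h v j| ≤ μ * h * (sineEig n h * |rs n v j| +
        2 / h ^ 2 * (|v 0 j| + |v (n - 1) j|)) := by gcongr
    _ = μ * (sineEig n h * (h * |rs n v j|)) + wallAbs n h μ v j := by
        unfold wallAbs; field_simp
    _ ≤ μ * (16 / X ^ 2 * (√X * K)) + wallAbs n h μ v j := by
        have : sineEig n h * (h * |rs n v j|) ≤ 16 / X ^ 2 * (√X * K) :=
          mul_le_mul h3 h2 (by positivity) (by positivity)
        gcongr
    _ = _ := by ring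

/-- Constant in the summed defect bound. -/
def defC (X Y : ℝ) : ℝ := Y * (16 / X ^ 2 * √X) + 8 * √Y

theorem sum_rowDefect_le (hn : 1 ≤ n) (hh : 0 < h) (hk : 0 < k) (hμ : 0 < μ) (hμ1 : μ ≤ √μ) (hK : 0 ≤ K)
    (hX : n * h = X) (hY : m * k = Y) (hr : RowBd n m h k μ K v) (hc : RowBd m n k h μ K (tr v)) :
    k * (μ * h * ∑ j ∈ range m, |rowDefect n h v j|) ≤ √μ * K * defC X Y := by
  have hY0 : 0 ≤ Y := by rw [← hY]; positivity
  have h1 : μ * h * ∑ j ∈ range m, |rowDefect n h v j| ≤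
      ∑ j ∈ range m, (16 / X ^ 2 * √X * (μ * K) + |wallAbs n h μ v j|) := by
    rw [mul_sum]
    refine sum_le_sum fun j hj => ?_
    rw [abs_of_nonneg (wallAbs_nonneg n hh hμ v j)]
    exact rowDefect_le hn hh hμ hX hr (mem_range.mp hj)
  rw [sum_add_distrib, sum_const, card_range, nsmul_eq_mul] at h1
  have h2 := sum_abs_le_nrm (n := m) hk (wallAbs n h μ v)
  have h3 := mul_le_mul_of_nonneg_left (nrm_wallAbs hh hk hμ hc) (sqrt_nonneg Y)
  rw [hY] at h2
  have h4 : μ * K ≤ √μ * K := by gcongr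
  have h5 : Y * (16 / X ^ 2 * √X) * (μ * K) ≤ Y * (16 / X ^ 2 * √X) * (√μ * K) :=
    mul_le_mul_of_nonneg_left h4 (by positivity)
  calc _ ≤ k * (m * (16 / X ^ 2 * √X * (μ * K)) + ∑ j ∈ range m, |wallAbs n h μ v j|) := by gcongr
    _ = Y * (16 / X ^ 2 * √X) * (μ * K) + k * ∑ j ∈ range m, |wallAbs n h μ v j| := by rw [← hY]; ring
    _ ≤ _ := by unfold defC; linarith

theorem abs_starRes_sum_le (hn : 1 ≤ n) (hm : 1 ≤ m) (hμ : 0 < μ) {i j : ℕ} (hi : i ≤ n) (hj : j < m) :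
    |∑ a ∈ range i, starRes n m h k μ v a j| ≤ μ * (|rowDefect n h v j| +
      2 / m * (∑ j ∈ range m, |rowDefect n h v j| + 2 * ∑ i ∈ range n, |rowDefect m k (tr v) i|)) := by
  obtain ⟨Q, hQ⟩ : ∃ Q, Q = ∑ j ∈ range m, |rowDefect n h v j| := ⟨_, rfl⟩
  obtain ⟨Q', hQ'⟩ : ∃ Q, Q = ∑ i ∈ range n, |rowDefect m k (tr v) i| := ⟨_, rfl⟩
  have hQ0 : 0 ≤ Q := hQ ▸ sum_nonneg fun _ _ => abs_nonneg _
  have hQ0' : 0 ≤ Q' := hQ' ▸ sum_nonneg fun _ _ => abs_nonneg _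
  have hb : ∀ a ∈ range n, |starRes n m h k μ v a j| ≤ μ * (sineMode n a * |rowDefect n h v j| +
      sineMode m j * |rowDefect m k (tr v) a| + sineMode n a * (sineMode m j * (Q + Q'))) := by
    intro a ha
    have h1 := sineMode_nonneg (mem_range.mp ha)
    have h2 := sineMode_nonneg hj
    rw [starRes, abs_mul, abs_neg, abs_of_pos hμ]
    refine mul_le_mul_of_nonneg_left ((abs_sub _ _).trans (add_le_add ((abs_add_le _ _).trans ?_) ?_)) hμ.le
    · rw [abs_mul, abs_mul, abs_of_nonneg h1, abs_of_nonneg h2]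
    · rw [abs_mul, abs_mul, abs_of_nonneg h1, abs_of_nonneg h2, mul_assoc]
      refine mul_le_mul_of_nonneg_left (mul_le_mul_of_nonneg_left ((abs_add_le _ _).trans ?_) h2) h1
      rw [hQ, hQ']
      exact add_le_add (abs_sum_le_sum_abs _ _) (abs_sum_le_sum_abs _ _)
  have h3 : |∑ a ∈ range i, starRes n m h k μ v a j| ≤ ∑ a ∈ range n, |starRes n m h k μ v a j| :=
    (abs_sum_le_sum_abs _ _).trans
      (sum_le_sum_of_subset_of_nonneg (range_mono hi) fun _ _ _ => abs_nonneg _)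
  refine h3.trans ((sum_le_sum hb).trans ?_)
  rw [← mul_sum, sum_add_distrib, sum_add_distrib, ← sum_mul, ← sum_mul, ← mul_sum, sum_sineMode hn,
    ← hQ, ← hQ']
  have h4 := sineMode_le hm j
  have h5 : sineMode m j * (Q + 2 * Q') ≤ 2 / m * (Q + 2 * Q') :=
    mul_le_mul_of_nonneg_right h4 (by positivity)
  refine mul_le_mul_of_nonneg_left ?_ hμ.le
  linarith

theorem abs_star_le (hm : 1 ≤ m) {i j : ℕ} (hi : i < n) (hj : j < m) {t : ℝ}
    (ht : sineMode n i ≤ t) :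
    |star n m v i j| ≤ |v i j| + t * |rs n v j| + 2 / m * ∑ b ∈ range m, |v i b| +
      t * (2 / m) * ∑ b ∈ range m, |rs n v b| := by
  have h1 := sineMode_nonneg hi
  have h2 := sineMode_nonneg hj
  have h3 := sineMode_le hm j
  have ht0 := h1.trans ht
  rw [star]
  refine (abs_add_le _ _).trans (add_le_add ((abs_sub _ _).trans (add_le_add ((abs_sub _ _).trans
    (add_le_add le_rfl ?_)) ?_)) ?_)
  · rw [abs_mul, abs_of_nonneg h1]; gcongr
  · rw [abs_mul, abs_of_nonneg h2]
    exact mul_le_mul h3 (abs_sum_le_sum_abs _ _) (abs_nonneg _) (by positivity)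
  · rw [abs_mul, abs_of_nonneg (mul_nonneg h1 h2)]
    exact mul_le_mul (mul_le_mul ht h3 h2 ht0) (abs_sum_le_sum_abs _ _) (abs_nonneg _)
      (by positivity)

/-- Constant in the pointwise residual bound. -/
def resC (X Y : ℝ) : ℝ := 16 / X ^ 2 * √X + 2 / Y * (defC X Y + 2 * defC Y X) + 8 / X ^ 2 * √X +
  2 / Y * (8 * √Y) + 16 / X ^ 2 * √X

theorem abs_potRes_le (hn : 1 ≤ n) (hm : 1 ≤ m) (hh : 0 < h) (hk : 0 < k) (hμ : 0 < μ) (hμ1 : μ ≤ √μ)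
    (hK : 0 ≤ K) (hX : n * h = X) (hY : m * k = Y) (hr : RowBd n m h k μ K v)
    (hc : RowBd m n k h μ K (tr v)) {i j : ℕ} (hi : i ≤ n) (hj : j < m) :
    |potRes n m h k μ v i j| ≤ 2 * wallAbs n h μ v j + √μ * K * resC X Y := by
  have hn0 : (0 : ℝ) < n := by exact_mod_cast hn
  have hm0 : (0 : ℝ) < m := by exact_mod_cast hm
  have hX0 : 0 < X := by rw [← hX]; positivity
  have hY0 : 0 < Y := by rw [← hY]; positivity
  have hμK : μ * K ≤ √μ * K := by gcongr
  have h1 : h * |∑ a ∈ range i, starRes n m h k μ v a j| ≤ wallAbs n h μ v j +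
      √μ * K * (16 / X ^ 2 * √X + 2 / Y * (defC X Y + 2 * defC Y X)) := by
    have a1 := abs_starRes_sum_le (h := h) (k := k) (v := v) hn hm hμ hi hj
    have a2 := rowDefect_le hn hh hμ hX hr hj
    have a3 := sum_rowDefect_le hn hh hk hμ hμ1 hK hX hY hr hc
    have a4 := sum_rowDefect_le hm hk hh hμ hμ1 hK hY hX hc hr
    have a5 : 2 / (m : ℝ) = 2 / Y * k := by rw [← hY]; field_simp
    have a6 : 16 / X ^ 2 * √X * (μ * K) ≤ 16 / X ^ 2 * √X * (√μ * K) :=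
      mul_le_mul_of_nonneg_left hμK (by positivity)
    have a7 : 2 / Y * (k * (μ * h * ∑ j ∈ range m, |rowDefect n h v j|) +
        2 * (h * (μ * k * ∑ i ∈ range n, |rowDefect m k (tr v) i|))) ≤
        2 / Y * (√μ * K * defC X Y + 2 * (√μ * K * defC Y X)) := by gcongr
    rw [a5] at a1
    have a8 := mul_le_mul_of_nonneg_left a1 hh.le
    linarith
  have h2 : 2 * μ / h * |star n m v 0 j| ≤ wallAbs n h μ v j +
      √μ * K * (8 / X ^ 2 * √X + 2 / Y * (8 * √Y) + 16 / X ^ 2 * √X) := by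
    have b1 := abs_star_le (v := v) hm hn hj (sineMode_zero_le hn)
    have b2 := mul_abs_rs_le hh hX hr hj
    have b3 : h * ∑ b ∈ range m, |rs n v b| ≤ m * (√X * K) := by
      rw [mul_sum]
      refine (sum_le_sum fun b hb => mul_abs_rs_le hh hX hr (mem_range.mp hb)).trans_eq ?_
      simp
    have b4 : k * ∑ b ∈ range m, 2 * μ / h * |v 0 b| ≤ √Y * (8 * √μ * K) := by
      refine le_trans ?_ (mul_le_mul_of_nonneg_left (nrm_wallAbs hh hk hμ hc) (sqrt_nonneg Y))
      refine le_trans ?_ ((sum_abs_le_nrm hk _).trans_eq (by rw [hY]))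
      gcongr with b _
      rw [abs_of_nonneg (wallAbs_nonneg n hh hμ v b), wallAbs]
      gcongr
      linarith [abs_nonneg (v (n - 1) b)]
    rw [← mul_sum] at b4
    have b5 : 2 * μ / h * |v 0 j| ≤ wallAbs n h μ v j := by
      unfold wallAbs; gcongr; linarith [abs_nonneg (v (n - 1) j)]
    have c1 : 2 * μ / h * (4 / (n : ℝ) ^ 2 * |rs n v j|) ≤ 8 / X ^ 2 * √X * (√μ * K) := by
      calc _ = 8 / X ^ 2 * (μ * (h * |rs n v j|)) := by rw [← hX]; field_simp; ring
        _ ≤ 8 / X ^ 2 * (μ * (√X * K)) := by gcongr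
        _ = 8 / X ^ 2 * √X * (μ * K) := by ring
        _ ≤ _ := mul_le_mul_of_nonneg_left hμK (by positivity)
    have c2 : 2 * μ / h * (2 / (m : ℝ) * ∑ b ∈ range m, |v 0 b|) ≤ 2 / Y * (8 * √Y) * (√μ * K) := by
      calc _ = 2 / Y * (k * (2 * μ / h * ∑ b ∈ range m, |v 0 b|)) := by rw [← hY]; field_simp
        _ ≤ 2 / Y * (√Y * (8 * √μ * K)) := by gcongr
        _ = _ := by ring
    have c3 : 2 * μ / h * (4 / (n : ℝ) ^ 2 * (2 / m) * ∑ b ∈ range m, |rs n v b|) ≤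
        16 / X ^ 2 * √X * (√μ * K) := by
      calc _ = 16 / X ^ 2 * (μ * (1 / m * (h * ∑ b ∈ range m, |rs n v b|))) := by
            rw [← hX]; field_simp; ring
        _ ≤ 16 / X ^ 2 * (μ * (1 / m * (m * (√X * K)))) := by gcongr
        _ = 16 / X ^ 2 * √X * (μ * K) := by field_simp
        _ ≤ _ := mul_le_mul_of_nonneg_left hμK (by positivity)
    have b6 := mul_le_mul_of_nonneg_left b1 (by positivity : 0 ≤ 2 * μ / h)
    linarith
  rw [potRes]
  refine (abs_sub _ _).trans ?_
  rw [abs_mul, abs_mul, abs_of_pos hh, abs_of_nonneg (by positivity : 0 ≤ 2 * μ / h)]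
  unfold resC
  linarith

theorem l2_potRes_le (hn : 1 ≤ n) (hm : 1 ≤ m) (hh : 0 < h) (hk : 0 < k) (hμ : 0 < μ) (hμ1 : μ ≤ √μ)
    (hK : 0 ≤ K) (hX : n * h = X) (hY : m * k = Y) (hr : RowBd n m h k μ K v)
    (hc : RowBd m n k h μ K (tr v)) :
    h * k * l2 n m (potRes n m h k μ v) (potRes n m h k μ v) ≤
      X * (√μ * K * (16 + √Y * resC X Y)) ^ 2 := by
  have hX0 : 0 ≤ X := by rw [← hX]; positivity
  have hY0 : 0 ≤ Y := by rw [← hY]; positivity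
  have hC : 0 ≤ resC X Y := by unfold resC defC; positivity
  have hrow : ∀ i < n, nrm m k (potRes n m h k μ v i) ≤ √μ * K * (16 + √Y * resC X Y) := by
    intro i hi
    have h1 : nrm m k (potRes n m h k μ v i) ≤
        nrm m k (fun j => 2 * wallAbs n h μ v j + √μ * K * resC X Y) := by
      refine nrm_mono hk fun j hj => ?_
      exact (abs_potRes_le hn hm hh hk hμ hμ1 hK hX hY hr hc hi.le hj).trans (le_abs_self _)
    refine h1.trans ((nrm_add_le hk _ _).trans ?_)
    rw [nrm_smul, nrm_const (by positivity), hY, abs_of_nonneg (by norm_num : (0 : ℝ) ≤ 2)]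
    have := nrm_wallAbs hh hk hμ hc
    linarith
  have h2 : h * k * l2 n m (potRes n m h k μ v) (potRes n m h k μ v) =
      h * ∑ i ∈ range n, nrm m k (potRes n m h k μ v i) ^ 2 := by
    rw [l2_self_eq, mul_assoc, mul_sum]
    exact congrArg _ (sum_congr rfl fun i _ => (nrm_sq hk _).symm)
  rw [h2]
  calc _ ≤ h * ∑ i ∈ range n, (√μ * K * (16 + √Y * resC X Y)) ^ 2 := by
        refine mul_le_mul_of_nonneg_left (sum_le_sum fun i hi => ?_) hh.le
        exact pow_le_pow_left₀ (nrm_nonneg _ _ _) (hrow i (mem_range.mp hi)) 2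
    _ = _ := by rw [sum_const, card_range, nsmul_eq_mul, ← hX]; ring

theorem abs_dy_pot_le (hn : 1 ≤ n) (hm : 1 ≤ m) (hh : 0 < h) (hk : 0 < k) (hX : n * h = X)
    (hr : RowBd n m h k μ K v) {i j : ℕ} (hi : i ≤ n) (hj : j < m) :
    |dy k (pot n m h k v) i j| ≤ 6 * (√X * K) := by
  have hm0 : (0 : ℝ) < m := by exact_mod_cast hm
  rw [dy_pot hn hm hk v hi hj, abs_mul, abs_of_pos hh]
  have h1 : |∑ a ∈ range i, star n m v a j| ≤ ∑ a ∈ range n, |star n m v a j| :=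
    (abs_sum_le_sum_abs _ _).trans
      (sum_le_sum_of_subset_of_nonneg (range_mono hi) fun _ _ _ => abs_nonneg _)
  have h2 : ∑ a ∈ range n, |star n m v a j| ≤ ∑ a ∈ range n, (|v a j| + sineMode n a * |rs n v j| +
      2 / m * ∑ b ∈ range m, |v a b| + sineMode n a * (2 / m * ∑ b ∈ range m, |rs n v b|)) := by
    refine sum_le_sum fun a ha => (abs_star_le hm (mem_range.mp ha) hj le_rfl).trans_eq ?_
    ring
  rw [sum_add_distrib, sum_add_distrib, sum_add_distrib, ← sum_mul, ← sum_mul, ← mul_sum, sum_comm,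
    sum_sineMode hn, one_mul, one_mul] at h2
  have h3 := mul_sum_abs_le hh hX hr hj
  have h4 := mul_abs_rs_le hh hX hr hj
  have h5 : h * ∑ b ∈ range m, ∑ a ∈ range n, |v a b| ≤ m * (√X * K) := by
    rw [mul_sum]
    refine (sum_le_sum fun b hb => mul_sum_abs_le hh hX hr (mem_range.mp hb)).trans_eq ?_
    simp
  have h6 : h * ∑ b ∈ range m, |rs n v b| ≤ m * (√X * K) := by
    rw [mul_sum]
    refine (sum_le_sum fun b hb => mul_abs_rs_le hh hX hr (mem_range.mp hb)).trans_eq ?_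
    simp
  have e : ∀ t : ℝ, h * t ≤ m * (√X * K) → h * (2 / m * t) ≤ 2 * (√X * K) := by
    intro t ht
    calc h * (2 / m * t) = 2 / m * (h * t) := by ring
      _ ≤ 2 / m * (m * (√X * K)) := by gcongr
      _ = _ := by field_simp
  have h7 := e _ h5
  have h8 := e _ h6
  have h9 := mul_le_mul_of_nonneg_left (h1.trans h2) hh.le
  linarith

end CorrectorBounds

section Stability

variable {n m : ℕ} {h k μ τ K X Y T : ℝ}

theorem l2_le_of_abs_le (hh : 0 < h) (hk : 0 < k) (hX : n * h = X) (hY : m * k = Y)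
    {E : ℕ → ℕ → ℝ} (hE : ∀ i < n, ∀ j < m, |E i j| ≤ K) : h * k * l2 n m E E ≤ X * Y * K ^ 2 := by
  have h1 : l2 n m E E ≤ ∑ _i ∈ range n, ∑ _j ∈ range m, K ^ 2 := by
    rw [l2_self_eq]
    refine sum_le_sum fun i hi => sum_le_sum fun j hj => ?_
    rw [← sq_abs]
    exact pow_le_pow_left₀ (abs_nonneg _) (hE i (mem_range.mp hi) j (mem_range.mp hj)) 2
  simp only [sum_const, card_range, nsmul_eq_mul] at h1
  calc _ ≤ h * k * (n * (m * K ^ 2)) := by gcongr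
    _ = _ := by rw [← hX, ← hY]; ring

theorem l2_comb_le (n m : ℕ) (a : ℝ) (U V : ℕ → ℕ → ℝ) :
    l2 n m (fun i j => a * U i j - V i j) (fun i j => a * U i j - V i j) ≤
      2 * (a ^ 2 * l2 n m U U) + 2 * l2 n m V V := by
  simp only [l2_self_eq, mul_sum, ← sum_add_distrib]
  refine sum_le_sum fun i _ => sum_le_sum fun j _ => ?_
  nlinarith [sq_nonneg (a * U i j + V i j)]

theorem l2_comb_left (n m : ℕ) (a : ℝ) (U V φ : ℕ → ℕ → ℝ) :
    l2 n m (fun i j => a * U i j - V i j) φ = a * l2 n m U φ - l2 n m V φ := by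
  simp only [l2, mul_sum, ← sum_sub_distrib]
  refine sum_congr rfl fun i _ => sum_congr rfl fun j _ => by ring

theorem abs_dy_le_of_mixed (hh : 0 < h) (hX : n * h = X) {κ : ℕ → ℕ → ℝ} (hκ : κ ∈ nodeSpace n m)
    {i j : ℕ} (hi : i ≤ n) (hK : nrm n h (fun i => dx h (dy k κ) i j) ≤ K) :
    |dy k κ i j| ≤ √X * K := by
  rw [← rs_mixed hh hκ i j, abs_mul, abs_of_pos hh, rs]
  have h1 : |∑ a ∈ range i, dx h (dy k κ) a j| ≤ ∑ a ∈ range n, |dx h (dy k κ) a j| :=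
    (abs_sum_le_sum_abs _ _).trans
      (sum_le_sum_of_subset_of_nonneg (range_mono hi) fun _ _ _ => abs_nonneg _)
  have h2 := sum_abs_le_nrm (n := n) hh (fun i => dx h (dy k κ) i j)
  rw [hX] at h2
  calc _ ≤ h * ∑ a ∈ range n, |dx h (dy k κ) a j| := by gcongr
    _ ≤ _ := h2.trans (by gcongr)

/-- The weak momentum balance of a discrete stream function driven by `κ` and residuals
`μ (Rx, Ry)`. -/
structure WeakFlow (n m : ℕ) (h k μ τ K : ℝ) (N : ℕ) (ψ κ Rx Ry : ℕ → ℕ → ℕ → ℝ) : Prop where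
  mem : ∀ s, ψ s ∈ nodeSpace n m
  start : ψ 0 = 0
  kmem : ∀ s, κ s ∈ nodeSpace n m
  eq : ∀ s < N, ∀ φ ∈ nodeSpace n m,
    Mf n m h k (ψ (s + 1) - ψ s) φ + τ * μ * af n m h k (ψ (s + 1)) φ =
      τ * (Mf n m h k (κ (s + 1)) φ +
        μ * (h * k * (l2 n m (Rx (s + 1)) (dy k φ) + l2 n m (Ry (s + 1)) (dx h φ))))
  rx : ∀ s < N, ∀ i < n, ∀ j < m, |Rx (s + 1) i j| ≤ K
  ry : ∀ s < N, ∀ i < n, ∀ j < m, |Ry (s + 1) i j| ≤ K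
  row : ∀ s < N, ∀ j < m, nrm n h (fun i => dx h (dy k (κ (s + 1))) i j) ≤ K
  col : ∀ s < N, ∀ i < n, nrm m k (fun j => dx h (dy k (κ (s + 1))) i j) ≤ K

theorem Mf_sub_left (n m : ℕ) (h k : ℝ) (u v w : ℕ → ℕ → ℝ) :
    Mf n m h k (u - v) w = Mf n m h k u w - Mf n m h k v w := by
  have := (Mf_isForm n m h k).add (u - v) v w
  rw [sub_add_cancel] at this; linarith

theorem af_sub_left (n m : ℕ) (h k : ℝ) (u v w : ℕ → ℕ → ℝ) :
    af n m h k (u - v) w = af n m h k u w - af n m h k v w := by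
  have := (af_isForm n m h k).add (u - v) v w
  rw [sub_add_cancel] at this; linarith

theorem dy_sub (k : ℝ) (u v : ℕ → ℕ → ℝ) (i j : ℕ) : dy k (u - v) i j = dy k u i j - dy k v i j := by
  simp only [dy, Pi.sub_apply]; ring

theorem dx_sub (k : ℝ) (u v : ℕ → ℕ → ℝ) (i j : ℕ) : dx k (u - v) i j = dx k u i j - dx k v i j := by
  simp only [dx, Pi.sub_apply]; ring

/-- Stability constant for viscosity at least one. -/
def stabLarge (X Y : ℝ) : ℝ := √10 * √(2 * (X * Y) * (2 + X + Y)) * √(9 * (X ^ 2 + Y ^ 2))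

/-- Squared residual constant for viscosity at most one. -/
def resSq (X Y : ℝ) : ℝ :=
  4 * (X * Y) + 2 * (X * (16 + √Y * resC X Y) ^ 2) + 2 * (Y * (16 + √X * resC Y X) ^ 2)

/-- Stability constant for viscosity at most one. -/
def stabSmall (X Y T : ℝ) : ℝ :=
  2 * √10 * ((1 + T) * √(resSq X Y)) * √T + 6 * ((√X + √Y) * (1 + T))

variable {N : ℕ} {ψ κ Rx Ry : ℕ → ℕ → ℕ → ℝ}

theorem stability_large (hh : 0 < h) (hk : 0 < k) (hτ : 0 < τ)
    (hμ : 1 ≤ μ) (hK : 0 ≤ K) (hX : n * h = X) (hY : m * k = Y) (hX0 : 0 < X) (hY0 : 0 < Y)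
    (hw : WeakFlow n m h k μ τ K N ψ κ Rx Ry) {q : ℕ} (hq : q ≤ N) :
    (∀ i j, i ≤ n → j < m → |dy k (ψ q) i j| ≤ stabLarge X Y * K) ∧
    (∀ i j, i < n → j ≤ m → |dx h (ψ q) i j| ≤ stabLarge X Y * K) := by
  have hμ0 : 0 < μ := by linarith
  obtain ⟨B, hB⟩ : ∃ B, B = 2 * (X * Y) * (2 + X + Y) := ⟨_, rfl⟩
  have hB0 : 0 ≤ B := by rw [hB]; positivity
  obtain ⟨Ex, hEx⟩ : ∃ E : ℕ → ℕ → ℕ → ℝ, E = fun s i j => μ * Rx s i j - -dy k (κ s) i j := ⟨_, rfl⟩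
  obtain ⟨Ey, hEy⟩ : ∃ E : ℕ → ℕ → ℕ → ℝ, E = fun s i j => μ * Ry s i j - -dx h (κ s) i j := ⟨_, rfl⟩
  have heq : ∀ s < N, ∀ φ ∈ nodeSpace n m,
      Mf n m h k (ψ (s + 1) - ψ s) φ + τ * μ * af n m h k (ψ (s + 1)) φ =
      τ * (h * k * (l2 n m (Ex (s + 1)) (dy k φ) +
        l2 n m (Ey (s + 1)) (dx h φ))) := by
    intro s hs φ hφ
    simp only [hEx, hEy]
    rw [hw.eq s hs φ hφ, l2_comb_left, l2_comb_left]
    have e1 : l2 n m (fun i j => -dy k (κ (s + 1)) i j) (dy k φ) = -l2 n m (dy k (κ (s + 1))) (dy k φ) := by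
      simp [l2]
    have e2 : l2 n m (fun i j => -dx h (κ (s + 1)) i j) (dx h φ) = -l2 n m (dx h (κ (s + 1))) (dx h φ) := by
      simp [l2]
    rw [e1, e2, Mf]; ring
  have hE : ∀ s < N, h * k *
      (l2 n m (Ex (s + 1))
        (Ex (s + 1)) +
      l2 n m (Ey (s + 1))
        (Ey (s + 1))) ≤ (μ * K * √B) ^ 2 := by
    intro s hs
    have a1 := l2_le_of_abs_le hh hk hX hY (hw.rx s hs)
    have a2 := l2_le_of_abs_le hh hk hX hY (hw.ry s hs)
    have a3 := l2_le_of_abs_le hh hk hX hY (E := fun i j => -dy k (κ (s + 1)) i j)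
      fun i hi j hj => (abs_neg _).trans_le (abs_dy_le_of_mixed hh hX (hw.kmem _) hi.le (hw.row s hs j hj))
    have a4 := l2_le_of_abs_le hh hk hX hY (E := fun i j => -dx h (κ (s + 1)) i j)
      fun i hi j hj => (abs_neg _).trans_le (abs_dy_le_of_mixed (k := h) hk hY (tr_mem (hw.kmem (s + 1)))
        hj.le ((by
          have := hw.col s hs i hi
          simp only [dx_dy_comm] at this; exact this)))
    have b1 := l2_comb_le n m μ (Rx (s + 1)) (fun i j => -dy k (κ (s + 1)) i j)
    have b2 := l2_comb_le n m μ (Ry (s + 1)) (fun i j => -dx h (κ (s + 1)) i j)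
    have hhk : 0 < h * k := mul_pos hh hk
    have c1 := mul_le_mul_of_nonneg_left b1 hhk.le
    have c2 := mul_le_mul_of_nonneg_left b2 hhk.le
    have d1 := mul_le_mul_of_nonneg_left a1 (sq_nonneg μ)
    have d2 := mul_le_mul_of_nonneg_left a2 (sq_nonneg μ)
    have e : (μ * K * √B) ^ 2 = μ ^ 2 * K ^ 2 * B := by rw [mul_pow, mul_pow, sq_sqrt hB0]
    rw [mul_pow, sq_sqrt hX0.le] at a3
    rw [mul_pow, sq_sqrt hY0.le] at a4
    have f1 : X * Y * ((X + Y) * K ^ 2) * 1 ≤ X * Y * ((X + Y) * K ^ 2) * μ ^ 2 :=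
      mul_le_mul_of_nonneg_left (one_le_pow₀ hμ) (by positivity)
    simp only [hEx, hEy]
    rw [e, hB]
    linarith
  have hL : (n * h) ^ 2 + (m * k) ^ 2 ≤ X ^ 2 + Y ^ 2 := by rw [hX, hY]
  have hfin : √10 * (μ * K * √B) * √(9 * (X ^ 2 + Y ^ 2)) / μ = stabLarge X Y * K := by
    rw [stabLarge, ← hB, div_eq_iff hμ0.ne']; ring
  refine ⟨fun i j hi hj => ?_, fun i j hi hj => ?_⟩
  · exact (evolution_bound hh hk hτ hμ0 (by positivity) (by positivity) hL ψ hw.mem hw.start Ex Ey N heq hE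
      hq hi hj).2.trans_eq hfin
  · exact (evolution_bound_dx hh hk hτ hμ0 (by positivity) (by positivity) hL ψ hw.mem hw.start Ex Ey N heq hE
      hq hi hj).2.trans_eq hfin

theorem corrector_weak (hn : 1 ≤ n) (hm : 1 ≤ m) (hh : 0 < h) (hk : 0 < k) (hτ : 0 < τ)
    {u w κ φ : ℕ → ℕ → ℝ} (hκ : κ ∈ nodeSpace n m) (hφ : φ ∈ nodeSpace n m)
    (heq : ∀ i < n, ∀ j < m, (u i j - w i j) / τ -
      μ * (Lc n h (fun i => u i j) i + Lc m k (u i) j) = dx h (dy k κ) i j) :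
    Mf n m h k (pot n m h k u - pot n m h k w) φ + τ * μ * af n m h k (pot n m h k u) φ =
      τ * (Mf n m h k κ φ + h * k * (l2 n m (potRes n m h k μ u) (dy k φ) +
        l2 n m (tr (potRes m n k h μ (tr u))) (dx h φ))) := by
  have h1 := weak_of_strong (h := h) (k := k) (μ := μ) (τ := τ) hn hm hφ
    (Ax := dy k κ + potRes n m h k μ u) (Ay := dx h κ + tr (potRes m n k h μ (tr u)))
    (ψ₁ := pot n m h k u) (ψ₀ := pot n m h k w)
    (fun i j hi0 hi hj => pot_momentum hm hh hk hτ hκ heq hi0 hi hj)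
    (fun i j hi hj0 hj => by
      have h2 := pot_momentum (n := m) (m := n) (h := k) (k := h) (u := tr u) (w := tr w) hn hk hh hτ
        (tr_mem hκ) (fun i hi j hj => by
          have := heq j hj i hi
          rw [dx_dy_comm, add_comm (Lc n h _ _)] at this
          exact this) hj0 hj hi
      rw [pot_tr, pot_tr] at h2
      exact h2)
  rw [h1, l2_add, l2_add, Mf]; ring

theorem stability_small (hn : 1 ≤ n) (hm : 1 ≤ m) (hh : 0 < h) (hk : 0 < k) (hτ : 0 < τ)
    (hμ : 0 < μ) (hμ1 : μ ≤ 1) (hK : 0 ≤ K) (hX : n * h = X) (hY : m * k = Y) (hX0 : 0 < X) (hY0 : 0 < Y)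
    (hT : 0 ≤ T) (hNT : N * τ ≤ T)
    (hw : WeakFlow n m h k μ τ K N ψ κ Rx Ry) {q : ℕ} (hq : q ≤ N) :
    (∀ i j, i ≤ n → j < m → |dy k (ψ q) i j| ≤ stabSmall X Y T * K) ∧
    (∀ i j, i < n → j ≤ m → |dx h (ψ q) i j| ≤ stabSmall X Y T * K) := by
  have hsm : μ ≤ √μ := by
    have := sq_sqrt hμ.le
    have h0 := sqrt_nonneg μ
    have h1 : √μ ≤ 1 := by rw [← sqrt_one]; exact sqrt_le_sqrt hμ1
    nlinarith
  obtain ⟨v, hv0, hvmem, hv⟩ := exists_heat n m (k := k) hh hμ hτ (fun s => dx h (dy k (κ s)))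
  obtain ⟨K', hK'⟩ : ∃ K', K' = K * (1 + T) := ⟨_, rfl⟩
  have hK'0 : 0 ≤ K' := by rw [hK']; positivity
  have hKK : K ≤ K' := by rw [hK']; nlinarith
  have hsT : ∀ s ≤ N, K * (1 + s * τ) ≤ K' := by
    intro s hs
    have : (s : ℝ) * τ ≤ N * τ := by gcongr
    rw [hK']; gcongr; linarith
  have hmono : ∀ {n m : ℕ} {h k : ℝ} {v : ℕ → ℕ → ℝ} {K₁ : ℝ}, K₁ ≤ K' →
      ((∀ j < m, nrm n h (fun i => v i j) ≤ K₁) ∧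
      μ / k * nrm n h (fun i => v i 0) ≤ 2 * √μ * K₁ ∧
      μ / k * nrm n h (fun i => v i (m - 1)) ≤ 2 * √μ * K₁) → RowBd n m h k μ K' v :=
    fun hle hb => ⟨fun j hj => (hb.1 j hj).trans hle,
      hb.2.1.trans (mul_le_mul_of_nonneg_left hle (by positivity)),
      hb.2.2.trans (mul_le_mul_of_nonneg_left hle (by positivity))⟩
  have hr : ∀ s ≤ N, RowBd n m h k μ K' (v s) := fun s hs =>
    hmono (hsT s hs) (heat_row_bounds (f := fun s => dx h (dy k (κ s))) hm hh hk hμ hτ hK hv0 hv hw.row hs)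
  have hc : ∀ s ≤ N, RowBd m n k h μ K' (tr (v s)) := fun s hs =>
    hmono (hsT s hs) (heat_row_bounds (v := fun s => tr (v s)) (f := fun s => tr (dx h (dy k (κ s))))
      hn hk hh hμ hτ hK (by simp only [hv0]; rfl) (fun s i hi j hj => by
        have := hv s j hj i hi
        rw [add_comm (Lc n h _ _)] at this
        exact this) hw.col hs)
  obtain ⟨B, hB⟩ : ∃ B, B = resSq X Y := ⟨_, rfl⟩
  have hB0 : 0 ≤ B := by rw [hB, resSq]; positivity
  obtain ⟨Ex, hEx⟩ : ∃ E : ℕ → ℕ → ℕ → ℝ, E = fun s i j => μ * Rx s i j - potRes n m h k μ (v s) i j := ⟨_, rfl⟩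
  obtain ⟨Ey, hEy⟩ : ∃ E : ℕ → ℕ → ℕ → ℝ, E = fun s i j => μ * Ry s i j - tr (potRes m n k h μ (tr (v s))) i j := ⟨_, rfl⟩
  obtain ⟨ρ, hρ⟩ : ∃ r : ℕ → ℕ → ℕ → ℝ, r = fun s => ψ s - pot n m h k (v s) := ⟨_, rfl⟩
  have heq : ∀ s < N, ∀ φ ∈ nodeSpace n m,
      Mf n m h k (ρ (s + 1) - ρ s) φ +
        τ * μ * af n m h k (ρ (s + 1)) φ =
      τ * (h * k * (l2 n m (Ex (s + 1)) (dy k φ) +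
        l2 n m (Ey (s + 1)) (dx h φ))) := by
    intro s hs φ hφ
    have h1 := hw.eq s hs φ hφ
    have h2 := corrector_weak (μ := μ) hn hm hh hk hτ (hw.kmem (s + 1)) hφ (hv s)
    simp only [hρ, hEx, hEy, Mf_sub_left, af_sub_left] at h1 h2 ⊢
    rw [l2_comb_left, l2_comb_left]
    linarith
  have hE : ∀ s < N, h * k *
      (l2 n m (Ex (s + 1))
        (Ex (s + 1)) +
      l2 n m (Ey (s + 1))
        (Ey (s + 1)))
      ≤ (√μ * K' * √B) ^ 2 := by
    intro s hs
    have a1 := l2_le_of_abs_le hh hk hX hY fun i hi j hj => (hw.rx s hs i hi j hj).trans hKK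
    have a2 := l2_le_of_abs_le hh hk hX hY fun i hi j hj => (hw.ry s hs i hi j hj).trans hKK
    have a3 := l2_potRes_le hn hm hh hk hμ hsm hK'0 hX hY (hr (s + 1) hs) (hc (s + 1) hs)
    have a4 := l2_potRes_le hm hn hk hh hμ hsm hK'0 hY hX (hc (s + 1) hs) (hr (s + 1) hs)
    rw [← l2_tr, mul_comm k h] at a4
    have b1 := l2_comb_le n m μ (Rx (s + 1)) (potRes n m h k μ (v (s + 1)))
    have b2 := l2_comb_le n m μ (Ry (s + 1)) (tr (potRes m n k h μ (tr (v (s + 1)))))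
    have hhk : 0 < h * k := mul_pos hh hk
    have c1 := mul_le_mul_of_nonneg_left b1 hhk.le
    have c2 := mul_le_mul_of_nonneg_left b2 hhk.le
    have d1 := mul_le_mul_of_nonneg_left a1 (sq_nonneg μ)
    have d2 := mul_le_mul_of_nonneg_left a2 (sq_nonneg μ)
    have e : (√μ * K' * √B) ^ 2 = μ * K' ^ 2 * B := by
      rw [mul_pow, mul_pow, sq_sqrt hB0, sq_sqrt hμ.le]
    have f1 : X * Y * K' ^ 2 * μ ^ 2 ≤ X * Y * K' ^ 2 * μ :=
      mul_le_mul_of_nonneg_left (by nlinarith) (by positivity)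
    rw [mul_pow, mul_pow, sq_sqrt hμ.le] at a3 a4
    simp only [hEx, hEy]
    rw [e, hB, resSq]
    linarith
  have hL : (n * h) ^ 2 + (m * k) ^ 2 ≤ X ^ 2 + Y ^ 2 := by rw [hX, hY]
  have hfin : 2 * √10 * (√μ * K' * √B) * √(q * τ / μ) ≤ 2 * √10 * ((1 + T) * √B) * √T * K := by
    have h1 : √(q * τ / μ) = √(q * τ) / √μ := sqrt_div (by positivity) μ
    have h2 : √(q * τ) ≤ √T := sqrt_le_sqrt (le_trans (by gcongr) hNT)
    have h3 : 0 < √μ := sqrt_pos.mpr hμ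
    calc _ = 2 * √10 * (K' * √B) * √(q * τ) := by rw [h1]; field_simp
      _ ≤ 2 * √10 * (K' * √B) * √T := by gcongr
      _ = _ := by rw [hK']; ring
  have hs : stabSmall X Y T * K = 2 * √10 * ((1 + T) * √B) * √T * K + 6 * (√X * K') + 6 * (√Y * K') := by
    rw [stabSmall, hB, hK']; ring
  have hX1 : 0 ≤ √X * K' := by positivity
  have hY1 : 0 ≤ √Y * K' := by positivity
  have hmem : ∀ s, ρ s ∈ nodeSpace n m := fun s => by
    rw [hρ]
    exact Submodule.sub_mem _ (hw.mem s) (pot_mem n m h k (v s))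
  have h0 : ρ 0 = 0 := by
    have : pot n m h k 0 = 0 := by funext i j; simp [pot, star, rs, tr]
    simp only [hρ, hw.start, hv0, this, sub_zero]
  refine ⟨fun i j hi hj => ?_, fun i j hi hj => ?_⟩
  · have e1 := (evolution_bound hh hk hτ hμ (by positivity) (by positivity) hL
      ρ hmem h0 Ex Ey N heq hE hq hi hj).1
    have e2 := abs_dy_pot_le hn hm hh hk hX (hr q hq) hi hj
    simp only [hρ, dy_sub] at e1
    have e3 := abs_add_le (dy k (ψ q) i j - dy k (pot n m h k (v q)) i j) (dy k (pot n m h k (v q)) i j)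
    rw [sub_add_cancel] at e3
    linarith
  · have e1 := (evolution_bound_dx hh hk hτ hμ (by positivity) (by positivity) hL
      ρ hmem h0 Ex Ey N heq hE hq hi hj).1
    have e2 := abs_dy_pot_le hm hn hk hh hY (hc q hq) hj hi
    rw [pot_tr, dy_tr] at e2
    simp only [hρ, dx_sub] at e1
    have e3 := abs_add_le (dx h (ψ q) i j - dx h (pot n m h k (v q)) i j) (dx h (pot n m h k (v q)) i j)
    rw [sub_add_cancel] at e3
    linarith

theorem stability (hn : 1 ≤ n) (hm : 1 ≤ m) (hh : 0 < h) (hk : 0 < k) (hτ : 0 < τ)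
    (hμ : 0 < μ) (hK : 0 ≤ K) (hX : n * h = X) (hY : m * k = Y) (hX0 : 0 < X) (hY0 : 0 < Y)
    (hT : 0 ≤ T) (hNT : N * τ ≤ T)
    (hw : WeakFlow n m h k μ τ K N ψ κ Rx Ry) {q : ℕ} (hq : q ≤ N) :
    (∀ i j, i ≤ n → j < m → |dy k (ψ q) i j| ≤ (stabSmall X Y T + stabLarge X Y) * K) ∧
    (∀ i j, i < n → j ≤ m → |dx h (ψ q) i j| ≤ (stabSmall X Y T + stabLarge X Y) * K) := by
  have h1 : 0 ≤ stabSmall X Y T := by unfold stabSmall; positivity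
  have h2 : 0 ≤ stabLarge X Y := by unfold stabLarge; positivity
  have h3 := mul_nonneg h1 hK
  have h4 := mul_nonneg h2 hK
  rcases le_total μ 1 with hc | hc
  · obtain ⟨a, b⟩ := stability_small hn hm hh hk hτ hμ hc hK hX hY hX0 hY0 hT hNT hw hq
    exact ⟨fun i j hi hj => (a i j hi hj).trans (by linarith),
      fun i j hi hj => (b i j hi hj).trans (by linarith)⟩
  · obtain ⟨a, b⟩ := stability_large hh hk hτ hc hK hX hY hX0 hY0 hw hq
    exact ⟨fun i j hi hj => (a i j hi hj).trans (by linarith),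
      fun i j hi hj => (b i j hi hj).trans (by linarith)⟩

end Stability

section TaylorBounds

theorem taylor_chain (n : ℕ) : ∀ (f : ℕ → ℝ → ℝ) {b K : ℝ},
    (∀ i < n, ∀ y ∈ Set.Icc 0 b, HasDerivAt (f i) (f (i + 1) y) y) →
    (∀ y ∈ Set.Icc 0 b, |f n y| ≤ K) → ∀ y ∈ Set.Icc 0 b,
    |f 0 y - ∑ i ∈ range n, f i 0 * y ^ i / i.factorial| ≤ K * y ^ n / n.factorial := by
  induction n with
  | zero => intro f b K _ hK y hy; simpa using hK y hy
  | succ n ih =>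
    intro f b K hd hK y hy
    have h1 := ih (fun i => f (i + 1)) (fun i hi => hd (i + 1) (by omega)) hK
    have hfac : ∀ i : ℕ, ((i + 1).factorial : ℝ) = (i + 1) * i.factorial := fun i => by
      rw [Nat.factorial_succ]; push_cast; ring
    have hpoly : ∀ y : ℝ, HasDerivAt (fun y => ∑ i ∈ range (n + 1), f i 0 * y ^ i / i.factorial)
        (∑ i ∈ range n, f (i + 1) 0 * y ^ i / i.factorial) y := by
      intro y
      simp only [sum_range_succ']
      have h2 : HasDerivAt (fun y => ∑ i ∈ range n, f (i + 1) 0 * y ^ (i + 1) / (i + 1).factorial)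
          (∑ i ∈ range n, f (i + 1) 0 * y ^ i / i.factorial) y := by
        refine HasDerivAt.fun_sum fun i _ => ?_
        have h3 := ((hasDerivAt_pow (i + 1) y).const_mul (f (i + 1) 0)).div_const ((i + 1).factorial : ℝ)
        refine h3.congr_deriv ?_
        rw [hfac]
        have : (i.factorial : ℝ) ≠ 0 := by positivity
        simp only [Nat.add_sub_cancel]
        push_cast
        field_simp
      simpa using h2.add_const (f 0 0)
    have key := image_norm_le_of_norm_deriv_right_le_deriv_boundary'
      (f := fun y => f 0 y - ∑ i ∈ range (n + 1), f i 0 * y ^ i / i.factorial)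
      (f' := fun y => f 1 y - ∑ i ∈ range n, f (i + 1) 0 * y ^ i / i.factorial)
      (B := fun y => K * y ^ (n + 1) / (n + 1).factorial) (B' := fun y => K * y ^ n / n.factorial)
      (a := 0) (b := b)
      (fun y hy => ((hd 0 (by omega) y hy).sub (hpoly y)).continuousAt.continuousWithinAt)
      (fun y hy => ((hd 0 (by omega) y ⟨hy.1, hy.2.le⟩).sub (hpoly y)).hasDerivWithinAt)
      (by simp [sum_range_succ'])
      (by fun_prop)
      (fun y _ => by
        have h3 := ((hasDerivAt_pow (n + 1) y).const_mul K).div_const ((n + 1).factorial : ℝ)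
        refine (h3.congr_deriv ?_).hasDerivWithinAt
        rw [hfac]
        have : (n.factorial : ℝ) ≠ 0 := by positivity
        simp only [Nat.add_sub_cancel]
        push_cast
        field_simp)
      (fun y hy => h1 y ⟨hy.1, hy.2.le⟩)
    exact key hy

/-- Two-sided Taylor estimate along a chain of derivatives. -/
theorem taylor_two_sided {n : ℕ} {f : ℕ → ℝ → ℝ} {a r K : ℝ}
    (hd : ∀ i < n, ∀ y ∈ Set.Icc (a - r) (a + r), HasDerivAt (f i) (f (i + 1) y) y)
    (hK : ∀ y ∈ Set.Icc (a - r) (a + r), |f n y| ≤ K) {y : ℝ} (hy0 : 0 ≤ y) (hy : y ≤ r) :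
    |f 0 (a + y) - ∑ i ∈ range n, f i a * y ^ i / i.factorial| ≤ K * y ^ n / n.factorial ∧
    |f 0 (a - y) - ∑ i ∈ range n, (-1) ^ i * f i a * y ^ i / i.factorial| ≤ K * y ^ n / n.factorial := by
  constructor
  · have h1 := taylor_chain n (fun i y => f i (a + y)) (b := r) (K := K)
      (fun i hi y hy => by
        have := (hd i hi (a + y) ⟨by linarith [hy.1, hy.1.trans hy.2], by linarith [hy.2]⟩)
        exact HasDerivAt.comp_const_add a y this)
      (fun y hy => hK _ ⟨by linarith [hy.1, hy.1.trans hy.2], by linarith [hy.2]⟩) y ⟨hy0, hy⟩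
    simpa using h1
  · have h1 := taylor_chain n (fun i y => (-1) ^ i * f i (a - y)) (b := r) (K := K)
      (fun i hi y hy => by
        have := (hd i hi (a - y) ⟨by linarith [hy.2], by linarith [hy.1, hy.1.trans hy.2]⟩)
        have h2 := (HasDerivAt.comp_const_sub a y this).const_mul ((-1 : ℝ) ^ i)
        refine h2.congr_deriv ?_
        rw [pow_succ]; ring)
      (fun y hy => by
        rw [abs_mul, abs_pow, abs_neg, abs_one, one_pow, one_mul]
        exact hK _ ⟨by linarith [hy.2], by linarith [hy.1, hy.1.trans hy.2]⟩) y ⟨hy0, hy⟩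
    simpa using h1

variable {f : ℕ → ℝ → ℝ} {a h K : ℝ}

/-- `f 1` has integral `f 0`; the centred mean is second order accurate. -/
theorem mean_sub_le (hh : 0 < h)
    (hd : ∀ i < 3, ∀ y ∈ Set.Icc (a - h / 2) (a + h / 2), HasDerivAt (f i) (f (i + 1) y) y)
    (hK : ∀ y ∈ Set.Icc (a - h / 2) (a + h / 2), |f 3 y| ≤ K) :
    |(f 0 (a + h / 2) - f 0 (a - h / 2)) / h - f 1 a| ≤ K * h ^ 2 := by
  have hK0 : 0 ≤ K := (abs_nonneg _).trans (hK a ⟨by linarith, by linarith⟩)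
  obtain ⟨h1, h2⟩ := taylor_two_sided hd hK (y := h / 2) (by linarith) le_rfl
  simp only [sum_range_succ, sum_range_zero, Nat.factorial] at h1 h2
  norm_num at h1 h2
  rw [abs_le] at h1 h2
  have e : (f 0 (a + h / 2) - f 0 (a - h / 2)) / h - f 1 a =
      (f 0 (a + h / 2) - f 0 (a - h / 2) - h * f 1 a) / h := by field_simp
  have hp : 0 ≤ K * h ^ 3 := by positivity
  rw [e, abs_div, abs_of_pos hh, div_le_iff₀ hh, abs_le]
  constructor <;> nlinarith [h1.1, h1.2, h2.1, h2.2]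

theorem second_diff_sub_le (hh : 0 < h)
    (hd : ∀ i < 4, ∀ y ∈ Set.Icc (a - h) (a + h), HasDerivAt (f i) (f (i + 1) y) y)
    (hK : ∀ y ∈ Set.Icc (a - h) (a + h), |f 4 y| ≤ K) :
    |(f 0 (a + h) - 2 * f 0 a + f 0 (a - h)) / h ^ 2 - f 2 a| ≤ K * h ^ 2 := by
  have hK0 : 0 ≤ K := (abs_nonneg _).trans (hK a ⟨by linarith, by linarith⟩)
  obtain ⟨h1, h2⟩ := taylor_two_sided hd hK (y := h) hh.le le_rfl
  simp only [sum_range_succ, sum_range_zero, Nat.factorial] at h1 h2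
  norm_num at h1 h2
  rw [abs_le] at h1 h2
  have hh2 : 0 < h ^ 2 := by positivity
  have e : (f 0 (a + h) - 2 * f 0 a + f 0 (a - h)) / h ^ 2 - f 2 a =
      (f 0 (a + h) - 2 * f 0 a + f 0 (a - h) - h ^ 2 * f 2 a) / h ^ 2 := by field_simp
  have hp : 0 ≤ K * h ^ 4 := by positivity
  rw [e, abs_div, abs_of_pos hh2, div_le_iff₀ hh2, abs_le]
  constructor <;> nlinarith [h1.1, h1.2, h2.1, h2.2]

theorem second_diff_le (hh : 0 < h)
    (hd : ∀ i < 2, ∀ y ∈ Set.Icc (a - h) (a + h), HasDerivAt (f i) (f (i + 1) y) y)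
    (hK : ∀ y ∈ Set.Icc (a - h) (a + h), |f 2 y| ≤ K) :
    |(f 0 (a + h) - 2 * f 0 a + f 0 (a - h)) / h ^ 2| ≤ K := by
  have hK0 : 0 ≤ K := (abs_nonneg _).trans (hK a ⟨by linarith, by linarith⟩)
  obtain ⟨h1, h2⟩ := taylor_two_sided hd hK (y := h) hh.le le_rfl
  simp only [sum_range_succ, sum_range_zero, Nat.factorial] at h1 h2
  norm_num at h1 h2
  rw [abs_le] at h1 h2
  have hh2 : 0 < h ^ 2 := by positivity
  rw [abs_div, abs_of_pos hh2, div_le_iff₀ hh2, abs_le]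
  constructor <;> nlinarith [h1.1, h1.2, h2.1, h2.2]

theorem third_diff_sub_le (hh : 0 < h)
    (hd : ∀ i < 5, ∀ y ∈ Set.Icc (a - 3 / 2 * h) (a + 3 / 2 * h), HasDerivAt (f i) (f (i + 1) y) y)
    (hK : ∀ y ∈ Set.Icc (a - 3 / 2 * h) (a + 3 / 2 * h), |f 5 y| ≤ K) :
    |(f 0 (a + 3 / 2 * h) - 3 * f 0 (a + 1 / 2 * h) + 3 * f 0 (a - 1 / 2 * h) - f 0 (a - 3 / 2 * h)) / h ^ 3
      - f 3 a| ≤ K * h ^ 2 := by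
  have hK0 : 0 ≤ K := (abs_nonneg _).trans (hK a ⟨by linarith, by linarith⟩)
  obtain ⟨h1, h2⟩ := taylor_two_sided hd hK (y := 3 / 2 * h) (by linarith) le_rfl
  obtain ⟨h3, h4⟩ := taylor_two_sided hd hK (y := 1 / 2 * h) (by linarith) (by linarith)
  simp only [sum_range_succ, sum_range_zero, Nat.factorial] at h1 h2 h3 h4
  norm_num at h1 h2 h3 h4
  rw [abs_le] at h1 h2 h3 h4
  have hh2 : 0 < h ^ 3 := by positivity
  have hp : 0 ≤ K * h ^ 5 := by positivity
  norm_num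
  rw [div_sub' hh2.ne', abs_div, abs_of_pos hh2, div_le_iff₀ hh2, abs_le]
  constructor <;> nlinarith [h1.1, h1.2, h2.1, h2.2, h3.1, h3.2, h4.1, h4.2]

theorem third_diff_le (hh : 0 < h)
    (hd : ∀ i < 3, ∀ y ∈ Set.Icc (a - 3 / 2 * h) (a + 3 / 2 * h), HasDerivAt (f i) (f (i + 1) y) y)
    (hK : ∀ y ∈ Set.Icc (a - 3 / 2 * h) (a + 3 / 2 * h), |f 3 y| ≤ K) :
    |(f 0 (a + 3 / 2 * h) - 3 * f 0 (a + 1 / 2 * h) + 3 * f 0 (a - 1 / 2 * h) - f 0 (a - 3 / 2 * h)) / h ^ 3|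
      ≤ 2 * K := by
  have hK0 : 0 ≤ K := (abs_nonneg _).trans (hK a ⟨by linarith, by linarith⟩)
  obtain ⟨h1, h2⟩ := taylor_two_sided hd hK (y := 3 / 2 * h) (by linarith) le_rfl
  obtain ⟨h3, h4⟩ := taylor_two_sided hd hK (y := 1 / 2 * h) (by linarith) (by linarith)
  simp only [sum_range_succ, sum_range_zero, Nat.factorial] at h1 h2 h3 h4
  norm_num at h1 h2 h3 h4
  rw [abs_le] at h1 h2 h3 h4
  have hh2 : 0 < h ^ 3 := by positivity
  have hp : 0 ≤ K * h ^ 3 := by positivity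
  norm_num
  rw [abs_div, abs_of_pos hh2, div_le_iff₀ hh2, abs_le]
  constructor <;> nlinarith [h1.1, h1.2, h2.1, h2.2, h3.1, h3.2, h4.1, h4.2]

/-- One-sided difference of a stream function at a no-slip wall. -/
theorem wall_diff_sub_le (hh : 0 < h)
    (hd : ∀ i < 5, ∀ y ∈ Set.Icc 0 (2 * h), HasDerivAt (f i) (f (i + 1) y) y)
    (hK : ∀ y ∈ Set.Icc 0 (2 * h), |f 5 y| ≤ K) (h0 : f 0 0 = 0) (h1 : f 1 0 = 0) :
    |(f 0 (2 * h) - 4 * f 0 h) / h ^ 3 - f 3 (h / 2) + f 3 0 / 3| ≤ 2 * K * h ^ 2 := by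
  have hK0 : 0 ≤ K := (abs_nonneg _).trans (hK 0 ⟨by linarith, by linarith⟩)
  have t1 := taylor_chain 5 f hd hK (2 * h) ⟨by linarith, by linarith⟩
  have t2 := taylor_chain 5 f hd hK h ⟨by linarith, by linarith⟩
  have t3 := taylor_chain 2 (fun i => f (i + 3)) (fun i hi => hd (i + 3) (by omega)) hK (h / 2)
    ⟨by linarith, by linarith⟩
  simp only [sum_range_succ, sum_range_zero, Nat.factorial, h0, h1] at t1 t2 t3
  norm_num at t1 t2 t3
  rw [abs_le] at t1 t2 t3
  have hh2 : 0 < h ^ 3 := by positivity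
  have hp : 0 ≤ K * h ^ 5 := by positivity
  have e : (f 0 (2 * h) - 4 * f 0 h) / h ^ 3 - f 3 (h / 2) + f 3 0 / 3 =
    (f 0 (2 * h) - 4 * f 0 h - h ^ 3 * f 3 (h / 2) + h ^ 3 * (f 3 0 / 3)) / h ^ 3 := by field_simp
  rw [e, abs_div, abs_of_pos hh2, div_le_iff₀ hh2, abs_le]
  have u1 := mul_le_mul_of_nonneg_left t3.1 hh2.le
  have u2 := mul_le_mul_of_nonneg_left t3.2 hh2.le
  constructor <;> nlinarith [t1.1, t1.2, t2.1, t2.2]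

theorem wall_corr_le (hh : 0 < h)
    (hd : ∀ i < 3, ∀ y ∈ Set.Icc 0 (2 * h), HasDerivAt (f i) (f (i + 1) y) y)
    (hK : ∀ y ∈ Set.Icc 0 (2 * h), |f 3 y| ≤ K) (h0 : f 0 0 = 0) :
    |(f 0 (2 * h) - 4 * f 0 h) / h ^ 3 + 2 * f 1 0 / h ^ 2| ≤ 2 * K := by
  have hK0 : 0 ≤ K := (abs_nonneg _).trans (hK 0 ⟨by linarith, by linarith⟩)
  have t1 := taylor_chain 3 f hd hK (2 * h) ⟨by linarith, by linarith⟩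
  have t2 := taylor_chain 3 f hd hK h ⟨by linarith, by linarith⟩
  simp only [sum_range_succ, sum_range_zero, Nat.factorial, h0] at t1 t2
  norm_num at t1 t2
  rw [abs_le] at t1 t2
  have hh2 : 0 < h ^ 3 := by positivity
  have hp : 0 ≤ K * h ^ 3 := by positivity
  have e : (f 0 (2 * h) - 4 * f 0 h) / h ^ 3 + 2 * f 1 0 / h ^ 2 =
    (f 0 (2 * h) - 4 * f 0 h + 2 * h * f 1 0) / h ^ 3 := by field_simp
  rw [e, abs_div, abs_of_pos hh2, div_le_iff₀ hh2, abs_le]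
  constructor <;> nlinarith [t1.1, t1.2, t2.1, t2.2]

theorem first_diff_le (hh : 0 < h)
    (hd : ∀ y ∈ Set.Icc a (a + h), HasDerivAt (f 0) (f 1 y) y)
    (hK : ∀ y ∈ Set.Icc a (a + h), |f 1 y| ≤ K) : |(f 0 (a + h) - f 0 a) / h| ≤ K := by
  have t1 := taylor_chain 1 (fun i y => f i (a + y)) (b := h) (K := K)
    (fun i hi y hy => by
      obtain rfl : i = 0 := by omega
      exact HasDerivAt.comp_const_add a y (hd _ ⟨by linarith [hy.1], by linarith [hy.2]⟩))
    (fun y hy => hK _ ⟨by linarith [hy.1], by linarith [hy.2]⟩) h ⟨hh.le, le_rfl⟩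
  simp only [sum_range_succ, sum_range_zero, Nat.factorial] at t1
  norm_num at t1
  rw [abs_div, abs_of_pos hh, div_le_iff₀ hh]
  exact t1

end TaylorBounds

section PlaneCalculus

/-- Smooth functions of two real variables, in curried form. -/
def Sm (F : ℝ → ℝ → ℝ) : Prop := ContDiff ℝ ((⊤ : ℕ∞) : WithTop ℕ∞) (fun q : ℝ × ℝ => F q.1 q.2)

/-- Exchange of the two variables. -/
def sw (F : ℝ → ℝ → ℝ) : ℝ → ℝ → ℝ := fun x y => F y x

/-- Partial derivative in the first variable. -/
def px (F : ℝ → ℝ → ℝ) : ℝ → ℝ → ℝ := fun x y => deriv (fun s => F s y) x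

/-- Partial derivative in the second variable. -/
def py (F : ℝ → ℝ → ℝ) : ℝ → ℝ → ℝ := fun x y => deriv (fun s => F x s) y

/-- The iterated partial derivative `∂ₓᵃ ∂ᵧᵇ F`. -/
def pd (a b : ℕ) (F : ℝ → ℝ → ℝ) : ℝ → ℝ → ℝ := px^[a] (py^[b] F)

variable {F G : ℝ → ℝ → ℝ}

theorem Sm.sw (hF : Sm F) : Sm (sw F) := by
  unfold Sm RMACProof.sw
  exact hF.comp (contDiff_snd.prodMk contDiff_fst)

theorem Sm.px_eq (hF : Sm F) (x y : ℝ) :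
    HasDerivAt (fun s => F s y) (fderiv ℝ (fun q : ℝ × ℝ => F q.1 q.2) (x, y) (1, 0)) x := by
  have h1 : HasFDerivAt (fun q : ℝ × ℝ => F q.1 q.2) _ (x, y) :=
    (hF.differentiable (by simp) (x, y)).hasFDerivAt
  have h2 : HasDerivAt (fun s : ℝ => (s, y)) ((1 : ℝ), (0 : ℝ)) x :=
    (hasDerivAt_id x).prodMk (hasDerivAt_const x y)
  exact HasFDerivAt.comp_hasDerivAt (f := fun s : ℝ => (s, y)) x h1 h2

theorem Sm.py_eq (hF : Sm F) (x y : ℝ) :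
    HasDerivAt (fun s => F x s) (fderiv ℝ (fun q : ℝ × ℝ => F q.1 q.2) (x, y) (0, 1)) y := by
  have h1 : HasFDerivAt (fun q : ℝ × ℝ => F q.1 q.2) _ (x, y) :=
    (hF.differentiable (by simp) (x, y)).hasFDerivAt
  have h2 : HasDerivAt (fun s : ℝ => (x, s)) ((0 : ℝ), (1 : ℝ)) y :=
    (hasDerivAt_const y x).prodMk (hasDerivAt_id y)
  exact HasFDerivAt.comp_hasDerivAt (f := fun s : ℝ => (x, s)) y h1 h2

theorem Sm.hasDerivAt_x (hF : Sm F) (x y : ℝ) : HasDerivAt (fun s => F s y) (px F x y) x :=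
  (hF.px_eq x y).differentiableAt.hasDerivAt

theorem Sm.hasDerivAt_y (hF : Sm F) (x y : ℝ) : HasDerivAt (fun s => F x s) (py F x y) y :=
  (hF.py_eq x y).differentiableAt.hasDerivAt

theorem Sm.px (hF : Sm F) : Sm (px F) := by
  have : (fun q : ℝ × ℝ => RMACProof.px F q.1 q.2)
      = fun q => fderiv ℝ (fun q : ℝ × ℝ => F q.1 q.2) q (1, 0) :=
    funext fun q => (hF.px_eq q.1 q.2).deriv
  unfold Sm
  rw [this]
  exact (hF.fderiv_right (m := ((⊤ : ℕ∞) : WithTop ℕ∞)) (by simp)).clm_apply contDiff_const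

theorem Sm.py (hF : Sm F) : Sm (py F) := hF.sw.px.sw

theorem px_py_comm (hF : Sm F) : px (py F) = py (px F) := by
  funext x y
  set f : ℝ × ℝ → ℝ := fun q => F q.1 q.2 with hf
  have hd : DifferentiableAt ℝ (fderiv ℝ f) (x, y) :=
    (hF.fderiv_right (m := ((⊤ : ℕ∞) : WithTop ℕ∞)) (by simp)).differentiable (by simp) _
  have e1 : (fun q : ℝ × ℝ => py F q.1 q.2) = fun q => fderiv ℝ f q (0, 1) :=
    funext fun q => (hF.py_eq q.1 q.2).deriv
  have e2 : (fun q : ℝ × ℝ => px F q.1 q.2) = fun q => fderiv ℝ f q (1, 0) :=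
    funext fun q => (hF.px_eq q.1 q.2).deriv
  have hsym : IsSymmSndFDerivAt ℝ f (x, y) :=
    (ContDiff.contDiffAt hF).isSymmSndFDerivAt
      (by simpa using WithTop.coe_le_coe.2 (le_top (a := (2 : ℕ∞))))
  have h1 := (hF.py.px_eq x y).deriv
  have h2 := (hF.px.py_eq x y).deriv
  rw [e1] at h1
  rw [e2] at h2
  have h3 : ∀ v w : ℝ × ℝ, fderiv ℝ (fun q => fderiv ℝ f q v) (x, y) w
      = fderiv ℝ (fderiv ℝ f) (x, y) w v := by
    intro v w
    have := (hd.hasFDerivAt.clm_apply (hasFDerivAt_const v (x, y))).fderiv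
    rw [this]; simp
  rw [h3] at h1 h2
  change deriv (fun s => py F s y) x = deriv (fun s => px F x s) y
  rw [h1, h2]
  exact hsym.eq _ _

theorem Sm.pd (hF : Sm F) (a b : ℕ) : Sm (pd a b F) := by
  have h1 : Sm (RMACProof.py^[b] F) := by
    induction b with
    | zero => exact hF
    | succ b ih => rw [Function.iterate_succ_apply']; exact ih.py
  unfold RMACProof.pd
  induction a with
  | zero => exact h1
  | succ a ih => rw [Function.iterate_succ_apply']; exact ih.px

theorem pd_succ_left (a b : ℕ) (F : ℝ → ℝ → ℝ) : pd (a + 1) b F = px (pd a b F) :=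
  Function.iterate_succ_apply' _ _ _

theorem pd_py (a b : ℕ) (F : ℝ → ℝ → ℝ) : pd a b (py F) = pd a (b + 1) F := rfl

theorem pd_succ_right (hF : Sm F) (a b : ℕ) : pd a (b + 1) F = py (pd a b F) := by
  induction a with
  | zero => exact Function.iterate_succ_apply' _ _ _
  | succ a ih => rw [pd_succ_left, ih, pd_succ_left, px_py_comm (hF.pd a b)]

theorem pd_sw (hF : Sm F) (a b : ℕ) : pd a b (sw F) = sw (pd b a F) := by
  induction b with
  | zero =>
    induction a with
    | zero => rfl
    | succ a ih => rw [pd_succ_left, ih, pd_succ_right hF]; rfl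
  | succ b ih => rw [pd_succ_right hF.sw, ih, pd_succ_left]; rfl

theorem Sm.lin (hF : Sm F) (hG : Sm G) (c : ℝ) : Sm (fun x y => F x y + c * G x y) :=
  ContDiff.add hF (ContDiff.mul contDiff_const hG)

theorem pd_lin (hF : Sm F) (hG : Sm G) (c : ℝ) (a b : ℕ) :
    pd a b (fun x y => F x y + c * G x y) = fun x y => pd a b F x y + c * pd a b G x y := by
  induction b with
  | zero =>
    induction a with
    | zero => rfl
    | succ a ih =>
      rw [pd_succ_left, ih]
      funext x y
      rw [pd_succ_left, pd_succ_left]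
      exact (((hF.pd a 0).hasDerivAt_x x y).add (((hG.pd a 0).hasDerivAt_x x y).const_mul c)).deriv
  | succ b ih =>
    rw [pd_succ_right (hF.lin hG c), ih]
    funext x y
    rw [pd_succ_right hF, pd_succ_right hG]
    exact (((hF.pd a b).hasDerivAt_y x y).add (((hG.pd a b).hasDerivAt_y x y).const_mul c)).deriv

theorem Sm.shift (hF : Sm F) (c : ℝ) : Sm (fun x y => F x (y + c)) := by
  unfold Sm
  exact hF.comp (contDiff_fst.prodMk (contDiff_snd.add contDiff_const))

theorem pd_shift (hF : Sm F) (c : ℝ) (a b : ℕ) :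
    pd a b (fun x y => F x (y + c)) = fun x y => pd a b F x (y + c) := by
  induction b with
  | zero =>
    induction a with
    | zero => rfl
    | succ a ih => rw [pd_succ_left, ih, pd_succ_left]; rfl
  | succ b ih =>
    rw [pd_succ_right (hF.shift c), ih]
    funext x y
    rw [pd_succ_right hF]
    exact deriv_comp_add_const _ _ _

theorem Sm.trace (hF : Sm F) (c : ℝ) {q : ℝ → ℝ} (hq : ContDiff ℝ ((⊤ : ℕ∞) : WithTop ℕ∞) q) :
    Sm (fun x y => q y * F x c) := by
  unfold Sm
  exact (hq.comp contDiff_snd).mul (hF.comp (contDiff_fst.prodMk contDiff_const))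

theorem pd_trace (F : ℝ → ℝ → ℝ) (c : ℝ) (q : ℝ → ℝ) (a b : ℕ) :
    pd a b (fun x y => q y * F x c) = fun x y => iteratedDeriv b q y * pd a 0 F x c := by
  induction a with
  | zero =>
    induction b with
    | zero => funext x y; simp [pd]
    | succ b ih =>
      have : pd 0 (b + 1) (fun x y => q y * F x c) = py (pd 0 b (fun x y => q y * F x c)) :=
        Function.iterate_succ_apply' _ _ _
      rw [this, ih]
      funext x y
      rw [iteratedDeriv_succ]
      exact deriv_mul_const_field _
  | succ a ih =>
    rw [pd_succ_left, ih]
    funext x y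
    rw [pd_succ_left]
    exact deriv_const_mul_field _

/-- All partial derivatives of order at most `r` are bounded by `K` on `[0,X] × [0,Y]`. -/
def CB (X Y : ℝ) (r : ℕ) (K : ℝ) (F : ℝ → ℝ → ℝ) : Prop :=
  ∀ a b : ℕ, a + b ≤ r → ∀ x ∈ Set.Icc 0 X, ∀ y ∈ Set.Icc 0 Y, |pd a b F x y| ≤ K

variable {X Y K L : ℝ} {r : ℕ}

theorem CB.bd (h : CB X Y r K F) {x y : ℝ} (hx : x ∈ Set.Icc 0 X) (hy : y ∈ Set.Icc 0 Y) :
    |F x y| ≤ K := h 0 0 (by omega) x hx y hy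

theorem CB.nonneg (h : CB X Y r K F) (hX : 0 ≤ X) (hY : 0 ≤ Y) : 0 ≤ K :=
  (abs_nonneg _).trans (h.bd (x := 0) (y := 0) ⟨le_rfl, hX⟩ ⟨le_rfl, hY⟩)

theorem CB.mono (h : CB X Y r K F) {r' : ℕ} {X' Y' : ℝ} (hX : X' ≤ X) (hY : Y' ≤ Y) (hr : r' ≤ r)
    (hK : K ≤ L) : CB X' Y' r' L F := fun a b hab x hx y hy =>
  (h a b (hab.trans hr) x ⟨hx.1, hx.2.trans hX⟩ y ⟨hy.1, hy.2.trans hY⟩).trans hK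

theorem CB.py (h : CB X Y (r + 1) K F) : CB X Y r K (py F) := fun a b hab x hx y hy => by
  rw [pd_py]; exact h a (b + 1) (by omega) x hx y hy

theorem CB.sw (h : CB X Y r K F) (hF : Sm F) : CB Y X r K (sw F) := fun a b hab x hx y hy => by
  rw [pd_sw hF]; exact h b a (by omega) y hy x hx

theorem CB.lin (h : CB X Y r K F) (h' : CB X Y r L G) (hF : Sm F) (hG : Sm G) (c : ℝ) :
    CB X Y r (K + |c| * L) (fun x y => F x y + c * G x y) := fun a b hab x hx y hy => by
  rw [pd_lin hF hG]
  refine (abs_add_le _ _).trans (add_le_add (h a b hab x hx y hy) ?_)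
  rw [abs_mul]
  exact mul_le_mul_of_nonneg_left (h' a b hab x hx y hy) (abs_nonneg _)

/-- Forward difference quotient in the second variable. -/
def sq (k : ℝ) (F : ℝ → ℝ → ℝ) : ℝ → ℝ → ℝ := fun x y => (F x (y + k) - F x y) / k

theorem Sm.zero : Sm (fun _ _ => 0) := contDiff_const

theorem sq_eq (k : ℝ) (F : ℝ → ℝ → ℝ) :
    sq k F = fun x y => (fun x y => (fun _ _ => (0 : ℝ)) x y + k⁻¹ * (fun x y => F x (y + k)) x y) x y
      + (-k⁻¹) * F x y := by
  funext x y; simp only [sq]; ring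

theorem Sm.sq (hF : Sm F) (k : ℝ) : Sm (sq k F) := by
  rw [sq_eq]; exact (Sm.zero.lin (hF.shift k) _).lin hF _

theorem pd_sq (hF : Sm F) (k : ℝ) (a b : ℕ) : pd a b (sq k F) = sq k (pd a b F) := by
  have h0 : pd a b (fun _ _ => (0 : ℝ)) = fun _ _ => 0 := by
    have := pd_lin Sm.zero Sm.zero (-1) a b
    simpa using this
  rw [sq_eq, pd_lin (Sm.zero.lin (hF.shift k) _) hF, pd_lin Sm.zero (hF.shift k), pd_shift hF, h0]
  funext x y; simp only [sq]; ring

theorem CB.sq (h : CB X Y (r + 1) K F) (hF : Sm F) {k : ℝ} (hk : 0 < k) :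
    CB X (Y - k) r K (sq k F) := fun a b hab x hx y hy => by
  rw [pd_sq hF]
  refine first_diff_le (f := fun i => if i = 0 then pd a b F x else pd a (b + 1) F x) hk
    (fun s _ => ?_) (fun s hs => ?_)
  · simp only [if_true, one_ne_zero, if_false]
    rw [pd_succ_right hF]
    exact (hF.pd a b).hasDerivAt_y x s
  · simp only [one_ne_zero, if_false]
    exact h a (b + 1) (by omega) x hx s ⟨hy.1.trans hs.1, by linarith [hs.2, hy.2]⟩

theorem CB.trace (h : CB X Y r K F) {c B : ℝ} (hc : c ∈ Set.Icc 0 Y) {q : ℝ → ℝ}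
    (hq : ∀ b ≤ r, ∀ y ∈ Set.Icc 0 Y, |iteratedDeriv b q y| ≤ B) :
    CB X Y r (B * K) (fun x y => q y * F x c) := fun a b hab x hx y hy => by
  rw [pd_trace, abs_mul]
  have h1 := hq b (by omega) y hy
  exact mul_le_mul h1 (h a 0 (by omega) x hx c hc) (abs_nonneg _) ((abs_nonneg _).trans h1)

end PlaneCalculus

section Averages

variable {F : ℝ → ℝ → ℝ} {X Y K h k x y : ℝ} {r : ℕ}

/-- Average over a segment of length `h` in the first variable. -/
def AX (h : ℝ) (F : ℝ → ℝ → ℝ) (x y : ℝ) : ℝ := (1 / h) * ∫ s in (x - h / 2)..(x + h / 2), F s y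

/-- Primitive in the second variable. -/
def NS (F : ℝ → ℝ → ℝ) (x y : ℝ) : ℝ := ∫ s in (0 : ℝ)..y, F x s

/-- Central second difference quotient in the second variable. -/
def d2 (k : ℝ) (F : ℝ → ℝ → ℝ) (x y : ℝ) : ℝ := (F x (y + k) - 2 * F x y + F x (y - k)) / k ^ 2

/-- Forward difference quotient in the first variable. -/
def sqx (h : ℝ) (F : ℝ → ℝ → ℝ) : ℝ → ℝ → ℝ := fun x y => (F (x + h) y - F x y) / h

theorem Sm.cont_x (hF : Sm F) (y : ℝ) : Continuous (fun s => F s y) :=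
  continuous_iff_continuousAt.2 fun x => (hF.hasDerivAt_x x y).continuousAt

theorem Sm.cont_y (hF : Sm F) (x : ℝ) : Continuous (fun s => F x s) :=
  continuous_iff_continuousAt.2 fun y => (hF.hasDerivAt_y x y).continuousAt

/-- A chain of successive derivatives starting with the primitive of `g 0`. -/
def primChain (g : ℕ → ℝ → ℝ) : ℕ → ℝ → ℝ
  | 0 => fun y => ∫ s in (0 : ℝ)..y, g 0 s
  | i + 1 => g i

theorem primChain_deriv {g : ℕ → ℝ → ℝ} {N : ℕ} (hN : 1 ≤ N)
    (hd : ∀ i < N, ∀ y, HasDerivAt (g i) (g (i + 1) y) y) :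
    ∀ i < N + 1, ∀ y, HasDerivAt (primChain g i) (primChain g (i + 1) y) y := by
  intro i hi y
  cases i with
  | zero =>
    have hc : Continuous (g 0) :=
      continuous_iff_continuousAt.2 fun x => (hd 0 (by omega) x).continuousAt
    exact intervalIntegral.integral_hasDerivAt_right (hc.intervalIntegrable _ _)
      hc.stronglyMeasurable.stronglyMeasurableAtFilter hc.continuousAt
  | succ i => exact hd i (by omega) y

theorem Sm.chain_x (hF : Sm F) (b : ℕ) (y : ℝ) (i : ℕ) (x : ℝ) :
    HasDerivAt (fun s => RMACProof.pd i b F s y) (RMACProof.pd (i + 1) b F x y) x := by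
  rw [pd_succ_left]; exact (hF.pd i b).hasDerivAt_x x y

theorem Sm.chain_y (hF : Sm F) (a : ℕ) (x : ℝ) (i : ℕ) (y : ℝ) :
    HasDerivAt (fun s => RMACProof.pd a i F x s) (RMACProof.pd a (i + 1) F x y) y := by
  rw [pd_succ_right hF]; exact (hF.pd a i).hasDerivAt_y x y

theorem AX_sub_le (hF : Sm F) (hh : 0 < h)
    (hK : ∀ s ∈ Set.Icc (x - h / 2) (x + h / 2), |pd 2 0 F s y| ≤ K) :
    |AX h F x y - F x y| ≤ K * h ^ 2 := by
  have hd := primChain_deriv (g := fun i s => pd i 0 F s y) (N := 2) (by norm_num)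
    (fun i _ s => hF.chain_x 0 y i s)
  have hc := hF.cont_x y
  have := mean_sub_le (f := primChain (fun i s => pd i 0 F s y)) (a := x) hh
    (fun i hi s _ => hd i hi s) hK
  have e : AX h F x y = (primChain (fun i s => pd i 0 F s y) 0 (x + h / 2)
      - primChain (fun i s => pd i 0 F s y) 0 (x - h / 2)) / h := by
    change (1 / h) * (∫ s in (x - h / 2)..(x + h / 2), F s y)
      = ((∫ s in (0 : ℝ)..(x + h / 2), F s y) - ∫ s in (0 : ℝ)..(x - h / 2), F s y) / h
    rw [intervalIntegral.integral_interval_sub_left (hc.intervalIntegrable _ _)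
      (hc.intervalIntegrable _ _)]
    ring
  rw [e]
  exact this

theorem AX_le (hh : 0 < h) (hK : ∀ s ∈ Set.Icc (x - h / 2) (x + h / 2), |F s y| ≤ K) :
    |AX h F x y| ≤ K := by
  have h1 := intervalIntegral.norm_integral_le_of_norm_le_const (a := x - h / 2) (b := x + h / 2)
    (f := fun s => F s y) (C := K) (fun s hs => by
      rw [Set.uIoc_of_le (by linarith)] at hs
      exact hK s ⟨hs.1.le, hs.2⟩)
  have e : x + h / 2 - (x - h / 2) = h := by ring
  rw [e, abs_of_pos hh, Real.norm_eq_abs] at h1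
  rw [AX, abs_mul, abs_of_pos (by positivity), one_div, inv_mul_le_iff₀ hh]
  linarith

theorem AX_lin {G : ℝ → ℝ → ℝ} (hF : Continuous fun s => F s y) (hG : Continuous fun s => G s y)
    (c : ℝ) : AX h (fun x y => F x y + c * G x y) x y = AX h F x y + c * AX h G x y := by
  unfold AX
  have c1 := hF.intervalIntegrable (μ := volume) (x - h / 2) (x + h / 2)
  have c2 := (hG.intervalIntegrable (μ := volume) (x - h / 2) (x + h / 2)).const_mul c
  rw [intervalIntegral.integral_add c1 c2, intervalIntegral.integral_const_mul]
  ring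

theorem AX_shift (c : ℝ) : AX h (fun x y => F (x + c) y) x y = AX h F (x + c) y := by
  unfold AX
  rw [intervalIntegral.integral_comp_add_right (fun s => F s y)]
  congr 2 <;> ring

theorem NS_hasChain (hF : Sm F) (x : ℝ) {N : ℕ} (hN : 1 ≤ N) :
    ∀ i < N + 1, ∀ y, HasDerivAt (primChain (fun i s => pd 0 i F x s) i)
      (primChain (fun i s => pd 0 i F x s) (i + 1) y) y :=
  primChain_deriv hN (fun i _ s => hF.chain_y 0 x i s)

theorem d2_NS_sub_le (hF : Sm F) (hk : 0 < k)
    (hK : ∀ s ∈ Set.Icc (y - k) (y + k), |pd 0 3 F x s| ≤ K) :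
    |d2 k (NS F) x y - pd 0 1 F x y| ≤ K * k ^ 2 :=
  second_diff_sub_le (f := primChain (fun i s => pd 0 i F x s)) hk
    (fun i hi s _ => NS_hasChain hF x (N := 3) (by norm_num) i hi s) hK

theorem d2_NS_le (hF : Sm F) (hk : 0 < k)
    (hK : ∀ s ∈ Set.Icc (y - k) (y + k), |pd 0 1 F x s| ≤ K) :
    |d2 k (NS F) x y| ≤ K :=
  second_diff_le (f := primChain (fun i s => pd 0 i F x s)) hk
    (fun i hi s _ => NS_hasChain hF x (N := 1) le_rfl i hi s) hK

theorem d2_le (hF : Sm F) (hk : 0 < k)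
    (hK : ∀ s ∈ Set.Icc (y - k) (y + k), |pd 0 2 F x s| ≤ K) :
    |d2 k F x y| ≤ K :=
  second_diff_le (f := fun i s => pd 0 i F x s) hk (fun i _ s _ => hF.chain_y 0 x i s) hK

/-- Discrepancy between two discretisations of the second partial derivative. -/
def crx (h k : ℝ) (F : ℝ → ℝ → ℝ) (x y : ℝ) : ℝ :=
  (AX h F x (y + k / 2) - AX h F x (y - k / 2)) / k - d2 k (NS F) x y

theorem crx_le (hF : Sm F) (hh : 0 < h) (hk : 0 < k) (hc : CB X Y 3 K F)
    (hx0 : h / 2 ≤ x) (hx1 : x + h / 2 ≤ X) (hy0 : k ≤ y) (hy1 : y + k ≤ Y) :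
    |crx h k F x y| ≤ K * (h ^ 2 + 2 * k ^ 2) := by
  have h1 : |AX h (fun s t => (F s (t + k / 2) - F s (t - k / 2)) / k - py F s t) x y| ≤ K * k ^ 2 := by
    refine AX_le hh fun s hs => ?_
    exact mean_sub_le (f := fun i t => pd 0 i F s t) hk
      (fun i _ t _ => hF.chain_y 0 s i t)
      (fun t ht => hc 0 3 (by norm_num) s ⟨by linarith [hs.1], by linarith [hs.2]⟩ t
        ⟨by linarith [ht.1], by linarith [ht.2]⟩)
  have h2 : AX h (fun s t => (F s (t + k / 2) - F s (t - k / 2)) / k - py F s t) x y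
      = (AX h F x (y + k / 2) - AX h F x (y - k / 2)) / k - AX h (py F) x y := by
    have c1 := (hF.cont_x (y + k / 2)).intervalIntegrable (μ := volume) (x - h / 2) (x + h / 2)
    have c2 := (hF.cont_x (y - k / 2)).intervalIntegrable (μ := volume) (x - h / 2) (x + h / 2)
    have c3 := (hF.py.cont_x y).intervalIntegrable (μ := volume) (x - h / 2) (x + h / 2)
    unfold AX
    rw [intervalIntegral.integral_sub ((c1.sub c2).div_const k) c3, intervalIntegral.integral_div,
      intervalIntegral.integral_sub c1 c2]
    ring
  rw [h2] at h1
  have h3 : |AX h (py F) x y - py F x y| ≤ K * h ^ 2 := AX_sub_le hF.py hh fun s hs => by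
    rw [pd_py]
    exact hc 2 1 (by norm_num) s ⟨by linarith [hs.1], by linarith [hs.2]⟩ y
      ⟨by linarith, by linarith⟩
  have h4 : |d2 k (NS F) x y - py F x y| ≤ K * k ^ 2 := d2_NS_sub_le hF hk fun s hs =>
    hc 0 3 (by norm_num) x ⟨by linarith, by linarith⟩ s ⟨by linarith [hs.1], by linarith [hs.2]⟩
  rw [abs_le] at *
  unfold crx
  constructor <;> linarith [h1.1, h1.2, h3.1, h3.2, h4.1, h4.2]

theorem d2_sq (c : ℝ) : d2 k (sq c F) x y = (d2 k F x (y + c) - d2 k F x y) / c := by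
  simp only [d2, sq]
  rw [show y + c + k = y + k + c by ring, show y + c - k = y - k + c by ring]
  ring

theorem d2_sqx (c : ℝ) : d2 k (sqx c F) x y = (d2 k F (x + c) y - d2 k F x y) / c := by
  simp only [d2, sqx]
  ring

theorem NS_sq (hF : Sm F) (c : ℝ) : NS (sq c F) x y = (NS F x (y + c) - NS F x c - NS F x y) / c := by
  have c1 : ∀ a b : ℝ, IntervalIntegrable (fun s => F x s) volume a b := fun a b =>
    (hF.cont_y x).intervalIntegrable a b
  have c2 : IntervalIntegrable (fun s => F x (s + c)) volume 0 y :=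
    ((hF.cont_y x).comp (continuous_id.add continuous_const)).intervalIntegrable 0 y
  unfold NS sq
  rw [intervalIntegral.integral_div, intervalIntegral.integral_sub c2 (c1 _ _),
    intervalIntegral.integral_comp_add_right (fun s => F x s),
    intervalIntegral.integral_interval_sub_left (c1 _ _) (c1 _ _), zero_add]

theorem NS_sqx (hF : Sm F) (c : ℝ) : NS (sqx c F) x y = sqx c (NS F) x y := by
  unfold NS sqx
  rw [intervalIntegral.integral_div, intervalIntegral.integral_sub
    ((hF.cont_y _).intervalIntegrable _ _) ((hF.cont_y _).intervalIntegrable _ _)]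

theorem d2_NS_sq (hF : Sm F) (c : ℝ) :
    d2 k (NS (sq c F)) x y = (d2 k (NS F) x (y + c) - d2 k (NS F) x y) / c := by
  simp only [d2, NS_sq hF]
  rw [show y + c + k = y + k + c by ring, show y + c - k = y - k + c by ring]
  ring

theorem d2_NS_sqx (hF : Sm F) (c : ℝ) :
    d2 k (NS (sqx c F)) x y = (d2 k (NS F) (x + c) y - d2 k (NS F) x y) / c := by
  rw [← d2_sqx]
  simp only [d2, NS_sqx hF]

theorem AX_sq (hF : Sm F) (c : ℝ) : AX h (sq c F) x y = sq c (AX h F) x y := by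
  unfold AX sq
  rw [intervalIntegral.integral_div, intervalIntegral.integral_sub
    ((hF.cont_x _).intervalIntegrable _ _) ((hF.cont_x _).intervalIntegrable _ _)]
  ring

theorem AX_sqx (hF : Sm F) (c : ℝ) : AX h (sqx c F) x y = sqx c (AX h F) x y := by
  have c2 : IntervalIntegrable (fun s => F (s + c) y) volume (x - h / 2) (x + h / 2) :=
    ((hF.cont_x y).comp (continuous_id.add continuous_const)).intervalIntegrable _ _
  have e := AX_shift (F := F) (h := h) (x := x) (y := y) c
  unfold AX at e
  unfold AX sqx
  rw [intervalIntegral.integral_div, intervalIntegral.integral_sub c2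
    ((hF.cont_x _).intervalIntegrable _ _)]
  beta_reduce
  rw [← e]
  ring

theorem crx_sq (hF : Sm F) (c : ℝ) :
    crx h k (sq c F) x y = (crx h k F x (y + c) - crx h k F x y) / c := by
  unfold crx
  rw [d2_NS_sq hF, AX_sq hF, AX_sq hF]
  simp only [sq]
  rw [show y + k / 2 + c = y + c + k / 2 by ring, show y - k / 2 + c = y + c - k / 2 by ring]
  ring

theorem crx_sqx (hF : Sm F) (c : ℝ) :
    crx h k (sqx c F) x y = (crx h k F (x + c) y - crx h k F x y) / c := by
  unfold crx
  rw [d2_NS_sqx hF, AX_sqx hF, AX_sqx hF]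
  simp only [sqx]
  ring

/-- The discrete curl of the consistency error of the time derivative. -/
def gfun (h k : ℝ) (a b e f Z : ℝ → ℝ → ℝ) (x y : ℝ) : ℝ :=
  crx h k a x y + crx k h (sw b) y x - d2 k (NS e) x y - d2 h (NS (sw f)) y x
    - d2 k Z x y - d2 h (sw Z) y x

theorem gfun_sw (a b e f Z : ℝ → ℝ → ℝ) :
    gfun k h (sw b) (sw a) (sw f) (sw e) (sw Z) y x = gfun h k a b e f Z x y := by
  unfold gfun
  change crx k h (sw b) y x + crx h k a x y - d2 h (NS (sw f)) y x - d2 k (NS e) x y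
    - d2 h (sw Z) y x - d2 k Z x y = _
  ring

variable {a b e f Z : ℝ → ℝ → ℝ} {K₁ K₂ K₃ : ℝ}

theorem gfun_le (hh : 0 < h) (hk : 0 < k) (sa : Sm a) (sb : Sm b) (se : Sm e) (sf : Sm f) (sZ : Sm Z)
    (ca : CB X Y 3 K₁ a) (cb : CB X Y 3 K₁ b) (ce : CB X Y 1 K₂ e) (cf : CB X Y 1 K₂ f)
    (cZ : CB X Y 2 K₃ Z) (hx0 : h ≤ x) (hx1 : x + h ≤ X) (hy0 : k ≤ y) (hy1 : y + k ≤ Y) :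
    |gfun h k a b e f Z x y| ≤ 3 * K₁ * (h ^ 2 + k ^ 2) + 2 * K₂ + 2 * K₃ := by
  have hx : x ∈ Set.Icc 0 X := ⟨by linarith, by linarith⟩
  have hy : y ∈ Set.Icc 0 Y := ⟨by linarith, by linarith⟩
  have iy : ∀ s ∈ Set.Icc (y - k) (y + k), s ∈ Set.Icc 0 Y := fun s hs =>
    ⟨by linarith [hs.1], by linarith [hs.2]⟩
  have ix : ∀ s ∈ Set.Icc (x - h) (x + h), s ∈ Set.Icc 0 X := fun s hs =>
    ⟨by linarith [hs.1], by linarith [hs.2]⟩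
  have h1 := crx_le sa hh hk ca (x := x) (y := y) (by linarith) (by linarith) hy0 hy1
  have h2 := crx_le sb.sw hk hh (cb.sw sb) (x := y) (y := x) (by linarith) (by linarith) hx0 hx1
  have h3 := d2_NS_le se hk (x := x) (y := y) fun s hs => ce 0 1 le_rfl x hx s (iy s hs)
  have h4 := d2_NS_le sf.sw hh (x := y) (y := x) fun s hs =>
    (cf.sw sf) 0 1 le_rfl y hy s (ix s hs)
  have h5 := d2_le sZ hk (x := x) (y := y) fun s hs => cZ 0 2 le_rfl x hx s (iy s hs)
  have h6 := d2_le sZ.sw hh (x := y) (y := x) fun s hs =>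
    (cZ.sw sZ) 0 2 le_rfl y hy s (ix s hs)
  unfold gfun
  rw [abs_le] at *
  constructor <;>
    linarith [h1.1, h1.2, h2.1, h2.2, h3.1, h3.2, h4.1, h4.2, h5.1, h5.2, h6.1, h6.2]

theorem gfun_diff_le (hh : 0 < h) (hk : 0 < k) (sa : Sm a) (sb : Sm b) (se : Sm e) (sf : Sm f)
    (sZ : Sm Z) (ca : CB X Y 4 K₁ a) (cb : CB X Y 4 K₁ b) (ce : CB X Y 2 K₂ e) (cf : CB X Y 2 K₂ f)
    (cZ : CB X Y 3 K₃ Z) (hx0 : h ≤ x) (hx1 : x + h ≤ X) (hy0 : k ≤ y) (hy1 : y + 2 * k ≤ Y) :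
    |gfun h k a b e f Z x (y + k) - gfun h k a b e f Z x y|
      ≤ k * (3 * K₁ * (h ^ 2 + k ^ 2) + 2 * K₂ + 2 * K₃) := by
  have key := gfun_le hh hk (sa.sq k) (sb.sq k) (se.sq k) (sf.sq k) (sZ.sq k) (ca.sq sa hk)
    (cb.sq sb hk) (ce.sq se hk) (cf.sq sf hk) (cZ.sq sZ hk) hx0 hx1 hy0
    (by linarith : y + k ≤ Y - k)
  have e1 : gfun h k (sq k a) (sq k b) (sq k e) (sq k f) (sq k Z) x y
      = (gfun h k a b e f Z x (y + k) - gfun h k a b e f Z x y) / k := by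
    have q1 := crx_sqx (h := k) (k := h) (x := y) (y := x) sb.sw k
    have q2 := d2_NS_sqx (k := h) (x := y) (y := x) sf.sw k
    have q3 := d2_sqx (F := sw Z) (k := h) (x := y) (y := x) k
    unfold gfun
    change crx h k (sq k a) x y + crx k h (sqx k (sw b)) y x - d2 k (NS (sq k e)) x y
      - d2 h (NS (sqx k (sw f))) y x - d2 k (sq k Z) x y - d2 h (sqx k (sw Z)) y x = _
    rw [q1, q2, q3, crx_sq sa, d2_NS_sq se, d2_sq]
    ring
  rw [e1, abs_div, abs_of_pos hk, div_le_iff₀ hk] at key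
  linarith

end Averages

section Corrector

/-- The derivatives `(∂ᵧS, ∂ₓS)` of a smooth stream function of a no-slip velocity field. -/
structure NoSlip (X Y : ℝ) (α β : ℝ → ℝ → ℝ) : Prop where
  sa : Sm α
  sb : Sm β
  div : ∀ x ∈ Set.Icc 0 X, ∀ y ∈ Set.Icc 0 Y, px α x y = py β x y
  bc : ∀ x ∈ Set.Icc 0 X, ∀ y ∈ Set.Icc 0 Y, (x = 0 ∨ x = X ∨ y = 0 ∨ y = Y) → α x y = 0 ∧ β x y = 0

variable {X Y L K B h k x y : ℝ} {α β : ℝ → ℝ → ℝ}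

theorem NoSlip.sw (H : NoSlip X Y α β) : NoSlip Y X (sw β) (sw α) where
  sa := H.sb.sw
  sb := H.sa.sw
  div := fun x hx y hy => (H.div y hy x hx).symm
  bc := fun x hx y hy h => (H.bc y hy x hx (by tauto)).symm

theorem eq_zero_of_zero_on {φ : ℝ → ℝ} {φ' : ℝ} (hL : 0 < L) (h0 : ∀ s ∈ Set.Icc 0 L, φ s = 0)
    (hx : x ∈ Set.Icc 0 L) (hd : HasDerivAt φ φ' x) : φ' = 0 := by
  have h1 : HasDerivWithinAt φ φ' (Set.Icc 0 L) x := hd.hasDerivWithinAt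
  have h2 : HasDerivWithinAt φ 0 (Set.Icc 0 L) x :=
    (hasDerivWithinAt_const x (Set.Icc 0 L) (0 : ℝ)).congr h0 (h0 x hx)
  exact (uniqueDiffOn_Icc hL x hx).eq_deriv _ h1 h2

theorem NoSlip.px_zero (H : NoSlip X Y α β) (hX : 0 < X) (hY : 0 < Y) (hx : x ∈ Set.Icc 0 X)
    (hy : y = 0 ∨ y = Y) : px α x y = 0 ∧ px β x y = 0 ∧ py (px β) x y = 0 := by
  have hy' : y ∈ Set.Icc 0 Y := by rcases hy with rfl | rfl <;> constructor <;> linarith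
  have ha : ∀ s ∈ Set.Icc 0 X, px α s y = 0 := fun s hs =>
    eq_zero_of_zero_on hX (fun s hs => (H.bc s hs y hy' (by tauto)).1) hs (H.sa.hasDerivAt_x s y)
  refine ⟨ha x hx, eq_zero_of_zero_on hX (fun s hs => (H.bc s hs y hy' (by tauto)).2) hx
    (H.sb.hasDerivAt_x x y), ?_⟩
  rw [← px_py_comm H.sb]
  exact eq_zero_of_zero_on hX (fun s hs => by rw [← H.div s hs y hy', ha s hs]) hx
    (H.sb.py.hasDerivAt_x x y)

/-- The smooth step `3η² - 2η³`, `η = y/L`. -/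
def sp (L y : ℝ) : ℝ := 3 * (y / L) ^ 2 - 2 * (y / L) ^ 3

theorem sp_contDiff (L : ℝ) : ContDiff ℝ ((⊤ : ℕ∞) : WithTop ℕ∞) (sp L) := by
  unfold sp; fun_prop

theorem sp_zero (L : ℝ) : sp L 0 = 0 := by simp [sp]

theorem sp_self (hL : 0 < L) : sp L L = 1 := by
  rw [sp, div_self hL.ne']; norm_num

theorem sp_deriv (L y : ℝ) : HasDerivAt (sp L) (6 * (y / L) * (1 - y / L) / L) y := by
  have h1 : HasDerivAt (fun y : ℝ => y / L) (1 / L) y := (hasDerivAt_id y).div_const L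
  exact (((h1.pow 2).const_mul 3).sub ((h1.pow 3).const_mul 2)).congr_deriv (by push_cast; ring)

/-- A bound for the first derivatives of the smooth step. -/
def SpBound (L B : ℝ) : Prop := ∀ b ≤ 3, ∀ y ∈ Set.Icc 0 L,
  |iteratedDeriv b (sp L) y| ≤ B ∧ |iteratedDeriv b (fun y => 1 - sp L y) y| ≤ B

theorem exists_spBound (L : ℝ) : ∃ B, ∀ B' ≥ B, SpBound L B' := by
  have hc : ∀ b : ℕ, ∃ C, ∀ y ∈ Set.Icc 0 L,
      |iteratedDeriv b (sp L) y| + |iteratedDeriv b (fun y => 1 - sp L y) y| ≤ C := by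
    intro b
    have c1 : Continuous (iteratedDeriv b (sp L)) :=
      (sp_contDiff L).continuous_iteratedDeriv b (by exact_mod_cast le_top)
    have c2 : Continuous (iteratedDeriv b (fun y => 1 - sp L y)) :=
      (contDiff_const.sub (sp_contDiff L)).continuous_iteratedDeriv b (by exact_mod_cast le_top)
    obtain ⟨C, hC⟩ := isCompact_Icc.exists_bound_of_continuousOn
      (s := Set.Icc 0 L) (c1.abs.add c2.abs).continuousOn
    exact ⟨C, fun y hy => (le_abs_self _).trans (hC y hy)⟩
  choose C hC using hc
  refine ⟨∑ b ∈ range 4, |C b|, fun B' hB' b hb y hy => ?_⟩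
  have h1 : |C b| ≤ ∑ b ∈ range 4, |C b| :=
    single_le_sum (f := fun b => |C b|) (fun i _ => abs_nonneg _) (mem_range.2 (by omega))
  have h2 := (hC b y hy).trans ((le_abs_self _).trans (h1.trans hB'))
  exact ⟨by linarith [abs_nonneg (iteratedDeriv b (fun y => 1 - sp L y) y)],
    by linarith [abs_nonneg (iteratedDeriv b (sp L) y)]⟩

/-- One half of the boundary-preserving corrector of the nodal stream function. -/
def corr (L k : ℝ) (α : ℝ → ℝ → ℝ) : ℝ → ℝ → ℝ := fun x y =>
  0 + (-(k ^ 2 / 6)) * ((py α x y + (-1) * ((1 - sp L y) * py α x 0)) + (-1) * (sp L y * py α x L))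

theorem Sm.corr (ha : Sm α) (L k : ℝ) : Sm (corr L k α) :=
  Sm.zero.lin ((ha.py.lin (ha.py.trace 0 (contDiff_const.sub (sp_contDiff L))) (-1)).lin
    (ha.py.trace L (sp_contDiff L)) (-1)) _

theorem CB.corr (ha : Sm α) (hc : CB X Y 4 K α) (hX : 0 ≤ X) (hY : 0 < Y) (hB : 1 ≤ B)
    (hs : SpBound Y B) : CB X Y 3 (k ^ 2 * B * K) (corr Y k α) := by
  have hK := hc.nonneg hX hY.le
  have q1 : ContDiff ℝ ((⊤ : ℕ∞) : WithTop ℕ∞) (fun y => 1 - sp Y y) :=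
    contDiff_const.sub (sp_contDiff Y)
  have t1 := hc.py.trace (c := 0) (B := B) (q := fun y => 1 - sp Y y) ⟨le_rfl, hY.le⟩
    (fun b hb y hy => (hs b hb y hy).2)
  have t2 := hc.py.trace (c := Y) (B := B) (q := sp Y) ⟨hY.le, le_rfl⟩
    (fun b hb y hy => (hs b hb y hy).1)
  have z : CB X Y 3 0 (fun _ _ => 0) := fun a b _ x _ y _ => by
    have := pd_lin Sm.zero Sm.zero (-1) a b
    simp only [mul_zero, add_zero] at this
    have h2 := congrFun (congrFun this x) y
    have : pd a b (fun _ _ => (0 : ℝ)) x y = 0 := by linarith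
    simp [this]
  have s1 := ha.py.trace 0 q1
  have s2 := ha.py.trace Y (sp_contDiff Y)
  have := z.lin (((hc.py.lin t1 ha.py s1 (-1)).lin t2 (ha.py.lin s1 (-1)) s2 (-1))) Sm.zero
    ((ha.py.lin s1 (-1)).lin s2 (-1)) (-(k ^ 2 / 6))
  refine CB.mono this le_rfl le_rfl le_rfl ?_
  rw [abs_neg, abs_neg, abs_one, abs_of_nonneg (by positivity)]
  have : K ≤ B * K := le_mul_of_one_le_left hK hB
  have h3 : 0 ≤ k ^ 2 * (B * K) := by positivity
  have h4 := mul_le_mul_of_nonneg_left this (sq_nonneg k)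
  linarith

theorem corr_left (L k x : ℝ) (α : ℝ → ℝ → ℝ) : corr L k α x 0 = 0 := by
  simp [corr, sp_zero]

theorem corr_right (hL : 0 < L) (k x : ℝ) (α : ℝ → ℝ → ℝ) : corr L k α x L = 0 := by
  simp [corr, sp_self hL]

theorem corr_py (ha : Sm α) (hL : 0 < L) (k x : ℝ) (hy : y = 0 ∨ y = L) :
    py (corr L k α) x y = -(k ^ 2 / 6) * pd 0 2 α x y := by
  have h1 := ha.py.hasDerivAt_y x y
  have h2 : HasDerivAt (sp L) 0 y := (sp_deriv L y).congr_deriv (by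
    rcases hy with rfl | rfl
    · simp
    · rw [div_self hL.ne']; simp)
  have h3 := (((((h1.add ((((h2.const_sub 1).mul_const (py α x 0))).const_mul (-1))).add
    ((h2.mul_const (py α x L)).const_mul (-1))).const_mul (-(k ^ 2 / 6))).const_add 0)).deriv
  refine h3.trans ?_
  change _ = -(k ^ 2 / 6) * py (py α) x y
  ring

/-- The corrector of the nodal stream function. -/
def Xf (X Y h k : ℝ) (α β : ℝ → ℝ → ℝ) : ℝ → ℝ → ℝ := fun x y =>
  corr Y k α x y + 1 * sw (corr X h (sw β)) x y

theorem Xf_sw : Xf Y X k h (sw β) (sw α) = sw (Xf X Y h k α β) := by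
  funext x y
  simp only [Xf]
  change corr X h (sw β) x y + 1 * corr Y k α y x = corr Y k α y x + 1 * corr X h (sw β) x y
  ring

theorem Sm.Xf (ha : Sm α) (hb : Sm β) : Sm (Xf X Y h k α β) := (ha.corr Y k).lin (hb.sw.corr X h).sw 1

theorem CB.Xf (ha : Sm α) (hb : Sm β) (ca : CB X Y 4 K α) (cb : CB X Y 4 K β) (hX : 0 < X)
    (hY : 0 < Y) (hB : 1 ≤ B) (hsX : SpBound X B) (hsY : SpBound Y B) :
    CB X Y 3 ((h ^ 2 + k ^ 2) * B * K) (Xf X Y h k α β) := by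
  have := (CB.corr (k := k) ha ca hX.le hY hB hsY).lin
    ((CB.corr (k := h) hb.sw (cb.sw hb) hY.le hX hB hsX).sw (hb.sw.corr X h)) (ha.corr Y k)
    (hb.sw.corr X h).sw 1
  exact this.mono le_rfl le_rfl le_rfl (by rw [abs_one]; linarith)

theorem NoSlip.corr_wall (H : NoSlip X Y α β) (hX : 0 < X) (hY : 0 < Y) (hx : x ∈ Set.Icc 0 X)
    (hy : y = 0 ∨ y = Y) : Xf X Y h k α β x y = 0 ∧
      py (Xf X Y h k α β) x y = -(k ^ 2 / 6) * pd 0 2 α x y := by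
  have p0 := H.px_zero hX hY ⟨le_rfl, hX.le⟩ hy
  have p1 := H.px_zero hX hY ⟨hX.le, le_rfl⟩ hy
  have p2 := H.px_zero hX hY hx hy
  constructor
  · have e1 : corr Y k α x y = 0 := by
      rcases hy with rfl | rfl
      · exact corr_left _ _ _ _
      · exact corr_right hY _ _ _
    have e2 : corr X h (RMACProof.sw β) y x = 0 := by
      change 0 + (-(h ^ 2 / 6)) * ((px β x y + (-1) * ((1 - sp X x) * px β 0 y))
        + (-1) * (sp X x * px β X y)) = 0
      rw [p0.2.1, p1.2.1, p2.2.1]; simp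
    change corr Y k α x y + 1 * corr X h (RMACProof.sw β) y x = 0
    rw [e1, e2]; simp
  · have h1 := (H.sa.corr Y k).hasDerivAt_y x y
    have d := fun s => H.sb.px.hasDerivAt_y s y
    have h2 := (((((d x).add (((d 0).const_mul (1 - sp X x)).const_mul (-1))).add
      (((d X).const_mul (sp X x)).const_mul (-1))).const_mul (-(h ^ 2 / 6))).const_add 0).const_mul 1
    rw [p0.2.2, p1.2.2, p2.2.2] at h2
    refine (h1.add h2).deriv.trans ?_
    rw [corr_py H.sa hY k x hy]
    ring

end Corrector

section Viscous

variable {X Y K K' B h k x y : ℝ} {α β : ℝ → ℝ → ℝ}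

/-- Path independence of the stream function. -/
theorem NoSlip.NS_eq (H : NoSlip X Y α β) (hx : x ∈ Set.Icc 0 X) (hy : y ∈ Set.Icc 0 Y) :
    NS α x y = NS (RMACProof.sw β) y x := by
  have hX : 0 ≤ X := hx.1.trans hx.2
  have hY : 0 ≤ Y := hy.1.trans hy.2
  have e1 : NS α x y = ∫ t in (0 : ℝ)..y, ∫ s in (0 : ℝ)..x, px α s t := by
    refine intervalIntegral.integral_congr fun t ht => ?_
    rw [Set.uIcc_of_le hy.1] at ht
    have := intervalIntegral.integral_eq_sub_of_hasDerivAt (a := 0) (b := x)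
      (fun s _ => H.sa.hasDerivAt_x s t) ((H.sa.px.cont_x t).intervalIntegrable _ _)
    have h0 := (H.bc 0 ⟨le_rfl, hX⟩ t ⟨ht.1, ht.2.trans hy.2⟩ (by simp)).1
    simp only [this, h0, sub_zero]
  have e2 : NS (RMACProof.sw β) y x = ∫ s in (0 : ℝ)..x, ∫ t in (0 : ℝ)..y, px α s t := by
    refine intervalIntegral.integral_congr fun s hs => ?_
    rw [Set.uIcc_of_le hx.1] at hs
    have hs' : s ∈ Set.Icc 0 X := ⟨hs.1, hs.2.trans hx.2⟩
    have := intervalIntegral.integral_eq_sub_of_hasDerivAt (a := 0) (b := y)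
      (fun t _ => H.sb.hasDerivAt_y s t) ((H.sb.py.cont_y s).intervalIntegrable _ _)
    have h0 := (H.bc s hs' 0 ⟨le_rfl, hY⟩ (by simp)).2
    have h1 : ∫ t in (0 : ℝ)..y, px α s t = ∫ t in (0 : ℝ)..y, py β s t :=
      intervalIntegral.integral_congr fun t ht => by
        rw [Set.uIcc_of_le hy.1] at ht
        exact H.div s hs' t ⟨ht.1, ht.2.trans hy.2⟩
    simp only [h1, this, h0, sub_zero]
    rfl
  rw [e1, e2]
  refine intervalIntegral_intervalIntegral_swap ?_
  have hc : Continuous (Function.uncurry fun t s => px α s t) :=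
    (H.sa.px.continuous).comp (continuous_snd.prodMk continuous_fst)
  have : IntegrableOn (Function.uncurry fun t s => px α s t) (Set.uIcc 0 y ×ˢ Set.uIcc 0 x) :=
    hc.continuousOn.integrableOn_compact (isCompact_uIcc.prod isCompact_uIcc)
  exact this.mono_set (Set.prod_mono Set.uIoc_subset_uIcc Set.uIoc_subset_uIcc)

/-- The corrected stream function. -/
def PsiC (X Y h k : ℝ) (α β : ℝ → ℝ → ℝ) (x y : ℝ) : ℝ := NS α x y + Xf X Y h k α β x y

theorem NoSlip.PsiC_sw (H : NoSlip X Y α β) (hx : x ∈ Set.Icc 0 X) (hy : y ∈ Set.Icc 0 Y) :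
    PsiC Y X k h (RMACProof.sw β) (RMACProof.sw α) y x = PsiC X Y h k α β x y := by
  rw [PsiC, PsiC, H.NS_eq hx hy, Xf_sw]; rfl

theorem NoSlip.NS_wall (H : NoSlip X Y α β) (hx : x ∈ Set.Icc 0 X) (hY : 0 ≤ Y)
    (hy : y = 0 ∨ y = Y) : NS α x y = 0 := by
  have hX : 0 ≤ X := hx.1.trans hx.2
  rcases hy with rfl | rfl
  · exact intervalIntegral.integral_same
  · rw [H.NS_eq hx ⟨hY, le_rfl⟩]
    refine (intervalIntegral.integral_congr (g := fun _ => 0) fun s hs => ?_).trans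
      intervalIntegral.integral_zero
    rw [Set.uIcc_of_le hx.1] at hs
    exact (H.bc s ⟨hs.1, hs.2.trans hx.2⟩ y ⟨hY, le_rfl⟩ (by simp)).2

theorem NoSlip.PsiC_zero (H : NoSlip X Y α β) (hX : 0 < X) (hY : 0 < Y) (hx : x ∈ Set.Icc 0 X)
    (hy : y ∈ Set.Icc 0 Y) (hw : x = 0 ∨ x = X ∨ y = 0 ∨ y = Y) : PsiC X Y h k α β x y = 0 := by
  have key : ∀ {X Y h k x y : ℝ} {α β : ℝ → ℝ → ℝ}, NoSlip X Y α β → 0 < X → 0 < Y →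
      x ∈ Set.Icc 0 X → (y = 0 ∨ y = Y) → PsiC X Y h k α β x y = 0 := by
    intro X Y h k x y α β H hX hY hx hy
    rw [PsiC, H.NS_wall hx hY.le hy, (H.corr_wall hX hY hx hy).1, add_zero]
  rcases or_assoc.2 hw with hw | hw
  · rw [← H.PsiC_sw hx hy]
    exact key H.sw hY hX hy hw
  · exact key H hX hY hx hw

theorem inner_yy_le (H : NoSlip X Y α β) (hk : 0 < k) (ca : CB X Y 4 K α)
    (cX : CB X Y 3 K' (Xf X Y h k α β)) (hx : x ∈ Set.Icc 0 X) (hy0 : 3 / 2 * k ≤ y)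
    (hy1 : y + 3 / 2 * k ≤ Y) :
    |(PsiC X Y h k α β x (y + 3 / 2 * k) - 3 * PsiC X Y h k α β x (y + 1 / 2 * k)
      + 3 * PsiC X Y h k α β x (y - 1 / 2 * k) - PsiC X Y h k α β x (y - 3 / 2 * k)) / k ^ 3
      - pd 0 2 α x y| ≤ K * k ^ 2 + 2 * K' := by
  have iy : ∀ s ∈ Set.Icc (y - 3 / 2 * k) (y + 3 / 2 * k), s ∈ Set.Icc 0 Y := fun s hs =>
    ⟨by linarith [hs.1], by linarith [hs.2]⟩
  have h1 : |(NS α x (y + 3 / 2 * k) - 3 * NS α x (y + 1 / 2 * k) + 3 * NS α x (y - 1 / 2 * k)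
      - NS α x (y - 3 / 2 * k)) / k ^ 3 - pd 0 2 α x y| ≤ K * k ^ 2 :=
    third_diff_sub_le (f := primChain (fun i s => pd 0 i α x s)) hk
      (fun i hi s _ => NS_hasChain H.sa x (N := 4) (by norm_num) i hi s)
      (fun s hs => ca 0 4 le_rfl x hx s (iy s hs))
  have h2 := third_diff_le (f := fun i s => pd 0 i (Xf X Y h k α β) x s) (a := y) hk
    (fun i _ s _ => (H.sa.Xf H.sb).chain_y 0 x i s)
    (fun s hs => cX 0 3 le_rfl x hx s (iy s hs))
  have e : ∀ s, pd 0 0 (Xf X Y h k α β) x s = Xf X Y h k α β x s := fun s => rfl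
  simp only [e] at h2
  refine le_trans (le_of_eq ?_) ((abs_add_le _ _).trans (add_le_add h1 h2))
  congr 1
  simp only [PsiC]
  ring

theorem near_yy_le (H : NoSlip X Y α β) (hX : 0 < X) (hY : 0 < Y) (hk : 0 < k) (ca : CB X Y 4 K α)
    (cX : CB X Y 3 K' (Xf X Y h k α β)) (hx : x ∈ Set.Icc 0 X) (hy1 : 2 * k ≤ Y) :
    |(PsiC X Y h k α β x (2 * k) - 4 * PsiC X Y h k α β x k) / k ^ 3 - pd 0 2 α x (k / 2)|
      ≤ 2 * K * k ^ 2 + 2 * K' := by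
  have iy : ∀ s ∈ Set.Icc 0 (2 * k), s ∈ Set.Icc 0 Y := fun s hs => ⟨hs.1, hs.2.trans hy1⟩
  have hw := H.corr_wall (h := h) (k := k) hX hY hx (Or.inl rfl)
  have h1 : |(NS α x (2 * k) - 4 * NS α x k) / k ^ 3 - pd 0 2 α x (k / 2) + pd 0 2 α x 0 / 3|
      ≤ 2 * K * k ^ 2 :=
    wall_diff_sub_le (f := primChain (fun i s => pd 0 i α x s)) hk
      (fun i hi s _ => NS_hasChain H.sa x (N := 4) (by norm_num) i hi s)
      (fun s hs => ca 0 4 le_rfl x hx s (iy s hs)) intervalIntegral.integral_same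
      (H.bc x hx 0 ⟨le_rfl, hY.le⟩ (by simp)).1
  have h2 : |(Xf X Y h k α β x (2 * k) - 4 * Xf X Y h k α β x k) / k ^ 3
      + 2 * py (Xf X Y h k α β) x 0 / k ^ 2| ≤ 2 * K' :=
    wall_corr_le (f := fun i s => pd 0 i (Xf X Y h k α β) x s) hk
      (fun i _ s _ => (H.sa.Xf H.sb).chain_y 0 x i s)
      (fun s hs => cX 0 3 le_rfl x hx s (iy s hs)) hw.1
  rw [hw.2] at h2
  refine le_trans (le_of_eq ?_) ((abs_add_le _ _).trans (add_le_add h1 h2))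
  congr 1
  simp only [PsiC]
  field_simp
  ring

theorem far_yy_le (H : NoSlip X Y α β) (hX : 0 < X) (hY : 0 < Y) (hk : 0 < k) (ca : CB X Y 4 K α)
    (cX : CB X Y 3 K' (Xf X Y h k α β)) (hx : x ∈ Set.Icc 0 X) (hy1 : 2 * k ≤ Y) :
    |(4 * PsiC X Y h k α β x (Y - k) - PsiC X Y h k α β x (Y - 2 * k)) / k ^ 3
      - pd 0 2 α x (Y - k / 2)| ≤ 2 * K * k ^ 2 + 2 * K' := by
  have iy : ∀ s ∈ Set.Icc 0 (2 * k), Y - s ∈ Set.Icc 0 Y := fun s hs =>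
    ⟨by linarith [hs.2], by linarith [hs.1]⟩
  have hw := H.corr_wall (h := h) (k := k) hX hY hx (Or.inr rfl)
  have hr : ∀ {f : ℕ → ℝ → ℝ} {N : ℕ}, (∀ i < N, ∀ s, HasDerivAt (f i) (f (i + 1) s) s) →
      ∀ i < N, ∀ s ∈ Set.Icc 0 (2 * k), HasDerivAt (fun s => (-1) ^ i * f i (Y - s))
        ((-1) ^ (i + 1) * f (i + 1) (Y - s)) s := fun hd i hi s _ =>
    ((HasDerivAt.comp_const_sub Y s (hd i hi (Y - s))).const_mul ((-1 : ℝ) ^ i)).congr_deriv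
      (by rw [pow_succ]; ring)
  have habs : ∀ (i : ℕ) (z : ℝ), |(-1) ^ i * z| = |z| := fun i z => by
    rw [abs_mul, abs_pow, abs_neg, abs_one, one_pow, one_mul]
  have h1 := wall_diff_sub_le
    (f := fun i s => (-1) ^ i * primChain (fun i s => pd 0 i α x s) i (Y - s)) (K := K) hk
    (hr (NS_hasChain H.sa x (N := 4) (by norm_num)))
    (fun s hs => by rw [habs]; exact ca 0 4 le_rfl x hx _ (iy s hs))
    (by
      have := H.NS_wall hx hY.le (Or.inr rfl)
      simp only [sub_zero, pow_zero, one_mul]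
      exact this)
    (by
      have := (H.bc x hx Y ⟨hY.le, le_rfl⟩ (by simp)).1
      simp only [sub_zero, pow_one, neg_mul, one_mul, neg_eq_zero]
      exact this)
  have h2 := wall_corr_le (f := fun i s => (-1) ^ i * pd 0 i (Xf X Y h k α β) x (Y - s)) (K := K') hk
    (hr (N := 3) (f := fun i s => pd 0 i (Xf X Y h k α β) x s)
      (fun i _ s => (H.sa.Xf H.sb).chain_y 0 x i s))
    (fun s hs => by rw [habs]; exact cX 0 3 le_rfl x hx _ (iy s hs))
    (by simp only [sub_zero, pow_zero, one_mul]; exact hw.1)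
  have e0 : ∀ s, primChain (fun i s => pd 0 i α x s) 0 s = NS α x s := fun s => rfl
  have e3 : ∀ s, primChain (fun i s => pd 0 i α x s) 3 s = pd 0 2 α x s := fun s => rfl
  have e4 : ∀ s, pd 0 0 (Xf X Y h k α β) x s = Xf X Y h k α β x s := fun s => rfl
  have e5 : pd 0 1 (Xf X Y h k α β) x Y = -(k ^ 2 / 6) * pd 0 2 α x Y := hw.2
  simp only [e0, e3, e4, sub_zero, e5] at h1 h2
  rw [abs_sub_comm] at *
  refine le_trans (le_of_eq ?_) ((abs_add_le _ _).trans (add_le_add h1 h2))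
  congr 1
  simp only [PsiC]
  field_simp
  ring

end Viscous

section Viscous

variable {X Y K K' h k x y : ℝ} {α β : ℝ → ℝ → ℝ}

theorem NS_sub (ha : Sm α) (x y : ℝ) :
    (NS α x (y + k) - NS α x y) / k = AX k (sw α) (y + k / 2) x := by
  have hc := ha.cont_y x
  have h1 : NS α x (y + k) - NS α x y = ∫ s in y..(y + k), α x s :=
    intervalIntegral.integral_interval_sub_left (hc.intervalIntegrable _ _)
      (hc.intervalIntegrable _ _)
  have e1 : y + k / 2 - k / 2 = y := by ring
  have e2 : y + k / 2 + k / 2 = y + k := by ring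
  rw [h1, AX, e1, e2]
  simp only [sw]
  ring

theorem NS_xx_le (ha : Sm α) (hh : 0 < h) (hk : 0 < k) (ca : CB X Y 4 K α)
    (hx0 : h ≤ x) (hx1 : x + h ≤ X) (hy0 : 0 ≤ y) (hy1 : y + k ≤ Y) :
    |(AX k (sw α) (y + k / 2) (x + h) - 2 * AX k (sw α) (y + k / 2) x
        + AX k (sw α) (y + k / 2) (x - h)) / h ^ 2 - pd 2 0 α x (y + k / 2)|
      ≤ K * (h ^ 2 + k ^ 2) := by
  have hx : x ∈ Set.Icc 0 X := ⟨by linarith, by linarith⟩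
  have h1 : |AX k (fun s t => (α (t + h) s - 2 * α t s + α (t - h) s) / h ^ 2 - pd 2 0 α t s)
      (y + k / 2) x| ≤ K * h ^ 2 := by
    refine AX_le hk fun s hs => ?_
    exact second_diff_sub_le (f := fun i t => pd i 0 α t s) hh
      (fun i _ t _ => ha.chain_x 0 s i t)
      (fun t ht => ca 4 0 (by norm_num) t ⟨by linarith [ht.1], by linarith [ht.2]⟩ s
        ⟨by linarith [hs.1], by linarith [hs.2]⟩)
  have h2 : AX k (fun s t => (α (t + h) s - 2 * α t s + α (t - h) s) / h ^ 2 - pd 2 0 α t s)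
      (y + k / 2) x = (AX k (sw α) (y + k / 2) (x + h) - 2 * AX k (sw α) (y + k / 2) x
        + AX k (sw α) (y + k / 2) (x - h)) / h ^ 2 - AX k (sw (pd 2 0 α)) (y + k / 2) x := by
    have c : ∀ z, IntervalIntegrable (fun s => α z s) volume (y + k / 2 - k / 2) (y + k / 2 + k / 2) :=
      fun z => (ha.cont_y z).intervalIntegrable _ _
    have c3 := ((ha.pd 2 0).cont_y x).intervalIntegrable (μ := volume) (y + k / 2 - k / 2)
      (y + k / 2 + k / 2)
    unfold AX sw
    rw [intervalIntegral.integral_sub ((((c _).sub ((c _).const_mul 2)).add (c _)).div_const _) c3,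
      intervalIntegral.integral_div, intervalIntegral.integral_add ((c _).sub ((c _).const_mul 2)) (c _),
      intervalIntegral.integral_sub (c _) ((c _).const_mul 2), intervalIntegral.integral_const_mul]
    ring
  have h3 : |AX k (sw (pd 2 0 α)) (y + k / 2) x - pd 2 0 α x (y + k / 2)| ≤ K * k ^ 2 := by
    refine AX_sub_le (ha.pd 2 0).sw hk fun s hs => ?_
    rw [pd_sw (ha.pd 2 0)]
    have e : pd 0 2 (pd 2 0 α) = pd 2 2 α := by
      rw [pd_succ_right (ha.pd 2 0), pd_succ_right (ha.pd 2 0), pd_succ_right ha 2 1,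
        pd_succ_right ha 2 0]
      rfl
    rw [sw, e]
    exact ca 2 2 le_rfl x hx s ⟨by linarith [hs.1], by linarith [hs.2]⟩
  rw [h2] at h1
  have := (abs_add_le _ _).trans (add_le_add h1 h3)
  rw [sub_add_sub_cancel] at this
  linarith

theorem xx_le (H : NoSlip X Y α β) (hh : 0 < h) (hk : 0 < k) (ca : CB X Y 4 K α)
    (cX : CB X Y 3 K' (Xf X Y h k α β)) (hx0 : h ≤ x) (hx1 : x + h ≤ X) (hy0 : 0 ≤ y)
    (hy1 : y + k ≤ Y) :
    |((PsiC X Y h k α β (x + h) (y + k) - PsiC X Y h k α β (x + h) y) / k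
        - 2 * ((PsiC X Y h k α β x (y + k) - PsiC X Y h k α β x y) / k)
        + (PsiC X Y h k α β (x - h) (y + k) - PsiC X Y h k α β (x - h) y) / k) / h ^ 2
      - pd 2 0 α x (y + k / 2)| ≤ K * (h ^ 2 + k ^ 2) + K' := by
  have h1 := NS_xx_le H.sa hh hk ca hx0 hx1 hy0 hy1
  have sX := H.sa.Xf (X := X) (Y := Y) (h := h) (k := k) H.sb
  have cs := CB.sq (r := 2) cX sX hk
  have h2 := second_diff_le (f := fun i t => pd i 0 (sq k (Xf X Y h k α β)) t y) (a := x) hh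
    (fun i _ t _ => (sX.sq k).chain_x 0 y i t)
    (fun t ht => cs 2 0 le_rfl t ⟨by linarith [ht.1], by linarith [ht.2]⟩ y
      ⟨hy0, by linarith⟩)
  have e : ∀ t, pd 0 0 (sq k (Xf X Y h k α β)) t y
    = (Xf X Y h k α β t (y + k) - Xf X Y h k α β t y) / k := fun _ => rfl
  simp only [e, ← NS_sub H.sa] at h1 h2
  refine le_trans (le_of_eq ?_) ((abs_add_le _ _).trans (add_le_add h1 h2))
  congr 1
  simp only [PsiC]
  ring

/-- The Laplacian. -/
def lap (α : ℝ → ℝ → ℝ) : ℝ → ℝ → ℝ := fun x y => pd 2 0 α x y + 1 * pd 0 2 α x y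

theorem Sm.lap (ha : Sm α) : Sm (lap α) := (ha.pd 2 0).lin (ha.pd 0 2) 1

theorem lap_sw (ha : Sm α) : lap (sw α) = sw (lap α) := by
  unfold lap
  rw [pd_sw ha, pd_sw ha]
  funext x y
  simp only [sw]
  ring

theorem AX_lap_le (ha : Sm α) (hh : 0 < h) (ca : CB X Y 4 K α)
    (hx0 : h ≤ x) (hx1 : x + h ≤ X) (hy : y ∈ Set.Icc 0 Y) :
    |AX h (lap α) x y - lap α x y| ≤ 2 * K * h ^ 2 := by
  refine AX_sub_le ha.lap hh fun s hs => ?_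
  have hs' : s ∈ Set.Icc 0 X := ⟨by linarith [hs.1], by linarith [hs.2]⟩
  unfold lap
  rw [pd_lin (ha.pd 2 0) (ha.pd 0 2)]
  have e1 : pd 2 0 (pd 2 0 α) = pd 4 0 α := rfl
  have e2 : pd 2 0 (pd 0 2 α) = pd 2 2 α := rfl
  have a1 := ca 4 0 le_rfl s hs' y hy
  have a2 := ca 2 2 le_rfl s hs' y hy
  rw [e1, e2]
  refine (abs_add_le _ _).trans ?_
  rw [one_mul]
  linarith

end Viscous

section Discrete

variable {n m : ℕ} {X Y K K' h k : ℝ} {α β : ℝ → ℝ → ℝ}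

/-- Nodal values of the corrected stream function. -/
def Psi (n m : ℕ) (X Y h k : ℝ) (α β : ℝ → ℝ → ℝ) (i j : ℕ) : ℝ :=
  if i ≤ n ∧ j ≤ m then PsiC X Y h k α β (i * h) (j * k) else 0

theorem Psi_eq {i j : ℕ} (hi : i ≤ n) (hj : j ≤ m) :
    Psi n m X Y h k α β i j = PsiC X Y h k α β (i * h) (j * k) := if_pos ⟨hi, hj⟩

theorem node_mem {n i : ℕ} {h X : ℝ} (hh : 0 < h) (hX : n * h = X) (hi : i ≤ n) :
    (i : ℝ) * h ∈ Set.Icc 0 X :=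
  ⟨by positivity, by rw [← hX]; exact mul_le_mul_of_nonneg_right (by exact_mod_cast hi) hh.le⟩

theorem NoSlip.Psi_mem (H : NoSlip X Y α β) (hh : 0 < h) (hk : 0 < k) (hX : n * h = X)
    (hY : m * k = Y) (hX0 : 0 < X) (hY0 : 0 < Y) : Psi n m X Y h k α β ∈ nodeSpace n m := by
  intro i j hij
  unfold Psi
  split_ifs with hc
  · refine H.PsiC_zero hX0 hY0 (node_mem hh hX hc.1) (node_mem hk hY hc.2) ?_
    rcases hij with rfl | hi | rfl | hj
    · simp
    · right; left; rw [← hX, le_antisymm hc.1 hi]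
    · simp
    · right; right; right; rw [← hY, le_antisymm hc.2 hj]
  · rfl

theorem NoSlip.Psi_tr (H : NoSlip X Y α β) (hh : 0 < h) (hk : 0 < k) (hX : n * h = X)
    (hY : m * k = Y) :
    Psi m n Y X k h (RMACProof.sw β) (RMACProof.sw α) = tr (Psi n m X Y h k α β) := by
  funext j i
  change _ = Psi n m X Y h k α β i j
  unfold Psi
  by_cases hc : i ≤ n ∧ j ≤ m
  · rw [if_pos hc, if_pos hc.symm]
    exact H.PsiC_sw (node_mem hh hX hc.1) (node_mem hk hY hc.2)
  · rw [if_neg hc, if_neg fun h => hc h.symm]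

theorem NoSlip.Lc_Psi_le (H : NoSlip X Y α β) (hh : 0 < h) (hk : 0 < k) (hX : n * h = X)
    (hY : m * k = Y) (hX0 : 0 < X) (hY0 : 0 < Y) (hm : 2 ≤ m) (ca : CB X Y 4 K α)
    (cX : CB X Y 3 K' (Xf X Y h k α β)) {i j : ℕ} (hi : i ≤ n) (hj : j < m) :
    |Lc m k (dy k (Psi n m X Y h k α β) i) j - RMACProof.pd 0 2 α (i * h) (j * k + k / 2)|
      ≤ 2 * K * k ^ 2 + 2 * K' := by
  have hx := node_mem hh hX hi
  have hK := ca.nonneg hX0.le hY0.le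
  have hv : ∀ l ≤ m, Psi n m X Y h k α β i l = PsiC X Y h k α β (i * h) (l * k) :=
    fun l hl => Psi_eq hi hl
  have h0 : ∀ l ≤ m, l = 0 ∨ l = m → PsiC X Y h k α β (i * h) (l * k) = 0 := fun l hl hl' =>
    H.PsiC_zero hX0 hY0 hx (node_mem hk hY hl) (by
      rcases hl' with rfl | rfl
      · simp
      · right; right; right; exact hY)
  have hm' : (2 : ℝ) ≤ m := by exact_mod_cast hm
  have hY2 : 2 * k ≤ Y := by rw [← hY]; exact mul_le_mul_of_nonneg_right hm' hk.le
  rcases Nat.eq_zero_or_pos j with rfl | hj0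
  · have := near_yy_le H hX0 hY0 hk ca cX hx hY2
    rw [Nat.cast_zero, zero_mul, zero_add]
    convert this using 3
    simp only [Lc, dy]
    rw [if_pos (by omega), if_pos trivial, hv 0 (by omega), hv (0 + 1) (by omega), hv (0 + 1 + 1) (by omega),
      h0 0 (by omega) (Or.inl rfl)]
    norm_num
    field_simp
    ring
  · by_cases hj1 : j + 1 < m
    · have hjm : (j : ℝ) + 2 ≤ m := by exact_mod_cast hj1
      have hj1' : (1 : ℝ) ≤ j := by exact_mod_cast hj0
      have := inner_yy_le H (y := j * k + k / 2) hk ca cX hx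
        (by nlinarith) (by rw [← hY]; nlinarith)
      refine le_trans (le_of_eq ?_) (this.trans (by nlinarith [mul_nonneg hK (sq_nonneg k)]))
      congr 2
      simp only [Lc, dy]
      rw [if_pos hj1, if_neg (by omega), hv j (by omega), hv (j + 1) (by omega),
        hv (j + 1 + 1) (by omega), hv (j - 1 + 1) (by omega), hv (j - 1) (by omega),
        Nat.sub_add_cancel hj0, Nat.cast_sub hj0]
      push_cast
      have e1 : (j : ℝ) * k + k / 2 + 3 / 2 * k = (j + 1 + 1) * k := by ring
      have e2 : (j : ℝ) * k + k / 2 + 1 / 2 * k = (j + 1) * k := by ring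
      have e3 : (j : ℝ) * k + k / 2 - 1 / 2 * k = j * k := by ring
      have e4 : (j : ℝ) * k + k / 2 - 3 / 2 * k = (j - 1) * k := by ring
      rw [e1, e2, e3, e4]
      field_simp
      ring
    · obtain rfl : m = j + 1 := by omega
      have := far_yy_le H hX0 hY0 hk ca cX hx hY2
      have e0 : (j : ℝ) * k + k / 2 = Y - k / 2 := by rw [← hY]; push_cast; ring
      rw [e0]
      convert this using 3
      simp only [Lc, dy]
      rw [if_neg hj1, if_neg (by omega), hv j (by omega), hv (j + 1) (by omega),
        hv (j - 1 + 1) (by omega), hv (j - 1) (by omega), h0 (j + 1) le_rfl (Or.inr rfl),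
        Nat.sub_add_cancel hj0, Nat.cast_sub hj0]
      have e1 : Y - k = j * k := by rw [← hY]; push_cast; ring
      have e2 : Y - 2 * k = (j - (1 : ℕ)) * k := by rw [← hY]; push_cast; ring
      rw [e1, e2]
      field_simp
      ring

/-- Consistency of the discrete viscous term. -/
theorem NoSlip.momLap_le (H : NoSlip X Y α β) (hh : 0 < h) (hk : 0 < k) (hX : n * h = X)
    (hY : m * k = Y) (hX0 : 0 < X) (hY0 : 0 < Y) (hm : 2 ≤ m) (ca : CB X Y 4 K α)
    (cX : CB X Y 3 K' (Xf X Y h k α β)) {i j : ℕ} (hi0 : 0 < i) (hi : i < n) (hj : j < m) :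
    |momLap n m h k (Psi n m X Y h k α β) i j - AX h (RMACProof.lap α) (i * h) (j * k + k / 2)|
      ≤ 3 * K * (h ^ 2 + k ^ 2) + 3 * K' := by
  have hi1 : (1 : ℝ) ≤ i := by exact_mod_cast hi0
  have hi2 : (i : ℝ) + 1 ≤ n := by exact_mod_cast hi
  have hj2 : (j : ℝ) + 1 ≤ m := by exact_mod_cast hj
  have hj0 : (0 : ℝ) ≤ j * k := by positivity
  have x0 : h ≤ i * h := by nlinarith
  have x1 : i * h + h ≤ X := by rw [← hX]; nlinarith
  have y1 : j * k + k ≤ Y := by rw [← hY]; nlinarith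
  have h1 := H.Lc_Psi_le hh hk hX hY hX0 hY0 hm ca cX hi.le hj
  have h2 := xx_le H hh hk ca cX x0 x1 hj0 y1
  have h3 := AX_lap_le (y := j * k + k / 2) H.sa hh ca x0 x1 ⟨by positivity, by linarith⟩
  have e : D2 n h (fun i => dy k (Psi n m X Y h k α β) i j) i
      = -(((PsiC X Y h k α β (i * h + h) (j * k + k) - PsiC X Y h k α β (i * h + h) (j * k)) / k
        - 2 * ((PsiC X Y h k α β (i * h) (j * k + k) - PsiC X Y h k α β (i * h) (j * k)) / k)
        + (PsiC X Y h k α β (i * h - h) (j * k + k) - PsiC X Y h k α β (i * h - h) (j * k)) / k)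
          / h ^ 2) := by
    simp only [D2, dy]
    rw [if_neg (by omega), Psi_eq (by omega) (by omega), Psi_eq (by omega) (by omega),
      Psi_eq (by omega) (by omega), Psi_eq (by omega) (by omega), Psi_eq (by omega) (by omega),
      Psi_eq (by omega) (by omega), Nat.cast_sub hi0]
    push_cast
    simp only [add_mul, sub_mul, one_mul]
    ring
  rw [momLap, e]
  have hl : RMACProof.lap α (i * h) (j * k + k / 2) = RMACProof.pd 2 0 α (i * h) (j * k + k / 2)
    + 1 * RMACProof.pd 0 2 α (i * h) (j * k + k / 2) := rfl
  rw [hl] at h3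
  have hK := ca.nonneg hX0.le hY0.le
  rw [abs_le] at h1 h2 h3 ⊢
  have p1 := mul_nonneg hK (sq_nonneg k)
  have p2 := mul_nonneg hK (sq_nonneg h)
  constructor <;> linarith [h1.1, h2.1, h3.1, h1.2, h2.2, h3.2]

end Discrete

section TimeConsistency

variable {n m : ℕ} {X Y h k x y c : ℝ} {α β α' β' e f a b : ℝ → ℝ → ℝ}

theorem py_lin (ha : Sm α) (hb : Sm β) (c x y : ℝ) :
    py (fun x y => α x y + c * β x y) x y = py α x y + c * py β x y :=
  congrFun (congrFun (pd_lin ha hb c 0 1) x) y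

theorem px_lin (ha : Sm α) (hb : Sm β) (c x y : ℝ) :
    px (fun x y => α x y + c * β x y) x y = px α x y + c * px β x y :=
  congrFun (congrFun (pd_lin ha hb c 1 0) x) y

theorem corr_lin (ha : Sm α) (hb : Sm β) (L k c x y : ℝ) :
    corr L k (fun x y => α x y + c * β x y) x y = corr L k α x y + c * corr L k β x y := by
  simp only [corr, py_lin ha hb]
  ring

theorem Xf_lin (ha : Sm α) (hb : Sm β) (ha' : Sm α') (hb' : Sm β') (X Y h k c x y : ℝ) :
    Xf X Y h k (fun x y => α x y + c * α' x y) (fun x y => β x y + c * β' x y) x y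
      = Xf X Y h k α β x y + c * Xf X Y h k α' β' x y := by
  have h1 := corr_lin ha ha' Y k c x y
  have h2 := corr_lin hb.sw hb'.sw X h c y x
  change corr Y k _ x y + 1 * corr X h (fun x y => sw β x y + c * sw β' x y) y x = 
    corr Y k α x y + 1 * corr X h (sw β) y x + c * (corr Y k α' x y + 1 * corr X h (sw β') y x)
  rw [h1, h2]
  ring

theorem NS_lin (ha : Sm α) (hb : Sm β) (c x y : ℝ) :
    NS (fun x y => α x y + c * β x y) x y = NS α x y + c * NS β x y := by
  unfold NS
  rw [intervalIntegral.integral_add ((ha.cont_y x).intervalIntegrable _ _)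
    (((hb.cont_y x).intervalIntegrable _ _).const_mul c), intervalIntegral.integral_const_mul]

theorem Psi_lin (ha : Sm α) (hb : Sm β) (ha' : Sm α') (hb' : Sm β') (X Y h k c : ℝ) (i j : ℕ) :
    Psi n m X Y h k (fun x y => α x y + c * α' x y) (fun x y => β x y + c * β' x y) i j
      = Psi n m X Y h k α β i j + c * Psi n m X Y h k α' β' i j := by
  unfold Psi
  split_ifs
  · rw [PsiC, PsiC, PsiC, NS_lin ha ha', Xf_lin ha hb ha' hb']
    ring
  · simp

/-- The quotient of two no-slip stream functions is no-slip. -/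
theorem NoSlip.of_lin (H₁ : NoSlip X Y (fun x y => α x y + c * a x y) (fun x y => β x y + c * b x y))
    (H₀ : NoSlip X Y α β) (hc : c ≠ 0) (ha : Sm a) (hb : Sm b) : NoSlip X Y a b where
  sa := ha
  sb := hb
  div := fun x hx y hy => by
    have h1 := H₁.div x hx y hy
    rw [px_lin H₀.sa ha, py_lin H₀.sb hb, H₀.div x hx y hy] at h1
    exact mul_left_cancel₀ hc (add_left_cancel h1)
  bc := fun x hx y hy hw => by
    have h1 := H₁.bc x hx y hy hw
    have h0 := H₀.bc x hx y hy hw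
    simp only [h0.1, h0.2, zero_add, mul_eq_zero, hc, false_or] at h1
    exact h1

/-- Residual of the time derivative of the first velocity component. -/
def REx (n m : ℕ) (X Y h k : ℝ) (α' a b : ℝ → ℝ → ℝ) (i j : ℕ) : ℝ :=
  AX h α' (i * h) (j * k + k / 2) - dy k (Psi n m X Y h k a b) i j

theorem REx_diff (sα : Sm α') (se : Sm e) (hk : 0 < k) {i j : ℕ} (hi : i ≤ n) (hj0 : 0 < j)
    (hj : j < m) :
    (REx n m X Y h k α' (fun x y => α' x y + 1 * e x y) b i j
        - REx n m X Y h k α' (fun x y => α' x y + 1 * e x y) b i (j - 1)) / k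
      = crx h k α' (i * h) (j * k) - d2 k (NS e) (i * h) (j * k)
        - d2 k (Xf X Y h k (fun x y => α' x y + 1 * e x y) b) (i * h) (j * k) := by
  obtain ⟨j, rfl⟩ : ∃ l, j = l + 1 := ⟨j - 1, by omega⟩
  simp only [REx, dy, Nat.add_sub_cancel]
  rw [Psi_eq hi (by omega), Psi_eq hi (by omega), Psi_eq hi (by omega)]
  simp only [PsiC, NS_lin sα se, crx, d2]
  have e1 : ((j + 1 : ℕ) : ℝ) * k - k = j * k := by push_cast; ring
  have e2 : ((j + 1 + 1 : ℕ) : ℝ) * k = (j + 1 : ℕ) * k + k := by push_cast; ring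
  have e3 : (j : ℝ) * k + k / 2 = (j + 1 : ℕ) * k - k / 2 := by push_cast; ring
  rw [e1, e2, e3]
  field_simp
  ring

/-- Nodal density of the time residual. -/
def gnode (n m : ℕ) (X Y h k : ℝ) (α' β' e f : ℝ → ℝ → ℝ) (i j : ℕ) : ℝ :=
  if i = 0 ∨ n ≤ i ∨ j = 0 ∨ m ≤ j then 0 else
    -gfun h k α' β' e f (Xf X Y h k (fun x y => α' x y + 1 * e x y) (fun x y => β' x y + 1 * f x y))
      (i * h) (j * k)

theorem gnode_mem : gnode n m X Y h k α' β' e f ∈ nodeSpace n m := fun _ _ hij => if_pos hij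

theorem gnode_tr : gnode m n Y X k h (sw β') (sw α') (sw f) (sw e) = tr (gnode n m X Y h k α' β' e f) := by
  funext j i
  change _ = gnode n m X Y h k α' β' e f i j
  unfold gnode
  by_cases hc : i = 0 ∨ n ≤ i ∨ j = 0 ∨ m ≤ j
  · rw [if_pos hc, if_pos (by tauto)]
  · rw [if_neg hc, if_neg (by tauto), ← gfun_sw, ← Xf_sw]
    rfl

theorem l2_dy_parts {φ : ℕ → ℕ → ℝ} (hφ : φ ∈ nodeSpace n m) (hm : 1 ≤ m) (P : ℕ → ℕ → ℝ) :
    l2 n m P (dy k φ) = - l2 n m (fun i j => (P i j - P i (j - 1)) / k) φ := by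
  obtain ⟨q, rfl⟩ : ∃ q, m = q + 1 := ⟨m - 1, by omega⟩
  unfold l2
  rw [← sum_neg_distrib]
  refine sum_congr rfl fun i _ => ?_
  have h1 := sum_by_parts (P i) (φ i) q
  rw [hφ i 0 (by simp), hφ i (q + 1) (by simp)] at h1
  rw [sum_range_succ' (fun j => (P i j - P i (j - 1)) / k * φ i j)]
  have h2 : ∑ j ∈ range (q + 1), P i j * dy k φ i j
      = (∑ j ∈ range (q + 1), P i j * (φ i (j + 1) - φ i j)) / k := by
    rw [sum_div]
    exact sum_congr rfl fun j _ => by simp only [dy]; ring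
  rw [h2, h1, hφ i 0 (by simp)]
  simp only [Nat.add_sub_cancel, mul_zero, add_zero, zero_sub, sub_zero]
  rw [neg_div, sum_div]
  congr 1
  exact sum_congr rfl fun j _ => by ring

theorem l2_dx_parts {φ : ℕ → ℕ → ℝ} (hφ : φ ∈ nodeSpace n m) (hn : 1 ≤ n) (P : ℕ → ℕ → ℝ) :
    l2 n m P (dx h φ) = - l2 n m (fun i j => (P i j - P (i - 1) j) / h) φ := by
  have := l2_dy_parts (k := h) (tr_mem hφ) hn (tr P)
  rw [← l2_tr n m P, ← l2_tr n m _ φ]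
  exact this

/-- The time residual tested against discretely divergence-free fields. -/
theorem RE_weak (sα : Sm α') (sβ : Sm β') (se : Sm e) (sf : Sm f) (hh : 0 < h) (hk : 0 < k)
    (hn : 1 ≤ n) (hm : 1 ≤ m) {φ : ℕ → ℕ → ℝ} (hφ : φ ∈ nodeSpace n m) :
    l2 n m (REx n m X Y h k α' (fun x y => α' x y + 1 * e x y) (fun x y => β' x y + 1 * f x y)) (dy k φ)
      + l2 n m (tr (REx m n Y X k h (sw β') (sw fun x y => β' x y + 1 * f x y)
          (sw fun x y => α' x y + 1 * e x y))) (dx h φ)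
      = l2 n m (gnode n m X Y h k α' β' e f) φ := by
  rw [l2_dy_parts hφ hm, l2_dx_parts hφ hn, ← neg_add]
  simp only [l2, ← sum_add_distrib, ← sum_neg_distrib]
  refine sum_congr rfl fun i _ => sum_congr rfl fun j _ => ?_
  by_cases hc : i = 0 ∨ n ≤ i ∨ j = 0 ∨ m ≤ j
  · rw [hφ i j hc]; simp
  · have h1 := REx_diff (X := X) (Y := Y) (h := h) (b := fun x y => β' x y + 1 * f x y) sα se hk
      (n := n) (m := m) (i := i) (j := j) (by omega) (by omega) (by omega)
    have h2 := REx_diff (X := Y) (Y := X) (h := k) (b := sw fun x y => α' x y + 1 * e x y) sβ.sw sf.sw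
      hh (n := m) (m := n) (i := j) (j := i) (by omega) (by omega) (by omega)
    have h3 := Xf_sw (X := X) (Y := Y) (h := h) (k := k) (α := fun x y => α' x y + 1 * e x y)
      (β := fun x y => β' x y + 1 * f x y)
    change (tr (REx m n Y X k h (sw β') (sw fun x y => β' x y + 1 * f x y)
          (sw fun x y => α' x y + 1 * e x y)) i j - tr (REx m n Y X k h (sw β')
            (sw fun x y => β' x y + 1 * f x y) (sw fun x y => α' x y + 1 * e x y)) (i - 1) j) / h
      = crx k h (sw β') (j * k) (i * h) - d2 h (NS (sw f)) (j * k) (i * h)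
        - d2 h (Xf Y X k h (sw fun x y => β' x y + 1 * f x y) (sw fun x y => α' x y + 1 * e x y))
          (j * k) (i * h) at h2
    rw [h1, h2, h3, gnode, if_neg hc, gfun]
    ring

end TimeConsistency

section Poisson

variable {n m : ℕ} {X Y h k G : ℝ} {g : ℕ → ℕ → ℝ}

/-- Constant in the Poisson estimate. -/
def poissonC (X Y : ℝ) : ℝ := √(32 * (X + Y) * (1 + X ^ 2 + Y ^ 2))

theorem poisson_nrm_le (hX0 : 0 < X) (hY0 : 0 < Y) (hG : 0 ≤ G) {S : ℝ}
    (hS : S ≤ 32 * X * (G ^ 2 + Y ^ 2 * G ^ 2)) : √S ≤ poissonC X Y * G := by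
  rw [poissonC]
  have e : √(32 * (X + Y) * (1 + X ^ 2 + Y ^ 2)) * G
      = √(32 * (X + Y) * (1 + X ^ 2 + Y ^ 2) * G ^ 2) := by
    rw [sqrt_mul (by positivity) (G ^ 2), sqrt_sq hG]
  rw [e]
  refine sqrt_le_sqrt (hS.trans ?_)
  have : 32 * (X + Y) * (1 + X ^ 2 + Y ^ 2) * G ^ 2 - 32 * X * (G ^ 2 + Y ^ 2 * G ^ 2)
    = 32 * (X * X ^ 2 + Y * (1 + X ^ 2 + Y ^ 2)) * G ^ 2 := by ring
  have h2 : 0 ≤ 32 * (X * X ^ 2 + Y * (1 + X ^ 2 + Y ^ 2)) * G ^ 2 := by positivity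
  linarith

theorem exists_kappa (hh : 0 < h) (hk : 0 < k) (hX : n * h = X) (hY : m * k = Y) (hX0 : 0 < X)
    (hY0 : 0 < Y) (hG : 0 ≤ G) (hg : g ∈ nodeSpace n m) (hg0 : ∀ i j, |g i j| ≤ G)
    (hg1 : ∀ i j, 0 < j → j + 1 < m → |g i (j + 1) - g i j| ≤ k * G)
    (hg2 : ∀ i j, 0 < i → i + 1 < n → |g (i + 1) j - g i j| ≤ h * G) :
    ∃ κ ∈ nodeSpace n m, (∀ φ ∈ nodeSpace n m, Mf n m h k κ φ = h * k * l2 n m g φ) ∧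
      (∀ j < m, nrm n h (fun i => dx h (dy k κ) i j) ≤ poissonC X Y * G) ∧
      (∀ i < n, nrm m k (fun j => dx h (dy k κ) i j) ≤ poissonC X Y * G) := by
  let r : nodeSpace n m →ₗ[ℝ] ℝ :=
    { toFun := fun φ => h * k * l2 n m g φ.1
      map_add' := fun u v => by
        change h * k * l2 n m g (u.1 + v.1) = _
        rw [(l2_isForm n m).add_right]; ring
      map_smul' := fun c u => by
        change h * k * l2 n m g (c • u.1) = _
        rw [(l2_isForm n m).smul_right]
        simp only [RingHom.id_apply, smul_eq_mul]; ring }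
  obtain ⟨κ, hκ⟩ := exists_riesz (nM_isPos n m hh hk) r
  have hM : ∀ φ ∈ nodeSpace n m, Mf n m h k κ.1 φ = h * k * l2 n m g φ := fun φ hφ => hκ ⟨φ, hφ⟩
  have hst := poisson_strong hh hk hM
  refine ⟨κ.1, κ.2, hM, fun j hj => ?_, fun i hi => ?_⟩
  · have := poisson_row_bound hh hk κ.2 hg hst hg0 hg1 hj
    rw [hX, hY] at this
    exact poisson_nrm_le hX0 hY0 hG this
  · have := poisson_row_bound hk hh (tr_mem κ.2) (tr_mem hg)
      (fun j i hj0 hj hi0 hi => (add_comm _ _).trans (hst i j hi0 hi hj0 hj))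
      (fun j i => hg0 i j) (fun j i hi0 hi => hg2 i j hi0 hi) hi
    rw [hX, hY] at this
    have h2 := poisson_nrm_le hY0 hX0 hG this
    have e1 : poissonC Y X = poissonC X Y := by unfold poissonC; congr 1; ring
    rw [e1] at h2
    refine le_trans (le_of_eq ?_) h2
    unfold nrm
    congr 2
    exact sum_congr rfl fun j _ => by rw [dx_dy_comm]; rfl

end Poisson

section Density

variable {n m : ℕ} {X Y h k K₁ K₂ K₃ : ℝ} {α' β' e f : ℝ → ℝ → ℝ}

theorem gnode_le (sα : Sm α') (sβ : Sm β') (se : Sm e) (sf : Sm f) (hh : 0 < h) (hk : 0 < k)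
    (hX : n * h = X) (hY : m * k = Y) (hX0 : 0 < X) (hY0 : 0 < Y) (ca : CB X Y 4 K₁ α')
    (cb : CB X Y 4 K₁ β') (ce : CB X Y 4 K₂ e) (cf : CB X Y 4 K₂ f)
    (cZ : CB X Y 3 K₃ (Xf X Y h k (fun x y => α' x y + 1 * e x y) (fun x y => β' x y + 1 * f x y)))
    (i j : ℕ) :
    |gnode n m X Y h k α' β' e f i j| ≤ 3 * K₁ * (h ^ 2 + k ^ 2) + 2 * K₂ + 2 * K₃ := by
  have p1 := ca.nonneg hX0.le hY0.le
  have p2 := ce.nonneg hX0.le hY0.le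
  have p3 := cZ.nonneg hX0.le hY0.le
  unfold gnode
  split_ifs with hc
  · rw [abs_zero]; positivity
  · have i1 : (1 : ℝ) ≤ i := by exact_mod_cast (by omega : 1 ≤ i)
    have i2 : (i : ℝ) + 1 ≤ n := by exact_mod_cast (by omega : i + 1 ≤ n)
    have j1 : (1 : ℝ) ≤ j := by exact_mod_cast (by omega : 1 ≤ j)
    have j2 : (j : ℝ) + 1 ≤ m := by exact_mod_cast (by omega : j + 1 ≤ m)
    rw [abs_neg]
    exact gfun_le hh hk sα sβ se sf ((sα.lin se 1).Xf (sβ.lin sf 1))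
      (ca.mono le_rfl le_rfl (by norm_num) le_rfl) (cb.mono le_rfl le_rfl (by norm_num) le_rfl)
      (ce.mono le_rfl le_rfl (by norm_num) le_rfl) (cf.mono le_rfl le_rfl (by norm_num) le_rfl)
      (cZ.mono le_rfl le_rfl (by norm_num) le_rfl) (by nlinarith) (by rw [← hX]; nlinarith)
      (by nlinarith) (by rw [← hY]; nlinarith)

theorem gnode_diff_le (sα : Sm α') (sβ : Sm β') (se : Sm e) (sf : Sm f) (hh : 0 < h) (hk : 0 < k)
    (hX : n * h = X) (hY : m * k = Y) (hX0 : 0 < X) (hY0 : 0 < Y) (ca : CB X Y 4 K₁ α')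
    (cb : CB X Y 4 K₁ β') (ce : CB X Y 4 K₂ e) (cf : CB X Y 4 K₂ f)
    (cZ : CB X Y 3 K₃ (Xf X Y h k (fun x y => α' x y + 1 * e x y) (fun x y => β' x y + 1 * f x y)))
    (i j : ℕ) (hj0 : 0 < j) (hj : j + 1 < m) :
    |gnode n m X Y h k α' β' e f i (j + 1) - gnode n m X Y h k α' β' e f i j|
      ≤ k * (3 * K₁ * (h ^ 2 + k ^ 2) + 2 * K₂ + 2 * K₃) := by
  have p1 := ca.nonneg hX0.le hY0.le
  have p2 := ce.nonneg hX0.le hY0.le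
  have p3 := cZ.nonneg hX0.le hY0.le
  by_cases hc : i = 0 ∨ n ≤ i
  · rw [gnode_mem i j (by tauto), gnode_mem i (j + 1) (by tauto), sub_zero, abs_zero]
    positivity
  · have i1 : (1 : ℝ) ≤ i := by exact_mod_cast (by omega : 1 ≤ i)
    have i2 : (i : ℝ) + 1 ≤ n := by exact_mod_cast (by omega : i + 1 ≤ n)
    have j1 : (1 : ℝ) ≤ j := by exact_mod_cast (by omega : 1 ≤ j)
    have j2 : (j : ℝ) + 2 ≤ m := by exact_mod_cast (by omega : j + 2 ≤ m)
    have key := gfun_diff_le (x := i * h) (y := j * k) hh hk sα sβ se sf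
      ((sα.lin se 1).Xf (sβ.lin sf 1)) ca cb
      (ce.mono le_rfl le_rfl (by norm_num) le_rfl) (cf.mono le_rfl le_rfl (by norm_num) le_rfl)
      cZ (by nlinarith) (by rw [← hX]; nlinarith) (by nlinarith) (by rw [← hY]; nlinarith)
    have e1 : ((j + 1 : ℕ) : ℝ) * k = j * k + k := by push_cast; ring
    rw [gnode, if_neg (by omega), gnode, if_neg (by omega), e1, ← abs_neg]
    refine le_trans (le_of_eq ?_) key
    congr 1
    ring

end Density

section Flow

variable {n m : ℕ} {X Y h k μ τ K₁ K₂ K₃ : ℝ} {α β α₁ β₁ α' β' e f : ℝ → ℝ → ℝ}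

theorem exists_kappa_of_noSlip
    (H : NoSlip X Y (fun x y => α' x y + 1 * e x y) (fun x y => β' x y + 1 * f x y))
    (sα : Sm α') (sβ : Sm β') (se : Sm e) (sf : Sm f) (hh : 0 < h) (hk : 0 < k)
    (hX : n * h = X) (hY : m * k = Y) (hX0 : 0 < X) (hY0 : 0 < Y) (hn : 1 ≤ n) (hm : 1 ≤ m)
    (ca : CB X Y 4 K₁ α') (cb : CB X Y 4 K₁ β') (ce : CB X Y 4 K₂ e) (cf : CB X Y 4 K₂ f)
    (cZ : CB X Y 3 K₃ (Xf X Y h k (fun x y => α' x y + 1 * e x y) (fun x y => β' x y + 1 * f x y))) :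
    ∃ κ ∈ nodeSpace n m, (∀ φ ∈ nodeSpace n m, Mf n m h k κ φ = h * k *
      (l2 n m (REx n m X Y h k α' (fun x y => α' x y + 1 * e x y) (fun x y => β' x y + 1 * f x y)) (dy k φ)
      + l2 n m (tr (REx m n Y X k h (sw β') (sw fun x y => β' x y + 1 * f x y)
          (sw fun x y => α' x y + 1 * e x y))) (dx h φ))) ∧
      (∀ j < m, nrm n h (fun i => dx h (dy k κ) i j)
        ≤ poissonC X Y * (3 * K₁ * (h ^ 2 + k ^ 2) + 2 * K₂ + 2 * K₃)) ∧
      (∀ i < n, nrm m k (fun j => dx h (dy k κ) i j)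
        ≤ poissonC X Y * (3 * K₁ * (h ^ 2 + k ^ 2) + 2 * K₂ + 2 * K₃)) := by
  have hK₁ := ca.nonneg hX0.le hY0.le
  have hK₂ := ce.nonneg hX0.le hY0.le
  have hK₃ := cZ.nonneg hX0.le hY0.le
  have cZ' : CB Y X 3 K₃ (Xf Y X k h (fun x y => sw β' x y + 1 * sw f x y)
      (fun x y => sw α' x y + 1 * sw e x y)) := by
    have := cZ.sw (H.sa.Xf H.sb)
    rwa [← Xf_sw] at this
  obtain ⟨κ, hκ, hM, h1, h2⟩ := exists_kappa hh hk hX hY hX0 hY0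
    (G := 3 * K₁ * (h ^ 2 + k ^ 2) + 2 * K₂ + 2 * K₃) (by positivity)
    (gnode_mem (n := n) (m := m) (X := X) (Y := Y) (h := h) (k := k) (α' := α') (β' := β') (e := e) (f := f))
    (gnode_le sα sβ se sf hh hk hX hY hX0 hY0 ca cb ce cf cZ)
    (gnode_diff_le sα sβ se sf hh hk hX hY hX0 hY0 ca cb ce cf cZ)
    (fun i j hi0 hi => by
      have := gnode_diff_le sβ.sw sα.sw sf.sw se.sw hk hh hY hX hY0 hX0 (cb.sw sβ) (ca.sw sα)
        (cf.sw sf) (ce.sw se) cZ' j i hi0 hi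
      rw [gnode_tr, add_comm (k ^ 2)] at this
      exact this)
  refine ⟨κ, hκ, fun φ hφ => ?_, h1, h2⟩
  rw [hM φ hφ, RE_weak sα sβ se sf hh hk hn hm hφ]

theorem momLap_sub (ψ φ : ℕ → ℕ → ℝ) (i j : ℕ) :
    momLap n m h k (ψ - φ) i j = momLap n m h k ψ i j - momLap n m h k φ i j := by
  simp only [momLap, Lc, D2, dy_sub]
  split_ifs <;> ring

/-- A discrete pressure gradient is orthogonal to discretely divergence free fields. -/
theorem l2_pressure {φ : ℕ → ℕ → ℝ} (hφ : φ ∈ nodeSpace n m) (hn : 1 ≤ n) (hm : 1 ≤ m) (q : ℕ → ℕ → ℝ) :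
    l2 n m (fun i j => (q i j - q (i - 1) j) / h) (dy k φ)
      = l2 n m (fun i j => (q i j - q i (j - 1)) / k) (dx h φ) := by
  rw [l2_dy_parts hφ hm, l2_dx_parts hφ hn]
  congr 2
  funext i j
  ring

/-- Residual of the momentum equation for the discrete stream function of a smooth flow. -/
def R2 (n m : ℕ) (X Y h k : ℝ) (α β : ℝ → ℝ → ℝ) (i j : ℕ) : ℝ :=
  if 0 < i then momLap n m h k (Psi n m X Y h k α β) i j - AX h (lap α) (i * h) (j * k + k / 2) else 0

theorem step_weak (H₀ : NoSlip X Y α β) (H₁ : NoSlip X Y α₁ β₁)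
    (sα : Sm α') (sβ : Sm β') (se : Sm e) (sf : Sm f)
    (ea : ∀ x y, α₁ x y = α x y + τ * (α' x y + 1 * e x y))
    (eb : ∀ x y, β₁ x y = β x y + τ * (β' x y + 1 * f x y))
    (hh : 0 < h) (hk : 0 < k) (hτ : 0 < τ)
    (hX : n * h = X) (hY : m * k = Y) (hn : 1 ≤ n) (hm : 1 ≤ m)
    {ψ₁ ψ₀ q : ℕ → ℕ → ℝ}
    (hx : ∀ i j, 0 < i → i < n → j < m →
      dy k ψ₁ i j - dy k ψ₀ i j - τ * μ * momLap n m h k ψ₁ i j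
        = τ * (AX h α' (i * h) (j * k + k / 2) - μ * AX h (lap α₁) (i * h) (j * k + k / 2)
          - (q i j - q (i - 1) j) / h))
    (hy : ∀ i j, i < n → 0 < j → j < m →
      dx h ψ₁ i j - dx h ψ₀ i j - τ * μ * momLap m n k h (tr ψ₁) j i
        = τ * (AX k (sw β') (j * k) (i * h + h / 2) - μ * AX k (lap (sw β₁)) (j * k) (i * h + h / 2)
          + (q i j - q i (j - 1)) / k))
    {φ : ℕ → ℕ → ℝ} (hφ : φ ∈ nodeSpace n m) :
    Mf n m h k ((ψ₁ - Psi n m X Y h k α₁ β₁) - (ψ₀ - Psi n m X Y h k α β)) φ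
        + τ * μ * af n m h k (ψ₁ - Psi n m X Y h k α₁ β₁) φ
      = τ * (h * k * (l2 n m (REx n m X Y h k α' (fun x y => α' x y + 1 * e x y)
            (fun x y => β' x y + 1 * f x y)) (dy k φ)
          + l2 n m (tr (REx m n Y X k h (sw β') (sw fun x y => β' x y + 1 * f x y)
            (sw fun x y => α' x y + 1 * e x y))) (dx h φ))
        + μ * (h * k * (l2 n m (R2 n m X Y h k α₁ β₁) (dy k φ)
          + l2 n m (tr (R2 m n Y X k h (sw β₁) (sw α₁))) (dx h φ)))) := by
  have sA : Sm (fun x y => α' x y + 1 * e x y) := sα.lin se 1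
  have sB : Sm (fun x y => β' x y + 1 * f x y) := sβ.lin sf 1
  have ea' : α₁ = fun x y => α x y + τ * (fun x y => α' x y + 1 * e x y) x y :=
    funext fun x => funext fun y => ea x y
  have eb' : β₁ = fun x y => β x y + τ * (fun x y => β' x y + 1 * f x y) x y :=
    funext fun x => funext fun y => eb x y
  obtain ⟨A, hA⟩ : ∃ A, A = fun x y => α' x y + 1 * e x y := ⟨_, rfl⟩
  obtain ⟨B, hB⟩ : ∃ B, B = fun x y => β' x y + 1 * f x y := ⟨_, rfl⟩
  rw [← hA] at ea' sA
  rw [← hB] at eb' sB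
  rw [← hA, ← hB]
  have hAB : NoSlip X Y A B := by
    rw [ea', eb'] at H₁
    exact H₁.of_lin H₀ hτ.ne' sA sB
  have hP : ∀ i j, Psi n m X Y h k α₁ β₁ i j
      = Psi n m X Y h k α β i j + τ * Psi n m X Y h k A B i j := by
    rw [ea', eb']
    exact Psi_lin H₀.sa H₀.sb sA sB X Y h k τ
  have hPy : ∀ i j, dy k (Psi n m X Y h k α₁ β₁) i j
      = dy k (Psi n m X Y h k α β) i j + τ * dy k (Psi n m X Y h k A B) i j := fun i j => by
    simp only [dy, hP]; ring
  have hPx : ∀ i j, dx h (Psi n m X Y h k α₁ β₁) i j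
      = dx h (Psi n m X Y h k α β) i j + τ * dx h (Psi n m X Y h k A B) i j := fun i j => by
    simp only [dx, hP]; ring
  have t1 := H₁.Psi_tr hh hk hX hY
  have t2 := hAB.Psi_tr hh hk hX hY
  rw [weak_of_strong hn hm hφ
    (Ax := fun i j => 1 * (fun i j => REx n m X Y h k α' A B i j - (q i j - q (i - 1) j) / h) i j
      - -(μ * R2 n m X Y h k α₁ β₁ i j))
    (Ay := fun i j => 1 * (fun i j => tr (REx m n Y X k h (sw β') (sw B) (sw A)) i j
        - -((q i j - q i (j - 1)) / k)) i j - -(μ * tr (R2 m n Y X k h (sw β₁) (sw α₁)) i j))]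
  · have c1 : ∀ (P Q R : ℕ → ℕ → ℝ) (v : ℕ → ℕ → ℝ), l2 n m (fun i j => 1 * (fun i j => P i j - Q i j) i j
        - -(μ * R i j)) v = l2 n m P v - l2 n m Q v + μ * l2 n m R v := fun P Q R v => by
      simp only [l2, mul_sum, ← sum_sub_distrib, ← sum_add_distrib]
      refine sum_congr rfl fun i _ => sum_congr rfl fun j _ => by ring
    have c2 : ∀ (P v : ℕ → ℕ → ℝ), l2 n m (fun i j => -(P i j)) v = - l2 n m P v := fun P v => by
      simp [l2]
    rw [c1, c1, c2, l2_pressure hφ hn hm]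
    ring
  · intro i j hi0 hi hj
    have e1 := hx i j hi0 hi hj
    dsimp only
    rw [dy_sub, dy_sub, momLap_sub, hPy, R2, if_pos hi0, REx]
    linear_combination e1
  · intro i j hi hj0 hj
    have e1 := hy i j hi hj0 hj
    have e2 : tr (REx m n Y X k h (sw β') (sw B) (sw A)) i j
        = AX k (sw β') (j * k) (i * h + h / 2) - dx h (Psi n m X Y h k A B) i j := by
      change REx m n Y X k h (sw β') (sw B) (sw A) j i = _
      rw [REx, t2, dy_tr]
    have e3 : tr (R2 m n Y X k h (sw β₁) (sw α₁)) i j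
        = momLap m n k h (tr (Psi n m X Y h k α₁ β₁)) j i
          - AX k (lap (sw β₁)) (j * k) (i * h + h / 2) := by
      change R2 m n Y X k h (sw β₁) (sw α₁) j i = _
      rw [R2, if_pos hj0, t1]
    have e4 : tr (ψ₁ - Psi n m X Y h k α₁ β₁) = tr ψ₁ - tr (Psi n m X Y h k α₁ β₁) := rfl
    dsimp only
    rw [dx_sub, dx_sub, e4, momLap_sub, hPx, e2, e3]
    linear_combination e1

end Flow

section FlowError

variable {n m N : ℕ} {X Y h k μ τ T M B : ℝ}

theorem Psi_eq_zero {α β : ℝ → ℝ → ℝ} (H : NoSlip X Y α β) (ca : CB X Y 4 0 α) (cb : CB X Y 4 0 β)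
    (hh : 0 < h) (hk : 0 < k) (hX : n * h = X) (hY : m * k = Y) (hX0 : 0 < X) (hY0 : 0 < Y)
    (hB : 1 ≤ B) (hsX : SpBound X B) (hsY : SpBound Y B) : Psi n m X Y h k α β = 0 := by
  funext i j
  rw [Psi]
  split_ifs with hij
  · have hx := node_mem hh hX hij.1
    have hy := node_mem hk hY hij.2
    have h1 := (CB.Xf (h := h) (k := k) H.sa H.sb ca cb hX0 hY0 hB hsX hsY).bd hx hy
    rw [mul_zero] at h1
    have h2 : NS α (i * h) (j * k) = 0 := by
      rw [NS, intervalIntegral.integral_congr (g := fun _ => 0), intervalIntegral.integral_zero]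
      intro s hs
      rw [Set.uIcc_of_le hy.1] at hs
      exact abs_nonpos_iff.1 (ca.bd hx ⟨hs.1, hs.2.trans hy.2⟩)
    rw [PsiC, h2, abs_nonpos_iff.1 h1]
    simp
  · rfl

/-- The discrete velocity of the corrected stream function is second order accurate. -/
theorem NoSlip.dy_Psi_le {α β : ℝ → ℝ → ℝ} (H : NoSlip X Y α β) (ca : CB X Y 4 M α) (cb : CB X Y 4 M β)
    (hh : 0 < h) (hk : 0 < k) (hX : n * h = X) (hY : m * k = Y) (hX0 : 0 < X) (hY0 : 0 < Y)
    (hB : 1 ≤ B) (hsX : SpBound X B) (hsY : SpBound Y B) {i j : ℕ} (hi : i ≤ n) (hj : j < m) :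
    |dy k (Psi n m X Y h k α β) i j - α (i * h) (j * k + k / 2)| ≤ (1 + B) * M * (h ^ 2 + k ^ 2) := by
  have hM := ca.nonneg hX0.le hY0.le
  have hx := node_mem hh hX hi
  have hy := node_mem hk hY hj.le
  have hy1 := node_mem hk hY (i := j + 1) hj
  have ey : ((j + 1 : ℕ) : ℝ) * k = j * k + k := by push_cast; ring
  have hI : ∀ y ∈ Set.Icc ((j : ℝ) * k) (j * k + k), y ∈ Set.Icc 0 Y := fun y h =>
    ⟨hy.1.trans h.1, h.2.trans (ey ▸ hy1.2)⟩
  have cX := CB.Xf (h := h) (k := k) H.sa H.sb ca cb hX0 hY0 hB hsX hsY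
  have sX : Sm (Xf X Y h k α β) := H.sa.Xf H.sb
  have h1 := AX_sub_le (x := j * k + k / 2) (y := i * h) (K := M) H.sa.sw hk fun s hs => by
    have hs' : s ∈ Set.Icc 0 Y := hI s ⟨by linarith [hs.1], by linarith [hs.2]⟩
    rw [pd_sw H.sa]
    exact ca 0 2 (by norm_num) _ hx _ hs'
  have h2 := first_diff_le (f := fun r y => pd 0 r (Xf X Y h k α β) (i * h) y) (a := j * k) hk
    (fun y _ => sX.hasDerivAt_y _ y)
    (fun y hy => cX 0 1 (by norm_num) _ hx _ (hI y hy))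
  have e1 : dy k (Psi n m X Y h k α β) i j
      = AX k (RMACProof.sw α) (j * k + k / 2) (i * h)
        + (Xf X Y h k α β (i * h) (j * k + k) - Xf X Y h k α β (i * h) (j * k)) / k := by
    rw [← NS_sub H.sa, dy, Psi_eq hi hj, Psi_eq hi hj.le, PsiC, PsiC, ey]
    ring
  rw [e1]
  change |AX k (RMACProof.sw α) (j * k + k / 2) (i * h) - α (i * h) (j * k + k / 2)| ≤ _ at h1
  change |(Xf X Y h k α β (i * h) (j * k + k) - Xf X Y h k α β (i * h) (j * k)) / k| ≤ _ at h2
  have h3 : 0 ≤ M * h ^ 2 := by positivity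
  rw [abs_le] at *
  constructor <;> nlinarith

/-- Time levels of a smooth no-slip flow with small time-stepping residuals `e`, `f`. -/
structure ExactFlow (X Y τ M : ℝ) (N : ℕ) (α β α' β' e f : ℕ → ℝ → ℝ → ℝ) : Prop where
  ns : ∀ s, NoSlip X Y (α s) (β s)
  za : CB X Y 4 0 (α 0)
  zb : CB X Y 4 0 (β 0)
  sa : ∀ s, Sm (α' s)
  sb : ∀ s, Sm (β' s)
  se : ∀ s, Sm (e s)
  sf : ∀ s, Sm (f s)
  ca : ∀ s, CB X Y 4 M (α s)
  cb : ∀ s, CB X Y 4 M (β s)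
  ca' : ∀ s < N, CB X Y 4 M (α' s)
  cb' : ∀ s < N, CB X Y 4 M (β' s)
  ce : ∀ s < N, CB X Y 4 (τ * M) (e s)
  cf : ∀ s < N, CB X Y 4 (τ * M) (f s)
  ea : ∀ s < N, ∀ x y, α (s + 1) x y = α s x y + τ * (α' s x y + 1 * e s x y)
  eb : ∀ s < N, ∀ x y, β (s + 1) x y = β s x y + τ * (β' s x y + 1 * f s x y)

/-- Constant of the velocity error estimate. -/
def flowC (X Y T B : ℝ) : ℝ :=
  (stabSmall X Y T + stabLarge X Y) * ((1 + poissonC X Y) * (5 + 5 * B * (1 + T))) + (1 + B)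

theorem flow_error {α β α' β' e f : ℕ → ℝ → ℝ → ℝ} (E : ExactFlow X Y τ M N α β α' β' e f)
    (hh : 0 < h) (hk : 0 < k) (hτ : 0 < τ) (hμ : 0 < μ) (hX : n * h = X) (hY : m * k = Y)
    (hX0 : 0 < X) (hY0 : 0 < Y) (hn : 2 ≤ n) (hm : 2 ≤ m) (hT : 0 ≤ T) (hNT : N * τ ≤ T)
    (hB : 1 ≤ B) (hsX : SpBound X B) (hsY : SpBound Y B) {ψ q : ℕ → ℕ → ℕ → ℝ}
    (hψ : ∀ s, ψ s ∈ nodeSpace n m) (hψ0 : ψ 0 = 0)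
    (hx : ∀ s < N, ∀ i j, 0 < i → i < n → j < m →
      dy k (ψ (s + 1)) i j - dy k (ψ s) i j - τ * μ * momLap n m h k (ψ (s + 1)) i j
        = τ * (AX h (α' s) (i * h) (j * k + k / 2) - μ * AX h (lap (α (s + 1))) (i * h) (j * k + k / 2)
          - (q s i j - q s (i - 1) j) / h))
    (hy : ∀ s < N, ∀ i j, i < n → 0 < j → j < m →
      dx h (ψ (s + 1)) i j - dx h (ψ s) i j - τ * μ * momLap m n k h (tr (ψ (s + 1))) j i
        = τ * (AX k (sw (β' s)) (j * k) (i * h + h / 2)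
          - μ * AX k (lap (sw (β (s + 1)))) (j * k) (i * h + h / 2)
          + (q s i j - q s i (j - 1)) / k))
    {r : ℕ} (hr : r ≤ N) :
    (∀ i j, i ≤ n → j < m →
      |dy k (ψ r) i j - α r (i * h) (j * k + k / 2)| ≤ flowC X Y T B * M * (h ^ 2 + k ^ 2 + τ)) ∧
    (∀ i j, i < n → j ≤ m →
      |dx h (ψ r) i j - β r (i * h + h / 2) (j * k)| ≤ flowC X Y T B * M * (h ^ 2 + k ^ 2 + τ)) := by
  have hM : 0 ≤ M := (E.ca 0).nonneg hX0.le hY0.le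
  obtain ⟨D, hD⟩ : ∃ D, D = h ^ 2 + k ^ 2 + τ := ⟨_, rfl⟩
  have hD0 : 0 ≤ D := by rw [hD]; positivity
  have hP0 : 0 ≤ poissonC X Y := sqrt_nonneg _
  have hB0 : 0 ≤ B := by linarith
  have hs1 : 0 ≤ stabSmall X Y T := by unfold stabSmall; positivity
  have hs2 : 0 ≤ stabLarge X Y := by unfold stabLarge; positivity
  obtain ⟨K, hK⟩ : ∃ K, K = (1 + poissonC X Y) * (5 + 5 * B * (1 + T)) * M * D := ⟨_, rfl⟩
  have hK0 : 0 ≤ K := by rw [hK]; positivity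
  have hτT : 1 ≤ N → τ ≤ T := fun h => by
    have : (1 : ℝ) ≤ N := by exact_mod_cast h
    nlinarith
  have hhk : h ^ 2 + k ^ 2 ≤ D := by rw [hD]; linarith
  have hτD : τ ≤ D := by rw [hD]; nlinarith [sq_nonneg h, sq_nonneg k]
  have hMD : 0 ≤ M * D := mul_nonneg hM hD0
  have hres : 3 * M * (h ^ 2 + k ^ 2) + 3 * ((h ^ 2 + k ^ 2) * B * M) ≤ K := by
    have a1 : M * (h ^ 2 + k ^ 2) ≤ M * D := mul_le_mul_of_nonneg_left hhk hM
    have a2 := mul_le_mul_of_nonneg_left a1 hB0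
    have a3 : 0 ≤ poissonC X Y * ((5 + 5 * B * (1 + T)) * (M * D)) := by positivity
    have a4 : 0 ≤ B * T * (M * D) := by positivity
    have a5 : 0 ≤ B * (M * D) := by positivity
    rw [hK]
    linarith
  have hpo : 1 ≤ N → poissonC X Y * (3 * M * (h ^ 2 + k ^ 2) + 2 * (τ * M)
      + 2 * ((h ^ 2 + k ^ 2) * B * (M + |1| * (τ * M)))) ≤ K := fun hN => by
    have a1 : M * (h ^ 2 + k ^ 2) ≤ M * D := mul_le_mul_of_nonneg_left hhk hM
    have a2 : M * τ ≤ M * D := mul_le_mul_of_nonneg_left hτD hM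
    have a3 : (1 + τ) * (M * (h ^ 2 + k ^ 2)) ≤ (1 + T) * (M * D) :=
      mul_le_mul (by linarith [hτT hN]) a1 (by positivity) (by positivity)
    have a4 := mul_le_mul_of_nonneg_left a3 hB0
    have a5 : 0 ≤ B * ((1 + T) * (M * D)) := by positivity
    have a6 : 3 * M * (h ^ 2 + k ^ 2) + 2 * (τ * M) + 2 * ((h ^ 2 + k ^ 2) * B * (M + |1| * (τ * M)))
        ≤ (5 + 5 * B * (1 + T)) * M * D := by
      rw [abs_one]; linarith
    have a7 := mul_le_mul_of_nonneg_left a6 hP0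
    have a8 : 0 ≤ (5 + 5 * B * (1 + T)) * M * D := by positivity
    rw [hK]; linarith
  have hex : ∀ s, ∃ κ ∈ nodeSpace n m, s < N → ((∀ φ ∈ nodeSpace n m, Mf n m h k κ φ = h * k *
      (l2 n m (REx n m X Y h k (α' s) (fun x y => α' s x y + 1 * e s x y)
          (fun x y => β' s x y + 1 * f s x y)) (dy k φ)
      + l2 n m (tr (REx m n Y X k h (sw (β' s)) (sw fun x y => β' s x y + 1 * f s x y)
          (sw fun x y => α' s x y + 1 * e s x y))) (dx h φ))) ∧
      (∀ j < m, nrm n h (fun i => dx h (dy k κ) i j) ≤ K) ∧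
      (∀ i < n, nrm m k (fun j => dx h (dy k κ) i j) ≤ K)) := by
    intro s
    by_cases hs : s < N
    · have H : NoSlip X Y (fun x y => α' s x y + 1 * e s x y) (fun x y => β' s x y + 1 * f s x y) := by
        have h1 := E.ns (s + 1)
        rw [show α (s + 1) = fun x y => α s x y + τ * (fun x y => α' s x y + 1 * e s x y) x y from
            funext fun x => funext fun y => E.ea s hs x y,
          show β (s + 1) = fun x y => β s x y + τ * (fun x y => β' s x y + 1 * f s x y) x y from
            funext fun x => funext fun y => E.eb s hs x y] at h1
        exact h1.of_lin (E.ns s) hτ.ne' ((E.sa s).lin (E.se s) 1) ((E.sb s).lin (E.sf s) 1)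
      have cZ := CB.Xf (h := h) (k := k) H.sa H.sb
        ((E.ca' s hs).lin (E.ce s hs) (E.sa s) (E.se s) 1)
        ((E.cb' s hs).lin (E.cf s hs) (E.sb s) (E.sf s) 1) hX0 hY0 hB hsX hsY
      obtain ⟨κ, hκ, h1, h2, h3⟩ := exists_kappa_of_noSlip H (E.sa s) (E.sb s) (E.se s) (E.sf s) hh hk hX hY
        hX0 hY0 (by omega) (by omega) (E.ca' s hs) (E.cb' s hs) (E.ce s hs) (E.cf s hs) cZ
      have hN : 1 ≤ N := by omega
      exact ⟨κ, hκ, fun _ => ⟨h1, fun j hj => (h2 j hj).trans (hpo hN),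
        fun i hi => (h3 i hi).trans (hpo hN)⟩⟩
    · exact ⟨0, zero_mem _, fun h => absurd h hs⟩
  choose κ hκ hκs using hex
  have hw : WeakFlow n m h k μ τ K N (fun s => ψ s - Psi n m X Y h k (α s) (β s)) (fun s => κ (s - 1))
      (fun s => R2 n m X Y h k (α s) (β s)) (fun s => tr (R2 m n Y X k h (sw (β s)) (sw (α s)))) := by
    refine ⟨fun s => sub_mem (hψ s) ((E.ns s).Psi_mem hh hk hX hY hX0 hY0), ?_, fun s => hκ _, ?_, ?_, ?_,
      fun s hs => (hκs s hs).2.1, fun s hs => (hκs s hs).2.2⟩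
    · simp only [hψ0, Psi_eq_zero (E.ns 0) E.za E.zb hh hk hX hY hX0 hY0 hB hsX hsY, sub_zero]
    · intro s hs φ hφ
      simp only [Nat.add_sub_cancel]
      rw [step_weak (E.ns s) (E.ns (s + 1)) (E.sa s) (E.sb s) (E.se s) (E.sf s) (E.ea s hs) (E.eb s hs)
        hh hk hτ hX hY (by omega) (by omega) (hx s hs) (hy s hs) hφ, (hκs s hs).1 φ hφ]
    · intro s hs i hi j hj
      rw [R2]
      split_ifs with hi0
      · exact ((E.ns (s + 1)).momLap_le hh hk hX hY hX0 hY0 hm (E.ca _)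
          (CB.Xf (E.ns (s + 1)).sa (E.ns (s + 1)).sb (E.ca _) (E.cb _) hX0 hY0 hB hsX hsY) hi0 hi hj).trans hres
      · rw [abs_zero]; exact hK0
    · intro s hs i hi j hj
      change |R2 m n Y X k h (sw (β (s + 1))) (sw (α (s + 1))) j i| ≤ K
      rw [R2]
      have H := (E.ns (s + 1)).sw
      split_ifs with hi0
      · refine (H.momLap_le hk hh hY hX hY0 hX0 hn ((E.cb _).sw (E.ns (s + 1)).sb)
          (CB.Xf H.sa H.sb ((E.cb _).sw (E.ns (s + 1)).sb)
            ((E.ca _).sw (E.ns (s + 1)).sa) hY0 hX0 hB hsY hsX) hi0 hj hi).trans ?_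
        rw [add_comm (k ^ 2)]; exact hres
      · rw [abs_zero]; exact hK0
  obtain ⟨s1, s2⟩ := stability (by omega) (by omega) hh hk hτ hμ hK0 hX hY hX0 hY0 hT hNT hw hr
  have hfin : (stabSmall X Y T + stabLarge X Y) * K + (1 + B) * M * (h ^ 2 + k ^ 2)
      ≤ flowC X Y T B * M * (h ^ 2 + k ^ 2 + τ) := by
    rw [← hD, flowC, hK]
    have a1 : (1 + B) * M * (h ^ 2 + k ^ 2) ≤ (1 + B) * M * D :=
      mul_le_mul_of_nonneg_left hhk (by positivity)
    linarith
  have H := E.ns r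
  refine ⟨fun i j hi hj => ?_, fun i j hi hj => ?_⟩
  · have b1 := s1 i j hi hj
    have b2 := H.dy_Psi_le (E.ca r) (E.cb r) hh hk hX hY hX0 hY0 hB hsX hsY hi hj
    rw [dy_sub] at b1
    have b3 := abs_add_le (dy k (ψ r) i j - dy k (Psi n m X Y h k (α r) (β r)) i j)
      (dy k (Psi n m X Y h k (α r) (β r)) i j - α r (i * h) (j * k + k / 2))
    rw [sub_add_sub_cancel] at b3
    linarith
  · have b1 := s2 i j hi hj
    have b2 := H.sw.dy_Psi_le ((E.cb r).sw H.sb) ((E.ca r).sw H.sa) hk hh hY hX hY0 hX0 hB hsY hsX hj hi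
    rw [H.Psi_tr hh hk hX hY, dy_tr] at b2
    change |dx h (Psi n m X Y h k (α r) (β r)) i j - β r (i * h + h / 2) (j * k)| ≤ _ at b2
    rw [dx_sub] at b1
    have b3 := abs_add_le (dx h (ψ r) i j - dx h (Psi n m X Y h k (α r) (β r)) i j)
      (dx h (Psi n m X Y h k (α r) (β r)) i j - β r (i * h + h / 2) (j * k))
    rw [sub_add_sub_cancel] at b3
    linarith

end FlowError

section SpaceTime

variable {f ux uy p gx gy : ℝ → ℝ → ℝ → ℝ} {X Y T M μ t t₀ t₁ τ : ℝ}

/-- Time slice of a function of `(x, y, t)`. -/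
def sl (f : ℝ → ℝ → ℝ → ℝ) (t : ℝ) : ℝ → ℝ → ℝ := fun x y => f x y t

/-- Pointwise negation. -/
def ng (f : ℝ → ℝ → ℝ → ℝ) : ℝ → ℝ → ℝ → ℝ := fun x y t => -f x y t

theorem smooth_iff : Smooth f ↔ ContDiff ℝ ((⊤ : ℕ∞) : WithTop ℕ∞) (fun q : ℝ × ℝ × ℝ => f q.1 q.2.1 q.2.2) :=
  contDiff_infty.symm

theorem smooth_slice_t (hf : Smooth f) (t : ℝ) : Sm (sl f t) :=
  (smooth_iff.1 hf).comp (contDiff_fst.prodMk (contDiff_snd.prodMk contDiff_const))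

theorem smooth_slice_y (hf : Smooth f) (y : ℝ) : Sm (fun x t => f x y t) :=
  (smooth_iff.1 hf).comp (contDiff_fst.prodMk (contDiff_const.prodMk contDiff_snd))

theorem smooth_slice_x (hf : Smooth f) (x : ℝ) : Sm (fun y t => f x y t) :=
  (smooth_iff.1 hf).comp (contDiff_const.prodMk (contDiff_fst.prodMk contDiff_snd))

theorem smooth_ng (hf : Smooth f) : Smooth (ng f) := smooth_iff.2 (smooth_iff.1 hf).neg

theorem smooth_pdx (hf : Smooth f) : Smooth (pdx f) := by
  have h := smooth_iff.1 hf
  refine smooth_iff.2 ?_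
  have : (fun q : ℝ × ℝ × ℝ => pdx f q.1 q.2.1 q.2.2)
      = fun q => fderiv ℝ (fun q : ℝ × ℝ × ℝ => f q.1 q.2.1 q.2.2) q (1, 0, 0) := funext fun q => by
    have h1 : HasFDerivAt (fun q : ℝ × ℝ × ℝ => f q.1 q.2.1 q.2.2) _ (q.1, q.2.1, q.2.2) :=
      (h.differentiable (by simp) _).hasFDerivAt
    have h2 : HasDerivAt (fun s : ℝ => (s, q.2.1, q.2.2)) ((1 : ℝ), (0 : ℝ), (0 : ℝ)) q.1 :=
      (hasDerivAt_id q.1).prodMk (hasDerivAt_const q.1 (q.2.1, q.2.2))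
    exact (HasFDerivAt.comp_hasDerivAt (f := fun s : ℝ => (s, q.2.1, q.2.2)) q.1 h1 h2).deriv
  rw [this]
  exact (h.fderiv_right (m := ((⊤ : ℕ∞) : WithTop ℕ∞)) (by simp)).clm_apply contDiff_const

theorem smooth_pdy (hf : Smooth f) : Smooth (pdy f) := by
  have h1 : Smooth (fun y x t => f x y t) := smooth_iff.2 ((smooth_iff.1 hf).comp
    ((contDiff_fst.comp contDiff_snd).prodMk (contDiff_fst.prodMk (contDiff_snd.comp contDiff_snd))))
  exact smooth_iff.2 ((smooth_iff.1 (smooth_pdx h1)).comp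
    ((contDiff_fst.comp contDiff_snd).prodMk (contDiff_fst.prodMk (contDiff_snd.comp contDiff_snd))))

theorem smooth_pdt (hf : Smooth f) : Smooth (pdt f) := by
  have h1 : Smooth (fun t y x => f x y t) := smooth_iff.2 ((smooth_iff.1 hf).comp
    ((contDiff_snd.comp contDiff_snd).prodMk ((contDiff_fst.comp contDiff_snd).prodMk contDiff_fst)))
  exact smooth_iff.2 ((smooth_iff.1 (smooth_pdx h1)).comp
    ((contDiff_snd.comp contDiff_snd).prodMk ((contDiff_fst.comp contDiff_snd).prodMk contDiff_fst)))

theorem smooth_iter (hf : Smooth f) (a b : ℕ) : Smooth (pdx^[a] (pdy^[b] f)) := by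
  have h1 : Smooth (pdy^[b] f) := by
    induction b with
    | zero => exact hf
    | succ b ih => rw [Function.iterate_succ_apply']; exact smooth_pdy ih
  induction a with
  | zero => exact h1
  | succ a ih => rw [Function.iterate_succ_apply']; exact smooth_pdx ih

theorem pdx_pdt (hf : Smooth f) : pdx (pdt f) = pdt (pdx f) := by
  funext x y t
  exact congrFun (congrFun (px_py_comm (smooth_slice_y hf y)) x) t

theorem pdy_pdt (hf : Smooth f) : pdy (pdt f) = pdt (pdy f) := by
  funext x y t
  exact congrFun (congrFun (px_py_comm (smooth_slice_x hf x)) y) t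

theorem iter_pdt (hf : Smooth f) (a b : ℕ) : pdx^[a] (pdy^[b] (pdt f)) = pdt (pdx^[a] (pdy^[b] f)) := by
  have h1 : pdy^[b] (pdt f) = pdt (pdy^[b] f) := by
    induction b with
    | zero => rfl
    | succ b ih =>
      rw [Function.iterate_succ_apply', Function.iterate_succ_apply', ih, pdy_pdt]
      exact smooth_iter hf 0 b
  rw [h1]
  induction a with
  | zero => rfl
  | succ a ih =>
    rw [Function.iterate_succ_apply', Function.iterate_succ_apply', ih, pdx_pdt (smooth_iter hf a b)]

theorem pd_sl (f : ℝ → ℝ → ℝ → ℝ) (t : ℝ) (a b : ℕ) : pd a b (sl f t) = sl (pdx^[a] (pdy^[b] f)) t := by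
  have h1 : py^[b] (sl f t) = sl (pdy^[b] f) t := by
    induction b generalizing f with
    | zero => rfl
    | succ b ih => exact ih (pdy f)
  rw [pd, h1]
  generalize pdy^[b] f = g
  induction a generalizing g with
  | zero => rfl
  | succ a ih => exact ih (pdx g)

theorem pdx_ng (f : ℝ → ℝ → ℝ → ℝ) : pdx (ng f) = ng (pdx f) :=
  funext fun _ => funext fun _ => funext fun _ => deriv.fun_neg

theorem pdy_ng (f : ℝ → ℝ → ℝ → ℝ) : pdy (ng f) = ng (pdy f) :=
  funext fun _ => funext fun _ => funext fun _ => deriv.fun_neg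

theorem pdt_ng (f : ℝ → ℝ → ℝ → ℝ) : pdt (ng f) = ng (pdt f) :=
  funext fun _ => funext fun _ => funext fun _ => deriv.fun_neg

theorem sobBound_ng {a b : ℕ} (h : SobBound a b f X Y T M) : SobBound a b (ng f) X Y T M := by
  have key : ∀ (D : (ℝ → ℝ → ℝ → ℝ) → ℝ → ℝ → ℝ → ℝ), (∀ f, D (ng f) = ng (D f)) →
      ∀ (r : ℕ) f, D^[r] (ng f) = ng (D^[r] f) := fun D hD r => by
    induction r with
    | zero => intro f; rfl
    | succ r ih => intro f; rw [Function.iterate_succ_apply, hD, ih, Function.iterate_succ_apply]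
  intro a' b' c' ha hbc x y t hx hy ht
  rw [key pdy pdy_ng, key pdx pdx_ng, key pdt pdt_ng, ng, abs_neg]
  exact h a' b' c' ha hbc x y t hx hy ht

theorem cb_sl (h : SobBound 2 4 f X Y T M) (ht : t ∈ Set.Icc 0 T) : CB X Y 4 M (sl f t) :=
  fun a b hab x hx y hy => by
    rw [pd_sl]
    exact h 0 a b (by norm_num) hab x y t hx hy ht

theorem cb_sl_pdt (hf : Smooth f) (h : SobBound 2 4 f X Y T M) (ht : t ∈ Set.Icc 0 T) :
    CB X Y 4 M (sl (pdt f) t) := fun a b hab x hx y hy => by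
  rw [pd_sl, iter_pdt hf]
  exact h 1 a b (by norm_num) hab x y t hx hy ht

/-- Residual of the backward difference quotient in time. -/
def eres (f : ℝ → ℝ → ℝ → ℝ) (τ t₀ t₁ : ℝ) : ℝ → ℝ → ℝ := fun x y =>
  sl (pdt f) t₁ x y + τ⁻¹ * (fun x y => (fun x y => sl f t₁ x y + (-1) * sl f t₀ x y) x y
    + (-2 * τ) * sl (pdt f) t₁ x y) x y

theorem sm_eres (hf : Smooth f) (τ t₀ t₁ : ℝ) : Sm (eres f τ t₀ t₁) :=
  (smooth_slice_t (smooth_pdt hf) t₁).lin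
    (((smooth_slice_t hf t₁).lin (smooth_slice_t hf t₀) (-1)).lin
      (smooth_slice_t (smooth_pdt hf) t₁) (-2 * τ)) τ⁻¹

theorem eres_eq (hτ : τ ≠ 0) (x y : ℝ) :
    sl f t₁ x y = sl f t₀ x y + τ * (sl (pdt f) t₁ x y + 1 * eres f τ t₀ t₁ x y) := by
  simp only [eres]
  field_simp
  ring

theorem backward_diff_le {g g' g'' : ℝ → ℝ} {a b K : ℝ} (hab : a < b)
    (h1 : ∀ t, HasDerivAt g (g' t) t) (h2 : ∀ t, HasDerivAt g' (g'' t) t)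
    (hK : ∀ t ∈ Set.Icc a b, |g'' t| ≤ K) : |(g b - g a) / (b - a) - g' b| ≤ (b - a) * K := by
  obtain ⟨ξ, hξ, e⟩ := exists_hasDerivAt_eq_slope g g' hab
    (fun t _ => (h1 t).continuousAt.continuousWithinAt) fun t _ => h1 t
  rw [← e]
  have h3 := (convex_Icc a b).norm_image_sub_le_of_norm_hasDerivWithin_le (f := g') (f' := g'') (C := K)
    (fun t _ => (h2 t).hasDerivWithinAt) hK (Set.right_mem_Icc.2 hab.le) ⟨hξ.1.le, hξ.2.le⟩
  rw [norm_eq_abs, norm_eq_abs] at h3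
  refine h3.trans ?_
  have hK0 : 0 ≤ K := (abs_nonneg _).trans (hK b (Set.right_mem_Icc.2 hab.le))
  rw [mul_comm]
  refine mul_le_mul_of_nonneg_right ?_ hK0
  rw [abs_le]
  constructor <;> linarith [hξ.1, hξ.2]

theorem cb_eres (hf : Smooth f) (h : SobBound 2 4 f X Y T M) (h0 : 0 ≤ t₀) (hτ : 0 < τ) (h1 : t₁ = t₀ + τ)
    (hT : t₁ ≤ T) : CB X Y 4 (τ * M) (eres f τ t₀ t₁) := fun a b hab x hx y hy => by
  have s0 := smooth_slice_t hf t₀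
  have s1 := smooth_slice_t hf t₁
  have s2 := smooth_slice_t (smooth_pdt hf) t₁
  obtain ⟨g, hg⟩ : ∃ g, g = pdx^[a] (pdy^[b] f) := ⟨_, rfl⟩
  have sg : Smooth g := hg ▸ smooth_iter hf a b
  have e1 : pd a b (eres f τ t₀ t₁) x y = (g x y t₁ - g x y t₀) / (t₁ - t₀) - pdt g x y t₁ := by
    unfold eres
    rw [pd_lin s2 ((s1.lin s0 (-1)).lin s2 (-2 * τ)), pd_lin (s1.lin s0 (-1)) s2, pd_lin s1 s0, pd_sl, pd_sl,
      pd_sl, iter_pdt hf, ← hg, show t₁ - t₀ = τ by linarith]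
    simp only [sl]
    field_simp
    ring
  rw [e1]
  have hlt : t₀ < t₁ := by linarith
  have := backward_diff_le (g := fun t => g x y t) (g' := fun t => pdt g x y t)
    (g'' := fun t => pdt (pdt g) x y t) (K := M) hlt (fun t => (smooth_slice_y sg y).hasDerivAt_y x t)
    (fun t => (smooth_slice_y (smooth_pdt sg) y).hasDerivAt_y x t) fun t ht => by
      have := h 2 a b le_rfl hab x y t hx hy ⟨by linarith [ht.1], by linarith [ht.2]⟩
      rw [← hg] at this
      exact this
  rwa [show τ = t₁ - t₀ by linarith]

theorem pd_eq_zero_on {F : ℝ → ℝ → ℝ} (hF : Sm F) (hX : 0 < X) (hY : 0 < Y)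
    (h0 : ∀ x ∈ Set.Icc 0 X, ∀ y ∈ Set.Icc 0 Y, F x y = 0) (a b : ℕ) :
    ∀ x ∈ Set.Icc 0 X, ∀ y ∈ Set.Icc 0 Y, pd a b F x y = 0 := by
  induction a with
  | zero =>
    induction b with
    | zero => exact h0
    | succ b ih =>
      intro x hx y hy
      rw [pd_succ_right hF]
      exact eq_zero_of_zero_on hY (fun s hs => ih x hx s hs) hy ((hF.pd 0 b).hasDerivAt_y x y)
  | succ a ih =>
    intro x hx y hy
    rw [pd_succ_left]
    exact eq_zero_of_zero_on hX (fun s hs => ih s hs y hy) hx ((hF.pd a b).hasDerivAt_x x y)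

theorem cb_zero_on {F : ℝ → ℝ → ℝ} (hF : Sm F) (hX : 0 < X) (hY : 0 < Y)
    (h0 : ∀ x ∈ Set.Icc 0 X, ∀ y ∈ Set.Icc 0 Y, F x y = 0) (r : ℕ) : CB X Y r 0 F :=
  fun a b _ x hx y hy => by rw [pd_eq_zero_on hF hX hY h0 a b x hx y hy, abs_zero]

theorem noSlip_of_open {α β : ℝ → ℝ → ℝ} (ha : Sm α) (hb : Sm β) (hX : 0 < X) (hY : 0 < Y)
    (hd : ∀ x ∈ Set.Ioo 0 X, ∀ y ∈ Set.Ioo 0 Y, px α x y = py β x y)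
    (hbc : ∀ x ∈ Set.Icc 0 X, ∀ y ∈ Set.Icc 0 Y, (x = 0 ∨ x = X ∨ y = 0 ∨ y = Y) → α x y = 0 ∧ β x y = 0) :
    NoSlip X Y α β where
  sa := ha
  sb := hb
  bc := hbc
  div := fun x hx y hy => by
    have hc : IsClosed {q : ℝ × ℝ | px α q.1 q.2 = py β q.1 q.2} :=
      isClosed_eq ha.px.continuous hb.py.continuous
    have hs : Set.Ioo 0 X ×ˢ Set.Ioo 0 Y ⊆ {q : ℝ × ℝ | px α q.1 q.2 = py β q.1 q.2} :=
      fun q hq => hd q.1 hq.1 q.2 hq.2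
    have hcl := closure_minimal hs hc
    rw [closure_prod_eq, closure_Ioo hX.ne, closure_Ioo hY.ne] at hcl
    exact hcl (Set.mk_mem_prod hx hy)

theorem noSlip_sl (hx : Smooth ux) (hy : Smooth uy) (hX : 0 < X) (hY : 0 < Y)
    (hs : IsStokesSol μ X Y T ux uy p gx gy) (ht : t ∈ Set.Icc 0 T) : NoSlip X Y (sl ux t) (sl (ng uy) t) := by
  have sa := smooth_slice_t hx t
  have sb := smooth_slice_t (smooth_ng hy) t
  rcases ht.1.eq_or_lt with h0 | h0
  · have za : ∀ x ∈ Set.Icc 0 X, ∀ y ∈ Set.Icc 0 Y, sl ux t x y = 0 := fun x hx y hy => by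
      rw [← h0]; exact (hs.2.2 x y hx hy).1
    have zb : ∀ x ∈ Set.Icc 0 X, ∀ y ∈ Set.Icc 0 Y, sl (ng uy) t x y = 0 := fun x hx y hy => by
      rw [← h0, sl, ng, (hs.2.2 x y hx hy).2, neg_zero]
    exact ⟨sa, sb, fun x hx y hy => (pd_eq_zero_on sa hX hY za 1 0 x hx y hy).trans
      (pd_eq_zero_on sb hX hY zb 0 1 x hx y hy).symm, fun x hx y hy _ => ⟨za x hx y hy, zb x hx y hy⟩⟩
  · refine noSlip_of_open sa sb hX hY (fun x hx y hy => ?_) fun x hx y hy hw => ?_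
    · have h1 := (hs.1 x y t hx hy ⟨h0, ht.2⟩).2.2
      change pdx ux x y t = pdy (ng uy) x y t
      rw [pdy_ng, ng]
      linarith
    · have h1 := hs.2.1 x y t hx hy ⟨h0, ht.2⟩ hw
      refine ⟨h1.1, ?_⟩
      rw [sl, ng, h1.2, neg_zero]

/-- Time levels, frozen after the last step. -/
def lev (N : ℕ) (τ : ℝ) (s : ℕ) : ℝ := (min s N : ℕ) * τ

theorem lev_eq {N s : ℕ} (hs : s ≤ N) (τ : ℝ) : lev N τ s = s * τ := by rw [lev, min_eq_left hs]

theorem exactFlow {N : ℕ} (hx : Smooth ux) (hy : Smooth uy) (hX : 0 < X) (hY : 0 < Y) (hτ : 0 < τ)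
    (hT : N * τ = T) (hs : IsStokesSol μ X Y T ux uy p gx gy)
    (bx : SobBound 2 4 ux X Y T M) (bY : SobBound 2 4 uy X Y T M) :
    ExactFlow X Y τ M N (fun s => sl ux (lev N τ s)) (fun s => sl (ng uy) (lev N τ s))
      (fun s => sl (pdt ux) (lev N τ (s + 1))) (fun s => sl (pdt (ng uy)) (lev N τ (s + 1)))
      (fun s => eres ux τ (lev N τ s) (lev N τ (s + 1)))
      (fun s => eres (ng uy) τ (lev N τ s) (lev N τ (s + 1))) := by
  have hlev : ∀ s, lev N τ s ∈ Set.Icc 0 T := fun s => by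
    refine ⟨by unfold lev; positivity, ?_⟩
    rw [lev, ← hT]
    exact mul_le_mul_of_nonneg_right (by exact_mod_cast min_le_right s N) hτ.le
  have hy' := smooth_ng hy
  have bY' := sobBound_ng bY
  have hl0 : lev N τ 0 = 0 := by simp [lev]
  have hstep : ∀ s < N, lev N τ (s + 1) = lev N τ s + τ := fun s hs => by
    rw [lev_eq hs, lev_eq hs.le]; push_cast; ring
  exact
    { ns := fun s => noSlip_sl hx hy hX hY hs (hlev s)
      za := by
        refine cb_zero_on (smooth_slice_t hx _) hX hY (fun x hx y hy => ?_) 4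
        rw [hl0]; exact (hs.2.2 x y hx hy).1
      zb := by
        refine cb_zero_on (smooth_slice_t hy' _) hX hY (fun x hx y hy => ?_) 4
        rw [hl0, sl, ng, (hs.2.2 x y hx hy).2, neg_zero]
      sa := fun s => smooth_slice_t (smooth_pdt hx) _
      sb := fun s => smooth_slice_t (smooth_pdt hy') _
      se := fun s => sm_eres hx _ _ _
      sf := fun s => sm_eres hy' _ _ _
      ca := fun s => cb_sl bx (hlev s)
      cb := fun s => cb_sl bY' (hlev s)
      ca' := fun s _ => cb_sl_pdt hx bx (hlev _)
      cb' := fun s _ => cb_sl_pdt hy' bY' (hlev _)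
      ce := fun s h => cb_eres hx bx (hlev s).1 hτ (hstep s h) (hlev _).2
      cf := fun s h => cb_eres hy' bY' (hlev s).1 hτ (hstep s h) (hlev _).2
      ea := fun s _ => eres_eq hτ.ne'
      eb := fun s _ => eres_eq hτ.ne' }

end SpaceTime

section Assembly

variable {n m : ℕ} {h k μ x y : ℝ}

theorem exists_stream {Wx Wy : ℤ → ℤ → ℝ} (hh : h ≠ 0) (hk : k ≠ 0) (hx0 : ∀ j, Wx 0 j = 0)
    (hxn : ∀ j, Wx n j = 0) (hy0 : ∀ i, Wy i 0 = 0) (hym : ∀ i, Wy i m = 0)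
    (hdiv : ∀ i j : ℕ, i < n → j < m →
      (Wx ((i : ℤ) + 1) j - Wx i j) / h + (Wy i ((j : ℤ) + 1) - Wy i j) / k = 0) :
    ∃ ψ ∈ nodeSpace n m, (∀ i j : ℕ, i ≤ n → j < m → dy k ψ i j = Wx i j) ∧
      (∀ i j : ℕ, i < n → j ≤ m → dx h ψ i j = -Wy i j) := by
  obtain ⟨S, hS⟩ : ∃ S : ℕ → ℕ → ℝ, S = fun (i : ℕ) (j : ℕ) => k * ∑ l ∈ range j, Wx (i : ℤ) (l : ℤ) := ⟨_, rfl⟩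
  have hSx : ∀ i j : ℕ, i < n → j ≤ m → (S (i + 1) j - S i j) / h = -Wy i j := by
    intro i j hi hj
    induction j with
    | zero => simp [hS, hy0]
    | succ j ih =>
      have h1 := ih (by omega)
      have h2 := hdiv i j hi hj
      have h3 : ∀ i : ℕ, S i (j + 1) = S i j + k * Wx i (j : ℤ) := fun i => by
        simp only [hS, sum_range_succ]; ring
      rw [h3, h3]
      push_cast
      field_simp at h1 h2 ⊢
      linear_combination h1 + h2
  have hS0 : ∀ j, S 0 j = 0 := fun j => by simp [hS, hx0]
  have hSn : ∀ j, S n j = 0 := fun j => by simp [hS, hxn]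
  have hSb : ∀ i, S i 0 = 0 := fun i => by simp [hS]
  have hSm : ∀ i, i ≤ n → S i m = 0 := by
    intro i hi
    induction i with
    | zero => exact hS0 m
    | succ i ih =>
      have h1 := hSx i m hi le_rfl
      rw [ih (by omega), hym, neg_zero, sub_zero, div_eq_zero_iff] at h1
      exact h1.resolve_right hh
  have hψ : ∀ i j, i ≤ n → j ≤ m → (if i < n ∧ j < m then S i j else 0) = S i j := by
    intro i j hi hj
    split_ifs with hc
    · rfl
    · rcases hi.eq_or_lt with rfl | hi'
      · rw [hSn]
      · rcases hj.eq_or_lt with rfl | hj'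
        · rw [hSm i hi]
        · exact absurd ⟨hi', hj'⟩ hc
  refine ⟨fun i j => if i < n ∧ j < m then S i j else 0, fun i j hij => ?_, fun i j hi hj => ?_,
    fun i j hi hj => ?_⟩
  · dsimp only
    split_ifs with hc
    · rcases hij with rfl | hij | rfl | hij
      · exact hS0 j
      · omega
      · exact hSb i
      · omega
    · rfl
  · rw [dy, hψ i _ hi hj, hψ i j hi hj.le]
    simp only [hS, sum_range_succ]
    field_simp
    ring
  · rw [dx, hψ _ j hi hj, hψ i j hi.le hj, hSx i j hi hj]

/-- The wall-modified second difference in flux form. -/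
theorem flux_eq_Lc (hk : k ≠ 0) {c w : ℤ → ℝ} (hc0 : c 0 = k / 2) (hcm : c m = k / 2)
    (hc : ∀ j : ℤ, 0 < j → j < m → c j = k) (hw0 : w (-1) = 0) (hwm : w m = 0) {j : ℕ} (hj : j < m) :
    ((w ((j : ℤ) + 1) - w j) / c ((j : ℤ) + 1) - (w j - w ((j : ℤ) - 1)) / c j) / k
      = Lc m k (fun j : ℕ => w j) j := by
  have h1 : (w ((j : ℤ) + 1) - w j) / c ((j : ℤ) + 1)
      = ((if j + 1 < m then w ((j : ℤ) + 1) else - w j) - w j) / k := by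
    split_ifs with hj1
    · rw [hc _ (by omega) (by omega)]
    · rw [show (j : ℤ) + 1 = m by omega, hcm, hwm]
      field_simp; ring
  have h2 : (w j - w ((j : ℤ) - 1)) / c j = (w j - (if j = 0 then - w j else w ((j : ℤ) - 1))) / k := by
    split_ifs with hj0
    · rw [hj0]
      norm_num
      rw [hc0, hw0]
      field_simp; ring
    · rw [hc _ (by omega) (by omega)]
  rw [h1, h2, Lc]
  have e2 : (if j = 0 then - w j else w ((j : ℤ) - 1)) = if j = 0 then - w ((0 : ℕ) : ℤ) else w ((j - 1 : ℕ) : ℤ) := by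
    split_ifs with hj0
    · rw [hj0]
    · rw [Nat.cast_sub (by omega)]; rfl
  rw [e2]
  push_cast
  field_simp
  ring

theorem flux_eq_D2 (hh : h ≠ 0) {w : ℤ → ℝ} {i : ℕ} (hi0 : 0 < i) (hi : i < n) :
    ((w ((i : ℤ) + 1) - w i) / h - (w ((i : ℤ) - 1 + 1) - w ((i : ℤ) - 1)) / h) / h
      = - D2 n h (fun i : ℕ => w i) i := by
  rw [D2, if_neg (by omega), sub_add_cancel, Nat.cast_sub (by omega)]
  push_cast
  field_simp
  ring

theorem momLap_eq_flux (hh : h ≠ 0) (hk : k ≠ 0) {ψ : ℕ → ℕ → ℝ} {W : ℤ → ℤ → ℝ} {c : ℤ → ℝ}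
    (hψ : ∀ i j : ℕ, i ≤ n → j < m → dy k ψ i j = W i j) (hc0 : c 0 = k / 2) (hcm : c m = k / 2)
    (hc : ∀ j : ℤ, 0 < j → j < m → c j = k) (hw0 : ∀ i, W i (-1) = 0) (hwm : ∀ i, W i m = 0)
    {i j : ℕ} (hi0 : 0 < i) (hi : i < n) (hj : j < m) :
    momLap n m h k ψ i j
      = ((W ((i : ℤ) + 1) j - W i j) / h - (W ((i : ℤ) - 1 + 1) j - W ((i : ℤ) - 1) j) / h) / h
        + ((W i ((j : ℤ) + 1) - W i j) / c ((j : ℤ) + 1) - (W i j - W i ((j : ℤ) - 1)) / c j) / k := by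
  rw [flux_eq_Lc hk hc0 hcm hc (hw0 i) (hwm i) hj,
    flux_eq_D2 (n := n) (w := fun i => W i j) hh hi0 hi, momLap,
    Lc_congr (fun j hj => hψ i j hi.le hj) hj]
  have : D2 n h (fun i => dy k ψ i j) i = D2 n h (fun i : ℕ => W i j) i := by
    rw [D2, D2]
    split_ifs
    · rfl
    · rw [hψ i j hi.le hj, hψ (i - 1) j (by omega) hj, hψ (i + 1) j hi hj]
  rw [this]
  ring

theorem AX_source {g A L P : ℝ → ℝ → ℝ} (hA : Sm A) (hL : Sm L) (hP : Sm P) (hh : 0 < h)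
    (hg : ∀ s ∈ Set.Icc (x - h / 2) (x + h / 2), g s y = A s y - μ * L s y + px P s y) :
    AX h g x y = AX h A x y - μ * AX h L x y + (P (x + h / 2) y - P (x - h / 2) y) / h := by
  have e1 : AX h g x y = AX h (fun s y => (fun s y => A s y + (-μ) * L s y) s y + 1 * px P s y) x y := by
    unfold AX
    congr 1
    refine intervalIntegral.integral_congr fun s hs => ?_
    rw [Set.uIcc_of_le (by linarith)] at hs
    simp only [hg s hs]
    ring
  have e2 : AX h (px P) x y = (P (x + h / 2) y - P (x - h / 2) y) / h := by
    unfold AX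
    rw [intervalIntegral.integral_eq_sub_of_hasDerivAt (f := fun s => P s y)
      (fun s _ => hP.hasDerivAt_x s y) ((hP.px.cont_x y).intervalIntegrable _ _)]
    ring
  rw [e1, AX_lin ((hA.lin hL _).cont_x y) (hP.px.cont_x y), AX_lin (hA.cont_x y) (hL.cont_x y), e2]
  ring

theorem uniform_points {xp : ℤ → ℝ} (h0 : xp 0 = 0) (hu : ∀ i : ℤ, 0 ≤ i → i < n → xp (i + 1) - xp i = h)
    {i : ℕ} (hi : i ≤ n) : xp i = i * h := by
  induction i with
  | zero => simpa using h0
  | succ i ih =>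
    have h1 := hu i (by omega) (by omega)
    rw [ih (by omega)] at h1
    push_cast
    linarith

end Assembly

section Scheme

variable {n m : ℕ} {h k μ τ : ℝ}

/-- One discrete momentum equation, written for the stream function and the pressure error. -/
theorem momentum_step (hh : 0 < h) (hk : 0 < k) (hτ : τ ≠ 0) {ψ₀ ψ₁ : ℕ → ℕ → ℝ} {W₀ W₁ z : ℤ → ℤ → ℝ}
    {c : ℤ → ℝ} (hψ₀ : ∀ i j : ℕ, i ≤ n → j < m → dy k ψ₀ i j = W₀ i j)
    (hψ₁ : ∀ i j : ℕ, i ≤ n → j < m → dy k ψ₁ i j = W₁ i j) (hc0 : c 0 = k / 2) (hcm : c m = k / 2)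
    (hc : ∀ j : ℤ, 0 < j → j < m → c j = k) (hw0 : ∀ i, W₁ i (-1) = 0) (hwm : ∀ i, W₁ i m = 0)
    {A L P g : ℝ → ℝ → ℝ} (hA : Sm A) (hL : Sm L) (hP : Sm P) {i j : ℕ} (hi0 : 0 < i) (hi : i < n)
    (hj : j < m)
    (hg : ∀ s ∈ Set.Icc (i * h - h / 2) (i * h + h / 2),
      g s (j * k + k / 2) = A s (j * k + k / 2) - μ * L s (j * k + k / 2) + px P s (j * k + k / 2))
    (he : (W₁ i j - W₀ i j) / τ
      - μ * (((W₁ ((i : ℤ) + 1) j - W₁ i j) / h - (W₁ ((i : ℤ) - 1 + 1) j - W₁ ((i : ℤ) - 1) j) / h) / h)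
      - μ * (((W₁ i ((j : ℤ) + 1) - W₁ i j) / c ((j : ℤ) + 1) - (W₁ i j - W₁ i ((j : ℤ) - 1)) / c j) / k)
      + (z i j - z ((i : ℤ) - 1) j) / h = AX h g (i * h) (j * k + k / 2)) :
    dy k ψ₁ i j - dy k ψ₀ i j - τ * μ * momLap n m h k ψ₁ i j
      = τ * (AX h A (i * h) (j * k + k / 2) - μ * AX h L (i * h) (j * k + k / 2)
        - ((z i j - P (i * h + h / 2) (j * k + k / 2))
          - (z ((i - 1 : ℕ) : ℤ) j - P ((i - 1 : ℕ) * h + h / 2) (j * k + k / 2))) / h) := by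
  rw [AX_source hA hL hP hh hg] at he
  rw [momLap_eq_flux hh.ne' hk.ne' hψ₁ hc0 hcm hc hw0 hwm hi0 hi hj, hψ₁ i j hi.le hj, hψ₀ i j hi.le hj]
  have e1 : ((i - 1 : ℕ) : ℝ) * h + h / 2 = i * h - h / 2 := by
    rw [Nat.cast_sub (by omega)]; push_cast; ring
  have e2 : ((i - 1 : ℕ) : ℤ) = (i : ℤ) - 1 := by omega
  rw [e1, e2]
  have e3 : W₁ i j - W₀ i j = τ * ((W₁ i j - W₀ i j) / τ) := by field_simp
  rw [e3]
  linear_combination τ * he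

theorem lap_sl (f : ℝ → ℝ → ℝ → ℝ) (t x y : ℝ) :
    lap (sl f t) x y = pdx (pdx f) x y t + pdy (pdy f) x y t := by
  rw [lap, pd_sl, pd_sl, one_mul]
  rfl

section UniformGrid

variable {G : Grid}

theorem xp_uniform (hU : G.Uniform h k) {i : ℕ} (hi : i ≤ G.Nx) : G.xp i = i * h :=
  uniform_points G.xp_zero hU.1 hi

theorem yp_uniform (hU : G.Uniform h k) {j : ℕ} (hj : j ≤ G.Ny) : G.yp j = j * k :=
  uniform_points G.yp_zero hU.2 hj

theorem xh_uniform (hU : G.Uniform h k) {i : ℕ} (hi : i < G.Nx) : G.xh i = i * h + h / 2 := by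
  have h1 := xp_uniform hU (i := i + 1) hi
  push_cast at h1
  rw [Grid.xh, h1, xp_uniform hU hi.le]
  ring

theorem yh_uniform (hU : G.Uniform h k) {j : ℕ} (hj : j < G.Ny) : G.yh j = j * k + k / 2 := by
  have h1 := yp_uniform hU (j := j + 1) hj
  push_cast at h1
  rw [Grid.yh, h1, yp_uniform hU hj.le]
  ring

theorem hc_uniform (hU : G.Uniform h k) :
    G.hc 0 = h / 2 ∧ G.hc G.Nx = h / 2 ∧ ∀ i : ℤ, 0 < i → i < G.Nx → G.hc i = h := by
  have h1 := G.one_le_Nx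
  refine ⟨?_, ?_, fun i hi hi' => ?_⟩
  · rw [Grid.hc, if_pos rfl, hU.1 0 le_rfl (by omega)]
  · rw [Grid.hc, if_neg (by omega), if_pos rfl, hU.1 _ (by omega) (by omega)]
  · rw [Grid.hc, if_neg (by omega), if_neg (by omega), hU.1 _ (by omega) (by omega),
      hU.1 _ (by omega) (by omega)]
    ring

theorem kc_uniform (hU : G.Uniform h k) :
    G.kc 0 = k / 2 ∧ G.kc G.Ny = k / 2 ∧ ∀ j : ℤ, 0 < j → j < G.Ny → G.kc j = k := by
  have h1 := G.one_le_Ny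
  refine ⟨?_, ?_, fun j hj hj' => ?_⟩
  · rw [Grid.kc, if_pos rfl, hU.2 0 le_rfl (by omega)]
  · rw [Grid.kc, if_neg (by omega), if_pos rfl, hU.2 _ (by omega) (by omega)]
  · rw [Grid.kc, if_neg (by omega), if_neg (by omega), hU.2 _ (by omega) (by omega),
      hU.2 _ (by omega) (by omega)]
    ring

theorem avgFx_uniform (hU : G.Uniform h k) (g : ℝ → ℝ → ℝ → ℝ) (s : ℕ) {i j : ℕ} (hi0 : 0 < i)
    (hi : i < G.Nx) (hj : j < G.Ny) :
    G.avgFx g τ s i j = AX h (sl g (s * τ)) (i * h) (j * k + k / 2) := by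
  have e : (i : ℤ) - 1 = ((i - 1 : ℕ) : ℤ) := by omega
  rw [Grid.avgFx, (hc_uniform hU).2.2 _ (by omega) (by omega), e, xh_uniform hU (by omega),
    xh_uniform hU hi, yh_uniform hU hj, AX, Nat.cast_sub (by omega),
    show ((i : ℝ) - (1 : ℕ)) * h + h / 2 = i * h - h / 2 by push_cast; ring]
  rfl

theorem avgFy_uniform (hU : G.Uniform h k) (g : ℝ → ℝ → ℝ → ℝ) (s : ℕ) {i j : ℕ} (hi : i < G.Nx)
    (hj0 : 0 < j) (hj : j < G.Ny) :
    G.avgFy g τ s i j = AX k (sw (sl g (s * τ))) (j * k) (i * h + h / 2) := by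
  have e : (j : ℤ) - 1 = ((j - 1 : ℕ) : ℤ) := by omega
  rw [Grid.avgFy, (kc_uniform hU).2.2 _ (by omega) (by omega), e, yh_uniform hU (by omega),
    yh_uniform hU hj, xh_uniform hU hi, AX, Nat.cast_sub (by omega),
    show ((j : ℝ) - (1 : ℕ)) * k + k / 2 = j * k - k / 2 by push_cast; ring]
  rfl

variable {ux uy p gx gy : ℝ → ℝ → ℝ → ℝ} {fx fy Wx Wy Z : ℕ → ℤ → ℤ → ℝ}

theorem exists_streams (hh : 0 < h) (hk : 0 < k) (hU : G.Uniform h k)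
    (hR : G.IsRMAC μ τ fx fy Wx Wy Z) :
    ∃ ψ : ℕ → ℕ → ℕ → ℝ, (∀ s, ψ s ∈ nodeSpace G.Nx G.Ny) ∧ ψ 0 = 0 ∧
      (∀ s, ∀ i j : ℕ, i ≤ G.Nx → j < G.Ny → dy k (ψ s) i j = Wx s i j) ∧
      (∀ s, ∀ i j : ℕ, i < G.Nx → j ≤ G.Ny → dx h (ψ s) i j = -Wy s i j) := by
  obtain ⟨r1, -, r3, -, r5, -, -, r8⟩ := hR
  have key : ∀ s, ∃ ψ : ℕ → ℕ → ℝ, ψ ∈ nodeSpace G.Nx G.Ny ∧ (s = 0 → ψ = 0) ∧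
      (∀ i j : ℕ, i ≤ G.Nx → j < G.Ny → dy k ψ i j = Wx s i j) ∧
      (∀ i j : ℕ, i < G.Nx → j ≤ G.Ny → dx h ψ i j = -Wy s i j) := by
    intro s
    rcases Nat.eq_zero_or_pos s with rfl | hs
    · exact ⟨0, Submodule.zero_mem _, fun _ => rfl, fun i j _ _ => by simp [dy, r5],
        fun i j _ _ => by simp [dx, r5]⟩
    · obtain ⟨ψ, h1, h2, h3⟩ := exists_stream (Wx := Wx s) (Wy := Wy s) (n := G.Nx) (m := G.Ny) hh.ne'
        hk.ne' (fun j => (r1 s j).1) (fun j => (r1 s j).2) (fun i => (r3 s i).1) (fun i => (r3 s i).2)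
        fun i j hi hj => by
          have := r8 s hs i (mem_Icc.2 ⟨by omega, by omega⟩) j (mem_Icc.2 ⟨by omega, by omega⟩)
          rwa [Grid.dxEx, Grid.dyEy, hU.1 i (by omega) (by omega), hU.2 j (by omega) (by omega)] at this
      exact ⟨ψ, h1, fun h0 => absurd h0 hs.ne', h2, h3⟩
  choose ψ h1 h2 h3 h4 using key
  exact ⟨ψ, h1, h2 0 rfl, h3, h4⟩

theorem mem_Ioo_cell {X : ℝ} (hh : 0 < h) (hX : n * h = X) {i : ℕ} (hi : i < n) :
    (i : ℝ) * h + h / 2 ∈ Set.Ioo 0 X := by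
  have : (i : ℝ) + 1 ≤ n := by exact_mod_cast hi
  have := mul_le_mul_of_nonneg_right this hh.le
  constructor
  · positivity
  · linarith

theorem mem_Ioo_edge {X s : ℝ} (hh : 0 < h) (hX : n * h = X) {i : ℕ} (hi0 : 0 < i) (hi : i < n)
    (hs : s ∈ Set.Icc ((i : ℝ) * h - h / 2) (i * h + h / 2)) : s ∈ Set.Ioo 0 X := by
  have h1 : (1 : ℝ) ≤ i := by exact_mod_cast hi0
  have h2 := mul_le_mul_of_nonneg_right h1 hh.le
  have h3 := mem_Ioo_cell hh hX hi
  exact ⟨by linarith [hs.1], lt_of_le_of_lt hs.2 h3.2⟩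

theorem momentum_x {X Y T : ℝ} (hh : 0 < h) (hk : 0 < k) (hτ : 0 < τ) (hU : G.Uniform h k)
    (hX : G.Nx * h = X) (hY : G.Ny * k = Y) (hx : Smooth ux) (hp : Smooth p)
    (hs : IsStokesSol μ X Y T ux uy p gx gy) (hR : G.IsRMAC μ τ (G.avgFx gx τ) fy Wx Wy Z)
    {ψ : ℕ → ℕ → ℕ → ℝ}
    (hψ : ∀ s, ∀ i j : ℕ, i ≤ G.Nx → j < G.Ny → dy k (ψ s) i j = Wx s i j) {s : ℕ}
    (hsT : ((s + 1 : ℕ) : ℝ) * τ ≤ T) {i j : ℕ} (hi0 : 0 < i) (hi : i < G.Nx) (hj : j < G.Ny) :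
    dy k (ψ (s + 1)) i j - dy k (ψ s) i j - τ * μ * momLap G.Nx G.Ny h k (ψ (s + 1)) i j
      = τ * (AX h (sl (pdt ux) ((s + 1 : ℕ) * τ)) (i * h) (j * k + k / 2)
        - μ * AX h (lap (sl ux ((s + 1 : ℕ) * τ))) (i * h) (j * k + k / 2)
        - ((Z (s + 1) i j - p (i * h + h / 2) (j * k + k / 2) ((s + 1 : ℕ) * τ))
          - (Z (s + 1) ((i - 1 : ℕ) : ℤ) j
            - p ((i - 1 : ℕ) * h + h / 2) (j * k + k / 2) ((s + 1 : ℕ) * τ))) / h) := by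
  obtain ⟨-, r2, -, -, -, r6, -, -⟩ := hR
  obtain ⟨c0, cm, c⟩ := kc_uniform hU
  have ht : 0 < ((s + 1 : ℕ) : ℝ) * τ := by positivity
  refine momentum_step (c := G.kc) (P := sl p ((s + 1 : ℕ) * τ)) (g := sl gx ((s + 1 : ℕ) * τ))
    hh hk hτ.ne' (hψ s) (hψ (s + 1)) c0 cm c (fun i => (r2 _ i).1)
    (fun i => (r2 _ i).2) (smooth_slice_t (smooth_pdt hx) _) (smooth_slice_t hx _).lap
    (smooth_slice_t hp _) hi0 hi hj (fun x hxs => ?_) ?_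
  · rw [lap_sl]
    exact (hs.1 x _ _ (mem_Ioo_edge hh hX hi0 hi hxs) (mem_Ioo_cell hk hY hj) ⟨ht, hsT⟩).1.symm
  · have := r6 (s + 1) (by omega) i (mem_Icc.2 ⟨by omega, by omega⟩) j (mem_Icc.2 ⟨by omega, by omega⟩)
    rwa [Grid.dxEx, Grid.dxEx, Grid.DyEx, Grid.DyEx, Grid.DxC, hU.1 i (by omega) (by omega),
      hU.1 _ (by omega) (by omega), hU.2 j (by omega) (by omega),
      (hc_uniform hU).2.2 i (by omega) (by omega), add_sub_cancel_right, Nat.add_sub_cancel,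
      avgFx_uniform hU gx (s + 1) hi0 hi hj] at this

theorem momentum_y {X Y T : ℝ} (hh : 0 < h) (hk : 0 < k) (hτ : 0 < τ) (hU : G.Uniform h k)
    (hX : G.Nx * h = X) (hY : G.Ny * k = Y) (hy : Smooth uy) (hp : Smooth p)
    (hs : IsStokesSol μ X Y T ux uy p gx gy) (hR : G.IsRMAC μ τ fx (G.avgFy gy τ) Wx Wy Z)
    {ψ : ℕ → ℕ → ℕ → ℝ}
    (hψ : ∀ s, ∀ i j : ℕ, i < G.Nx → j ≤ G.Ny → dx h (ψ s) i j = -Wy s i j) {s : ℕ}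
    (hsT : ((s + 1 : ℕ) : ℝ) * τ ≤ T) {i j : ℕ} (hi : i < G.Nx) (hj0 : 0 < j) (hj : j < G.Ny) :
    dx h (ψ (s + 1)) i j - dx h (ψ s) i j - τ * μ * momLap G.Ny G.Nx k h (tr (ψ (s + 1))) j i
      = τ * (AX k (sw (sl (pdt (ng uy)) ((s + 1 : ℕ) * τ))) (j * k) (i * h + h / 2)
        - μ * AX k (lap (sw (sl (ng uy) ((s + 1 : ℕ) * τ)))) (j * k) (i * h + h / 2)
        + ((Z (s + 1) i j - p (i * h + h / 2) (j * k + k / 2) ((s + 1 : ℕ) * τ))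
          - (Z (s + 1) i ((j - 1 : ℕ) : ℤ)
            - p (i * h + h / 2) ((j - 1 : ℕ) * k + k / 2) ((s + 1 : ℕ) * τ))) / k) := by
  obtain ⟨-, -, -, r4, -, -, r7, -⟩ := hR
  obtain ⟨c0, cm, c⟩ := hc_uniform hU
  have ht : 0 < ((s + 1 : ℕ) : ℝ) * τ := by positivity
  have hy' := smooth_ng hy
  have key := momentum_step (n := G.Ny) (m := G.Nx) (c := G.hc) (z := fun j i => -Z (s + 1) i j)
    (W₀ := fun j i => -Wy s i j) (W₁ := fun j i => -Wy (s + 1) i j) (ψ₀ := tr (ψ s))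
    (ψ₁ := tr (ψ (s + 1))) (P := sw (sl (ng p) ((s + 1 : ℕ) * τ)))
    (g := sw (sl (ng gy) ((s + 1 : ℕ) * τ))) (μ := μ)
    hk hh hτ.ne' (fun j i hj hi => hψ s i j hi hj) (fun j i hj hi => hψ (s + 1) i j hi hj) c0 cm c
    (fun j => by rw [(r4 _ j).1, neg_zero]) (fun j => by rw [(r4 _ j).2, neg_zero])
    (smooth_slice_t (smooth_pdt hy') ((s + 1 : ℕ) * τ)).sw (smooth_slice_t hy' ((s + 1 : ℕ) * τ)).sw.lap
    (smooth_slice_t (smooth_ng hp) _).sw hj0 hj hi (fun y hys => ?_) ?_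
  · have e : dx h (ψ (s + 1)) i j = dy h (tr (ψ (s + 1))) j i := rfl
    have e' : dx h (ψ s) i j = dy h (tr (ψ s)) j i := rfl
    rw [e, e', key]
    simp only [sw, sl, ng]
    ring
  · have := (hs.1 _ y _ (mem_Ioo_cell hh hX hi) (mem_Ioo_edge hk hY hj0 hj hys) ⟨ht, hsT⟩).2.1
    rw [lap_sw (smooth_slice_t hy' _)]
    have e : px (sw (sl (ng p) ((s + 1 : ℕ) * τ))) y (i * h + h / 2)
      = pdy (ng p) (i * h + h / 2) y ((s + 1 : ℕ) * τ) := rfl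
    rw [e]
    simp only [sw, lap_sl, sl]
    rw [pdx_ng, pdx_ng, pdy_ng, pdy_ng, pdt_ng, pdy_ng]
    simp only [ng]
    linarith
  · have := r7 (s + 1) (by omega) i (mem_Icc.2 ⟨by omega, by omega⟩) j (mem_Icc.2 ⟨by omega, by omega⟩)
    rw [Grid.dyEy, Grid.dyEy, Grid.DxEy, Grid.DxEy, Grid.DyC, hU.2 j (by omega) (by omega),
      hU.2 _ (by omega) (by omega), hU.1 i (by omega) (by omega),
      (kc_uniform hU).2.2 j (by omega) (by omega), add_sub_cancel_right, Nat.add_sub_cancel,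
      avgFy_uniform hU gy (s + 1) hi hj0 hj] at this
    have e : AX k (sw (sl (ng gy) ((s + 1 : ℕ) * τ))) (j * k) (i * h + h / 2)
        = -AX k (sw (sl gy ((s + 1 : ℕ) * τ))) (j * k) (i * h + h / 2) := by
      simp only [AX, sw, sl, ng, intervalIntegral.integral_neg]
      ring
    rw [e, ← this]
    ring

end UniformGrid

end Scheme

theorem eq_zero_of_thin {n m : ℕ} {ψ : ℕ → ℕ → ℝ} (hψ : ψ ∈ nodeSpace n m) (h : n ≤ 1 ∨ m ≤ 1) : ψ = 0 :=
  funext fun i => funext fun j => hψ i j (by omega)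

theorem rmac_error {X Y T h k μ τ M B : ℝ} {N : ℕ} {G : Grid} {ux uy p gx gy : ℝ → ℝ → ℝ → ℝ}
    {Wx Wy Z : ℕ → ℤ → ℤ → ℝ} (hX0 : 0 < X) (hY0 : 0 < Y) (hh : 0 < h) (hk : 0 < k) (hτ : 0 < τ)
    (hμ : 0 < μ) (hU : G.Uniform h k) (hX : G.Nx * h = X) (hY : G.Ny * k = Y) (hT : N * τ = T)
    (hB : 1 ≤ B) (hsX : SpBound X B) (hsY : SpBound Y B) (hx : Smooth ux) (hy : Smooth uy) (hp : Smooth p)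
    (hs : IsStokesSol μ X Y T ux uy p gx gy) (bx : SobBound 2 4 ux X Y T M) (bY : SobBound 2 4 uy X Y T M)
    (hR : G.IsRMAC μ τ (G.avgFx gx τ) (G.avgFy gy τ) Wx Wy Z) {K : ℝ}
    (hK : flowC X Y T B * M * (h ^ 2 + k ^ 2 + τ) ≤ K) (hKx : G.Nx = 1 → M ≤ K) (hKy : G.Ny = 1 → M ≤ K)
    {r : ℕ} (hr : r ≤ N) :
    (∀ i j : ℕ, i ≤ G.Nx → j < G.Ny → |Wx r i j - ux (i * h) (j * k + k / 2) (r * τ)| ≤ K) ∧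
    (∀ i j : ℕ, i < G.Nx → j ≤ G.Ny → |Wy r i j - uy (i * h + h / 2) (j * k) (r * τ)| ≤ K) := by
  obtain ⟨ψ, h1, h2, h3, h4⟩ := exists_streams hh hk hU hR
  have hT0 : 0 ≤ T := by rw [← hT]; positivity
  have hle : ∀ s, s ≤ N → (s : ℝ) * τ ≤ T := fun s hs => by
    rw [← hT]; exact mul_le_mul_of_nonneg_right (by exact_mod_cast hs) hτ.le
  have nx := G.one_le_Nx
  have ny := G.one_le_Ny
  by_cases hc : 2 ≤ G.Nx ∧ 2 ≤ G.Ny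
  · have key := flow_error (exactFlow hx hy hX0 hY0 hτ hT hs bx bY) hh hk hτ hμ hX hY hX0 hY0 hc.1 hc.2
      hT0 hT.le hB hsX hsY
      (q := fun s i j => Z (s + 1) i j - p (i * h + h / 2) (j * k + k / 2) ((s + 1 : ℕ) * τ)) h1 h2
      (fun s hsN i j hi0 hi hj => by
        rw [lev_eq hsN]
        exact momentum_x hh hk hτ hU hX hY hx hp hs hR h3 (hle _ hsN) hi0 hi hj)
      (fun s hsN i j hi hj0 hj => by
        rw [lev_eq hsN]
        exact momentum_y hh hk hτ hU hX hY hy hp hs hR h4 (hle _ hsN) hi hj0 hj) hr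
    rw [lev_eq hr] at key
    refine ⟨fun i j hi hj => ?_, fun i j hi hj => ?_⟩
    · rw [← h3 r i j hi hj]
      exact (key.1 i j hi hj).trans hK
    · have := (key.2 i j hi hj).trans hK
      rw [h4 r i j hi hj, sl, ng, ← abs_neg] at this
      rwa [show Wy r i j - uy (i * h + h / 2) (j * k) (r * τ)
        = -(-Wy r i j - -uy (i * h + h / 2) (j * k) (r * τ)) by ring]
  · have hM : M ≤ K := by
      by_cases h5 : G.Nx = 1
      · exact hKx h5
      · exact hKy (by omega)
    have hz := eq_zero_of_thin (h1 r) (by omega)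
    have ht : (r : ℝ) * τ ∈ Set.Icc 0 T := ⟨by positivity, hle r hr⟩
    have pt : ∀ {n : ℕ} {h X : ℝ}, 0 < h → n * h = X → ∀ i : ℕ, i ≤ n → (i : ℝ) * h ∈ Set.Icc 0 X :=
      fun hh hX i hi => ⟨by positivity, by rw [← hX]; gcongr⟩
    refine ⟨fun i j hi hj => ?_, fun i j hi hj => ?_⟩
    · rw [← h3 r i j hi hj, hz]
      have := bx 0 0 0 (by omega) (by omega) (i * h) (j * k + k / 2) (r * τ) (pt hh hX i hi)
        (Set.Ioo_subset_Icc_self (mem_Ioo_cell hk hY hj)) ht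
      simpa [dy] using this.trans hM
    · have h6 := h4 r i j hi hj
      rw [hz] at h6
      have h7 : Wy r i j = 0 := by simpa [dx] using h6
      have := bY 0 0 0 (by omega) (by omega) (i * h + h / 2) (j * k) (r * τ)
        (Set.Ioo_subset_Icc_self (mem_Ioo_cell hh hX hi)) (pt hk hY j hj) ht
      rw [h7]
      simpa using this.trans hM

end RMACProof

/-- second-order maximum-norm velocity error of the RMAC scheme on
uniform grids. On a uniform grid with `k` comparable to `h` and `Δt ≤ c₀ h²`, the velocity
error is `O(h²)` in the discrete maximum norm, with a constant independent of `h`, `Δt`, the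
pressure `p`, and bounded as `μ → 0`. -/
theorem rmac_velocity_maxnorm_uniform (Lx Ly T c₀ ρ Mu : ℝ)
    (hLx : 0 < Lx) (hLy : 0 < Ly) (hT : 0 < T) (hc₀ : 0 < c₀) (hρ : 0 < ρ) (hMu : 0 ≤ Mu) :
    ∃ C : ℝ, 0 < C ∧
      ∀ μ : ℝ, 0 < μ →
      ∀ G : RMAC.Grid, G.Lx = Lx → G.Ly = Ly →
      ∀ h k : ℝ, 0 < h → 0 < k → G.Uniform h k → k ≤ ρ * h → h ≤ ρ * k →
      ∀ N : ℕ, 1 ≤ N → ∀ Δt : ℝ, Δt = T / N → Δt ≤ c₀ * h ^ 2 →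
      ∀ ux uy p gx gy : ℝ → ℝ → ℝ → ℝ,
        RMAC.Smooth ux → RMAC.Smooth uy → RMAC.Smooth p →
        RMAC.IsStokesSol μ Lx Ly T ux uy p gx gy →
        RMAC.SobBound 2 4 ux Lx Ly T Mu → RMAC.SobBound 2 4 uy Lx Ly T Mu →
      ∀ Wx Wy Z : ℕ → ℤ → ℤ → ℝ,
        G.IsRMAC μ Δt (G.avgFx gx Δt) (G.avgFy gy Δt) Wx Wy Z →
      ∀ m : ℕ, 1 ≤ m → m ≤ N →
        (∀ i ∈ Finset.Icc (0 : ℤ) (G.Nx : ℤ), ∀ j ∈ Finset.Icc (0 : ℤ) ((G.Ny : ℤ) - 1),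
          |Wx m i j - ux (G.xp i) (G.yh j) ((m : ℝ) * Δt)| ≤ C * h ^ 2) ∧
        (∀ i ∈ Finset.Icc (0 : ℤ) ((G.Nx : ℤ) - 1), ∀ j ∈ Finset.Icc (0 : ℤ) (G.Ny : ℤ),
          |Wy m i j - uy (G.xh i) (G.yp j) ((m : ℝ) * Δt)| ≤ C * h ^ 2) := by
  obtain ⟨B₁, hB₁⟩ := RMACProof.exists_spBound Lx
  obtain ⟨B₂, hB₂⟩ := RMACProof.exists_spBound Ly
  set B := max 1 (max B₁ B₂) with hBdef
  have hB : 1 ≤ B := le_max_left _ _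
  have hsX := hB₁ B ((le_max_left B₁ B₂).trans (le_max_right _ _))
  have hsY := hB₂ B ((le_max_right B₁ B₂).trans (le_max_right _ _))
  set F := |RMACProof.flowC Lx Ly T B| with hF
  have hF0 : 0 ≤ F := abs_nonneg _
  refine ⟨F * Mu * (1 + ρ ^ 2 + c₀) + Mu / Lx ^ 2 + Mu * ρ ^ 2 / Ly ^ 2 + 1, by positivity, ?_⟩
  intro μ hμ G hGx hGy h k hh hk hU hkh _ N hN Δt hΔ hΔh ux uy p gx gy hx hy hp hs bx bY Wx Wy Z hR m _ hm
  have hN0 : (0 : ℝ) < N := by exact_mod_cast hN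
  have hτ : 0 < Δt := by rw [hΔ]; positivity
  have hNT : N * Δt = T := by rw [hΔ]; field_simp
  have hX : G.Nx * h = Lx := by rw [← hGx, ← G.xp_last, RMACProof.xp_uniform hU le_rfl]
  have hY : G.Ny * k = Ly := by rw [← hGy, ← G.yp_last, RMACProof.yp_uniform hU le_rfl]
  have hk2 : k ^ 2 ≤ ρ ^ 2 * h ^ 2 := by rw [← mul_pow]; exact pow_le_pow_left₀ hk.le hkh 2
  have a1 : 0 ≤ F * Mu * (1 + ρ ^ 2 + c₀) * h ^ 2 := by positivity
  have a2 : 0 ≤ Mu / Lx ^ 2 * h ^ 2 := by positivity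
  have a3 : 0 ≤ Mu * ρ ^ 2 / Ly ^ 2 * h ^ 2 := by positivity
  have a4 : 0 ≤ h ^ 2 := by positivity
  obtain ⟨e1, e2⟩ := RMACProof.rmac_error hLx hLy hh hk hτ hμ hU hX hY hNT hB hsX hsY hx hy hp hs bx bY hR
    (K := (F * Mu * (1 + ρ ^ 2 + c₀) + Mu / Lx ^ 2 + Mu * ρ ^ 2 / Ly ^ 2 + 1) * h ^ 2)
    (by
      have b1 : RMACProof.flowC Lx Ly T B * Mu * (h ^ 2 + k ^ 2 + Δt)
          ≤ F * Mu * ((1 + ρ ^ 2 + c₀) * h ^ 2) := by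
        refine mul_le_mul (mul_le_mul_of_nonneg_right (le_abs_self _) hMu) ?_ (by positivity) (by positivity)
        linarith
      linarith)
    (fun h1 => by
      have : Mu / Lx ^ 2 * h ^ 2 = Mu := by
        rw [← hX, h1]; push_cast; field_simp
      linarith)
    (fun h1 => by
      have : Mu ≤ Mu * ρ ^ 2 / Ly ^ 2 * h ^ 2 := by
        rw [← hY, h1, Nat.cast_one, one_mul, div_mul_eq_mul_div, le_div_iff₀ (by positivity), mul_assoc]
        exact mul_le_mul_of_nonneg_left hk2 hMu
      linarith) hm
  have n1 := G.one_le_Nx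
  have n2 := G.one_le_Ny
  refine ⟨fun i hi j hj => ?_, fun i hi j hj => ?_⟩
  · obtain ⟨hi1, hi2⟩ := mem_Icc.1 hi
    obtain ⟨hj1, hj2⟩ := mem_Icc.1 hj
    lift i to ℕ using hi1
    lift j to ℕ using hj1
    rw [RMACProof.xp_uniform hU (by omega), RMACProof.yh_uniform hU (by omega)]
    exact e1 i j (by omega) (by omega)
  · obtain ⟨hi1, hi2⟩ := mem_Icc.1 hi
    obtain ⟨hj1, hj2⟩ := mem_Icc.1 hj
    lift i to ℕ using hi1
    lift j to ℕ using hj1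
    rw [RMACProof.xh_uniform hU (by omega), RMACProof.yp_uniform hU (by omega)]
    exact e2 i j (by omega) (by omega)
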